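/- Trace on coordinate subspaces (Theorem 6.1): Let n ≥ 2, 1 ≤ n' < n, n'' := n − n'. Let p, q ∈ (0,∞), r ∈ (0,∞], θ ∈ (0, min{r,p}], α₃ ≥ 0, α₁ > n·(1/θ − 1/r), l ∈ ℕ with l > α₂, σ₁ = θ·p̄_θ, σ₂ = p, and let {t_k} ∈ X^{α₃}_{α,σ,p}(ℝⁿ) be a p-admissible weight sequence with associated multiple sequence {t_{k,m}}. Define t'_{k,m'} := t_{k,(m',0)} for m' ∈ ℤ^{n'} and t'_k(x') := 2^{kn'/p}·Σ_{m'} χ_{Q̃^{n'}_{k,m'}}(x')·t'_{k,m'}, and assume the weight sequence {t'_k} belongs to X^{α'₃}_{α',σ',p}(ℝ^{n'}) for some l' ≥ l, r' ∈ (0,∞], θ' ∈ (0, min{r',p}], α'₃ ≥ 0, α'₁ > n'·(1/θ' − 1/r'), α'₂ < l', σ'₁ = θ'·p̄_{θ'}, σ'₂ = p. Then: (a) the restriction map f ↦ f(·,0), defined on the dense subset of splines Σ^l ∩ B̃^l_{p,q,r}(ℝⁿ,{t_k}), extends uniquely to a bounded linear trace operator Tr: B̃^l_{p,q,r}(ℝⁿ,{t_k})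 → B̃^{l'}_{p,q,r'}(ℝ^{n'},{t'_k}); (b) there exists a bounded (possibly nonlinear) extension operator Ext: B̃^{l'}_{p,q,r'}(ℝ^{n'},{t'_k}) → B̃^l_{p,q,r}(ℝⁿ,{t_k}) with Tr ∘ Ext = Id on B̃^{l'}_{p,q,r'}(ℝ^{n'},{t'_k}). In particular the trace space Tr|_{x''=0} B̃^l_{p,q,r}(ℝⁿ,{t_k}) equals B̃^{l'}_{p,q,r'}(ℝ^{n'},{t'_k}) with equivalent norms. -/

import Mathlib

open MeasureTheory ENNReal Filter
open scoped Classical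

noncomputable section

/-- `ℓ_q` quasinorm of a family of extended nonnegative reals (supremum when `q = ∞`). -/
def lqNorm {ι : Type*} (q : ℝ≥0∞) (c : ι → ℝ≥0∞) : ℝ≥0∞ :=
  if q = ∞ then ⨆ i, c i else (∑' i, c i ^ q.toReal) ^ (1 / q.toReal)

/-- `L_p` quasinorm of an `ℝ≥0∞`-valued function (essential supremum when `p = ∞`). -/
def lpNormE {α : Type*} [MeasurableSpace α] (p : ℝ≥0∞) (μ : Measure α) (f : α → ℝ≥0∞) : ℝ≥0∞ :=
  if p = ∞ then essSup f μ else (∫⁻ x, f x ^ p.toReal ∂μ) ^ (1 / p.toReal)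

abbrev Rn (n : ℕ) := Fin n → ℝ

/-- Open cube centred at `x` of half-side `s` (i.e. `x + s·Iⁿ`). -/
def openCube {n : ℕ} (x : Rn n) (s : ℝ) : Set (Rn n) := {y | ∀ i, |y i - x i| < s}

/-- Open axis-parallel cube with lower corner `c` and side `s`. -/
def cubeAt {n : ℕ} (c : Rn n) (s : ℝ) : Set (Rn n) := {x | ∀ i, c i < x i ∧ x i < c i + s}

/-- Open dyadic cube `Q^n_{k,m}` of side `2^{-k}`. -/
def dyadicCube (n k : ℕ) (m : Fin n → ℤ) : Set (Rn n) :=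
  {x | ∀ i, (m i : ℝ) / 2 ^ k < x i ∧ x i < ((m i : ℝ) + 1) / 2 ^ k}

/-- Half-open dyadic cube `Q̃^n_{k,m}`. -/
def dyadicCubeHalf (n k : ℕ) (m : Fin n → ℤ) : Set (Rn n) :=
  {x | ∀ i, (m i : ℝ) / 2 ^ k ≤ x i ∧ x i < ((m i : ℝ) + 1) / 2 ^ k}

def dyadicCenter (n k : ℕ) (m : Fin n → ℤ) : Rn n := fun i => ((m i : ℝ) + 1 / 2) / 2 ^ k

/-- The concentric dilate `c·Q^n_{k,m}` of a dyadic cube. -/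
def dilatedCube (n k : ℕ) (m : Fin n → ℤ) (c : ℝ) : Set (Rn n) :=
  openCube (dyadicCenter n k m) (c / 2 ^ (k + 1))

def euclNorm {d : ℕ} (y : Rn d) : ℝ := Real.sqrt (∑ i, y i ^ 2)

/-- The difference `Δ^l(h)g(x)`. -/
def diffl {n : ℕ} (l : ℕ) (h : Rn n) (g : Rn n → ℝ) (x : Rn n) : ℝ :=
  ∑ j ∈ Finset.range (l + 1), ((l.choose j : ℝ) * (-1 : ℝ) ^ (l + j)) * g (x + (j : ℝ) • h)

/-- The difference `Δ^l(h,Ω)g(x)`, vanishing unless the segment `[x, x + l·h]` lies in `Ω`. -/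
def difflOn {n : ℕ} (l : ℕ) (Ω : Set (Rn n)) (h : Rn n) (g : Rn n → ℝ) (x : Rn n) : ℝ :=
  if ∀ τ ∈ Set.Icc (0 : ℝ) 1, x + (τ * l) • h ∈ Ω then diffl l h g x else 0

/-- `δ^l_r(Q)g`, where `s` is the side length of the cube `Q`. -/
def deltaE (n l : ℕ) (r : ℝ≥0∞) (s : ℝ) (Q : Set (Rn n)) (g : Rn n → ℝ) : ℝ≥0∞ :=
  ENNReal.ofReal s ^ (-(2 * (n : ℝ)) / r.toReal) *
    eLpNorm (fun hx : Rn n × Rn n => diffl l hx.1 g hx.2) r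
      ((volume.restrict (openCube (0 : Rn n) s)).prod (volume.restrict Q))

/-- `δ^l_r(Q,Ω)g`, where `s` is the side length of the cube `Q`. -/
def deltaEOn (n l : ℕ) (r : ℝ≥0∞) (s : ℝ) (Q Ω : Set (Rn n)) (g : Rn n → ℝ) : ℝ≥0∞ :=
  ENNReal.ofReal s ^ (-(2 * (n : ℝ)) / r.toReal) *
    eLpNorm (fun hx : Rn n × Rn n => difflOn l Ω hx.1 g hx.2) r
      ((volume.restrict (openCube (0 : Rn n) s)).prod (volume.restrict Q))

/-- `Δ̄^l_r(s)g(x)`. -/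
def barDelta (n l : ℕ) (r : ℝ≥0∞) (s : ℝ) (g : Rn n → ℝ) (x : Rn n) : ℝ≥0∞ :=
  ENNReal.ofReal s ^ (-(n : ℝ) / r.toReal) *
    eLpNorm (fun h : Rn n => diffl l h g x) r (volume.restrict (openCube (0 : Rn n) s))

/-- Membership in `L_r^{loc}(ℝⁿ)`. -/
def MemLrLoc (n : ℕ) (r : ℝ≥0∞) (φ : Rn n → ℝ) : Prop :=
  Measurable φ ∧ ∀ K : Set (Rn n), IsCompact K → eLpNorm φ r (volume.restrict K) < ∞

def IsWeight {n : ℕ} (w : Rn n → ℝ) : Prop := Measurable w ∧ ∀ x, 0 < w x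

/-- A `p`-admissible weight sequence. -/
def pAdmissible (n : ℕ) (p : ℝ≥0∞) (t : ℕ → Rn n → ℝ) : Prop :=
  ∀ k, IsWeight (t k) ∧ MemLrLoc n p (t k)

/-- The multiple sequence `t_{k,m} = ‖t_k‖_{L_p(Q^n_{k,m})}` associated with a weight sequence. -/
def tkm (n : ℕ) (p : ℝ≥0∞) (t : ℕ → Rn n → ℝ) (k : ℕ) (m : Fin n → ℤ) : ℝ≥0∞ :=
  eLpNorm (t k) p (volume.restrict (dyadicCube n k m))

/-- The weight `t̄_k` built from a multiple sequence `T`. -/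
def tbarOf (n : ℕ) (p : ℝ≥0∞) (T : ℕ → (Fin n → ℤ) → ℝ≥0∞) (k : ℕ) (x : Rn n) : ℝ≥0∞ :=
  (2 : ℝ≥0∞) ^ (((k * n : ℕ) : ℝ) / p.toReal) *
    ∑' m : Fin n → ℤ, (dyadicCubeHalf n k m).indicator (fun _ => T k m) x

/-- `(2^{kn} ∫_Q f^e)^{1/e}`, with the essential supremum modification for `e = ∞`. -/
def avgNorm (n k : ℕ) (e : ℝ≥0∞) (Q : Set (Rn n)) (f : Rn n → ℝ≥0∞) : ℝ≥0∞ :=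
  if e = ∞ then essSup f (volume.restrict Q)
  else ((2 : ℝ≥0∞) ^ (k * n) * ∫⁻ x in Q, f x ^ e.toReal) ^ (1 / e.toReal)

/-- Conditions (2.14)–(2.16) of the class `X^{α₃}_{α,σ,p}`, expressed for a multiple
sequence `T`. -/
def MemXseq (n : ℕ) (α₁ α₂ α₃ : ℝ) (σ₁ σ₂ p : ℝ≥0∞) (T : ℕ → (Fin n → ℤ) → ℝ≥0∞) : Prop :=
  (∃ C₁ : ℝ≥0∞, 0 < C₁ ∧ C₁ < ∞ ∧ ∀ k j : ℕ, k ≤ j → ∀ m : Fin n → ℤ,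
    avgNorm n k p (dyadicCube n k m) (tbarOf n p T k) *
      avgNorm n k σ₁ (dyadicCube n k m) (fun x => (tbarOf n p T j x)⁻¹) ≤
      C₁ * (2 : ℝ≥0∞) ^ (α₁ * ((k : ℝ) - (j : ℝ)))) ∧
  (∃ C₂ : ℝ≥0∞, 0 < C₂ ∧ C₂ < ∞ ∧ ∀ k j : ℕ, k ≤ j → ∀ m : Fin n → ℤ,
    (avgNorm n k p (dyadicCube n k m) (tbarOf n p T k))⁻¹ *
      avgNorm n k σ₂ (dyadicCube n k m) (tbarOf n p T j) ≤
      C₂ * (2 : ℝ≥0∞) ^ (α₂ * ((j : ℝ) - (k : ℝ)))) ∧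
  (∀ k : ℕ, ∀ m m' : Fin n → ℤ, (∀ i, |m i - m' i| ≤ 1) →
    0 < T k m ∧ T k m ≤ (2 : ℝ≥0∞) ^ (α₃ : ℝ) * T k m')

/-- The weighted class `X^{α₃}_{α,σ,p}` of weight sequences. -/
def MemX (n : ℕ) (α₁ α₂ α₃ : ℝ) (σ₁ σ₂ p : ℝ≥0∞) (t : ℕ → Rn n → ℝ) : Prop :=
  pAdmissible n p t ∧ MemXseq n α₁ α₂ α₃ σ₁ σ₂ p (tkm n p t)

/-- Quasinorm of `B̃^l_{p,q,r}(ℝⁿ, T)` with an `ℝ≥0∞`-valued weight sequence `T`. -/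
def tildeBnormE (n l : ℕ) (p q r : ℝ≥0∞) (T : ℕ → Rn n → ℝ≥0∞) (φ : Rn n → ℝ) : ℝ≥0∞ :=
  lqNorm q (fun k : ℕ =>
    lpNormE p volume (fun x =>
      T (k + 1) x *
        deltaE n l r ((2 : ℝ) ^ (1 - ((k : ℤ) + 1))) (openCube x ((2 : ℝ) ^ (-((k : ℤ) + 1)))) φ)) +
  lpNormE p volume (fun x => T 0 x * eLpNorm φ r (volume.restrict (openCube x 1)))

/-- Quasinorm of `B̃^l_{p,q,r}(ℝⁿ, {t_k})`. -/
def tildeBnorm (n l : ℕ) (p q r : ℝ≥0∞) (t : ℕ → Rn n → ℝ) (φ : Rn n → ℝ) : ℝ≥0∞ :=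
  tildeBnormE n l p q r (fun k x => ENNReal.ofReal (t k x)) φ

/-- Membership in `B̃^l_{p,q,r}(ℝⁿ, {t_k})`. -/
def MemTildeB (n l : ℕ) (p q r : ℝ≥0∞) (t : ℕ → Rn n → ℝ) (φ : Rn n → ℝ) : Prop :=
  MemLrLoc n r φ ∧ tildeBnorm n l p q r t φ < ∞

/-- Quasinorm of `B̄^l_{p,q,r}(ℝⁿ, {t_k})`. -/
def barBnorm (n l : ℕ) (p q r : ℝ≥0∞) (t : ℕ → Rn n → ℝ) (φ : Rn n → ℝ) : ℝ≥0∞ :=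
  lqNorm q (fun k : ℕ =>
    lpNormE p volume (fun x =>
      ENNReal.ofReal (t (k + 1) x) * barDelta n l r ((2 : ℝ) ^ (-((k : ℤ) + 1))) φ x)) +
  lpNormE p volume (fun x => ENNReal.ofReal (t 0 x) * eLpNorm φ r (volume.restrict (openCube x 1)))

/-- Membership in `B̄^l_{p,q,r}(ℝⁿ, {t_k})`. -/
def MemBarB (n l : ℕ) (p q r : ℝ≥0∞) (t : ℕ → Rn n → ℝ) (φ : Rn n → ℝ) : Prop :=
  MemLrLoc n r φ ∧ barBnorm n l p q r t φ < ∞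

/-- The class `A^{loc}_∞`. -/
def MemAlocInfty (n : ℕ) (w : Rn n → ℝ) : Prop :=
  ∃ α : ℝ, α ∈ Set.Ioo (0 : ℝ) 1 ∧ ∃ M : ℝ≥0∞, M < ∞ ∧
    ∀ (c : Rn n) (s : ℝ), 0 < s → s ≤ 1 →
      ∀ F : Set (Rn n), F ⊆ cubeAt c s → MeasurableSet F →
        ENNReal.ofReal α * volume (cubeAt c s) ≤ volume F →
        (∫⁻ x in cubeAt c s, ENNReal.ofReal (w x)) ≤ M * ∫⁻ x in F, ENNReal.ofReal (w x)

/-- The class `A^{loc}_1`. -/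
def MemAloc1 (n : ℕ) (w : Rn n → ℝ) : Prop :=
  ∃ C : ℝ≥0∞, C < ∞ ∧ ∀ (c : Rn n) (s : ℝ), 0 < s → s ≤ 1 →
    ∀ᵐ x ∂volume.restrict (cubeAt c s),
      (∫⁻ y in cubeAt c s, ENNReal.ofReal (w y)) ≤ C * volume (cubeAt c s) * ENNReal.ofReal (w x)

/-- The class `A^{loc}_{p₀}` for `p₀ > 1`. -/
def MemAlocGt (n : ℕ) (p₀ : ℝ) (w : Rn n → ℝ) : Prop :=
  ∃ C : ℝ≥0∞, C < ∞ ∧ ∀ (c : Rn n) (s : ℝ), 0 < s → s ≤ 1 →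
    ((volume (cubeAt c s))⁻¹ * ∫⁻ y in cubeAt c s, ENNReal.ofReal (w y)) *
      ((volume (cubeAt c s))⁻¹ *
        ∫⁻ y in cubeAt c s, ENNReal.ofReal (w y) ^ (-(1 : ℝ) / (p₀ - 1))) ^ (p₀ - 1) ≤ C

/-- The class `A^{loc}_{p₀}` for `p₀ ∈ [1,∞)`. -/
def MemAlocP (n : ℕ) (p₀ : ℝ) (w : Rn n → ℝ) : Prop :=
  if p₀ = 1 then MemAloc1 n w else MemAlocGt n p₀ w

/-- The class `{}^{loc}Y^{α₃}_{α₁,α₂}` of weight sequences of variable smoothness. -/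
def MemLocY (n : ℕ) (α₁ α₂ α₃ : ℝ) (s : ℕ → Rn n → ℝ) : Prop :=
  (∀ k, IsWeight (s k)) ∧
  (∃ C : ℝ, 0 < C ∧ ∀ j k : ℕ, j ≤ k → ∀ x : Rn n,
    C⁻¹ * (2 : ℝ) ^ (α₁ * ((k : ℝ) - (j : ℝ))) ≤ s k x / s j x ∧
      s k x / s j x ≤ C * (2 : ℝ) ^ (α₂ * ((k : ℝ) - (j : ℝ)))) ∧
  (∀ k : ℕ, ∀ x y : Rn n, euclNorm (x - y) ≤ (2 : ℝ) ^ (-(k : ℤ)) →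
    s k x ≤ (2 : ℝ) ^ α₃ * s k y)

/-- The set `Ξ^{d,n}_{k,m} = Q^n_{k,m} × (2^{-k}B^d ∖ 2^{-k-1}B^d) ⊂ ℝ^{n+d}`. -/
def Xi (n d k : ℕ) (m : Fin n → ℤ) : Set (Rn (n + d)) :=
  {z | (fun i => z (Fin.castAdd d i)) ∈ dyadicCube n k m ∧
       euclNorm (fun i : Fin d => z (Fin.natAdd n i)) < (2 : ℝ) ^ (-(k : ℤ)) ∧
       (2 : ℝ) ^ (-(k : ℤ) - 1) ≤ euclNorm (fun i : Fin d => z (Fin.natAdd n i))}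

/-- The multiple sequence `γ̂_{k,m} = ‖γ‖_{L_p(Ξ^{d,n}_{k,m})}` generated by a weight `γ`. -/
def gammaHat (n d : ℕ) (p : ℝ≥0∞) (γ : Rn (n + d) → ℝ) (k : ℕ) (m : Fin n → ℤ) : ℝ≥0∞ :=
  eLpNorm γ p (volume.restrict (Xi n d k m))

def delta1Good (n d : ℕ) (p : ℝ≥0∞) (γ : Rn (n + d) → ℝ) (δ : ℝ) : Prop :=
  ∃ C : ℝ≥0∞, C < ∞ ∧ ∀ k j : ℕ, k ≤ j → ∀ m : Fin n → ℤ,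
    (∑' m' : {m' : Fin n → ℤ // dyadicCube n j m' ⊆ dyadicCube n k m},
        gammaHat n d p γ j m'.1 ^ p.toReal) ≤
      C * (2 : ℝ≥0∞) ^ ((((k : ℝ) - (j : ℝ)) * (d : ℝ)) * δ) * gammaHat n d p γ k m ^ p.toReal

/-- `δ₁(γ,n,d)`. -/
def delta1 (n d : ℕ) (p : ℝ≥0∞) (γ : Rn (n + d) → ℝ) : ℝ :=
  sSup {δ : ℝ | 0 < δ ∧ delta1Good n d p γ δ}

def delta2Good (n d : ℕ) (p : ℝ≥0∞) (γ : Rn (n + d) → ℝ) (δ : ℝ) : Prop :=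
  ∃ C : ℝ≥0∞, C < ∞ ∧ ∀ k j : ℕ, k ≤ j → ∀ m : Fin n → ℤ,
    ∀ G : Set (Fin n → ℤ), (∀ m' ∈ G, dyadicCube n j m' ⊆ dyadicCube n k m) →
      (∑' m' : G, gammaHat n d p γ j m'.1 ^ p.toReal) ≤
        C * (volume (⋃ m' ∈ G, dyadicCube n j m') / volume (dyadicCube n k m)) ^ δ *
          ∑' m' : {m' : Fin n → ℤ // dyadicCube n j m' ⊆ dyadicCube n k m},
            gammaHat n d p γ j m'.1 ^ p.toReal

/-- `δ₂(γ,n,d)`. -/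
def delta2 (n d : ℕ) (p : ℝ≥0∞) (γ : Rn (n + d) → ℝ) : ℝ :=
  sSup {δ : ℝ | 0 < δ ∧ delta2Good n d p γ δ}

/-- The cardinal B-spline of degree `deg` with knots `0, 1, …, deg + 1`. -/
def cardB : ℕ → ℝ → ℝ
  | 0, x => if 0 ≤ x ∧ x < 1 then 1 else 0
  | (d + 1), x => (x / (d + 1)) * cardB d x + (((d : ℝ) + 2 - x) / (d + 1)) * cardB d (x - 1)

/-- The tensor-product B-spline `N^{deg}_{k,m}` on `ℝⁿ`. -/
def Bspl (n deg k : ℕ) (m : Fin n → ℤ) (x : Rn n) : ℝ :=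
  ∏ i, cardB deg (2 ^ k * x i - (m i : ℝ))

/-- The spline `Σ_m β_m N^{deg}_{k,m}`. -/
def splineSum (n deg k : ℕ) (β : (Fin n → ℤ) → ℝ) (x : Rn n) : ℝ :=
  ∑' m, β m * Bspl n deg k m x

/-- A dyadic spline of degree `deg` (an element of `Σ^{deg} = ⋃_k Σ^{deg}_k`). -/
def IsSplineFn (n deg : ℕ) (S : Rn n → ℝ) : Prop :=
  ∃ (k : ℕ) (β : (Fin n → ℤ) → ℝ), S = splineSum n deg k β

/-- The weighted best spline approximation `s_k(φ)` by splines of degree `deg`. -/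
def sApprox (n deg : ℕ) (p r : ℝ≥0∞) (T : ℕ → (Fin n → ℤ) → ℝ≥0∞) (φ : Rn n → ℝ) (k : ℕ) :
    ℝ≥0∞ :=
  ⨅ β : (Fin n → ℤ) → ℝ,
    lqNorm p (fun m => T k m *
      eLpNorm (fun x => φ x - splineSum n deg k β x) r (volume.restrict (dyadicCube n k m)))

/-- `s_j(φ)` for `j ∈ {-1, 0, 1, 2, …}`, including the term `s_{-1}`. -/
def sApproxZ (n deg : ℕ) (p r : ℝ≥0∞) (T : ℕ → (Fin n → ℤ) → ℝ≥0∞) (φ : Rn n → ℝ) (j : ℤ) :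
    ℝ≥0∞ :=
  if j < 0 then
    lqNorm p (fun m => T 0 m * eLpNorm φ r (volume.restrict (dyadicCube n 0 m)))
  else sApprox n deg p r T φ j.toNat

/-- Local best polynomial approximation `E_l(φ,Q)_r` by polynomials of total degree `< l`. -/
def bestApproxE (n l : ℕ) (r : ℝ≥0∞) (φ : Rn n → ℝ) (Q : Set (Rn n)) : ℝ≥0∞ :=
  ⨅ P : {P : MvPolynomial (Fin n) ℝ // P.totalDegree < l},
    eLpNorm (fun x => φ x - MvPolynomial.eval x P.1) r (volume.restrict Q)

/-- The modulus of continuity `ω_l(φ,Q)_r`. -/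
def modulusE (n l : ℕ) (r : ℝ≥0∞) (φ : Rn n → ℝ) (Q : Set (Rn n)) : ℝ≥0∞ :=
  ⨆ h : Rn n, eLpNorm (difflOn l Q h φ) r (volume : Measure (Rn n))

def partialDeriv {N : ℕ} (i : Fin N) (ψ : Rn N → ℝ) : Rn N → ℝ :=
  fun x => fderiv ℝ ψ x (Pi.single i 1)

def iterPD {N : ℕ} : List (Fin N) → (Rn N → ℝ) → Rn N → ℝ
  | [], ψ => ψ
  | i :: L, ψ => partialDeriv i (iterPD L ψ)

def multiIdxList {N : ℕ} (α : Fin N → ℕ) : List (Fin N) :=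
  (List.finRange N).foldr (fun i L => List.replicate (α i) i ++ L) []

/-- Iterated partial derivative `D^α`. -/
def multiDeriv {N : ℕ} (α : Fin N → ℕ) (ψ : Rn N → ℝ) : Rn N → ℝ :=
  iterPD (multiIdxList α) ψ

/-- `g` is the weak (Sobolev) derivative `D^α f`. -/
def IsWeakDeriv {N : ℕ} (α : Fin N → ℕ) (f g : Rn N → ℝ) : Prop :=
  ∀ ψ : Rn N → ℝ, ContDiff ℝ (⊤ : ℕ∞) ψ → HasCompactSupport ψ →
    ∫ x, f x * multiDeriv α ψ x = (-1 : ℝ) ^ (∑ i, α i) * ∫ x, g x * ψ x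

/-- The weighted Sobolev norm `Σ_{|α| ≤ l} ‖γ · D^α f‖_{L_p}` computed from a system `D` of
weak derivatives. -/
def sobNorm (N : ℕ) (p : ℝ≥0∞) (l : ℕ) (γ : Rn N → ℝ) (D : (Fin N → ℕ) → Rn N → ℝ) : ℝ≥0∞ :=
  ∑' α : Fin N → ℕ,
    if (∑ i, α i) ≤ l then eLpNorm (fun x => γ x * D α x) p volume else 0

/-- Membership in the weighted Sobolev space `W^l_p(ℝ^N, γ)`, witnessed by the system `D`
of weak derivatives of `f`. -/
def MemW (N : ℕ) (p : ℝ≥0∞) (l : ℕ) (γ : Rn N → ℝ) (f : Rn N → ℝ)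
    (D : (Fin N → ℕ) → Rn N → ℝ) : Prop :=
  MeasureTheory.LocallyIntegrable f volume ∧ D 0 = f ∧
    (∀ α : Fin N → ℕ, (∑ i, α i) ≤ l →
      MeasureTheory.LocallyIntegrable (D α) volume ∧ IsWeakDeriv α f (D α)) ∧
    sobNorm N p l γ D < ∞

/-- `φ` is the trace of `f` on the plane `y = 0`. -/
def IsTraceSob {n d : ℕ} (f : Rn (n + d) → ℝ) (φ : Rn n → ℝ) : Prop :=
  ∃ f' : Rn (n + d) → ℝ, f' =ᵐ[volume] f ∧
    ∀ (c : Rn n) (s : ℝ), 0 < s →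
      Filter.Tendsto (fun y : Rn d => ∫ x in cubeAt c s, |f' (Fin.append x y) - φ x|)
        (nhds 0) (nhds 0)

/-- The weight sequence `γ_k(x) = 2^{k(l+n/p)} Σ_m χ_{Q̃^n_{k,m}}(x) γ̂_{k,m}`. -/
def gammaSeq (n d : ℕ) (p : ℝ≥0∞) (l : ℕ) (γ : Rn (n + d) → ℝ) (k : ℕ) (x : Rn n) : ℝ≥0∞ :=
  (2 : ℝ≥0∞) ^ ((k : ℝ) * ((l : ℝ) + (n : ℝ) / p.toReal)) *
    ∑' m : Fin n → ℤ, (dyadicCubeHalf n k m).indicator (fun _ => gammaHat n d p γ k m) x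

/-- Conjugate exponent in `ℝ≥0∞`. -/
def conjE (e : ℝ≥0∞) : ℝ≥0∞ := (1 - e⁻¹)⁻¹

/-- The exponent `p_θ`. -/
def pTheta (p θ : ℝ≥0∞) : ℝ≥0∞ := if θ = ∞ ∧ p = ∞ then 1 else p / θ

/-- The multiple sequence `t'_{k,m'} = t_{k,(m',0)}` on `ℝ^{n'}`. -/
def traceSeqM (n' n'' : ℕ) (p : ℝ≥0∞) (t : ℕ → Rn (n' + n'') → ℝ) (k : ℕ)
    (m' : Fin n' → ℤ) : ℝ≥0∞ :=
  tkm (n' + n'') p t k (Fin.append m' (0 : Fin n'' → ℤ))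

/-- The weight sequence `t'_k(x') = 2^{kn'/p} Σ_{m'} χ_{Q̃^{n'}_{k,m'}}(x') t'_{k,m'}`. -/
def traceSeq (n' n'' : ℕ) (p : ℝ≥0∞) (t : ℕ → Rn (n' + n'') → ℝ) (k : ℕ)
    (x : Rn n') : ℝ≥0∞ :=
  tbarOf n' p (traceSeqM n' n'' p t) k x

/-- `φ'` is the trace of `φ` on the plane `x'' = 0`, in the sense that the pointwise
restrictions of any sequence of splines converging to `φ` in `B̃^l_{p,q,r}(ℝⁿ,{t_k})`
converge to `φ'` in `B̃^{l'}_{p,q,r'}(ℝ^{n'},{t'_k})`. -/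
def IsBTrace (n' n'' l l' : ℕ) (p q r r' : ℝ≥0∞) (t : ℕ → Rn (n' + n'') → ℝ)
    (φ : Rn (n' + n'') → ℝ) (φ' : Rn n' → ℝ) : Prop :=
  ∀ S : ℕ → Rn (n' + n'') → ℝ, (∀ j, IsSplineFn (n' + n'') l (S j)) →
    Filter.Tendsto (fun j => tildeBnorm (n' + n'') l p q r t (fun x => φ x - S j x))
      Filter.atTop (nhds 0) →
    Filter.Tendsto (fun j => tildeBnormE n' l' p q r' (traceSeq n' n'' p t)
        (fun x' => φ' x' - S j (Fin.append x' (0 : Fin n'' → ℝ))))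
      Filter.atTop (nhds 0)

section
open scoped NNReal

/-- bounded finite differences up to order `s` along an initial segment -/
def SB (s : ℕ) (t A : ℝ) (F : ℕ → ℝ) : Prop :=
  ∀ i b, i + b ≤ s → |(fwdDiff 1)^[i] F b| ≤ A * t ^ i

lemma diffl_eq_fwd {n : ℕ} (l : ℕ) (h : Rn n) (g : Rn n → ℝ) (x : Rn n) :
    diffl l h g x = (fwdDiff 1)^[l] (fun b : ℕ => g (x + (b : ℝ) • h)) 0 := by
  rw [fwdDiff_iter_eq_sum_shift, diffl]
  refine Finset.sum_congr rfl fun j hj => ?_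
  have hj' : j ≤ l := by simpa [Nat.lt_succ_iff] using hj
  have : (-1 : ℝ) ^ (l + j) = (-1) ^ (l - j) := by
    have : l + j = (l - j) + 2 * j := by omega
    rw [this, pow_add, pow_mul]; simp
  simp [this]
  left; ring

lemma SB.nonneg {s : ℕ} {t A : ℝ} {F : ℕ → ℝ} (h : SB s t A F) : 0 ≤ A := by
  have := h 0 0 (by omega)
  simp at this
  exact (abs_nonneg _).trans this

lemma SB.mono {s : ℕ} {t A B : ℝ} {F : ℕ → ℝ} (h : SB s t A F) (ht : 0 ≤ t) (hAB : A ≤ B) :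
    SB s t B F := fun i b hib =>
  (h i b hib).trans (by gcongr)

lemma SB.mono_t {s : ℕ} {t t' A : ℝ} {F : ℕ → ℝ} (h : SB s t A F) (ht : 0 ≤ t) (htt : t ≤ t') :
    SB s t' A F := fun i b hib =>
  (h i b hib).trans (by have := h.nonneg; gcongr)

lemma SB.mono_s {s s' : ℕ} {t A : ℝ} {F : ℕ → ℝ} (h : SB s t A F) (hs : s' ≤ s) :
    SB s' t A F := fun i b hib => h i b (by omega)

lemma SB.add {s : ℕ} {t A B : ℝ} {F G : ℕ → ℝ} (hF : SB s t A F) (hG : SB s t B G) :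
    SB s t (A + B) (fun b => F b + G b) := by
  intro i b hib
  have : (fun b => F b + G b) = F + G := rfl
  rw [this, fwdDiff_iter_add, Pi.add_apply, add_mul]
  exact (abs_add_le _ _).trans (add_le_add (hF i b hib) (hG i b hib))

lemma SB.const_mul {s : ℕ} {t A : ℝ} {F : ℕ → ℝ} (hF : SB s t A F) (c : ℝ) :
    SB s t (|c| * A) (fun b => c * F b) := by
  intro i b hib
  have : (fun b => c * F b) = c • F := rfl
  rw [this, fwdDiff_iter_const_smul, Pi.smul_apply, smul_eq_mul, abs_mul, mul_assoc]
  gcongr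
  exact hF i b hib

lemma SB.sub {s : ℕ} {t A B : ℝ} {F G : ℕ → ℝ} (hF : SB s t A F) (hG : SB s t B G) :
    SB s t (A + B) (fun b => F b - G b) := by
  have := hF.add (hG.const_mul (-1))
  simpa [sub_eq_add_neg] using this

lemma fwdDiff_iter_zero_fun (i : ℕ) : (fwdDiff 1)^[i] (fun _ : ℕ => (0 : ℝ)) = fun _ => 0 := by
  induction i with
  | zero => rfl
  | succ i ih => rw [Function.iterate_succ_apply, fwdDiff_const, ih]

lemma SB.zero {s : ℕ} {t : ℝ} : SB s t 0 (fun _ => 0) := by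
  intro i b _
  rw [fwdDiff_iter_zero_fun]; simp

lemma SB.const {s : ℕ} {t : ℝ} (ht : 0 ≤ t) (c : ℝ) : SB s t |c| (fun _ => c) := by
  intro i b _
  rcases i with _ | i
  · simp
  · rw [Function.iterate_succ_apply, fwdDiff_const, fwdDiff_iter_zero_fun]; simp; positivity

lemma SB.sum {ι : Type*} (S : Finset ι) {s : ℕ} {t : ℝ} {A : ι → ℝ} {F : ι → ℕ → ℝ}
    (h : ∀ i ∈ S, SB s t (A i) (F i)) : SB s t (∑ i ∈ S, A i) (fun b => ∑ i ∈ S, F i b) := by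
  induction S using Finset.induction_on with
  | empty => simpa using SB.zero
  | insert a S ha ih =>
    simp only [Finset.sum_insert ha]
    exact (h a (by simp)).add (ih fun i hi => h i (by simp [hi]))

lemma SB.shift {s : ℕ} {t A : ℝ} {F : ℕ → ℝ} (h : SB (s + 1) t A F) :
    SB s t A (fun b => F (b + 1)) := by
  intro i b hib
  rw [fwdDiff_iter_comp_add]
  exact h i (b + 1) (by omega)

lemma SB.fwd {s : ℕ} {t A : ℝ} {F : ℕ → ℝ} (h : SB (s + 1) t A F) :
    SB s t (A * t) (fwdDiff 1 F) := by
  intro i b hib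
  rw [← Function.iterate_succ_apply]
  have := h (i + 1) b (by omega)
  rw [pow_succ] at this
  linarith

lemma SB.mul_aux (t : ℝ) (i : ℕ) : ∀ (s : ℕ) (A B : ℝ) (F G : ℕ → ℝ), SB s t A F → SB s t B G →
    ∀ b, i + b ≤ s → |(fwdDiff 1)^[i] (fun b => F b * G b) b| ≤ 2 ^ i * (A * B) * t ^ i := by
  induction i with
  | zero =>
    intro s A B F G hF hG b hb
    simp only [Function.iterate_zero, id, abs_mul, pow_zero, one_mul, mul_one]
    have h1 := hF 0 b hb
    have h2 := hG 0 b hb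
    simp at h1 h2
    have := hF.nonneg
    gcongr
  | succ i ih =>
    intro s A B F G hF hG b hb
    obtain ⟨s, rfl⟩ : ∃ s', s = s' + 1 := ⟨s - 1, by omega⟩
    have e : fwdDiff 1 (fun b => F b * G b) =
        (fun b => fwdDiff 1 F b * G b) + (fun b => F (b + 1) * fwdDiff 1 G b) := by
      ext b; simp only [fwdDiff, Pi.add_apply]; ring
    rw [Function.iterate_succ_apply, e, fwdDiff_iter_add, Pi.add_apply]
    have h1 := ih s _ _ _ _ hF.fwd (hG.mono_s (Nat.le_succ s)) b (by omega)
    have h2 := ih s _ _ _ _ hF.shift hG.fwd b (by omega)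
    refine (abs_add_le _ _).trans ((add_le_add h1 h2).trans (le_of_eq ?_))
    ring

lemma SB.mul {s : ℕ} {t A B : ℝ} {F G : ℕ → ℝ} (ht : 0 ≤ t) (hF : SB s t A F) (hG : SB s t B G) :
    SB s t (2 ^ s * (A * B)) (fun b => F b * G b) := by
  intro i b hib
  refine (SB.mul_aux t i s A B F G hF hG b hib).trans ?_
  have := hF.nonneg; have := hG.nonneg
  have : (2:ℝ) ^ i ≤ 2 ^ s := pow_le_pow_right₀ (by norm_num) (by omega)
  gcongr

lemma SB.prod {ι : Type*} (S : Finset ι) {s : ℕ} {t K : ℝ} (ht : 0 ≤ t) {F : ι → ℕ → ℝ}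
    (h : ∀ i ∈ S, SB s t K (F i)) : SB s t ((2 ^ s * K) ^ S.card) (fun b => ∏ i ∈ S, F i b) := by
  induction S using Finset.induction_on with
  | empty => simpa using SB.const ht (1:ℝ)
  | insert a S ha ih =>
    simp only [Finset.prod_insert ha, Finset.card_insert_of_notMem ha]
    have := (h a (by simp)).mul ht (ih fun i hi => h i (by simp [hi]))
    refine this.mono ht (le_of_eq ?_)
    ring

/-- polynomials on bounded regions -/
lemma SB.poly (s : ℕ) (R : ℝ) (hR : 0 ≤ R) (q : Polynomial ℝ) : ∃ K : ℝ, 0 ≤ K ∧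
    ∀ c τ t : ℝ, |c| ≤ R → |τ| ≤ t → t ≤ 2 → SB s t K (fun b : ℕ => q.eval (c + b * τ)) := by
  induction q using Polynomial.induction_on with
  | C a =>
    refine ⟨|a|, abs_nonneg _, fun c τ t _ h1 _ => ?_⟩
    simpa using SB.const ((abs_nonneg τ).trans h1) a
  | add p q hp hq =>
    obtain ⟨K, hK, h⟩ := hp
    obtain ⟨K', hK', h'⟩ := hq
    refine ⟨K + K', by positivity, fun c τ t a b d => ?_⟩
    simpa using (h c τ t a b d).add (h' c τ t a b d)
  | monomial m a ih =>
    obtain ⟨K, hK, h⟩ := ih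
    refine ⟨2 ^ s * (K * (R + 2 * s + 1)), by positivity, fun c τ t a1 b1 d1 => ?_⟩
    have ht : 0 ≤ t := (abs_nonneg τ).trans b1
    have hX : SB s t (R + 2 * s + 1) (fun b : ℕ => c + b * τ) := by
      intro i b hib
      rcases i with _ | _ | i
      · simp only [Function.iterate_zero, id, pow_zero, mul_one]
        have hb : (b : ℝ) ≤ s := by exact_mod_cast (by omega : b ≤ s)
        calc |c + b * τ| ≤ |c| + |b * τ| := abs_add_le _ _
          _ ≤ R + s * 2 := by
            rw [abs_mul, Nat.abs_cast]
            have : |τ| ≤ 2 := b1.trans d1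
            gcongr
          _ ≤ _ := by linarith
      · have : fwdDiff 1 (fun b : ℕ => c + b * τ) = fun _ => τ := by
          ext b; simp [fwdDiff]; ring
        simp only [zero_add, Function.iterate_one, this, pow_one]
        have : (0:ℝ) ≤ R + 2 * s := by positivity
        nlinarith
      · have : fwdDiff 1 (fun b : ℕ => c + b * τ) = fun _ => τ := by
          ext b; simp [fwdDiff]; ring
        rw [Function.iterate_succ_apply, this, Function.iterate_succ_apply, fwdDiff_const,
          fwdDiff_iter_zero_fun]
        simp; positivity
    have := (h c τ t a1 b1 d1).mul ht hX
    convert this using 2 with b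
    simp [pow_succ]; ring

/-- smooth compactly supported functions of one variable -/
lemma bump_fwd (i : ℕ) : ∀ F : ℝ → ℝ, ContDiff ℝ (⊤ : ℕ∞) F → HasCompactSupport F →
    ∃ K : ℝ, 0 ≤ K ∧ ∀ τ x : ℝ, |(fwdDiff τ)^[i] F x| ≤ K * |τ| ^ i := by
  induction i with
  | zero =>
    intro F hF hc
    obtain ⟨C, hC⟩ := hc.exists_bound_of_continuous hF.continuous
    refine ⟨C, (norm_nonneg _).trans (hC 0), fun τ x => by simpa using hC x⟩
  | succ i ih =>
    intro F hF hc
    have hd : ContDiff ℝ (⊤ : ℕ∞) (deriv F) := by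
      have := (contDiff_infty_iff_deriv (𝕜 := ℝ) (f := F)).1 (by simpa using hF)
      simpa using this.2
    obtain ⟨K, hK, h⟩ := ih (deriv F) hd hc.deriv
    refine ⟨K, hK, fun τ x => ?_⟩
    have hFd : Differentiable ℝ F := hF.differentiable (by simp)
    have key : ∀ (j : ℕ) (F : ℝ → ℝ), Differentiable ℝ F → ∀ y,
        HasDerivAt ((fwdDiff τ)^[j] F) ((fwdDiff τ)^[j] (deriv F) y) y := by
      intro j F hF y
      simp only [funext (fwdDiff_iter_eq_sum_shift τ F j), fwdDiff_iter_eq_sum_shift τ (deriv F) j]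
      refine HasDerivAt.fun_sum fun a _ => ?_
      simp only [zsmul_eq_mul]
      refine HasDerivAt.const_mul _ ?_
      exact (hF (y + a • τ)).hasDerivAt.comp_add_const y (a • τ)
    have := Convex.norm_image_sub_le_of_norm_hasDerivWithin_le (𝕜 := ℝ) (s := Set.univ)
      (f := (fwdDiff τ)^[i] F) (C := K * |τ| ^ i) (x := x) (y := x + τ)
      (fun y _ => (key i F hFd y).hasDerivWithinAt) (fun y _ => by simpa using h τ y)
      convex_univ (by simp) (by simp)
    rw [Function.iterate_succ_apply']
    simpa [fwdDiff, pow_succ, mul_assoc] using this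

lemma bump_SB (s : ℕ) (F : ℝ → ℝ) (hF : ContDiff ℝ (⊤ : ℕ∞) F) (hc : HasCompactSupport F) :
    ∃ K : ℝ, 0 ≤ K ∧ ∀ c τ t : ℝ, |τ| ≤ t → SB s t K (fun b : ℕ => F (c + b * τ)) := by
  choose K hK h using fun i => bump_fwd i F hF hc
  refine ⟨∑ i ∈ Finset.range (s + 1), K i, Finset.sum_nonneg fun i _ => hK i,
    fun c τ t hτ i b hib => ?_⟩
  have e : (fwdDiff 1)^[i] (fun b : ℕ => F (c + b * τ)) b = (fwdDiff τ)^[i] F (c + b * τ) := by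
    rw [fwdDiff_iter_eq_sum_shift, fwdDiff_iter_eq_sum_shift]
    refine Finset.sum_congr rfl fun j _ => ?_
    simp; left; ring_nf
  rw [e]
  refine (h i τ _).trans ?_
  have : K i ≤ ∑ i ∈ Finset.range (s + 1), K i :=
    Finset.single_le_sum (f := K) (fun i _ => hK i) (by simp; omega)
  have := hK i
  have : 0 ≤ ∑ i ∈ Finset.range (s + 1), K i := by linarith
  gcongr

/-- the basic bump -/
def chi (x : ℝ) : ℝ := Real.smoothTransition (x + 1) - Real.smoothTransition x

lemma chi_contDiff : ContDiff ℝ (⊤ : ℕ∞) chi := by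
  unfold chi
  exact ((Real.smoothTransition.contDiff (n := ⊤)).comp (contDiff_id.add contDiff_const)).sub
    Real.smoothTransition.contDiff

lemma chi_continuous : Continuous chi := chi_contDiff.continuous

lemma chi_eq_zero {x : ℝ} (h : 1 ≤ |x|) : chi x = 0 := by
  unfold chi
  rcases le_abs.1 h with h | h
  · rw [Real.smoothTransition.one_of_one_le (by linarith), Real.smoothTransition.one_of_one_le h]
    simp
  · rw [Real.smoothTransition.zero_of_nonpos (by linarith),
      Real.smoothTransition.zero_of_nonpos (by linarith)]
    simp

lemma chi_zero : chi 0 = 1 := by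
  simp [chi]

lemma chi_compact : HasCompactSupport chi := by
  refine HasCompactSupport.intro (K := Set.Icc (-1) 1) isCompact_Icc fun x hx => chi_eq_zero ?_
  by_contra h
  push Not at h
  exact hx ⟨by linarith [(abs_lt.1 h).1], (abs_lt.1 h).2.le⟩

lemma chi_nonneg (x : ℝ) : 0 ≤ chi x := by
  unfold chi
  have := Real.smoothTransition.monotone (by linarith : x ≤ x + 1)
  linarith

lemma chi_le_one (x : ℝ) : chi x ≤ 1 := by
  unfold chi
  have := Real.smoothTransition.nonneg x
  have := Real.smoothTransition.le_one (x + 1)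
  linarith

lemma chi_sum_Ico (x : ℝ) (a : ℤ) (N : ℕ) :
    ∑ j ∈ Finset.range N, chi (x - ((a + j : ℤ) : ℝ)) =
      Real.smoothTransition (x - a + 1) - Real.smoothTransition (x - a - N + 1) := by
  induction N with
  | zero => simp
  | succ N ih =>
    rw [Finset.sum_range_succ, ih]
    unfold chi
    push_cast
    ring_nf

/-- `N`-periodic partition of unity, sum over a large enough block -/
lemma chi_sum_block (x : ℝ) (S : Finset ℤ) (h : ∀ m : ℤ, |x - m| < 1 → m ∈ S) :
    ∑ m ∈ S, chi (x - m) = 1 := by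
  have e1 : ∑ j ∈ Finset.range 2, chi (x - ((⌊x⌋ + j : ℤ) : ℝ)) = 1 := by
    rw [chi_sum_Ico, Real.smoothTransition.one_of_one_le, Real.smoothTransition.zero_of_nonpos]
    · simp
    · have := Int.lt_floor_add_one x; push_cast; linarith
    · have := Int.floor_le x; linarith
  have h0 := Int.floor_le x
  have h1 := Int.lt_floor_add_one x
  have z : ∀ m : ℤ, m ≠ ⌊x⌋ → m ≠ ⌊x⌋ + 1 → chi (x - m) = 0 := by
    intro m hm hm'
    apply chi_eq_zero
    rcases lt_or_ge m ⌊x⌋ with h | h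
    · have : (m:ℝ) + 1 ≤ ⌊x⌋ := by exact_mod_cast h
      rw [le_abs]; left; linarith
    · have : ⌊x⌋ + 2 ≤ m := by omega
      have : ((⌊x⌋:ℝ)) + 2 ≤ m := by exact_mod_cast this
      rw [le_abs]; right; linarith
  have e2 : ∑ m ∈ S, chi (x - m) = ∑ m ∈ ({⌊x⌋, ⌊x⌋ + 1} : Finset ℤ), chi (x - m) := by
    have hu : ∑ m ∈ S ∪ {⌊x⌋, ⌊x⌋ + 1}, chi (x - m) = ∑ m ∈ S, chi (x - m) := by
      symm
      apply Finset.sum_subset Finset.subset_union_left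
      intro m _ hm
      apply chi_eq_zero
      by_contra hc
      exact hm (h m (not_le.1 hc))
    rw [← hu]
    symm
    apply Finset.sum_subset Finset.subset_union_right
    intro m _ hm
    simp at hm
    exact z m hm.1 hm.2
  rw [e2, Finset.sum_pair (by omega), ← e1]
  simp [Finset.sum_range_succ]

/-! continuity of splines -/
lemma cardB_zero_of_neg (d : ℕ) : ∀ x : ℝ, x < 0 → cardB d x = 0 := by
  induction d with
  | zero => intro x hx; simp [cardB, hx]
  | succ d ih => intro x hx; simp [cardB, ih x hx, ih (x - 1) (by linarith)]

lemma cardB_zero_of_ge (d : ℕ) : ∀ x : ℝ, (d : ℝ) + 1 ≤ x → cardB d x = 0 := by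
  induction d with
  | zero =>
    intro x hx
    simp at hx
    simp only [cardB, ite_eq_right_iff]
    intro h; linarith [h.2]
  | succ d ih =>
    intro x hx
    push_cast at hx
    simp [cardB, ih x (by linarith), ih (x - 1) (by linarith)]

lemma cardB_one (x : ℝ) : cardB 1 x = max 0 (min x (2 - x)) := by
  simp only [cardB]
  rcases lt_or_ge x 0 with h | h
  · rw [max_eq_left ((min_le_left _ _).trans h.le)]
    simp [not_le.2 h, not_le.2 (by linarith : x < 1)]
  rcases lt_or_ge x 1 with h1 | h1
  · rw [min_eq_left (by linarith), max_eq_right h]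
    simp [h, h1, not_le.2 h1]
  rcases lt_or_ge x 2 with h2 | h2
  · rw [min_eq_right (by linarith), max_eq_right (by linarith)]
    simp [not_lt.2 h1, h1, (by linarith : x - 1 < 1)]
  · rw [max_eq_left ((min_le_right _ _).trans (by linarith))]
    simp [not_lt.2 h1, not_lt.2 (by linarith : 1 ≤ x - 1)]

lemma cardB_continuous (d : ℕ) : Continuous (cardB (d + 1)) := by
  induction d with
  | zero =>
    have : cardB (0 + 1) = fun x => max 0 (min x (2 - x)) := funext cardB_one
    rw [this]; fun_prop
  | succ d ih =>
    have : cardB (d + 1 + 1) = fun x => (x / ((d + 1 : ℕ) + 1)) * cardB (d + 1) x +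
      ((((d + 1 : ℕ) : ℝ) + 2 - x) / ((d + 1 : ℕ) + 1)) * cardB (d + 1) (x - 1) := by
      ext x; rw [cardB]
    rw [this]; fun_prop

lemma splineFn_continuous (n d : ℕ) (S : Rn n → ℝ) (h : IsSplineFn n (d + 1) S) :
    Continuous S := by
  obtain ⟨k, β, rfl⟩ := h
  unfold splineSum
  rw [continuous_iff_continuousAt]
  intro x
  let F : Finset (Fin n → ℤ) := Fintype.piFinset fun i =>
    Finset.Icc (⌊2 ^ k * x i⌋ - d - 4) (⌊2 ^ k * x i⌋ + 4)
  have hfin : Continuous fun y => ∑ m ∈ F, β m * Bspl n (d + 1) k m y := by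
    unfold Bspl
    have := cardB_continuous d
    fun_prop
  refine hfin.continuousAt.congr ?_
  have hN : ∀ᶠ y in nhds x, ∀ i, |2 ^ k * y i - 2 ^ k * x i| < 1 := by
    rw [Filter.eventually_all]
    intro i
    have : Continuous fun y : Rn n => |2 ^ k * y i - 2 ^ k * x i| := by fun_prop
    exact this.continuousAt.eventually_lt continuousAt_const (by simp)
  filter_upwards [hN] with y hy
  symm
  apply tsum_eq_sum
  intro m hm
  simp only [F, Fintype.mem_piFinset, not_forall, Finset.mem_Icc] at hm
  obtain ⟨i, hi⟩ := hm
  have : Bspl n (d + 1) k m y = 0 := by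
    unfold Bspl
    apply Finset.prod_eq_zero (Finset.mem_univ i)
    have hyi := abs_lt.1 (hy i)
    have h0 := Int.floor_le (2 ^ k * x i)
    have h1 := Int.lt_floor_add_one (2 ^ k * x i)
    rw [not_and_or] at hi
    rcases hi with hi | hi
    · apply cardB_zero_of_ge
      have : (m i : ℝ) + 1 ≤ ⌊2 ^ k * x i⌋ - d - 4 := by
        exact_mod_cast (by omega : m i + 1 ≤ ⌊2 ^ k * x i⌋ - d - 4)
      push_cast; linarith [hyi.1]
    · apply cardB_zero_of_neg
      have : (⌊2 ^ k * x i⌋ : ℝ) + 4 + 1 ≤ m i := by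
        exact_mod_cast (by omega : ⌊2 ^ k * x i⌋ + 4 + 1 ≤ m i)
      linarith [hyi.2]
  rw [this, mul_zero]


def node (L : ℕ) (b : Fin L) : ℝ := (b : ℝ) / L

def lg (L : ℕ) (b : Fin L) : Polynomial ℝ := Lagrange.basis Finset.univ (node L) b

lemma node_inj (L : ℕ) : Function.Injective (node L) := by
  intro a b h
  have hL : (L : ℝ) ≠ 0 := by
    have := a.pos
    positivity
  unfold node at h
  rw [div_left_inj' hL] at h
  exact Fin.ext (by exact_mod_cast h)

lemma node_nonneg (L : ℕ) (b : Fin L) : 0 ≤ node L b := by unfold node; positivity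

lemma node_le (L : ℕ) (b : Fin L) : node L b + 1 / L ≤ 1 := by
  have hL : (0 : ℝ) < L := by exact_mod_cast b.pos
  unfold node
  rw [← add_div, div_le_one hL]
  exact_mod_cast b.2

lemma lg_degree (L : ℕ) (b : Fin L) : (lg L b).natDegree < L := by
  have h := Lagrange.degree_basis (s := (Finset.univ : Finset (Fin L))) (v := node L)
    (node_inj L).injOn (Finset.mem_univ b)
  have := Polynomial.natDegree_eq_of_degree_eq_some h
  unfold lg
  rw [this]
  have := b.pos
  simp; omega

lemma repr_one (L : ℕ) (q : Polynomial ℝ) (hq : q.natDegree < L) (x : ℝ) :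
    q.eval x = ∑ b : Fin L, q.eval (node L b) * (lg L b).eval x := by
  have h := Lagrange.eq_interpolate (s := (Finset.univ : Finset (Fin L))) (v := node L) (f := q)
    (node_inj L).injOn (by
      simp only [Finset.card_univ, Fintype.card_fin]
      exact Polynomial.degree_le_natDegree.trans_lt (by exact_mod_cast hq))
  conv_lhs => rw [h, Lagrange.interpolate_apply]
  simp [Polynomial.eval_finsetSum, lg]

lemma lg_node (L : ℕ) (a b : Fin L) : (lg L b).eval (node L a) = if a = b then 1 else 0 := by
  unfold lg
  split_ifs with h
  · subst h
    exact Lagrange.eval_basis_self (node_inj L).injOn (Finset.mem_univ _)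
  · exact Lagrange.eval_basis_of_ne (Ne.symm h) (Finset.mem_univ _)

def lag {n : ℕ} (L : ℕ) (f : Rn n → ℝ) (x : Rn n) : ℝ :=
  ∑ b : Fin n → Fin L, f (fun i => node L (b i)) * ∏ i, (lg L (b i)).eval (x i)

def VL (n L : ℕ) : Submodule ℝ (Rn n → ℝ) where
  carrier := {f | ∀ x, f x = lag L f x}
  add_mem' := by
    intro f g hf hg x
    simp only [Set.mem_ofPred_eq] at hf hg
    rw [Pi.add_apply, hf x, hg x]
    simp only [lag, Pi.add_apply, add_mul, Finset.sum_add_distrib]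
  zero_mem' := by intro x; simp [lag]
  smul_mem' := by
    intro c f hf x
    simp only [Set.mem_ofPred_eq] at hf
    rw [Pi.smul_apply, hf x]
    simp only [lag, Pi.smul_apply, smul_eq_mul, mul_assoc, Finset.mul_sum]

lemma mem_VL {n L : ℕ} {f : Rn n → ℝ} : f ∈ VL n L ↔ ∀ x, f x = lag L f x := Iff.rfl

lemma tens_mem (n L : ℕ) (q : Fin n → Polynomial ℝ) (hq : ∀ i, (q i).natDegree < L) :
    (fun x : Rn n => ∏ i, (q i).eval (x i)) ∈ VL n L := by
  rw [mem_VL]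
  intro x
  simp only [fun i => repr_one L (q i) (hq i) (x i), Finset.prod_univ_sum, Fintype.piFinset_univ,
    lag, Finset.prod_mul_distrib]

lemma lag_mem {n : ℕ} (L : ℕ) (f : Rn n → ℝ) : lag L f ∈ VL n L := by
  have : lag L f = ∑ b : Fin n → Fin L, f (fun i => node L (b i)) •
      (fun x : Rn n => ∏ i, (lg L (b i)).eval (x i)) := by
    ext x; simp [lag, Finset.sum_apply]
  rw [this]
  exact Submodule.sum_mem _ fun b _ => Submodule.smul_mem _ _
    (tens_mem n L _ fun i => lg_degree L (b i))

lemma VL_affine {n L : ℕ} {P : Rn n → ℝ} (hP : P ∈ VL n L) (a : ℝ) (c : Rn n) :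
    (fun x => P (fun i => a * x i + c i)) ∈ VL n L := by
  have : (fun x => P (fun i => a * x i + c i)) =
      ∑ b : Fin n → Fin L, P (fun i => node L (b i)) •
      (fun x : Rn n => ∏ i, ((lg L (b i)).comp
        (Polynomial.C a * Polynomial.X + Polynomial.C (c i))).eval (x i)) := by
    ext x
    rw [mem_VL.1 hP]
    simp [lag, Finset.sum_apply]
  rw [this]
  refine Submodule.sum_mem _ fun b _ => Submodule.smul_mem _ _ (tens_mem n L _ fun i => ?_)
  refine Polynomial.natDegree_comp_le.trans_lt ?_
  have h1 : (Polynomial.C a * Polynomial.X + Polynomial.C (c i)).natDegree ≤ 1 :=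
    Polynomial.natDegree_linear_le
  calc _ ≤ (lg L (b i)).natDegree * 1 := Nat.mul_le_mul_left _ h1
    _ < L := by simpa using lg_degree L (b i)

lemma VL_shift {n L : ℕ} {P : Rn n → ℝ} (hP : P ∈ VL n L) (c : Rn n) :
    (fun x => P (x + c)) ∈ VL n L := by
  have := VL_affine hP 1 c
  simp only [one_mul] at this
  exact this

lemma VL_const {n L : ℕ} (hL : 0 < L) (c : ℝ) : (fun _ : Rn n => c) ∈ VL n L := by
  have := Submodule.smul_mem _ c (tens_mem n L (fun _ => Polynomial.C 1) (fun i => by simpa using hL))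
  convert this using 1
  ext x; simp

lemma VL_continuous {n L : ℕ} {P : Rn n → ℝ} (hP : P ∈ VL n L) : Continuous P := by
  have : P = lag L P := funext hP
  rw [this]; unfold lag
  fun_prop

lemma VL_SB (n L s : ℕ) (R : ℝ) (hR : 0 ≤ R) : ∃ K : ℝ, 0 ≤ K ∧ ∀ P ∈ VL n L,
    ∀ (c w h : Rn n) (t A : ℝ), (∀ b : Fin n → Fin L, |P (c + fun i => node L (b i))| ≤ A) →
    (∀ i, |w i - c i| ≤ R) → (∀ i, |h i| ≤ t) → 0 ≤ t → t ≤ 2 → 0 ≤ A →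
    SB s t (K * A) (fun b => P (w + (b : ℝ) • h)) := by
  choose K hK h using fun b : Fin L => SB.poly s R hR (lg L b)
  set K' := ∑ b, K b
  have hK' : ∀ b, K b ≤ K' := fun b => Finset.single_le_sum (f := K) (fun i _ => hK i) (by simp)
  have hK'0 : 0 ≤ K' := Finset.sum_nonneg fun i _ => hK i
  refine ⟨∑ b : Fin n → Fin L, (2 ^ s * K') ^ n, by positivity, ?_⟩
  intro P hP c w hh t A hA hw ht ht0 ht2 hA0
  have e : (fun b : ℕ => P (w + (b : ℝ) • hh)) = fun b : ℕ => ∑ β : Fin n → Fin L,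
      P (c + fun i => node L (β i)) * ∏ i, (lg L (β i)).eval ((w i - c i) + b * hh i) := by
    ext b
    have := mem_VL.1 (VL_shift hP c) (w + (b : ℝ) • hh - c)
    simp only [sub_add_cancel] at this
    rw [this, lag]
    refine Finset.sum_congr rfl fun β _ => ?_
    rw [add_comm c]
    congr 1
    refine Finset.prod_congr rfl fun i _ => ?_
    congr 1
    simp; ring
  rw [e, Finset.sum_mul]
  refine SB.sum Finset.univ fun β _ => ?_
  have h1 := SB.prod Finset.univ ht0 (K := K') (s := s)
    (F := fun i (b : ℕ) => (lg L (β i)).eval ((w i - c i) + b * hh i))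
    (fun i _ => (h (β i) _ _ t (hw i) (ht i) ht2).mono ht0 (hK' _))
  have h2 := h1.const_mul (P (c + fun i => node L (β i)))
  refine h2.mono ht0 ?_
  simp only [Finset.card_univ, Fintype.card_fin]
  rw [mul_comm]
  gcongr
  exact hA β

lemma remez (n L : ℕ) (hL : 0 < L) : ∃ η : ℝ≥0∞, 0 < η ∧ ∀ (s : ℕ) (R : ℝ), 0 ≤ R →
    ∃ K : ℝ, 0 ≤ K ∧ ∀ P ∈ VL n L, ∀ (c : Rn n) (lam : ℝ), 0 ≤ lam →
    volume {u | u ∈ Set.Icc c (c + 1) ∧ lam < |P u|} ≤ η →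
    ∀ (w h : Rn n) (t : ℝ), (∀ i, |w i - c i| ≤ R) → (∀ i, |h i| ≤ t) → 0 ≤ t → t ≤ 2 →
    SB s t (K * lam) (fun b => P (w + (b : ℝ) • h)) := by
  have hL' : (0 : ℝ) < L := by exact_mod_cast hL
  refine ⟨ENNReal.ofReal (1 / (2 * (L : ℝ) ^ n * (L : ℝ) ^ n)), by
    rw [ENNReal.ofReal_pos]; positivity, ?_⟩
  intro s R hR
  obtain ⟨K, hK, h⟩ := VL_SB n L s (R + 1) (by linarith)
  refine ⟨K, hK, ?_⟩
  intro P hP c lam hlam hvol w hh t hw hht ht0 ht2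
  set B := {u | u ∈ Set.Icc c (c + 1) ∧ lam < |P u|}
  let nb : (Fin n → Fin L) → Rn n := fun b i => node L (b i)
  let Bad : Set (Rn n) := ⋃ b : Fin n → Fin L, (fun v => (c + nb b) + v) ⁻¹' B
  have hbad : volume Bad < volume (Set.Icc (0 : Rn n) (fun _ => 1 / (L:ℝ))) := by
    have h1 : volume Bad ≤ (L : ℝ≥0∞) ^ n *
        ENNReal.ofReal (1 / (2 * (L : ℝ) ^ n * (L : ℝ) ^ n)) := by
      refine (measure_iUnion_fintype_le _ _).trans ?_
      refine (Finset.sum_le_sum (g := fun _ =>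
        ENNReal.ofReal (1 / (2 * (L : ℝ) ^ n * (L : ℝ) ^ n))) fun b _ => ?_).trans ?_
      · rw [measure_preimage_add]; exact hvol
      · simp
    refine h1.trans_lt ?_
    rw [Real.volume_Icc_pi]
    simp only [Pi.zero_apply, sub_zero, Finset.prod_const, Finset.card_univ, Fintype.card_fin]
    have e1 : (L : ℝ≥0∞) = ENNReal.ofReal L := by simp
    rw [e1, ← ENNReal.ofReal_pow (by positivity), ← ENNReal.ofReal_mul (by positivity),
      ← ENNReal.ofReal_pow (by positivity), ENNReal.ofReal_lt_ofReal_iff (by positivity)]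
    have : (0:ℝ) < (L:ℝ) ^ n := by positivity
    rw [one_div_pow]
    field_simp
    norm_num
  obtain ⟨v, hv, hvb⟩ : ∃ v, v ∈ Set.Icc (0 : Rn n) (fun _ => 1 / (L:ℝ)) ∧ v ∉ Bad := by
    by_contra hcon
    push Not at hcon
    exact absurd (measure_mono hcon) (not_le.2 hbad)
  have hv0 : ∀ i, 0 ≤ v i := fun i => hv.1 i
  have hv1 : ∀ i, v i ≤ 1 / L := fun i => hv.2 i
  have hL1 : (1 : ℝ) / L ≤ 1 := by
    rw [div_le_one hL']; exact_mod_cast hL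
  refine h P hP (c + v) w hh t lam ?_ ?_ hht ht0 ht2 hlam
  · intro b
    simp only [Bad, Set.mem_iUnion, not_exists, Set.mem_preimage] at hvb
    have h2 := hvb b
    simp only [B, Set.mem_ofPred_eq, not_and, not_lt] at h2
    have e : c + v + (fun i => node L (b i)) = c + nb b + v := by
      simp only [nb]; abel
    rw [e]
    apply h2
    constructor
    · intro i
      have := node_nonneg L (b i)
      have := hv0 i
      simp [nb]; linarith
    · intro i
      have := node_le L (b i)
      have := hv1 i
      simp only [nb, Pi.add_apply, Pi.one_apply]; linarith
  · intro i
    have := hw i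
    have h3 := hv0 i
    have h4 := hv1 i
    simp only [Pi.add_apply]
    rw [abs_le] at *
    constructor <;> linarith [this.1, this.2]

/-! exact polynomial characterisation -/

lemma rec_zero (L M : ℕ) (G : ℕ → ℝ) (h0 : ∀ a < L, G a = 0)
    (h : ∀ a, a + L ≤ M → (fwdDiff 1)^[L] G a = 0) : ∀ a ≤ M, G a = 0 := by
  intro a
  induction a using Nat.strong_induction_on with
  | _ a ih =>
    intro ha
    rcases lt_or_ge a L with h1 | h1
    · exact h0 a h1
    · have h2 := h (a - L) (by omega)
      rw [fwdDiff_iter_eq_sum_shift, Finset.sum_range_succ] at h2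
      rw [Finset.sum_eq_zero] at h2
      · have : a - L + L • 1 = a := by simp; omega
        rw [this] at h2
        simpa using h2
      · intro j hj
        simp only [Finset.mem_range] at hj
        rw [ih (a - L + j • 1) (by simp; omega) (by simp; omega)]
        simp

lemma one_dim_exact (L : ℕ) (hL : 0 < L) (F : ℝ → ℝ) (hF : ContinuousOn F (Set.Icc 0 1))
    (hD : ∀ x h : ℝ, 0 ≤ h → 0 ≤ x → x + L * h ≤ 1 →
      (fwdDiff 1)^[L] (fun b : ℕ => F (x + b * h)) 0 = 0) :
    ∀ x ∈ Set.Icc (0 : ℝ) 1, F x = ∑ b : Fin L, F (node L b) * (lg L b).eval x := by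
  have hL' : (0 : ℝ) < L := by exact_mod_cast hL
  have pol0 : ∀ (q : Polynomial ℝ), q.natDegree < L → ∀ (x h : ℝ) (a : ℕ),
      (fwdDiff 1)^[L] (fun b : ℕ => q.eval (x + b * h)) a = 0 := by
    intro q hq x h a
    set q' := q.comp (Polynomial.C h * Polynomial.X + Polynomial.C x)
    have h1 : q'.natDegree < L := by
      refine Polynomial.natDegree_comp_le.trans_lt ?_
      calc _ ≤ q.natDegree * 1 := Nat.mul_le_mul_left _ Polynomial.natDegree_linear_le
        _ < L := by simpa using hq
    have h2 := congrFun (Polynomial.fwdDiff_iter_eq_zero_of_degree_lt h1) (a : ℝ)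
    rw [fwdDiff_iter_eq_sum_shift] at h2 ⊢
    rw [← Pi.zero_apply (a : ℝ) (M := fun _ => ℝ), ← h2]
    refine Finset.sum_congr rfl fun j _ => ?_
    congr 1
    simp [q']; congr 1; ring
  set q0 : Polynomial ℝ := ∑ b : Fin L, Polynomial.C (F (node L b)) * lg L b with hq0
  have hq0d : q0.natDegree < L := by
    refine (Polynomial.natDegree_sum_le_of_forall_le (n := L - 1) Finset.univ _ fun b _ => ?_).trans_lt
      (by omega)
    exact (Polynomial.natDegree_C_mul_le _ _).trans (by have := lg_degree L b; omega)
  have hq0e : ∀ x, q0.eval x = ∑ b : Fin L, F (node L b) * (lg L b).eval x := by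
    intro x; simp [hq0, Polynomial.eval_finsetSum]
  have hq0n : ∀ a : Fin L, q0.eval (node L a) = F (node L a) := by
    intro a; rw [hq0e]; simp [lg_node]
  -- vanishing at rational points
  have hrat : ∀ N : ℕ, 0 < N → ∀ a : ℕ, a ≤ L * N → F (a / (L * N)) = q0.eval ((a : ℝ) / (L * N)) := by
    intro N hN
    have hN' : (0 : ℝ) < N := by exact_mod_cast hN
    -- interpolate on the fine grid
    let fine : Fin L → ℝ := fun b => (b : ℝ) / (L * N)
    have finj : Function.Injective fine := by
      intro a b h
      simp only [fine] at h
      rw [div_left_inj' (by positivity)] at h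
      exact Fin.ext (by exact_mod_cast h)
    set G : ℝ → ℝ := fun x => F x - q0.eval x with hG
    set qN := Lagrange.interpolate Finset.univ fine (fun b => G (fine b)) with hqN
    have hqNd : qN.natDegree < L := by
      have := Lagrange.degree_interpolate_lt (s := (Finset.univ : Finset (Fin L)))
        (r := fun b => G (fine b)) finj.injOn
      simp only [Finset.card_univ, Fintype.card_fin] at this
      by_cases hz : qN = 0
      · rw [hz]; simpa using hL
      · rwa [Polynomial.natDegree_lt_iff_degree_lt hz]
    have hz : ∀ a ≤ L * N, G ((a:ℝ) * (1 / (L * N))) - qN.eval ((a:ℝ) * (1 / (L * N))) = 0 := by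
      apply rec_zero L (L * N) (fun a : ℕ => G ((a:ℝ) * (1 / (L * N))) - qN.eval ((a:ℝ) * (1 / (L * N))))
      · intro a ha
        have := Lagrange.eval_interpolate_at_node (s := (Finset.univ : Finset (Fin L)))
          (fun b => G (fine b)) finj.injOn (Finset.mem_univ ⟨a, ha⟩)
        have e : (a : ℝ) * (1 / (L * N)) = fine ⟨a, ha⟩ := by simp [fine]; ring
        simp only [e]
        rw [hqN, this, sub_self]
      · intro a ha
        have e1 := hD ((a:ℝ) / (L * N)) (1 / (L * N)) (by positivity) (by positivity) (by
          rw [mul_one_div, ← add_div, div_le_one (by positivity)]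
          exact_mod_cast ha)
        have e2 := pol0 q0 hq0d 0 (1 / (L * N)) a
        have e3 := pol0 qN hqNd 0 (1 / (L * N)) a
        rw [fwdDiff_iter_eq_sum_shift] at e1 e2 e3 ⊢
        have : ∀ j : ℕ, (a:ℝ) / (L * N) + ((0 + j • 1 : ℕ) : ℝ) * (1 / (L * N)) =
            ((a + j • 1 : ℕ) : ℝ) * (1 / (L * N)) := by
          intro j; push_cast; ring
        simp only [this] at e1
        simp only [zero_add] at e2 e3
        simp only [hG, smul_sub, Finset.sum_sub_distrib]
        rw [e1, e2, e3]; simp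
    have hq0' : qN = 0 := by
      by_contra hne
      apply absurd (Polynomial.card_le_degree_of_subset_roots
        (p := qN) (Z := Finset.univ.image (node L)) ?_)
      · rw [Finset.card_image_of_injective _ (node_inj L)]
        simpa using hqNd
      · intro x hx
        rw [Multiset.mem_toFinset.symm] at *
        simp only [Finset.mem_val, Finset.mem_image, Finset.mem_univ, true_and,
          Multiset.mem_toFinset] at hx ⊢
        obtain ⟨b, rfl⟩ := hx
        rw [Polynomial.mem_roots hne, Polynomial.IsRoot.def]
        have h1 := hz (b * N) (Nat.mul_le_mul_right _ b.2.le)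
        have e : ((b * N : ℕ) : ℝ) * (1 / (L * N)) = node L b := by
          unfold node; push_cast; field_simp
        rw [e] at h1
        have : G (node L b) = 0 := by simp [hG, hq0n]
        linarith
    intro a ha
    have h1 := hz a ha
    rw [hq0'] at h1
    simp only [Polynomial.eval_zero, sub_zero, hG, mul_one_div] at h1
    linarith
  -- density
  intro x hx
  rw [← hq0e]
  have hlim : Tendsto (fun N : ℕ => ((⌊x * (L * (N + 1 : ℕ))⌋₊ : ℕ) : ℝ) / (L * (N + 1 : ℕ)))
      atTop (nhds x) := by
    rw [Metric.tendsto_atTop]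
    intro ε hε
    obtain ⟨N0, hN0⟩ := exists_nat_gt (1 / ε)
    refine ⟨N0, fun N hN => ?_⟩
    have hpos : (0:ℝ) < L * (N + 1 : ℕ) := by positivity
    have h1 := Nat.floor_le (mul_nonneg hx.1 hpos.le)
    have h2 := Nat.lt_floor_add_one (x * (L * (N + 1 : ℕ)))
    have hL1 : (1 : ℝ) ≤ L := by exact_mod_cast hL
    have hN1 : (N0 : ℝ) ≤ N := by exact_mod_cast hN
    have h3 : 1 / ε < L * (N + 1 : ℕ) := by push_cast; nlinarith
    rw [Real.dist_eq, abs_lt]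
    rw [div_lt_iff₀ hε] at h3
    constructor
    · have : x - ε < ((⌊x * (L * (N + 1 : ℕ))⌋₊ : ℕ) : ℝ) / (L * (N + 1 : ℕ)) := by
        rw [lt_div_iff₀ hpos]
        nlinarith
      linarith
    · have : ((⌊x * (L * (N + 1 : ℕ))⌋₊ : ℕ) : ℝ) / (L * (N + 1 : ℕ)) ≤ x := by
        rw [div_le_iff₀ hpos]; exact h1
      linarith
  have hmem : ∀ N : ℕ, ((⌊x * (L * (N + 1 : ℕ))⌋₊ : ℕ) : ℝ) / (L * (N + 1 : ℕ)) ∈ Set.Icc (0:ℝ) 1 := by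
    intro N
    have hpos : (0:ℝ) < L * (N + 1 : ℕ) := by positivity
    refine ⟨by positivity, ?_⟩
    rw [div_le_one hpos]
    refine (Nat.floor_le (mul_nonneg hx.1 hpos.le)).trans ?_
    nlinarith [hx.2]
  have hl1 : Tendsto (fun N : ℕ => F (((⌊x * (L * (N + 1 : ℕ))⌋₊ : ℕ) : ℝ) / (L * (N + 1 : ℕ))))
      atTop (nhds (F x)) :=
    (hF x hx).tendsto.comp (tendsto_nhdsWithin_iff.2 ⟨hlim, Eventually.of_forall hmem⟩)
  have hl2 : Tendsto (fun N : ℕ => q0.eval (((⌊x * (L * (N + 1 : ℕ))⌋₊ : ℕ) : ℝ) / (L * (N + 1 : ℕ))))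
      atTop (nhds (q0.eval x)) :=
    (q0.continuous.tendsto x).comp hlim
  refine tendsto_nhds_unique hl1 (hl2.congr fun N => ?_)
  have hpos : (0:ℝ) < L * (N + 1 : ℕ) := by positivity
  refine (hrat (N + 1) (by omega) _ ?_).symm
  have h5 : x * (L * (N + 1 : ℕ)) ≤ ((L * (N + 1) : ℕ) : ℝ) := by
    push_cast; push_cast at hpos; nlinarith [hx.2]
  have := Nat.floor_le_floor h5
  rwa [Nat.floor_natCast] at this

lemma VL_of_diff (n L : ℕ) (hL : 0 < L) (g : Rn n → ℝ) (hg : Continuous g)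
    (hD : ∀ x ∈ Set.Icc (0 : Rn n) 1, ∀ y ∈ Set.Icc (0 : Rn n) 1,
      diffl L ((1 / (L : ℝ)) • (y - x)) g x = 0) :
    ∀ x ∈ Set.Icc (0 : Rn n) 1, g x = lag L g x := by
  have hL' : (0 : ℝ) < L := by exact_mod_cast hL
  -- reproduction in each coordinate
  have h1 : ∀ x ∈ Set.Icc (0 : Rn n) 1, ∀ i, g x =
      ∑ b : Fin L, g (Function.update x i (node L b)) * (lg L b).eval (x i) := by
    intro x hx i
    have := one_dim_exact L hL (fun s => g (Function.update x i s))
      (by apply Continuous.continuousOn; fun_prop) ?_ (x i) ⟨hx.1 i, hx.2 i⟩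
    · simpa using this
    · intro s h hh hs hsh
      have hm : ∀ s : ℝ, 0 ≤ s → s ≤ 1 → Function.update x i s ∈ Set.Icc (0 : Rn n) 1 := by
        intro s h0 h1
        constructor
        · intro j
          by_cases hj : j = i
          · subst hj; simpa using h0
          · simpa [hj] using hx.1 j
        · intro j
          by_cases hj : j = i
          · subst hj; simpa using h1
          · simpa [hj] using hx.2 j
      have hLh : 0 ≤ L * h := by positivity
      have := hD (Function.update x i s) (hm s hs (by linarith)) (Function.update x i (s + L * h))
        (hm _ (by linarith) hsh)
      rw [diffl_eq_fwd] at this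
      rw [← this]
      have ee : (fun b : ℕ => g (Function.update x i (s + b * h))) = fun b : ℕ =>
          g (Function.update x i s + (b : ℝ) • ((1 / (L : ℝ)) •
            (Function.update x i (s + L * h) - Function.update x i s))) := by
        funext b
        congr 1
        funext j
        by_cases hj : j = i
        · subst hj; simp; field_simp; simp
        · simp [hj]
      rw [ee]
  have h2 : ∀ x, ∀ i, lag L g x =
      ∑ b : Fin L, lag L g (Function.update x i (node L b)) * (lg L b).eval (x i) := by
    intro x i
    unfold lag
    simp only [Finset.sum_mul]
    rw [Finset.sum_comm]
    refine Finset.sum_congr rfl fun β _ => ?_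
    have : ∀ b : Fin L, ∏ j, (lg L (β j)).eval (Function.update x i (node L b) j) =
        (if b = β i then 1 else 0) * ∏ j ∈ Finset.univ.erase i, (lg L (β j)).eval (x j) := by
      intro b
      rw [← Finset.mul_prod_erase _ _ (Finset.mem_univ i)]
      congr 1
      · simp [lg_node]
      · refine Finset.prod_congr rfl fun j hj => ?_
        rw [Function.update_of_ne (Finset.ne_of_mem_erase hj)]
    simp only [this]
    rw [Finset.sum_eq_single (β i)]
    · rw [← Finset.mul_prod_erase _ _ (Finset.mem_univ i)]
      simp; ring
    · intro b _ hb; simp [hb]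
    · simp
  have h3 : ∀ S : Finset (Fin n), ∀ x ∈ Set.Icc (0 : Rn n) 1,
      (∀ i ∉ S, ∃ b : Fin L, x i = node L b) → g x = lag L g x := by
    intro S
    induction S using Finset.induction_on with
    | empty =>
      intro x hx h
      choose b hb using fun i => h i (by simp)
      have : x = fun i => node L (b i) := funext hb
      subst this
      unfold lag
      rw [Finset.sum_eq_single b]
      · simp [lg_node]
      · intro b' _ hb'
        obtain ⟨i, hi⟩ := Function.ne_iff.1 hb'
        rw [Finset.prod_eq_zero (Finset.mem_univ i), mul_zero]
        rw [lg_node, if_neg (Ne.symm hi)]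
      · simp
    | insert i S hi ih =>
      intro x hx h
      rw [h1 x hx i, h2 x i]
      refine Finset.sum_congr rfl fun b _ => ?_
      congr 1
      have hb0 := node_nonneg L b
      have hb1 := node_le L b
      have : 0 < 1 / (L : ℝ) := by positivity
      apply ih
      · constructor
        · intro j
          by_cases hj : j = i
          · subst hj; simpa using hb0
          · simpa [hj] using hx.1 j
        · intro j
          by_cases hj : j = i
          · subst hj; simp; linarith
          · simpa [hj] using hx.2 j
      · intro j hj
        by_cases hji : j = i
        · subst hji; exact ⟨b, by simp⟩
        · obtain ⟨b', hb'⟩ := h j (by simp [hji, hj])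
          exact ⟨b', by simp [hji, hb']⟩
  intro x hx
  exact h3 Finset.univ x hx (by simp)


/-! Whitney-type lemma in measure -/

abbrev UU (n : ℕ) : Set (Rn n) := Set.Icc 0 1

def muU (n : ℕ) : Measure (Rn n) := volume.restrict (UU n)

instance muU_prob (n : ℕ) : IsProbabilityMeasure (muU n) := by
  constructor
  unfold muU
  rw [Measure.restrict_apply_univ, Real.volume_Icc_pi]
  simp

def zz (n L j : ℕ) (x y : Rn n) : Rn n := x + (j : ℝ) • ((1 / (L : ℝ)) • (y - x))

def DD {n : ℕ} (L : ℕ) (φ : Rn n → ℝ) (x y : Rn n) : ℝ := diffl L ((1 / (L : ℝ)) • (y - x)) φ x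

lemma DD_eq {n : ℕ} (L : ℕ) (φ : Rn n → ℝ) (x y : Rn n) : DD L φ x y =
    ∑ j ∈ Finset.range (L + 1), ((L.choose j : ℝ) * (-1 : ℝ) ^ (L + j)) * φ (zz n L j x y) := rfl

lemma zz_mem {n L j : ℕ} (hj : j ≤ L) {x y : Rn n} (hx : x ∈ UU n) (hy : y ∈ UU n) :
    zz n L j x y ∈ UU n := by
  rcases Nat.eq_zero_or_pos L with h0 | h0
  · subst h0; simpa [zz] using hx
  have hL : (0:ℝ) < L := by exact_mod_cast h0
  set s : ℝ := (j : ℝ) / L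
  have hs0 : 0 ≤ s := by positivity
  have hs1 : s ≤ 1 := by
    rw [div_le_one hL]; exact_mod_cast hj
  have e : ∀ i, zz n L j x y i = (1 - s) * x i + s * y i := by
    intro i; simp [zz, s]; ring
  constructor
  · intro i
    rw [e]
    have h1 : 0 ≤ x i := hx.1 i
    have h2 : 0 ≤ y i := hy.1 i
    have : 0 ≤ 1 - s := by linarith
    simp only [Pi.zero_apply]
    positivity
  · intro i
    rw [e]
    have h1 : x i ≤ 1 := hx.2 i
    have h2 : y i ≤ 1 := hy.2 i
    have : 0 ≤ 1 - s := by linarith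
    simp only [Pi.one_apply]
    nlinarith

lemma zz_measurable (n L j : ℕ) : Measurable (fun p : Rn n × Rn n => zz n L j p.1 p.2) := by
  unfold zz; fun_prop

lemma DD_measurable {n : ℕ} (L : ℕ) {φ : Rn n → ℝ} (hφ : Measurable φ) :
    Measurable (fun p : Rn n × Rn n => DD L φ p.1 p.2) := by
  simp only [DD_eq]
  refine Finset.measurable_sum _ fun j _ => ?_
  exact (hφ.comp (zz_measurable n L j)).const_mul _

lemma sum_abs_coef (L : ℕ) :
    ∑ j ∈ Finset.range (L + 1), |((L.choose j : ℝ) * (-1 : ℝ) ^ (L + j))| = 2 ^ L := by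
  have h := Nat.sum_range_choose L
  have : ∀ j, |((L.choose j : ℝ) * (-1 : ℝ) ^ (L + j))| = (L.choose j : ℝ) := by
    intro j; rw [abs_mul, abs_pow]; simp
  simp only [this]
  exact_mod_cast h

lemma DD_abs_le {n : ℕ} (L : ℕ) {φ : Rn n → ℝ} {x y : Rn n} {A : ℝ}
    (h : ∀ j ≤ L, |φ (zz n L j x y)| ≤ A) : |DD L φ x y| ≤ 2 ^ L * A := by
  rw [DD_eq, ← sum_abs_coef, Finset.sum_mul]
  refine (Finset.abs_sum_le_sum_abs _ _).trans (Finset.sum_le_sum fun j hj => ?_)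
  rw [abs_mul]
  gcongr
  exact h j (by simpa [Nat.lt_succ_iff] using hj)

lemma DD_sub {n : ℕ} (L : ℕ) (φ ψ : Rn n → ℝ) (x y : Rn n) :
    DD L (fun z => φ z - ψ z) x y = DD L φ x y - DD L ψ x y := by
  simp only [DD_eq, mul_sub, Finset.sum_sub_distrib]

lemma DD_const_mul {n : ℕ} (L : ℕ) (c : ℝ) (φ : Rn n → ℝ) (x y : Rn n) :
    DD L (fun z => c * φ z) x y = c * DD L φ x y := by
  simp only [DD_eq, Finset.mul_sum]
  exact Finset.sum_congr rfl fun j _ => by ring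

lemma DD_congr {n : ℕ} (L : ℕ) {φ ψ : Rn n → ℝ} {x y : Rn n}
    (h : ∀ j ≤ L, φ (zz n L j x y) = ψ (zz n L j x y)) : DD L φ x y = DD L ψ x y := by
  simp only [DD_eq]
  exact Finset.sum_congr rfl fun j hj => by rw [h j (by simpa [Nat.lt_succ_iff] using hj)]

lemma DD_zero_of_top {n L : ℕ} {φ : Rn n → ℝ} {x y : Rn n} {A B : ℝ}
    (h : ∀ j, 1 ≤ j → j ≤ L → |φ (zz n L j x y)| ≤ A) (hA : 0 ≤ A) (hD : |DD L φ x y| ≤ B) :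
    |φ x| ≤ 2 ^ L * A + B := by
  have hz : zz n L 0 x y = x := by simp [zz]
  set φ' : Rn n → ℝ := fun z => φ z
  have e : DD L φ x y = ∑ j ∈ Finset.range L,
      ((L.choose (j+1) : ℝ) * (-1 : ℝ) ^ (L + (j+1))) * φ (zz n L (j+1) x y) + (-1)^L * φ x := by
    rw [DD_eq, Finset.sum_range_succ', hz]; simp
  have h2 : |∑ j ∈ Finset.range L,
      ((L.choose (j+1) : ℝ) * (-1 : ℝ) ^ (L + (j+1))) * φ (zz n L (j+1) x y)| ≤ 2 ^ L * A := by
    have := sum_abs_coef L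
    rw [Finset.sum_range_succ'] at this
    have h3 : ∑ j ∈ Finset.range L, |((L.choose (j+1) : ℝ) * (-1 : ℝ) ^ (L + (j+1)))| ≤ 2 ^ L := by
      rw [← this]; simp
    refine (Finset.abs_sum_le_sum_abs _ _).trans ?_
    refine le_trans ?_ (mul_le_mul_of_nonneg_right h3 hA)
    rw [Finset.sum_mul]
    refine Finset.sum_le_sum fun j hj => ?_
    rw [abs_mul]
    gcongr
    exact h _ (by omega) (by simp at hj; omega)
  have h4 : |φ x| = |(-1)^L * φ x| := by rw [abs_mul, abs_pow]; simp
  rw [h4]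
  have : (-1)^L * φ x = DD L φ x y - ∑ j ∈ Finset.range L,
      ((L.choose (j+1) : ℝ) * (-1 : ℝ) ^ (L + (j+1))) * φ (zz n L (j+1) x y) := by rw [e]; ring
  rw [this]
  refine (abs_sub _ _).trans ?_
  linarith

lemma muU_scale {n L j : ℕ} (h1 : 1 ≤ j) (hj : j ≤ L) {x : Rn n} (hx : x ∈ UU n) {E : Set (Rn n)}
    (hE : MeasurableSet E) : muU n {y | zz n L j x y ∈ E} ≤ (L : ℝ≥0∞) ^ n * muU n E := by
  have hL : (0:ℝ) < L := by exact_mod_cast (by omega : 0 < L)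
  have hj' : (1:ℝ) ≤ j := by exact_mod_cast h1
  set s : ℝ := (j : ℝ) / L
  have hs0 : 0 < s := by positivity
  have hm : MeasurableSet {y | zz n L j x y ∈ E} :=
    ((zz_measurable n L j).comp (measurable_const.prodMk measurable_id)) hE
  unfold muU
  rw [Measure.restrict_apply hm, Measure.restrict_apply hE]
  have hsub : {y | zz n L j x y ∈ E} ∩ UU n ⊆
      (fun y => s • y) ⁻¹' ((fun y => y + (1 - s) • x) ⁻¹' (E ∩ UU n)) := by
    rintro y ⟨hy1, hy2⟩
    have e : s • y + (1 - s) • x = zz n L j x y := by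
      ext i; simp [zz, s]; ring
    simp only [Set.mem_preimage, e]
    exact ⟨hy1, zz_mem hj hx hy2⟩
  refine (measure_mono hsub).trans ?_
  rw [Measure.addHaar_preimage_smul _ hs0.ne', measure_preimage_add_right]
  gcongr
  simp only [Module.finrank_fintype_fun_eq_card, Fintype.card_fin]
  rw [abs_of_pos (by positivity), ← inv_pow, ENNReal.ofReal_pow (by positivity)]
  gcongr
  rw [← ENNReal.ofReal_natCast]
  apply ENNReal.ofReal_le_ofReal
  simp only [s, inv_div]
  exact div_le_self hL.le hj'

def nuU (n : ℕ) : Measure (Rn n × Rn n) := (muU n).prod (muU n)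

lemma nuU_le_of {n : ℕ} {E : Set (Rn n × Rn n)} (hE : MeasurableSet E) (c : ℝ≥0∞)
    (h : ∀ x ∈ UU n, muU n {y | (x, y) ∈ E} ≤ c) : nuU n E ≤ c := by
  unfold nuU
  rw [Measure.prod_apply hE]
  calc ∫⁻ x, muU n (Prod.mk x ⁻¹' E) ∂muU n ≤ ∫⁻ x, c ∂muU n := by
        apply lintegral_mono_ae
        unfold muU
        rw [ae_restrict_iff' measurableSet_Icc]
        exact Eventually.of_forall fun x hx => h x hx
    _ = c := by simp

/-- preimages of a small set under the maps `zz` -/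
lemma nuU_zz {n L j : ℕ} (hL : 0 < L) (hj : j ≤ L) {E : Set (Rn n)} (hE : MeasurableSet E) :
    nuU n {p | zz n L j p.1 p.2 ∈ E} ≤ (L : ℝ≥0∞) ^ n * muU n E := by
  rcases Nat.eq_zero_or_pos j with h0 | h0
  · subst h0
    have : {p : Rn n × Rn n | zz n L 0 p.1 p.2 ∈ E} = E ×ˢ Set.univ := by
      ext p; simp [zz]
    rw [this, nuU, Measure.prod_prod]
    simp only [measure_univ, mul_one]
    have : (1 : ℝ≥0∞) ≤ (L : ℝ≥0∞) ^ n := one_le_pow₀ (by exact_mod_cast hL)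
    calc muU n E = 1 * muU n E := (one_mul _).symm
      _ ≤ _ := by gcongr
  · exact nuU_le_of (zz_measurable n L j hE) _ fun x hx => muU_scale h0 hj hx hE

lemma nuU_zz_union {n L : ℕ} (hL : 0 < L) {E : Set (Rn n)} (hE : MeasurableSet E) :
    nuU n {p | ∃ j ≤ L, zz n L j p.1 p.2 ∈ E} ≤ ((L + 1 : ℕ) : ℝ≥0∞) * ((L : ℝ≥0∞) ^ n * muU n E) := by
  have : {p : Rn n × Rn n | ∃ j ≤ L, zz n L j p.1 p.2 ∈ E} ⊆
      ⋃ j ∈ Finset.range (L + 1), {p | zz n L j p.1 p.2 ∈ E} := by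
    rintro p ⟨j, hj, h⟩
    simp only [Set.mem_iUnion]
    exact ⟨j, by simpa [Nat.lt_succ_iff] using hj, h⟩
  refine (measure_mono this).trans ((measure_biUnion_finset_le _ _).trans ?_)
  refine (Finset.sum_le_sum (g := fun _ => (L : ℝ≥0∞) ^ n * muU n E) fun j hj => ?_).trans ?_
  · exact nuU_zz hL (by simpa [Nat.lt_succ_iff] using hj) hE
  · simp

/-- compactness: an equi-Lipschitz function with small differences is close to a polynomial -/
lemma exact_near (n L : ℕ) (hL : 0 < L) (M K δ : ℝ) (hK : 0 ≤ K) (hδ : 0 < δ) : ∃ ε : ℝ, 0 < ε ∧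
    ∀ g : Rn n → ℝ, (∀ x, |g x| ≤ M) → (∀ x y, |g x - g y| ≤ K * ‖x - y‖) →
    (∀ x ∈ UU n, ∀ y ∈ UU n, |DD L g x y| ≤ ε) →
    ∃ P ∈ VL n L, (∀ x ∈ UU n, ∀ y ∈ UU n, DD L P x y = 0) ∧ ∀ x ∈ UU n, |g x - P x| ≤ δ := by
  by_contra! hcon
  choose! g hgM hgK hgD hgP using fun i : ℕ => hcon (1 / ((i : ℝ) + 1)) (by positivity)
  let A : Set (Rn n → ℝ) := (Set.pi Set.univ fun _ => Set.Icc (-M) M) ∩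
    {g | ∀ x y, |g x - g y| ≤ K * ‖x - y‖}
  have hA : IsCompact A := by
    refine (isCompact_univ_pi fun _ => isCompact_Icc).inter_right ?_
    simp only [Set.ofPred_forall]
    refine isClosed_iInter fun x => isClosed_iInter fun y => isClosed_le ?_ continuous_const
    exact ((continuous_apply x).sub (continuous_apply y)).abs
  have hgA : ∀ i, g i ∈ A := fun i => ⟨fun x _ => abs_le.1 (hgM i x), hgK i⟩
  obtain ⟨G, hGA, hG⟩ := hA.exists_mapClusterPt (u := g) (f := atTop)
    (tendsto_principal.2 (Eventually.of_forall hgA))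
  have hGc : Continuous G := by
    have : LipschitzWith K.toNNReal G := LipschitzWith.of_dist_le_mul fun x y => by
      rw [Real.dist_eq, dist_eq_norm, Real.coe_toNNReal _ hK]; exact hGA.2 x y
    exact this.continuous
  have hGD : ∀ x ∈ UU n, ∀ y ∈ UU n, DD L G x y = 0 := by
    intro x hx y hy
    by_contra hne
    have hc : 0 < |DD L G x y| := abs_pos.2 hne
    have hcont : Continuous fun g : Rn n → ℝ => |DD L g x y| := by
      simp only [DD_eq]
      refine Continuous.abs (continuous_finsetSum _ fun j _ => ?_)
      exact continuous_const.mul (continuous_apply _)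
    have hN : {g : Rn n → ℝ | |DD L G x y| / 2 < |DD L g x y|} ∈ nhds G :=
      (isOpen_lt continuous_const hcont).mem_nhds (by simp only [Set.mem_ofPred_eq]; linarith)
    have hfr := mapClusterPt_iff_frequently.1 hG _ hN
    have hev : ∀ᶠ i : ℕ in atTop, 1 / ((i : ℝ) + 1) < |DD L G x y| / 2 :=
      (tendsto_one_div_add_atTop_nhds_zero_nat).eventually_lt_const (by linarith)
    obtain ⟨i, h1, h2⟩ := (hfr.and_eventually hev).exists
    have h3 := hgD i x hx y hy
    simp only [Set.mem_ofPred_eq] at h1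
    linarith
  have hPG : ∀ x ∈ UU n, G x = lag L G x := VL_of_diff n L hL G hGc hGD
  obtain ⟨ρ, hρ, hρK⟩ : ∃ ρ : ℝ, 0 < ρ ∧ K * ρ ≤ δ / 3 := by
    refine ⟨δ / (3 * (K + 1)), by positivity, ?_⟩
    rw [mul_div_assoc', div_le_div_iff₀ (by positivity) (by positivity)]
    nlinarith
  obtain ⟨t, htU, htf, htc⟩ := (isCompact_Icc (a := (0 : Rn n)) (b := 1)).finite_cover_balls hρ
  have hN : {g : Rn n → ℝ | ∀ x ∈ t, |g x - G x| < δ / 3} ∈ nhds G := by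
    have : {g : Rn n → ℝ | ∀ x ∈ t, |g x - G x| < δ / 3} = ⋂ x ∈ t, {g | |g x - G x| < δ / 3} := by
      ext g; simp
    rw [this]
    refine (htf.isOpen_biInter fun x _ => ?_).mem_nhds ?_
    · exact isOpen_lt (((continuous_apply x).sub continuous_const).abs) continuous_const
    · simp; intros; linarith
  obtain ⟨i, hi⟩ := (mapClusterPt_iff_frequently.1 hG _ hN).exists
  obtain ⟨x, hx, hxd⟩ := hgP i (lag L G) (lag_mem L G) (fun x hx y hy => by
    rw [← hGD x hx y hy]
    exact DD_congr L fun j hj => (hPG _ (zz_mem hj hx hy)).symm)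
  rw [← hPG x hx] at hxd
  have := htc hx
  simp only [Set.mem_iUnion] at this
  obtain ⟨z, hz, hzx⟩ := this
  rw [mem_ball_iff_norm] at hzx
  have h1 := hgK i x z
  have h2 := hGA.2 z x
  have h3 := hi z hz
  rw [norm_sub_rev] at h2
  have h4 : K * ‖x - z‖ ≤ δ / 3 := (mul_le_mul_of_nonneg_left hzx.le hK).trans hρK
  have : |g i x - G x| ≤ |g i x - g i z| + |g i z - G z| + |G z - G x| := by
    have e : g i x - G x = (g i x - g i z) + (g i z - G z) + (G z - G x) := by ring
    rw [e]
    exact abs_add_three _ _ _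
  linarith


lemma exists_psi (n : ℕ) : ∃ (ψ : Rn n → ℝ) (c : ℝ), 0 ≤ c ∧ Continuous ψ ∧ (∀ y, 0 ≤ ψ y) ∧
    (∀ y, ψ y ≤ c) ∧ (∀ y ∉ UU n, ψ y = 0) ∧ (∀ y z, |ψ y - ψ z| ≤ c * ‖y - z‖) ∧ Integrable ψ ∧
    ∫ y, ψ y = 1 := by
  let ψ0 : Rn n → ℝ := fun y => max 0 (1 / 2 - ‖y - fun _ => 1 / 2‖)
  have hc : Continuous ψ0 := by fun_prop
  have hs : ∀ y ∉ UU n, ψ0 y = 0 := by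
    intro y hy
    simp only [ψ0, max_eq_left_iff]
    by_contra hcon
    push Not at hcon
    apply hy
    have : ∀ i, |y i - 1 / 2| ≤ 1 / 2 := by
      intro i
      have := norm_le_pi_norm (y - fun _ => (1:ℝ) / 2) i
      simp only [Pi.sub_apply, Real.norm_eq_abs] at this
      linarith
    constructor
    · intro i; have := abs_le.1 (this i); simp only [Pi.zero_apply]; linarith
    · intro i; have := abs_le.1 (this i); simp only [Pi.one_apply]; linarith
  have h0 : ∀ y, 0 ≤ ψ0 y := fun y => le_max_left _ _
  have h1 : ∀ y, ψ0 y ≤ 1 := fun y => max_le (by norm_num) (by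
    have := norm_nonneg (y - fun _ => (1:ℝ) / 2); linarith)
  have hl : ∀ y z, |ψ0 y - ψ0 z| ≤ ‖y - z‖ := by
    intro y z
    refine (abs_max_sub_max_le_max 0 _ 0 _).trans ?_
    have : (1 / 2 - ‖y - fun _ => (1:ℝ) / 2‖) - (1 / 2 - ‖z - fun _ => (1:ℝ) / 2‖) =
      ‖z - fun _ => (1:ℝ) / 2‖ - ‖y - fun _ => (1:ℝ) / 2‖ := by ring
    rw [this, sub_zero, abs_zero, max_eq_right (abs_nonneg _)]
    refine (abs_norm_sub_norm_le _ _).trans ?_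
    rw [sub_sub_sub_cancel_right, norm_sub_rev]
  have hcs : HasCompactSupport ψ0 := HasCompactSupport.intro isCompact_Icc hs
  have hintg : Integrable ψ0 := hc.integrable_of_hasCompactSupport hcs
  have hI : 0 < ∫ y, ψ0 y := hc.integral_pos_of_hasCompactSupport_nonneg_nonzero hcs h0
    (x := fun _ => 1 / 2) (by simp [ψ0])
  set I := ∫ y, ψ0 y with hIdef
  refine ⟨fun y => I⁻¹ * ψ0 y, I⁻¹, by positivity, by fun_prop, fun y => by have := h0 y; positivity,
    fun y => mul_le_of_le_one_right (by positivity) (h1 y), fun y hy => by simp [hs y hy], fun y z => ?_,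
    hintg.const_mul _, ?_⟩
  · rw [← mul_sub, abs_mul, abs_of_pos (inv_pos.2 hI)]
    gcongr
    exact hl y z
  · rw [integral_const_mul, ← hIdef, inv_mul_cancel₀ hI.ne']

lemma smooth (n L : ℕ) (hL : 0 < L) (C : ℝ) (hC : 0 ≤ C) : ∃ M K B : ℝ, 0 ≤ K ∧ 0 ≤ B ∧
    ∀ φ : Rn n → ℝ, Measurable φ → (∀ x, |φ x| ≤ C) → ∃ g : Rn n → ℝ, (∀ x, |g x| ≤ M) ∧
      (∀ x y, |g x - g y| ≤ K * ‖x - y‖) ∧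
      ∀ x ∈ UU n, ‖φ x - g x‖ₑ ≤ ENNReal.ofReal B * ∫⁻ y, ‖DD L φ x y‖ₑ ∂muU n := by
  obtain ⟨ψ, c, hc0, hψc, hψ0, hψ1, hψs, hψl, hψi, hψI⟩ := exists_psi n
  have hL' : (0:ℝ) < L := by exact_mod_cast hL
  refine ⟨2 ^ L * C, 2 ^ L * (C * (c * L * 2)), c, by positivity, hc0, ?_⟩
  intro φ hφ hφC
  let co : ℕ → ℝ := fun j => (L.choose j : ℝ) * (-1 : ℝ) ^ (L + j)
  let Gj : ℕ → Rn n → ℝ := fun j x => ∫ y, φ (zz n L j x y) * ψ y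
  have hmeas : ∀ j x, Measurable fun y => φ (zz n L j x y) := fun j x =>
    hφ.comp ((zz_measurable n L j).comp (measurable_const.prodMk measurable_id))
  have hintj : ∀ j x, Integrable fun y => φ (zz n L j x y) * ψ y := fun j x =>
    hψi.bdd_mul (c := C) (hmeas j x).aestronglyMeasurable
      (Eventually.of_forall fun y => hφC _)
  have hGb : ∀ j x, |Gj j x| ≤ C := by
    intro j x
    have := norm_integral_le_of_norm_le (f := fun y => φ (zz n L j x y) * ψ y) (hψi.const_mul C)
      (Eventually.of_forall fun y => by
        rw [norm_mul, Real.norm_eq_abs, Real.norm_eq_abs, abs_of_nonneg (hψ0 y)]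
        exact mul_le_mul_of_nonneg_right (hφC _) (hψ0 y))
    rwa [integral_const_mul, hψI, mul_one] at this
  have hGl : ∀ j, 1 ≤ j → j ≤ L → ∀ x x', |Gj j x - Gj j x'| ≤ C * (c * L * 2) * ‖x - x'‖ := by
    intro j hj1 hjL x x'
    have hj1' : (1:ℝ) ≤ j := by exact_mod_cast hj1
    have hjL' : (j:ℝ) ≤ L := by exact_mod_cast hjL
    set s : ℝ := (j : ℝ) / L with hs
    have hs0 : 0 < s := by positivity
    have hs1 : s ≤ 1 := by rw [hs, div_le_one hL']; exact hjL'
    set a := (1 - s) / s with ha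
    have ha0 : 0 ≤ a := div_nonneg (by linarith) hs0.le
    have haL : a ≤ L := by
      rw [ha, div_le_iff₀ hs0, hs, mul_div_cancel₀ _ hL'.ne']
      linarith
    have key : ∀ x, Gj j x = ∫ y, φ (s • y) * ψ (y - a • x) := by
      intro x
      simp only [Gj]
      rw [← integral_sub_right_eq_self (fun y => φ (zz n L j x y) * ψ y) (a • x)]
      congr 1
      ext y
      congr 2
      ext i
      simp only [zz, Pi.add_apply, Pi.smul_apply, Pi.sub_apply, smul_eq_mul]
      have : (j : ℝ) * (1 / L * (y i - a * x i - x i)) = s * y i - (s * a + s) * x i := by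
        rw [hs]; ring
      rw [this]
      have : s * a + s = 1 := by rw [ha]; field_simp; ring
      rw [this]; ring
    have hm : Measurable fun y : Rn n => φ (s • y) := hφ.comp (measurable_id.const_smul s)
    have hi : ∀ x, Integrable fun y => φ (s • y) * ψ (y - a • x) := fun x =>
      (hψi.comp_sub_right (a • x)).bdd_mul (c := C) hm.aestronglyMeasurable
        (Eventually.of_forall fun y => hφC _)
    rw [key x, key x', ← integral_sub (hi x) (hi x')]
    let bd : Rn n → ℝ := fun y => C * (c * L * ‖x - x'‖) *
      ((UU n).indicator 1 (y - a • x) + (UU n).indicator 1 (y - a • x'))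
    have hUi : Integrable ((UU n).indicator (1 : Rn n → ℝ)) :=
      (integrable_indicator_iff measurableSet_Icc).2
        (integrableOn_const (by exact isCompact_Icc.measure_lt_top.ne))
    have hU1 : ∫ y, (UU n).indicator (1 : Rn n → ℝ) y = 1 := by
      rw [integral_indicator_one measurableSet_Icc, measureReal_def, Real.volume_Icc_pi]
      simp
    have hbdi : Integrable bd :=
      ((hUi.comp_sub_right _).add (hUi.comp_sub_right _)).const_mul _
    have hle := norm_integral_le_of_norm_le (f := fun y => φ (s • y) * ψ (y - a • x) -
      φ (s • y) * ψ (y - a • x')) hbdi (Eventually.of_forall fun y => by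
        rw [← mul_sub, norm_mul, Real.norm_eq_abs, Real.norm_eq_abs]
        simp only [bd]
        rw [mul_assoc C]
        refine mul_le_mul (hφC _) ?_ (abs_nonneg _) hC
        have h1 := hψl (y - a • x) (y - a • x')
        have h2 : ‖(y - a • x) - (y - a • x')‖ ≤ L * ‖x - x'‖ := by
          have e : (y - a • x) - (y - a • x') = a • (x' - x) := by rw [smul_sub]; abel
          rw [e, norm_smul, norm_sub_rev, Real.norm_eq_abs, abs_of_nonneg ha0]
          gcongr
        have h3 : |ψ (y - a • x) - ψ (y - a • x')| ≤ c * L * ‖x - x'‖ := by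
          refine h1.trans ?_
          rw [mul_assoc]
          gcongr
        have hnn : ∀ z, 0 ≤ (UU n).indicator (1 : Rn n → ℝ) z := fun z =>
          Set.indicator_nonneg (fun _ _ => zero_le_one) z
        by_cases hx1 : y - a • x ∈ UU n
        · have : (1:ℝ) ≤ (UU n).indicator 1 (y - a • x) + (UU n).indicator 1 (y - a • x') := by
            have := hnn (y - a • x')
            rw [Set.indicator_of_mem hx1, Pi.one_apply]; linarith
          exact h3.trans (le_mul_of_one_le_right (by positivity) this)
        by_cases hx2 : y - a • x' ∈ UU n
        · have : (1:ℝ) ≤ (UU n).indicator 1 (y - a • x) + (UU n).indicator 1 (y - a • x') := by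
            have := hnn (y - a • x)
            rw [Set.indicator_of_mem hx2, Pi.one_apply]; linarith
          exact h3.trans (le_mul_of_one_le_right (by positivity) this)
        rw [hψs _ hx1, hψs _ hx2, sub_zero, abs_zero]
        have := hnn (y - a • x)
        have := hnn (y - a • x')
        positivity)
    refine hle.trans (le_of_eq ?_)
    simp only [bd]
    rw [integral_const_mul, integral_add (hUi.comp_sub_right _) (hUi.comp_sub_right _),
      integral_sub_right_eq_self (fun y => (UU n).indicator (1 : Rn n → ℝ) y),
      integral_sub_right_eq_self (fun y => (UU n).indicator (1 : Rn n → ℝ) y), hU1]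
    ring
  have hco : ∑ j ∈ Finset.range L, |co (j + 1)| ≤ 2 ^ L := by
    have := sum_abs_coef L
    rw [Finset.sum_range_succ'] at this
    rw [← this]; simp [co]
  let g : Rn n → ℝ := fun x => -(-1) ^ L * ∑ j ∈ Finset.range L, co (j + 1) * Gj (j + 1) x
  refine ⟨g, ?_, ?_, ?_⟩
  · intro x
    simp only [g]
    rw [abs_mul]
    have : |(-(-1 : ℝ) ^ L)| = 1 := by rw [abs_neg, abs_pow]; simp
    rw [this, one_mul]
    refine (Finset.abs_sum_le_sum_abs _ _).trans (le_trans ?_ (mul_le_mul_of_nonneg_right hco hC))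
    rw [Finset.sum_mul]
    refine Finset.sum_le_sum fun j _ => ?_
    rw [abs_mul]
    gcongr
    exact hGb _ _
  · intro x y
    simp only [g]
    rw [← mul_sub, abs_mul]
    have : |(-(-1 : ℝ) ^ L)| = 1 := by rw [abs_neg, abs_pow]; simp
    rw [this, one_mul, ← Finset.sum_sub_distrib]
    refine (Finset.abs_sum_le_sum_abs _ _).trans ?_
    rw [mul_assoc]
    refine (le_trans ?_ (mul_le_mul_of_nonneg_right hco (by positivity)))
    rw [Finset.sum_mul]
    refine Finset.sum_le_sum fun j hj => ?_
    rw [← mul_sub, abs_mul]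
    gcongr
    exact hGl (j + 1) (by omega) (by simp at hj; omega) x y
  · intro x hx
    have e : (-1) ^ L * (φ x - g x) = ∫ y, DD L φ x y * ψ y := by
      have h1 : ∀ y, DD L φ x y * ψ y = ∑ j ∈ Finset.range (L + 1),
          co j * (φ (zz n L j x y) * ψ y) := by
        intro y; rw [DD_eq, Finset.sum_mul]
        exact Finset.sum_congr rfl fun j _ => by simp only [co]; ring
      simp only [h1]
      rw [integral_finsetSum _ fun j _ => (hintj j x).const_mul _]
      simp only [integral_const_mul]
      rw [Finset.sum_range_succ']
      have h2 : ∫ y, φ (zz n L 0 x y) * ψ y = φ x := by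
        simp only [zz, Nat.cast_zero, zero_smul, add_zero]
        rw [integral_const_mul, hψI, mul_one]
      rw [h2]
      simp only [g, co, Gj]
      have : ((-1:ℝ) ^ L) * (-1) ^ L = 1 := by rw [← mul_pow]; simp
      have h3 : ∀ S : ℝ, (-1) ^ L * (φ x - -(-1) ^ L * S) = (-1)^L * φ x + ((-1) ^ L * (-1)^L) * S := by
        intro S; ring
      rw [h3, this]
      simp; ring
    have e2 : ‖φ x - g x‖ₑ = ‖(-1) ^ L * (φ x - g x)‖ₑ := by
      rw [enorm_mul]; simp
    rw [e2, e]
    refine (enorm_integral_le_lintegral_enorm _).trans ?_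
    unfold muU
    rw [← lintegral_const_mul' _ _ ENNReal.ofReal_ne_top, ← lintegral_indicator measurableSet_Icc]
    refine lintegral_mono fun y => ?_
    by_cases hy : y ∈ UU n
    · rw [Set.indicator_of_mem hy, enorm_mul, mul_comm]
      gcongr
      rw [Real.enorm_eq_ofReal (hψ0 y)]
      exact ENNReal.ofReal_le_ofReal (hψ1 y)
    · rw [hψs y hy]; simp


lemma muU_mono {n : ℕ} {A B : Set (Rn n)} (h : ∀ x ∈ UU n, x ∈ A → x ∈ B) :
    muU n A ≤ muU n B := by
  have h2 : ∀ᵐ x ∂muU n, x ∈ A → x ∈ B :=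
    (ae_restrict_iff' measurableSet_Icc).2 (Eventually.of_forall h)
  exact measure_mono_ae h2

lemma small_box {n : ℕ} {x : Rn n} (hx : x ∈ UU n) {ρ : ℝ} (h0 : 0 < ρ) (h1 : ρ ≤ 1) :
    ∃ A : Set (Rn n), MeasurableSet A ∧ A ⊆ UU n ∧ muU n A = ENNReal.ofReal (ρ ^ n) ∧
      ∀ z ∈ A, ‖z - x‖ ≤ ρ := by
  have hsub : Set.Icc ((1 - ρ) • x) ((1 - ρ) • x + fun _ => ρ) ⊆ UU n := by
    intro z hz
    constructor
    · intro i
      have a := hz.1 i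
      have b : 0 ≤ x i := hx.1 i
      simp only [Pi.smul_apply, smul_eq_mul, Pi.zero_apply] at *
      nlinarith
    · intro i
      have a := hz.2 i
      have b : x i ≤ 1 := hx.2 i
      simp only [Pi.smul_apply, Pi.add_apply, smul_eq_mul, Pi.one_apply] at *
      nlinarith
  refine ⟨_, measurableSet_Icc, hsub, ?_, ?_⟩
  · unfold muU
    rw [Measure.restrict_apply measurableSet_Icc, Set.inter_eq_left.2 hsub, Real.volume_Icc_pi]
    simp [ENNReal.ofReal_pow h0.le]
  · intro z hz
    rw [pi_norm_le_iff_of_nonneg h0.le]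
    intro i
    have a := hz.1 i
    have b := hz.2 i
    have c : 0 ≤ x i := hx.1 i
    have d : x i ≤ 1 := hx.2 i
    simp only [Pi.smul_apply, Pi.add_apply, smul_eq_mul, Pi.sub_apply, Real.norm_eq_abs] at *
    rw [abs_le]
    constructor <;> nlinarith

lemma zz_lip {n L j : ℕ} (hj : j ≤ L) {x y x' y' : Rn n} {ρ : ℝ} (hx : ‖x' - x‖ ≤ ρ)
    (hy : ‖y' - y‖ ≤ ρ) : ‖zz n L j x' y' - zz n L j x y‖ ≤ ρ := by
  rcases Nat.eq_zero_or_pos L with h0 | h0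
  · subst h0; simpa [zz] using hx
  have hL : (0:ℝ) < L := by exact_mod_cast h0
  set s : ℝ := (j : ℝ) / L with hs
  have hs0 : 0 ≤ s := by positivity
  have hs1 : s ≤ 1 := by
    rw [hs, div_le_one hL]; exact_mod_cast hj
  have e : zz n L j x' y' - zz n L j x y = (1 - s) • (x' - x) + s • (y' - y) := by
    ext i; simp [zz, s]; ring
  rw [e]
  refine (norm_add_le _ _).trans ?_
  rw [norm_smul, norm_smul, Real.norm_eq_abs, Real.norm_eq_abs, abs_of_nonneg hs0,
    abs_of_nonneg (by linarith : 0 ≤ 1 - s)]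
  nlinarith

lemma bdd_case (n L : ℕ) (hL : 0 < L) (C δ η : ℝ) (hC : 0 ≤ C) (hδ : 0 < δ) (hη : 0 < η) :
    ∃ ε : ℝ, 0 < ε ∧ ∀ φ : Rn n → ℝ, Measurable φ → (∀ x, |φ x| ≤ C) →
    nuU n {p | ε < |DD L φ p.1 p.2|} ≤ ENNReal.ofReal ε →
    ∃ P ∈ VL n L, (∀ x ∈ UU n, ∀ y ∈ UU n, DD L P x y = 0) ∧
      muU n {x | δ < |φ x - P x|} ≤ ENNReal.ofReal η := by
  obtain ⟨M, K, B, hK, hB, hsm⟩ := smooth n L hL C hC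
  obtain ⟨ε₁, hε₁, hex⟩ := exact_near n L hL M K (δ / 2) hK (by positivity)
  have h2L : (0:ℝ) < 2 ^ L := by positivity
  obtain ⟨τ, hτ0, hτ1, hτ2⟩ : ∃ τ : ℝ, 0 < τ ∧ τ ≤ δ / 2 ∧ 2 ^ L * τ ≤ ε₁ / 4 := by
    refine ⟨min (δ / 2) (ε₁ / 4 / 2 ^ L), by positivity, min_le_left _ _, ?_⟩
    rw [← le_div_iff₀' h2L]; exact min_le_right _ _
  obtain ⟨ρ, hρ0, hρ1, hρ2⟩ : ∃ ρ : ℝ, 0 < ρ ∧ ρ ≤ 1 ∧ 2 ^ L * (K * ρ) ≤ ε₁ / 2 := by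
    refine ⟨min 1 (ε₁ / 2 / (2 ^ L * K + 1)), by positivity, min_le_left _ _, ?_⟩
    have : min 1 (ε₁ / 2 / (2 ^ L * K + 1)) ≤ ε₁ / 2 / (2 ^ L * K + 1) := min_le_right _ _
    rw [le_div_iff₀ (by positivity)] at this
    have h3 : 0 < min 1 (ε₁ / 2 / (2 ^ L * K + 1)) := by positivity
    nlinarith
  set c0 : ℝ := B * (1 + 2 ^ L * C) / τ with hc0
  have hc0' : 0 ≤ c0 := by positivity
  set c1 : ℝ := 1 + (L + 1) * (L ^ n * c0) with hc1
  have hc1' : 0 < c1 := by positivity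
  set ε := min (ε₁ / 4) (min (η / (c0 + 1)) (ρ ^ n * ρ ^ n / (2 * c1))) with hε
  have hε0 : 0 < ε := by positivity
  have hεa : ε ≤ ε₁ / 4 := min_le_left _ _
  have hεb : c0 * ε ≤ η := by
    have : ε ≤ η / (c0 + 1) := (min_le_right _ _).trans (min_le_left _ _)
    rw [le_div_iff₀ (by positivity)] at this
    nlinarith
  have hεc : c1 * ε < ρ ^ n * ρ ^ n := by
    have : ε ≤ ρ ^ n * ρ ^ n / (2 * c1) := (min_le_right _ _).trans (min_le_right _ _)
    rw [le_div_iff₀ (by positivity)] at this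
    have : 0 < c1 * ε := by positivity
    nlinarith
  refine ⟨ε, hε0, ?_⟩
  intro φ hφ hφC hD
  obtain ⟨g, hgM, hgK, hgφ⟩ := hsm φ hφ hφC
  have hgc : Continuous g := by
    have : LipschitzWith K.toNNReal g := LipschitzWith.of_dist_le_mul fun x y => by
      rw [Real.dist_eq, dist_eq_norm, Real.coe_toNNReal _ hK]; exact hgK x y
    exact this.continuous
  set F := {p : Rn n × Rn n | ε < |DD L φ p.1 p.2|} with hF
  have hDm := DD_measurable L hφ
  have hFm : MeasurableSet F := measurableSet_lt measurable_const hDm.norm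
  have hintg : ∫⁻ x, ∫⁻ y, ‖DD L φ x y‖ₑ ∂muU n ∂muU n ≤ ENNReal.ofReal ((1 + 2 ^ L * C) * ε) := by
    rw [lintegral_lintegral (f := fun x y => ‖DD L φ x y‖ₑ) hDm.enorm.aemeasurable]
    calc ∫⁻ p, ‖DD L φ p.1 p.2‖ₑ ∂(muU n).prod (muU n)
        ≤ ∫⁻ p, (ENNReal.ofReal ε + F.indicator (fun _ => ENNReal.ofReal (2 ^ L * C)) p)
            ∂(muU n).prod (muU n) := by
          refine lintegral_mono fun p => ?_
          rw [← ofReal_norm, Real.norm_eq_abs]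
          by_cases hp : p ∈ F
          · rw [Set.indicator_of_mem hp]
            exact le_add_left (ENNReal.ofReal_le_ofReal (DD_abs_le L fun j _ => hφC _))
          · simp only [hF, Set.mem_ofPred_eq, not_lt] at hp
            exact le_add_right (ENNReal.ofReal_le_ofReal hp)
      _ ≤ ENNReal.ofReal ε + ENNReal.ofReal (2 ^ L * C) * ENNReal.ofReal ε := by
          rw [lintegral_add_left measurable_const, lintegral_indicator_const hFm, lintegral_const,
            measure_univ, mul_one]
          gcongr
          exact hD
      _ = _ := by
          rw [← ENNReal.ofReal_mul (by positivity), ← ENNReal.ofReal_add (by positivity) (by positivity)]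
          congr 1; ring
  set E := {x : Rn n | τ < |φ x - g x|} with hE
  have hEm : MeasurableSet E := measurableSet_lt measurable_const (hφ.sub hgc.measurable).norm
  have hEμ : muU n E ≤ ENNReal.ofReal (c0 * ε) := by
    have h1 : ENNReal.ofReal τ * muU n E ≤ ENNReal.ofReal B * ENNReal.ofReal ((1 + 2 ^ L * C) * ε) := by
      calc ENNReal.ofReal τ * muU n E ≤ ENNReal.ofReal τ * muU n {x | ENNReal.ofReal τ ≤ ‖φ x - g x‖ₑ} := by
            gcongr
            intro hx
            simp only [Set.mem_ofPred_eq]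
            rw [← ofReal_norm]
            exact fun h => ENNReal.ofReal_le_ofReal (le_of_lt h)
        _ ≤ ∫⁻ x, ‖φ x - g x‖ₑ ∂muU n :=
            mul_meas_ge_le_lintegral (hφ.sub hgc.measurable).enorm _
        _ ≤ ∫⁻ x, ENNReal.ofReal B * ∫⁻ y, ‖DD L φ x y‖ₑ ∂muU n ∂muU n := by
            refine lintegral_mono_ae ?_
            rw [muU, ae_restrict_iff' measurableSet_Icc]
            exact Eventually.of_forall hgφ
        _ ≤ _ := by
            rw [lintegral_const_mul' _ _ ENNReal.ofReal_ne_top]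
            gcongr
    rw [← ENNReal.ofReal_mul hB, mul_comm] at h1
    have h2 := (ENNReal.le_div_iff_mul_le (Or.inl (ENNReal.ofReal_pos.2 hτ0).ne')
      (Or.inl ENNReal.ofReal_ne_top)).2 h1
    rw [← ENNReal.ofReal_div_of_pos hτ0] at h2
    refine h2.trans (le_of_eq ?_)
    congr 1
    rw [hc0]; ring
  set Bad := F ∪ {p | ∃ j ≤ L, zz n L j p.1 p.2 ∈ E} with hBad
  have hbad : nuU n Bad < ENNReal.ofReal (ρ ^ n * ρ ^ n) := by
    calc nuU n Bad ≤ ENNReal.ofReal ε + ((L + 1 : ℕ) : ℝ≥0∞) * ((L : ℝ≥0∞) ^ n * ENNReal.ofReal (c0 * ε)) := by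
          refine (measure_union_le _ _).trans (add_le_add hD ((nuU_zz_union hL hEm).trans ?_))
          gcongr
      _ = ENNReal.ofReal (c1 * ε) := by
          rw [← ENNReal.ofReal_natCast, ← ENNReal.ofReal_natCast, ← ENNReal.ofReal_pow (by positivity),
            ← ENNReal.ofReal_mul (by positivity), ← ENNReal.ofReal_mul (by positivity),
            ← ENNReal.ofReal_add (by positivity) (by positivity)]
          congr 1
          rw [hc1]; push_cast; ring
      _ < _ := (ENNReal.ofReal_lt_ofReal_iff (by positivity)).2 hεc
  have hgD : ∀ x ∈ UU n, ∀ y ∈ UU n, |DD L g x y| ≤ ε₁ := by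
    intro x hx y hy
    obtain ⟨A1, hA1m, hA1U, hA1μ, hA1⟩ := small_box hx hρ0 hρ1
    obtain ⟨A2, hA2m, hA2U, hA2μ, hA2⟩ := small_box hy hρ0 hρ1
    obtain ⟨⟨x', y'⟩, hp, hpb⟩ : ∃ v, v ∈ A1 ×ˢ A2 ∧ v ∉ Bad := by
      by_contra hcon
      push Not at hcon
      refine absurd (measure_mono (μ := nuU n) hcon) (not_le.2 ?_)
      rw [nuU, Measure.prod_prod, hA1μ, hA2μ, ← ENNReal.ofReal_mul (by positivity)]
      exact hbad
    simp only [hBad, Set.mem_union, hF, hE, Set.mem_ofPred_eq, not_or, not_lt, not_exists, not_and] at hpb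
    have h1 : |DD L (fun z => φ z - g z) x' y'| ≤ 2 ^ L * τ := DD_abs_le L fun j hj => hpb.2 j hj
    have h2 : |DD L (fun z => g z - g (z + (0:Rn n))) x' y'| ≤ 2 ^ L * τ := by
      simp [DD_eq]; positivity
    have h3 : |DD L g x y - DD L g x' y'| ≤ 2 ^ L * (K * ρ) := by
      simp only [DD_eq]
      rw [← Finset.sum_sub_distrib, ← sum_abs_coef, Finset.sum_mul]
      refine (Finset.abs_sum_le_sum_abs _ _).trans (Finset.sum_le_sum fun j hj => ?_)
      rw [← mul_sub, abs_mul]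
      gcongr
      refine (hgK _ _).trans ?_
      gcongr
      rw [norm_sub_rev]
      exact zz_lip (by simpa [Nat.lt_succ_iff] using hj) (hA1 _ hp.1) (hA2 _ hp.2)
    rw [DD_sub] at h1
    have h4 := hpb.1
    rw [abs_le] at *
    constructor <;> linarith [h1.1, h1.2, h3.1, h3.2, h4.1, h4.2]
  obtain ⟨P, hP, hPD, hPg⟩ := hex g hgM hgK hgD
  refine ⟨P, hP, hPD, ?_⟩
  refine le_trans ?_ (hEμ.trans (ENNReal.ofReal_le_ofReal hεb))
  refine muU_mono fun x hx2 hx1 => ?_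
  have h1 := hPg x hx2
  simp only [hE, Set.mem_ofPred_eq] at hx1 ⊢
  have h2 : |φ x - P x| ≤ |φ x - g x| + |g x - P x| := by
    have : φ x - P x = (φ x - g x) + (g x - P x) := by ring
    rw [this]; exact abs_add_le _ _
  linarith


lemma nuU_mono {n : ℕ} {A B : Set (Rn n × Rn n)}
    (h : ∀ x ∈ UU n, ∀ y ∈ UU n, (x, y) ∈ A → (x, y) ∈ B) : nuU n A ≤ nuU n B := by
  have h2 : ∀ᵐ p ∂nuU n, p ∈ A → p ∈ B := by
    unfold nuU muU
    rw [Measure.prod_restrict, ae_restrict_iff' (measurableSet_Icc.prod measurableSet_Icc)]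
    exact Eventually.of_forall fun p hp => h p.1 hp.1 p.2 hp.2
  exact measure_mono_ae h2

lemma whit_bad (n L : ℕ) (hL : 0 < L) (φ : Rn n → ℝ) (hφ : Measurable φ) (ε : ℝ) (he : 0 < ε)
    (he1 : ε ≤ 1)
    (h1 : muU n {x | 1 < |φ x|} ≤ ENNReal.ofReal (1 / (2 * (L : ℝ) ^ (n + 1))))
    (h2 : nuU n {p | ε < |DD L φ p.1 p.2|} ≤ ENNReal.ofReal ε) :
    muU n {x | (2 : ℝ) ^ L * 1 + 1 < |φ x|} ≤ ENNReal.ofReal (4 * ε) := by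
  set E : Set (Rn n × Rn n) := {p | ε < |DD L φ p.1 p.2|} with hE
  have hEm : MeasurableSet E := measurableSet_lt measurable_const (DD_measurable L hφ).abs
  have hFm : MeasurableSet {x | 1 < |φ x|} := measurableSet_lt measurable_const hφ.abs
  have hmk : ENNReal.ofReal (1 / 4) * muU n {x | ENNReal.ofReal (1 / 4) ≤ muU n (Prod.mk x ⁻¹' E)} ≤
      ENNReal.ofReal ε := by
    refine le_trans (mul_meas_ge_le_lintegral (measurable_measure_prodMk_left hEm) _) ?_
    rw [← Measure.prod_apply hEm]
    exact h2
  have hmk2 : muU n {x | ENNReal.ofReal (1 / 4) ≤ muU n (Prod.mk x ⁻¹' E)} ≤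
      ENNReal.ofReal (4 * ε) := by
    have : ENNReal.ofReal 4 * (ENNReal.ofReal (1 / 4) *
      muU n {x | ENNReal.ofReal (1 / 4) ≤ muU n (Prod.mk x ⁻¹' E)}) ≤
      ENNReal.ofReal 4 * ENNReal.ofReal ε := by gcongr
    rwa [← mul_assoc, ← ENNReal.ofReal_mul (by norm_num), ← ENNReal.ofReal_mul (by norm_num),
      (by norm_num : (4:ℝ) * (1 / 4) = 1), ENNReal.ofReal_one, one_mul] at this
  refine le_trans (muU_mono ?_) hmk2
  intro x hx hxl
  by_contra hcon
  rw [Set.mem_ofPred_eq, not_le] at hcon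
  rw [Set.mem_ofPred_eq] at hxl
  set G : Set (Rn n) := ⋃ j ∈ Finset.Icc 1 L, {y | zz n L j x y ∈ {x | 1 < |φ x|}} with hG
  have hGm : muU n G ≤ ENNReal.ofReal (1 / 2) := by
    calc muU n G ≤ ∑ j ∈ Finset.Icc 1 L, muU n {y | zz n L j x y ∈ {x | 1 < |φ x|}} :=
          measure_biUnion_finset_le _ _
      _ ≤ ∑ j ∈ Finset.Icc 1 L, (L : ℝ≥0∞) ^ n * ENNReal.ofReal (1 / (2 * (L : ℝ) ^ (n + 1))) := by
          refine Finset.sum_le_sum fun j hj => ?_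
          rw [Finset.mem_Icc] at hj
          exact le_trans (muU_scale hj.1 hj.2 hx hFm) (by gcongr)
      _ = ENNReal.ofReal (1 / 2) := by
          rw [Finset.sum_const, Nat.card_Icc, Nat.add_sub_cancel, nsmul_eq_mul,
            ← ENNReal.ofReal_natCast L, ← ENNReal.ofReal_pow (by positivity),
            ← ENNReal.ofReal_mul (by positivity), ← ENNReal.ofReal_mul (by positivity)]
          congr 1
          have : (L : ℝ) ≠ 0 := by positivity
          field_simp
          ring
  have hlt : muU n (Prod.mk x ⁻¹' E ∪ G) < 1 := by
    calc muU n (Prod.mk x ⁻¹' E ∪ G) ≤ _ := measure_union_le _ _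
      _ ≤ ENNReal.ofReal (1 / 4) + ENNReal.ofReal (1 / 2) := add_le_add hcon.le hGm
      _ = ENNReal.ofReal (3 / 4) := by
          rw [← ENNReal.ofReal_add (by norm_num) (by norm_num)]; norm_num
      _ < 1 := by
          rw [← ENNReal.ofReal_one]
          exact (ENNReal.ofReal_lt_ofReal_iff (by norm_num)).2 (by norm_num)
  have : ∃ y, y ∉ Prod.mk x ⁻¹' E ∪ G := by
    by_contra hall
    push Not at hall
    have : Prod.mk x ⁻¹' E ∪ G = Set.univ := Set.eq_univ_of_forall hall
    rw [this, measure_univ] at hlt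
    exact lt_irrefl _ hlt
  obtain ⟨y, hy⟩ := this
  rw [Set.mem_union, not_or] at hy
  have hy1 : |DD L φ x y| ≤ ε := not_lt.1 hy.1
  have hy2 : ∀ j, 1 ≤ j → j ≤ L → |φ (zz n L j x y)| ≤ 1 := by
    intro j h1 h2
    by_contra hc
    refine hy.2 ?_
    rw [hG]
    simp only [Set.mem_iUnion]
    exact ⟨j, Finset.mem_Icc.2 ⟨h1, h2⟩, not_le.1 hc⟩
  have := DD_zero_of_top hy2 zero_le_one hy1
  linarith

lemma whit_I (n L : ℕ) (hL : 0 < L) (η : ℝ) (hη : 0 < η) :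
    ∃ ε : ℝ, 0 < ε ∧ ε ≤ 1 ∧ ∀ φ : Rn n → ℝ, Measurable φ →
    muU n {x | 1 < |φ x|} ≤ ENNReal.ofReal (1 / (2 * (L : ℝ) ^ (n + 1))) →
    nuU n {p | ε < |DD L φ p.1 p.2|} ≤ ENNReal.ofReal ε →
    ∃ P ∈ VL n L, (∀ x ∈ UU n, ∀ y ∈ UU n, DD L P x y = 0) ∧
      muU n {x | 1 / 2 < |φ x - P x|} ≤ ENNReal.ofReal η := by
  set C : ℝ := (2 : ℝ) ^ L * 1 + 1 with hC
  have hC0 : 0 ≤ C := by positivity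
  obtain ⟨ε₀, h0, hb⟩ := bdd_case n L hL C (1 / 2) (η / 2) hC0 (by norm_num) (by positivity)
  set c : ℝ := ((L + 1 : ℕ) : ℝ) * ((L : ℝ) ^ n * 4) with hc
  have hcn : 0 ≤ c := by positivity
  set ε := min 1 (min (ε₀ / (1 + c)) (η / 8)) with hε
  have e0 : 0 < ε := by
    rw [hε]; exact lt_min one_pos (lt_min (by positivity) (by positivity))
  have e1 : ε ≤ 1 := min_le_left _ _
  have e2 : ε ≤ ε₀ / (1 + c) := (min_le_right _ _).trans (min_le_left _ _)
  have e3 : ε ≤ η / 8 := (min_le_right _ _).trans (min_le_right _ _)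
  have e2' : ε + c * ε ≤ ε₀ := by
    rw [le_div_iff₀ (by positivity)] at e2; linarith
  have e4 : ε ≤ ε₀ := by nlinarith
  refine ⟨ε, e0, e1, fun φ hφ h1 h2 => ?_⟩
  have hbad := whit_bad n L hL φ hφ ε e0 e1 h1 h2
  set F : Set (Rn n) := {x | C < |φ x|} with hF
  have hFm : MeasurableSet F := measurableSet_lt measurable_const hφ.abs
  set ψ : Rn n → ℝ := fun x => if x ∈ F then 0 else φ x with hψ
  have hψm : Measurable ψ := Measurable.ite hFm measurable_const hφ
  have hψb : ∀ x, |ψ x| ≤ C := by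
    intro x
    simp only [hψ]
    split_ifs with hx
    · simpa using hC0
    · exact not_lt.1 hx
  obtain ⟨P, hP, hD, hm⟩ := hb ψ hψm hψb (by
    have hsub : {p : Rn n × Rn n | ε₀ < |DD L ψ p.1 p.2|} ⊆
        {p | ε < |DD L φ p.1 p.2|} ∪ {p | ∃ j ≤ L, zz n L j p.1 p.2 ∈ F} := by
      intro p hp
      by_cases hq : ∃ j ≤ L, zz n L j p.1 p.2 ∈ F
      · exact Or.inr hq
      · left
        push Not at hq
        have : DD L φ p.1 p.2 = DD L ψ p.1 p.2 := DD_congr L fun j hj => by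
          simp only [hψ]; rw [if_neg (hq j hj)]
        rw [Set.mem_ofPred_eq, this]
        exact lt_of_le_of_lt e4 hp
    calc nuU n {p : Rn n × Rn n | ε₀ < |DD L ψ p.1 p.2|} ≤ _ := measure_mono hsub
      _ ≤ _ := measure_union_le _ _
      _ ≤ ENNReal.ofReal ε + ((L + 1 : ℕ) : ℝ≥0∞) * ((L : ℝ≥0∞) ^ n * ENNReal.ofReal (4 * ε)) := by
          refine add_le_add h2 ((nuU_zz_union hL hFm).trans ?_)
          gcongr
      _ = ENNReal.ofReal (ε + c * ε) := by
          rw [← ENNReal.ofReal_natCast L, ← ENNReal.ofReal_natCast (L + 1),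
            ← ENNReal.ofReal_pow (by positivity),
            ← ENNReal.ofReal_mul (by positivity), ← ENNReal.ofReal_mul (by positivity),
            ← ENNReal.ofReal_add (by positivity) (by positivity)]
          congr 1
          rw [hc]; ring
      _ ≤ _ := ENNReal.ofReal_le_ofReal e2')
  refine ⟨P, hP, hD, ?_⟩
  have hsub : {x | 1 / 2 < |φ x - P x|} ⊆ {x | 1 / 2 < |ψ x - P x|} ∪ F := by
    intro x hx
    by_cases hxF : x ∈ F
    · exact Or.inr hxF
    · left
      simp only [hψ, Set.mem_ofPred_eq, if_neg hxF]
      exact hx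
  calc muU n {x | 1 / 2 < |φ x - P x|} ≤ _ := measure_mono hsub
    _ ≤ _ := measure_union_le _ _
    _ ≤ ENNReal.ofReal (η / 2) + ENNReal.ofReal (4 * ε) := add_le_add hm hbad
    _ = ENNReal.ofReal (η / 2 + 4 * ε) := (ENNReal.ofReal_add (by positivity) (by positivity)).symm
    _ ≤ _ := ENNReal.ofReal_le_ofReal (by linarith)

lemma whit_iter (n L : ℕ) (η ε : ℝ) (hη : η ≤ 1 / (2 * (L : ℝ) ^ (n + 1))) (he : 0 < ε)
    (hI : ∀ φ : Rn n → ℝ, Measurable φ →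
    muU n {x | 1 < |φ x|} ≤ ENNReal.ofReal (1 / (2 * (L : ℝ) ^ (n + 1))) →
    nuU n {p | ε < |DD L φ p.1 p.2|} ≤ ENNReal.ofReal ε →
    ∃ P ∈ VL n L, (∀ x ∈ UU n, ∀ y ∈ UU n, DD L P x y = 0) ∧
      muU n {x | 1 / 2 < |φ x - P x|} ≤ ENNReal.ofReal η) (M : ℝ) (hM : 0 < M) (j : ℕ) :
    ∀ φ : Rn n → ℝ, Measurable φ → muU n {x | 2 ^ j * M < |φ x|} ≤ ENNReal.ofReal η →
    nuU n {p | ε * M < |DD L φ p.1 p.2|} ≤ ENNReal.ofReal ε →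
    ∃ P ∈ VL n L, muU n {x | M < |φ x - P x|} ≤ ENNReal.ofReal η := by
  induction j with
  | zero =>
    intro φ hφ h1 h2
    exact ⟨0, Submodule.zero_mem _, by simpa using h1⟩
  | succ j ih =>
    intro φ hφ h1 h2
    set A : ℝ := 2 ^ (j + 1) * M with hA
    have hA0 : 0 < A := by positivity
    have hMA : M ≤ A := by
      have : (1:ℝ) ≤ 2 ^ (j + 1) := one_le_pow₀ (by norm_num)
      rw [hA]; nlinarith
    obtain ⟨P₁, hP₁, hD₁, hm₁⟩ := hI (fun x => A⁻¹ * φ x) (hφ.const_mul _) (by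
      refine le_trans (measure_mono ?_) (h1.trans (ENNReal.ofReal_le_ofReal hη))
      intro x hx
      rw [Set.mem_ofPred_eq, abs_mul, abs_of_pos (by positivity : 0 < A⁻¹), lt_inv_mul_iff₀ hA0] at hx
      rw [Set.mem_ofPred_eq]; linarith) (by
      refine le_trans (measure_mono ?_) h2
      intro x hx
      rw [Set.mem_ofPred_eq, DD_const_mul, abs_mul, abs_of_pos (by positivity : 0 < A⁻¹),
        lt_inv_mul_iff₀ hA0] at hx
      rw [Set.mem_ofPred_eq]
      nlinarith)
    have hPm : Measurable P₁ := (VL_continuous hP₁).measurable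
    obtain ⟨P₂, hP₂, hm₂⟩ := ih (fun x => φ x - A * P₁ x) (hφ.sub (hPm.const_mul _)) (by
      refine le_trans (measure_mono ?_) hm₁
      intro x hx
      rw [Set.mem_ofPred_eq] at hx ⊢
      have : φ x - A * P₁ x = A * (A⁻¹ * φ x - P₁ x) := by field_simp
      have hA2 : A = 2 * (2 ^ j * M) := by rw [hA, pow_succ]; ring
      rw [this, abs_mul, abs_of_pos hA0] at hx
      have hq : 0 < 2 ^ j * M := by positivity
      by_contra hcon
      have := mul_le_mul_of_nonneg_left (not_lt.1 hcon) hA0.le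
      linarith) (by
      refine le_trans (nuU_mono ?_) h2
      intro x hx y hy hxy
      rw [Set.mem_ofPred_eq] at hxy ⊢
      have hsub := DD_sub L φ (fun x => A * P₁ x) x y
      have hmul := DD_const_mul L A P₁ x y
      rw [hD₁ x hx y hy, mul_zero] at hmul
      simp only [hmul, sub_zero] at hsub
      rw [← hsub]
      exact hxy)
    refine ⟨A • P₁ + P₂, Submodule.add_mem _ (Submodule.smul_mem _ _ hP₁) hP₂, ?_⟩
    refine le_trans (measure_mono ?_) hm₂
    intro x hx
    rw [Set.mem_ofPred_eq] at hx ⊢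
    simpa [sub_sub] using hx

lemma whit_pos (n L : ℕ) (hL : 0 < L) (η : ℝ) (hη : 0 < η) :
    ∃ ε : ℝ, 0 < ε ∧ ∀ φ : Rn n → ℝ, Measurable φ → ∀ M : ℝ, 0 < M →
    nuU n {p | ε * M < |DD L φ p.1 p.2|} ≤ ENNReal.ofReal ε →
    ∃ P ∈ VL n L, muU n {x | M < |φ x - P x|} ≤ ENNReal.ofReal η := by
  set η' := min η (1 / (2 * (L : ℝ) ^ (n + 1))) with h'
  have hη' : 0 < η' := lt_min hη (by positivity)
  obtain ⟨ε, he, he1, hI⟩ := whit_I n L hL η' hη'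
  refine ⟨ε, he, fun φ hφ M hM h2 => ?_⟩
  have hex : ∃ j : ℕ, muU n {x | 2 ^ j * M < |φ x|} ≤ ENNReal.ofReal η' := by
    have hanti : Antitone fun j : ℕ => {x | (2:ℝ) ^ j * M < |φ x|} := by
      intro i j hij x hx
      rw [Set.mem_ofPred_eq] at *
      have : (2:ℝ) ^ i ≤ 2 ^ j := pow_le_pow_right₀ (by norm_num) hij
      nlinarith
    have ht := tendsto_measure_iInter_atTop (μ := muU n)
      (fun j => (measurableSet_lt (measurable_const (a := (2:ℝ) ^ j * M)) hφ.abs).nullMeasurableSet) hanti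
      ⟨0, measure_ne_top _ _⟩
    have hemp : (⋂ j : ℕ, {x | (2:ℝ) ^ j * M < |φ x|}) = ∅ := by
      ext x
      simp only [Set.mem_iInter, Set.mem_ofPred_eq, Set.mem_empty_iff_false, iff_false, not_forall, not_lt]
      obtain ⟨j, hj⟩ := pow_unbounded_of_one_lt (|φ x| / M) (by norm_num : (1:ℝ) < 2)
      exact ⟨j, by rw [div_lt_iff₀ hM] at hj; exact hj.le⟩
    rw [hemp, measure_empty] at ht
    exact (ht.eventually_le_const (u := ENNReal.ofReal η') (by simpa using hη')).exists
  obtain ⟨j, hj⟩ := hex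
  obtain ⟨P, hP, hm⟩ := whit_iter n L η' ε (min_le_right _ _) he hI M hM j φ hφ hj h2
  exact ⟨P, hP, hm.trans (ENNReal.ofReal_le_ofReal (min_le_left _ _))⟩


lemma whitney (n L : ℕ) (hL : 0 < L) (η : ℝ) (hη : 0 < η) :
    ∃ ε : ℝ, 0 < ε ∧ ∀ φ : Rn n → ℝ, Measurable φ → ∀ M : ℝ, 0 ≤ M →
    nuU n {p | ε * M < |DD L φ p.1 p.2|} ≤ ENNReal.ofReal ε →
    ∃ P ∈ VL n L, muU n {x | M < |φ x - P x|} ≤ ENNReal.ofReal η := by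
  obtain ⟨ηr, hηr, hrem⟩ := remez n L hL
  obtain ⟨e, he0, he1, he2⟩ : ∃ e : ℝ, 0 < e ∧ e ≤ η ∧ ENNReal.ofReal e + ENNReal.ofReal e ≤ ηr := by
    refine ⟨min η ((min ηr 1).toReal / 2), ?_, min_le_left _ _, ?_⟩
    · refine lt_min hη (half_pos (ENNReal.toReal_pos (lt_min hηr one_pos).ne' ?_))
      exact ((min_le_right _ _).trans_lt one_lt_top).ne
    · rw [← ENNReal.ofReal_add (by positivity) (by positivity)]
      refine le_trans (ENNReal.ofReal_le_ofReal (q := (min ηr 1).toReal) ?_) ?_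
      · have := min_le_right η ((min ηr 1).toReal / 2)
        linarith
      · exact ENNReal.ofReal_toReal_le.trans (min_le_left _ _)
  obtain ⟨ε, hε, hW⟩ := whit_pos n L hL e he0
  refine ⟨ε, hε, fun φ hφ M hM h2 => ?_⟩
  rcases hM.lt_or_eq with hM0 | hM0
  · obtain ⟨P, hP, hm⟩ := hW φ hφ M hM0 h2
    exact ⟨P, hP, hm.trans (ENNReal.ofReal_le_ofReal he1)⟩
  subst hM0
  have hex : ∀ i : ℕ, ∃ P ∈ VL n L, muU n {x | 1 / ((i : ℝ) + 1) < |φ x - P x|} ≤ ENNReal.ofReal e := by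
    intro i
    refine hW φ hφ _ (by positivity) (le_trans (measure_mono ?_) h2)
    intro x hx
    rw [Set.mem_ofPred_eq] at *
    have : 0 < ε * (1 / ((i : ℝ) + 1)) := by positivity
    linarith
  choose P hP hm using hex
  have hcmp : ∀ R : ℝ, 0 ≤ R → ∃ K : ℝ, 0 ≤ K ∧ ∀ i j : ℕ, i ≤ j → ∀ w : Rn n, (∀ a, |w a| ≤ R) →
      |P i w - P j w| ≤ K * (2 / ((i : ℝ) + 1)) := by
    intro R hR
    obtain ⟨K, hK, hKK⟩ := hrem 0 R hR
    refine ⟨K, hK, fun i j hij w hw => ?_⟩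
    have := hKK (P i - P j) (Submodule.sub_mem _ (hP i) (hP j)) 0 (2 / ((i : ℝ) + 1)) (by positivity) ?_
      w 0 0 (by simpa using hw) (by simp) le_rfl (by norm_num)
    · simpa using this 0 0 (by simp)
    · have hsub : ∀ u ∈ UU n, u ∈ {u | 2 / ((i : ℝ) + 1) < |(P i - P j) u|} →
          u ∈ {x | 1 / ((i : ℝ) + 1) < |φ x - P i x|} ∪ {x | 1 / ((j : ℝ) + 1) < |φ x - P j x|} := by
        intro u _ hu
        by_contra hcon
        simp only [Set.mem_union, Set.mem_ofPred_eq, not_or, not_lt] at hcon hu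
        have h1 : 1 / ((j : ℝ) + 1) ≤ 1 / ((i : ℝ) + 1) :=
          one_div_le_one_div_of_le (by positivity) (by exact_mod_cast Nat.add_le_add_right hij 1)
        have h3 : (P i - P j) u = (φ u - P j u) - (φ u - P i u) := by simp
        have h4 := abs_sub (φ u - P j u) (φ u - P i u)
        have h5 : 2 / ((i : ℝ) + 1) = 1 / ((i : ℝ) + 1) + 1 / ((i : ℝ) + 1) := by ring
        rw [h3] at hu
        linarith [hcon.1, hcon.2]
      have h6 := (muU_mono hsub).trans ((measure_union_le _ _).trans (add_le_add (hm i) (hm j)))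
      refine le_trans ?_ (h6.trans he2)
      unfold muU
      have hc : Continuous (P i - P j) := VL_continuous (Submodule.sub_mem _ (hP i) (hP j))
      rw [Measure.restrict_apply (measurableSet_lt measurable_const hc.measurable.abs)]
      refine measure_mono ?_
      rintro u ⟨hu1, hu2⟩
      refine ⟨hu2, ?_⟩
      simpa [UU] using hu1
  have hcau : ∀ w, ∃ y, Tendsto (fun i => P i w) atTop (nhds y) := by
    intro w
    obtain ⟨K, hK, hKK⟩ := hcmp ‖w‖ (norm_nonneg _)
    refine cauchySeq_tendsto_of_complete (cauchySeq_of_le_tendsto_0 (fun i : ℕ => 2 * (K * (2 / ((i : ℝ) + 1)))) ?_ ?_)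
    · intro i j N hi hj
      have h1 := hKK N i hi w (fun a => norm_le_pi_norm w a)
      have h3 := hKK N j hj w (fun a => norm_le_pi_norm w a)
      rw [Real.dist_eq]
      have h4 : P i w - P j w = (P N w - P j w) - (P N w - P i w) := by ring
      rw [h4]
      have := abs_sub (P N w - P j w) (P N w - P i w)
      linarith
    · have : Tendsto (fun i : ℕ => (4 * K) * (1 / ((i : ℝ) + 1))) atTop (nhds ((4 * K) * 0)) :=
        tendsto_one_div_add_atTop_nhds_zero_nat.const_mul _
      rw [mul_zero] at this
      refine this.congr fun i => ?_
      ring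
  choose Q hQ using hcau
  have hQV : Q ∈ VL n L := by
    rw [mem_VL]
    intro x
    refine tendsto_nhds_unique (hQ x) ?_
    have h1 : ∀ i, P i x = lag L (P i) x := fun i => mem_VL.1 (hP i) x
    simp only [h1]
    unfold lag
    refine tendsto_finsetSum _ fun b _ => ?_
    exact (hQ _).mul_const _
  obtain ⟨K, hK, hKK⟩ := hcmp 1 zero_le_one
  have hQK : ∀ i : ℕ, ∀ w ∈ UU n, |P i w - Q w| ≤ K * (2 / ((i : ℝ) + 1)) := by
    intro i w hw
    have ht : Tendsto (fun j => |P i w - P j w|) atTop (nhds |P i w - Q w|) :=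
      ((tendsto_const_nhds.sub (hQ w))).abs
    refine le_of_tendsto ht ?_
    filter_upwards [eventually_ge_atTop i] with j hj
    refine hKK i j hj w fun a => ?_
    have h1 : 0 ≤ w a := hw.1 a
    have h3 : w a ≤ 1 := hw.2 a
    rw [abs_of_nonneg h1]; exact h3
  refine ⟨Q, hQV, le_trans ?_ (ENNReal.ofReal_le_ofReal he1)⟩
  have hmono : Monotone fun i : ℕ => {x | (1 + 2 * K) * (1 / ((i : ℝ) + 1)) < |φ x - Q x|} := by
    intro i j hij x hx
    rw [Set.mem_ofPred_eq] at *
    have h1 : 1 / ((j : ℝ) + 1) ≤ 1 / ((i : ℝ) + 1) :=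
          one_div_le_one_div_of_le (by positivity) (by exact_mod_cast Nat.add_le_add_right hij 1)
    have := mul_le_mul_of_nonneg_left h1 (by positivity : 0 ≤ 1 + 2 * K)
    linarith
  have hun : {x | 0 < |φ x - Q x|} ⊆ ⋃ i : ℕ, {x | (1 + 2 * K) * (1 / ((i : ℝ) + 1)) < |φ x - Q x|} := by
    intro x hx
    rw [Set.mem_ofPred_eq] at hx
    rw [Set.mem_iUnion]
    obtain ⟨i, hi⟩ := exists_nat_one_div_lt (div_pos hx (by positivity : 0 < 1 + 2 * K))
    refine ⟨i, ?_⟩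
    rw [lt_div_iff₀ (by positivity)] at hi
    rw [Set.mem_ofPred_eq]; linarith
  refine le_trans (measure_mono hun) ?_
  rw [hmono.measure_iUnion]
  refine iSup_le fun i => le_trans (muU_mono ?_) (hm i)
  intro x hx hxx
  rw [Set.mem_ofPred_eq] at *
  have h1 := hQK i x hx
  have h3 : φ x - Q x = (φ x - P i x) + (P i x - Q x) := by ring
  have h4 := abs_add_le (φ x - P i x) (P i x - Q x)
  rw [← h3] at h4
  have h5 : K * (2 / ((i : ℝ) + 1)) = 2 * K * (1 / ((i : ℝ) + 1)) := by ring
  rw [add_mul, one_mul] at hxx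
  linarith


/-! dyadic basics -/

/-- powers of two -/
def tw (a : ℝ) : ℝ≥0∞ := (2 : ℝ≥0∞) ^ a

lemma tw_add (a b : ℝ) : tw (a + b) = tw a * tw b := ENNReal.rpow_add a b two_ne_zero ofNat_ne_top
lemma tw_zero : tw 0 = 1 := ENNReal.rpow_zero
lemma tw_pos (a : ℝ) : 0 < tw a := ENNReal.rpow_pos two_pos ofNat_ne_top
lemma tw_ne_zero (a : ℝ) : tw a ≠ 0 := (tw_pos a).ne'
lemma tw_ne_top (a : ℝ) : tw a ≠ ∞ := by
  unfold tw
  exact ENNReal.rpow_ne_top_of_ne_zero two_ne_zero ofNat_ne_top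
lemma tw_lt_top (a : ℝ) : tw a < ∞ := (tw_ne_top a).lt_top
lemma tw_rpow (a b : ℝ) : tw a ^ b = tw (a * b) := (ENNReal.rpow_mul _ _ _).symm
lemma tw_nat (a : ℕ) : (2 : ℝ≥0∞) ^ a = tw a := (ENNReal.rpow_natCast _ _).symm
lemma tw_mono {a b : ℝ} (h : a ≤ b) : tw a ≤ tw b :=
  ENNReal.rpow_le_rpow_of_exponent_le one_le_two h
lemma tw_neg_mul (a : ℝ) : tw (-a) * tw a = 1 := by rw [← tw_add]; simp [tw_zero]
lemma tw_inv (a : ℝ) : (tw a)⁻¹ = tw (-a) := (ENNReal.rpow_neg _ _).symm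

lemma tw_sum (ε : ℝ) (h : 0 < ε) : ∑' j : ℕ, tw (-(ε * j)) < ∞ := by
  have h1 : ∀ j : ℕ, tw (-(ε * j)) = (tw (-ε)) ^ j := by
    intro j
    rw [← ENNReal.rpow_natCast, tw_rpow]; congr 1; ring
  simp only [h1]
  rw [ENNReal.tsum_geometric]
  rw [ENNReal.inv_lt_top, tsub_pos_iff_lt]
  unfold tw
  exact ENNReal.rpow_lt_one_of_one_lt_of_neg one_lt_two (by linarith)

def idx {n : ℕ} (k : ℕ) (x : Rn n) : Fin n → ℤ := fun i => ⌊(2:ℝ) ^ k * x i⌋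

lemma idx_measurable {n : ℕ} (k : ℕ) : Measurable (idx k : Rn n → Fin n → ℤ) := by
  unfold idx
  refine measurable_pi_lambda _ fun i => ?_
  exact Int.measurable_floor.comp ((measurable_pi_apply i).const_mul _)

def cell (n k : ℕ) (m : Fin n → ℤ) : Set (Rn n) := {x | idx k x = m}

lemma mem_cell {n k : ℕ} {m : Fin n → ℤ} {x : Rn n} : x ∈ cell n k m ↔ idx k x = m := Iff.rfl

lemma cell_meas (n k : ℕ) (m : Fin n → ℤ) : MeasurableSet (cell n k m) :=
  idx_measurable k (measurableSet_singleton m)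

lemma idx_le {n k : ℕ} (x : Rn n) (i : Fin n) : ((idx k x i : ℤ) : ℝ) ≤ 2 ^ k * x i := Int.floor_le _
lemma idx_lt {n k : ℕ} (x : Rn n) (i : Fin n) : 2 ^ k * x i < ((idx k x i : ℤ) : ℝ) + 1 :=
  Int.lt_floor_add_one _

lemma half_eq (n k : ℕ) (m : Fin n → ℤ) : dyadicCubeHalf n k m = cell n k m := by
  ext x
  simp only [dyadicCubeHalf, cell, Set.mem_ofPred_eq, idx, funext_iff, Int.floor_eq_iff]
  refine forall_congr' fun i => ?_
  have h : (0:ℝ) < 2 ^ k := by positivity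
  rw [div_le_iff₀ h, lt_div_iff₀ h, mul_comm (x i)]

lemma cell_eq_pi (n k : ℕ) (m : Fin n → ℤ) : cell n k m =
    Set.pi Set.univ (fun i => Set.Ico ((m i : ℝ) / 2 ^ k) (((m i : ℝ) + 1) / 2 ^ k)) := by
  rw [← half_eq]; ext x; simp [dyadicCubeHalf]

lemma cube_eq_pi (n k : ℕ) (m : Fin n → ℤ) : dyadicCube n k m =
    Set.pi Set.univ (fun i => Set.Ioo ((m i : ℝ) / 2 ^ k) (((m i : ℝ) + 1) / 2 ^ k)) := by
  ext x; simp [dyadicCube]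

lemma cube_ae (n k : ℕ) (m : Fin n → ℤ) : dyadicCube n k m =ᵐ[volume] cell n k m := by
  rw [cell_eq_pi, cube_eq_pi]
  exact Measure.univ_pi_Ioo_ae_eq_Icc.trans Measure.univ_pi_Ico_ae_eq_Icc.symm

lemma cube_restrict (n k : ℕ) (m : Fin n → ℤ) :
    (volume : Measure (Rn n)).restrict (dyadicCube n k m) = volume.restrict (cell n k m) :=
  Measure.restrict_congr_set (cube_ae n k m)

lemma cell_vol (n k : ℕ) (m : Fin n → ℤ) : volume (cell n k m) = tw (-((k * n : ℕ) : ℝ)) := by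
  rw [cell_eq_pi, Real.volume_pi_Ico]
  have : ∀ i, ENNReal.ofReal (((m i : ℝ) + 1) / 2 ^ k - (m i : ℝ) / 2 ^ k) = tw (-(k:ℝ)) := by
    intro i
    rw [← sub_div, add_sub_cancel_left, ← tw_inv, ← tw_nat, one_div,
      ENNReal.ofReal_inv_of_pos (by positivity), ENNReal.ofReal_pow (by norm_num)]
    simp
  simp only [this, Finset.prod_const, Finset.card_univ, Fintype.card_fin]
  rw [← ENNReal.rpow_natCast, tw_rpow]
  congr 1; push_cast; ring

lemma cells_union (n k : ℕ) : (⋃ m, cell n k m) = Set.univ := by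
  ext x; simp [cell]

lemma cells_disj (n k : ℕ) : Pairwise (Function.onFun Disjoint (cell n k)) := by
  intro a b hab
  rw [Function.onFun, Set.disjoint_left]
  intro x h1 h2
  exact hab (h1.symm.trans h2)

lemma lint_cells {n : ℕ} (k : ℕ) (f : Rn n → ℝ≥0∞) :
    ∫⁻ x, f x = ∑' m, ∫⁻ x in cell n k m, f x := by
  rw [← lintegral_iUnion (cell_meas n k) (cells_disj n k), cells_union, Measure.restrict_univ]

lemma lint_cell_congr {n k : ℕ} {m : Fin n → ℤ} {f g : Rn n → ℝ≥0∞}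
    (h : ∀ x, idx k x = m → f x = g x) : ∫⁻ x in cell n k m, f x = ∫⁻ x in cell n k m, g x :=
  setLIntegral_congr_fun (cell_meas n k m) fun x hx => h x hx

lemma lint_cell_mono {n k : ℕ} {m : Fin n → ℤ} {f g : Rn n → ℝ≥0∞}
    (h : ∀ x, idx k x = m → f x ≤ g x) : ∫⁻ x in cell n k m, f x ≤ ∫⁻ x in cell n k m, g x :=
  setLIntegral_mono' (cell_meas n k m) fun x hx => h x hx

lemma lint_cell_const {n k : ℕ} {m : Fin n → ℤ} (c : ℝ≥0∞) :
    ∫⁻ _ in cell n k m, c = c * tw (-((k * n : ℕ) : ℝ)) := by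
  rw [setLIntegral_const, cell_vol]

/-- coarser indices are functions of the finer ones -/
lemma idx_coarse {n j k : ℕ} (h : j ≤ k) {x y : Rn n} (hxy : idx k x = idx k y) :
    idx j x = idx j y := by
  have key : ∀ z : Rn n, ∀ i, idx j z i = idx k z i / 2 ^ (k - j) := by
    intro z i
    have : (2:ℝ) ^ j * z i = (2 ^ k * z i) / ((2 ^ (k - j) : ℕ) : ℝ) := by
      have : (2:ℝ) ^ k = 2 ^ j * 2 ^ (k - j) := by rw [← pow_add]; congr 1; omega
      rw [this]; push_cast; field_simp
    unfold idx
    rw [this, Int.floor_div_natCast]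
    push_cast; rfl
  ext i
  rw [key, key, hxy]

lemma cell_sub {n j k : ℕ} (h : j ≤ k) (y : Rn n) : cell n k (idx k y) ⊆ cell n j (idx j y) :=
  fun _ hz => idx_coarse h hz

/-- nearby points have nearby indices -/
lemma idx_near {n k : ℕ} {x y : Rn n} {R : ℕ} (h : ∀ i, 2 ^ k * |x i - y i| ≤ R) (i : Fin n) :
    |idx k x i - idx k y i| ≤ R + 1 := by
  have h1 := idx_le (k := k) x i
  have h2 := idx_lt (k := k) x i
  have h3 := idx_le (k := k) y i
  have h4 := idx_lt (k := k) y i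
  have h5 := h i
  have h6 : (0:ℝ) < 2 ^ k := by positivity
  have h7 : |(2:ℝ) ^ k * x i - 2 ^ k * y i| ≤ R := by
    rw [← mul_sub, abs_mul, abs_of_pos h6]; exact h5
  rw [abs_le] at h7
  have h8 : ((idx k x i - idx k y i : ℤ) : ℝ) < ((R + 2 : ℤ) : ℝ) := by push_cast; linarith [h7.2]
  have h9 : ((-(R + 2) : ℤ) : ℝ) < ((idx k x i - idx k y i : ℤ) : ℝ) := by push_cast; linarith [h7.1]
  rw [Int.cast_lt] at h8 h9
  rw [abs_le]; constructor <;> omega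

lemma idx_near_lt {n k : ℕ} {x y : Rn n} {R : ℕ} (h : ∀ i, 2 ^ k * |x i - y i| < R) (i : Fin n) :
    |idx k x i - idx k y i| ≤ R := by
  have h1 := idx_le (k := k) x i
  have h2 := idx_lt (k := k) x i
  have h3 := idx_le (k := k) y i
  have h4 := idx_lt (k := k) y i
  have h5 := h i
  have h6 : (0:ℝ) < 2 ^ k := by positivity
  have h7 : |(2:ℝ) ^ k * x i - 2 ^ k * y i| < R := by
    rw [← mul_sub, abs_mul, abs_of_pos h6]; exact h5
  rw [abs_lt] at h7
  have h8 : ((idx k x i - idx k y i : ℤ) : ℝ) < ((R + 1 : ℤ) : ℝ) := by push_cast; linarith [h7.2]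
  have h9 : ((-(R + 1) : ℤ) : ℝ) < ((idx k x i - idx k y i : ℤ) : ℝ) := by push_cast; linarith [h7.1]
  rw [Int.cast_lt] at h8 h9
  rw [abs_le]; constructor <;> omega

/-- The step weight -/
def tb {n : ℕ} (P : ℝ) (T : ℕ → (Fin n → ℤ) → ℝ≥0∞) (k : ℕ) (x : Rn n) : ℝ≥0∞ :=
  tw ((k * n : ℕ) / P) * T k (idx k x)

lemma tb_meas {n : ℕ} (P : ℝ) (T : ℕ → (Fin n → ℤ) → ℝ≥0∞) (k : ℕ) : Measurable (tb P T k) :=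
  ((measurable_of_countable (T k)).comp (idx_measurable k)).const_mul _

lemma tbarOf_eq {n : ℕ} (p : ℝ≥0∞) (T : ℕ → (Fin n → ℤ) → ℝ≥0∞) (k : ℕ) (x : Rn n) :
    tbarOf n p T k x = tb p.toReal T k x := by
  unfold tbarOf tb
  congr 1
  rw [tsum_eq_single (idx k x)]
  · rw [half_eq, Set.indicator_of_mem (show x ∈ cell n k (idx k x) from rfl)]
  · intro m hm
    rw [half_eq, Set.indicator_of_notMem]
    exact fun h => hm h.symm

lemma tb_lint {n : ℕ} {P : ℝ} (hP : 0 < P) (T : ℕ → (Fin n → ℤ) → ℝ≥0∞) (k : ℕ) (m : Fin n → ℤ) :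
    ∫⁻ x in cell n k m, tb P T k x ^ P = T k m ^ P := by
  rw [lint_cell_congr (g := fun _ => tw ((k * n : ℕ)) * T k m ^ P), lint_cell_const]
  · rw [mul_comm, ← mul_assoc, tw_neg_mul, one_mul]
  · intro x hx
    rw [tb, hx, ENNReal.mul_rpow_of_nonneg _ _ hP.le, tw_rpow]
    congr 2
    field_simp

/-- elementary quasi-Hoelder inequality -/
lemma geoG {ι : Type*} (w x : ι → ℝ≥0∞) {s : ℝ} (hs : 0 < s) :
    (∑' j, w j * (w j * x j)) ^ s ≤ (∑' j, w j) ^ s * ∑' j, (w j * x j) ^ s := by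
  set S := ∑' j, (w j * x j) ^ s with hS
  have h1 : ∀ j, w j * x j ≤ S ^ (1 / s) := by
    intro j
    rw [one_div, ENNReal.le_rpow_inv_iff hs]
    exact ENNReal.le_tsum j
  calc (∑' j, w j * (w j * x j)) ^ s ≤ (∑' j, w j * S ^ (1 / s)) ^ s := by
        gcongr with j; exact h1 j
    _ = (∑' j, w j) ^ s * S := by
        rw [ENNReal.tsum_mul_right, ENNReal.mul_rpow_of_nonneg _ _ hs.le, ← ENNReal.rpow_mul,
          one_div_mul_cancel hs.ne', ENNReal.rpow_one]

lemma sum_rpow_le {ι : Type*} (S : Finset ι) (x : ι → ℝ≥0∞) {s : ℝ} (hs : 0 < s) :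
    (∑ j ∈ S, x j) ^ s ≤ (S.card : ℝ≥0∞) ^ s * ∑ j ∈ S, (x j) ^ s := by
  have := geoG (fun _ : S => 1) (fun j : S => x j) hs
  simp only [one_mul, tsum_fintype] at this
  rw [Finset.sum_coe_sort S x, Finset.sum_coe_sort S (fun j => x j ^ s)] at this
  simpa using this

lemma add_rpow_le (x y : ℝ≥0∞) {s : ℝ} (hs : 0 < s) :
    (x + y) ^ s ≤ (2 : ℝ≥0∞) ^ s * (x ^ s + y ^ s) := by
  have := sum_rpow_le (Finset.univ : Finset (Fin 2)) ![x, y] hs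
  simpa using this

/-- Weight data -/
structure WD (n : ℕ) (P θ α₁ α₂ : ℝ) (T : ℕ → (Fin n → ℤ) → ℝ≥0∞) : Prop where
  pos : ∀ k m, 0 < T k m
  fin : ∀ k m, T k m < ∞
  t1 : ∀ R : ℕ, ∃ C : ℝ≥0∞, C < ∞ ∧ ∀ (k : ℕ) (m m' : Fin n → ℤ), (∀ i, |m i - m' i| ≤ (R : ℤ)) → T k m ≤ C * T k m'
  t2 : ∃ C : ℝ≥0∞, C < ∞ ∧ ∀ k j : ℕ, k ≤ j → ∀ m, ∀ G : Rn n → ℝ≥0∞, Measurable G →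
    T k m ^ P * (tw ((k * n : ℕ)) * ∫⁻ x in cell n k m, G x ^ θ) ^ (P / θ) ≤
      C * (tw (-(α₁ * P * ((j : ℝ) - k))) * ∫⁻ x in cell n k m, (tb P T j x * G x) ^ P)
  t3 : ∃ C : ℝ≥0∞, C < ∞ ∧ ∀ k j : ℕ, k ≤ j → ∀ m,
    ∫⁻ x in cell n k m, tb P T j x ^ P ≤ C * (tw (α₂ * P * ((j : ℝ) - k)) * T k m ^ P)

/-- Weight functions adapted to the multiple sequence -/
structure WW (n : ℕ) (P : ℝ) (T : ℕ → (Fin n → ℤ) → ℝ≥0∞) (W : ℕ → Rn n → ℝ≥0∞) : Prop where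
  meas : ∀ k, Measurable (W k)
  pos : ∀ k x, 0 < W k x
  int : ∀ k m, ∫⁻ x in cell n k m, W k x ^ P = T k m ^ P

lemma WD_t1 {n : ℕ} {T : ℕ → (Fin n → ℤ) → ℝ≥0∞} {c : ℝ≥0∞} (hc : c < ∞)
    (h : ∀ k : ℕ, ∀ m m' : Fin n → ℤ, (∀ i, |m i - m' i| ≤ 1) → T k m ≤ c * T k m') (R : ℕ) :
    ∃ C : ℝ≥0∞, C < ∞ ∧ ∀ (k : ℕ) (m m' : Fin n → ℤ), (∀ i, |m i - m' i| ≤ (R : ℤ)) → T k m ≤ C * T k m' := by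
  induction R with
  | zero =>
    refine ⟨1, one_lt_top, fun k m m' hm => ?_⟩
    have : m = m' := by
      ext i
      have := hm i
      simp only [Nat.cast_zero, abs_nonpos_iff] at this
      omega
    rw [this, one_mul]
  | succ R ih =>
    obtain ⟨C, hC, hCC⟩ := ih
    refine ⟨c * C, ENNReal.mul_lt_top hc hC, fun k m m' hm => ?_⟩
    set m'' : Fin n → ℤ := fun i => if m i < m' i then m i + 1 else if m' i < m i then m i - 1 else m i
    have h1 : ∀ i, |m i - m'' i| ≤ 1 := by
      intro i; simp only [m'']; split_ifs <;> rw [abs_le] <;> constructor <;> omega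
    have h2 : ∀ i, |m'' i - m' i| ≤ R := by
      intro i
      have := hm i
      push_cast at this
      rw [abs_le] at this
      simp only [m'']; split_ifs <;> rw [abs_le] <;> constructor <;> omega
    calc T k m ≤ c * T k m'' := h k m m'' h1
      _ ≤ c * (C * T k m') := by gcongr; exact hCC k m'' m' h2
      _ = _ := (mul_assoc _ _ _).symm


lemma avg_eq {n k : ℕ} {e : ℝ≥0∞} (he : e ≠ ∞) (m : Fin n → ℤ) (f : Rn n → ℝ≥0∞) :
    avgNorm n k e (dyadicCube n k m) f =
      (tw ((k * n : ℕ)) * ∫⁻ x in cell n k m, f x ^ e.toReal) ^ (1 / e.toReal) := by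
  unfold avgNorm
  rw [if_neg he, cube_restrict, tw_nat]

lemma avg_tb {n k : ℕ} {p : ℝ≥0∞} (hp0 : 0 < p) (hp : p ≠ ∞) (T : ℕ → (Fin n → ℤ) → ℝ≥0∞) (m : Fin n → ℤ) :
    avgNorm n k p (dyadicCube n k m) (tbarOf n p T k) ^ p.toReal =
      tw ((k * n : ℕ)) * T k m ^ p.toReal := by
  have hP : 0 < p.toReal := ENNReal.toReal_pos hp0.ne' hp
  rw [avg_eq hp, ← ENNReal.rpow_mul, one_div_mul_cancel hP.ne', ENNReal.rpow_one]
  simp only [tbarOf_eq]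
  rw [tb_lint hP]

lemma tb_pos {n : ℕ} {P : ℝ} {T : ℕ → (Fin n → ℤ) → ℝ≥0∞} (h : ∀ k m, 0 < T k m) (k : ℕ) (x : Rn n) :
    0 < tb P T k x := ENNReal.mul_pos (tw_ne_zero _) (h _ _).ne'

lemma tb_ne_top {n : ℕ} {P : ℝ} {T : ℕ → (Fin n → ℤ) → ℝ≥0∞} (h : ∀ k m, T k m < ∞) (k : ℕ) (x : Rn n) :
    tb P T k x ≠ ∞ := ENNReal.mul_ne_top (tw_ne_top _) (h _ _).ne

/-- Hoelder step -/
lemma holder_avg {n k : ℕ} {p θ : ℝ≥0∞} (hp : p < ∞) (hθ0 : 0 < θ) (hθp : θ ≤ p)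
    (m : Fin n → ℤ) (τ G : Rn n → ℝ≥0∞) (hτ : Measurable τ) (hG : Measurable G)
    (hτ0 : ∀ x, 0 < τ x) (hτ1 : ∀ x, τ x ≠ ∞) :
    (tw ((k * n : ℕ)) * ∫⁻ x in cell n k m, G x ^ θ.toReal) ^ (p.toReal / θ.toReal) ≤
      (tw ((k * n : ℕ)) * ∫⁻ x in cell n k m, (τ x * G x) ^ p.toReal) *
      (avgNorm n k (θ * conjE (pTheta p θ)) (dyadicCube n k m) (fun x => (τ x)⁻¹)) ^ p.toReal := by
  have hp0 : 0 < p := hθ0.trans_le hθp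
  have hθt : θ ≠ ∞ := (hθp.trans_lt hp).ne
  have hP : 0 < p.toReal := ENNReal.toReal_pos hp0.ne' hp.ne
  have hΘ : 0 < θ.toReal := ENNReal.toReal_pos hθ0.ne' hθt
  have hpT : pTheta p θ = p / θ := by unfold pTheta; rw [if_neg]; exact fun h => hθt h.1
  set μ : Measure (Rn n) := tw ((k * n : ℕ)) • volume.restrict (cell n k m) with hμ
  have hμi : ∀ f : Rn n → ℝ≥0∞, tw ((k * n : ℕ)) * ∫⁻ x in cell n k m, f x = ∫⁻ x, f x ∂μ := by
    intro f; rw [hμ, lintegral_smul_measure]; rfl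
  rw [hμi, hμi]
  have hsplit : ∀ x, G x ^ θ.toReal = (τ x * G x) ^ θ.toReal * (τ x)⁻¹ ^ θ.toReal := by
    intro x
    rw [← ENNReal.mul_rpow_of_nonneg _ _ hΘ.le]
    congr 1
    rw [mul_comm (τ x), mul_assoc, ENNReal.mul_inv_cancel (hτ0 x).ne' (hτ1 x), mul_one]
  rcases hθp.eq_or_lt with heq | hlt
  · subst heq
    have hσ : θ * conjE (pTheta θ θ) = ∞ := by
      rw [hpT, ENNReal.div_self hθ0.ne' hθt, conjE]
      simp [hθ0.ne']
    rw [hσ, div_self hΘ.ne', ENNReal.rpow_one]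
    unfold avgNorm
    rw [if_pos rfl, cube_restrict]
    have hes : ∀ᵐ x ∂μ, (τ x)⁻¹ ≤ essSup (fun x => (τ x)⁻¹) (volume.restrict (cell n k m)) :=
      (Measure.smul_absolutelyContinuous).ae_le (ENNReal.ae_le_essSup _)
    have hmm : Measurable fun x => (τ x * G x) ^ θ.toReal := (hτ.mul hG).pow_const _
    rw [← lintegral_mul_const _ hmm]
    refine lintegral_mono_ae ?_
    filter_upwards [hes] with x hx
    rw [hsplit]
    gcongr
  · have hlt' : θ.toReal < p.toReal := (ENNReal.toReal_lt_toReal hθt hp.ne).2 hlt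
    set a := p.toReal / θ.toReal with ha
    set b := p.toReal / (p.toReal - θ.toReal) with hb
    have hsub : 0 < p.toReal - θ.toReal := by linarith
    have hab : a.HolderConjugate b := by
      rw [Real.holderConjugate_iff]
      constructor
      · rw [ha, lt_div_iff₀ hΘ]; linarith
      · rw [ha, hb]; field_simp; ring
    have hσ : θ * conjE (pTheta p θ) = ENNReal.ofReal (θ.toReal * b) := by
      rw [hpT, conjE, ENNReal.inv_div (Or.inl hθt) (Or.inl hθ0.ne')]
      have h1 : θ / p = ENNReal.ofReal (θ.toReal / p.toReal) := by
        rw [ENNReal.ofReal_div_of_pos hP, ENNReal.ofReal_toReal hθt, ENNReal.ofReal_toReal hp.ne]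
      rw [h1, ← ENNReal.ofReal_one, ← ENNReal.ofReal_sub _ (by positivity),
        ← ENNReal.ofReal_inv_of_pos (by rw [sub_pos, div_lt_one hP]; exact hlt')]
      have h6 : (1 - θ.toReal / p.toReal)⁻¹ = b := by rw [hb]; field_simp
      rw [h6, ENNReal.ofReal_mul hΘ.le, ENNReal.ofReal_toReal hθt]
    have hb0 : 0 < b := by positivity
    have hσR : (ENNReal.ofReal (θ.toReal * b)).toReal = θ.toReal * b :=
      ENNReal.toReal_ofReal (by positivity)
    rw [hσ, avg_eq ENNReal.ofReal_ne_top, hσR, hμi]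
    simp only [hsplit]
    have hH := ENNReal.lintegral_mul_le_Lp_mul_Lq μ hab (f := fun x => (τ x * G x) ^ θ.toReal)
      (g := fun x => (τ x)⁻¹ ^ θ.toReal) ((hτ.mul hG).pow_const _).aemeasurable
      (hτ.inv.pow_const _).aemeasurable
    refine le_trans (ENNReal.rpow_le_rpow hH (by positivity : 0 ≤ a)) ?_
    rw [ENNReal.mul_rpow_of_nonneg _ _ (by positivity), ← ENNReal.rpow_mul, ← ENNReal.rpow_mul,
      ← ENNReal.rpow_mul, one_div_mul_cancel (by positivity), ENNReal.rpow_one]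
    simp only [← ENNReal.rpow_mul]
    have e1 : θ.toReal * a = p.toReal := by rw [ha]; field_simp
    have e2 : 1 / b * a = 1 / (θ.toReal * b) * p.toReal := by rw [ha]; field_simp
    rw [e1, e2]

lemma WD_of {n : ℕ} {p θ : ℝ≥0∞} (hp : p < ∞) (hθ0 : 0 < θ) (hθp : θ ≤ p) {α₁ α₂ α₃ : ℝ}
    {T : ℕ → (Fin n → ℤ) → ℝ≥0∞} (hfin : ∀ k m, T k m < ∞)
    (h : MemXseq n α₁ α₂ α₃ (θ * conjE (pTheta p θ)) p p T) :
    WD n p.toReal θ.toReal α₁ α₂ T := by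
  obtain ⟨⟨C₁, -, hC₁, h1⟩, ⟨C₂, -, hC₂, h2⟩, h3⟩ := h
  have hp0 : 0 < p := hθ0.trans_le hθp
  have hP : 0 < p.toReal := ENNReal.toReal_pos hp0.ne' hp.ne
  have hpos : ∀ k m, 0 < T k m := fun k m => (h3 k m m (by simp)).1
  refine ⟨hpos, hfin, WD_t1 (c := (2 : ℝ≥0∞) ^ α₃) (tw_lt_top _) fun k m m' hm => (h3 k m m' hm).2,
    ⟨C₁ ^ p.toReal, ENNReal.rpow_lt_top_of_nonneg hP.le hC₁.ne, ?_⟩,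
    ⟨C₂ ^ p.toReal, ENNReal.rpow_lt_top_of_nonneg hP.le hC₂.ne, ?_⟩⟩
  · intro k j hkj m G hG
    have hh := h1 k j hkj m
    have hh2 := ENNReal.rpow_le_rpow hh hP.le
    rw [ENNReal.mul_rpow_of_nonneg _ _ hP.le, avg_tb hp0 hp.ne,
      ENNReal.mul_rpow_of_nonneg _ _ hP.le] at hh2
    have hτ : (fun x => (tbarOf n p T j x)⁻¹) = fun x => (tb p.toReal T j x)⁻¹ := by
      funext x; rw [tbarOf_eq]
    rw [hτ] at hh2
    have hho := holder_avg (k := k) hp hθ0 hθp m (tb p.toReal T j) G (tb_meas _ _ _) hG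
      (tb_pos hpos j) (tb_ne_top hfin j)
    set A := avgNorm n k (θ * conjE (pTheta p θ)) (dyadicCube n k m) (fun x => (tb p.toReal T j x)⁻¹)
    set I := ∫⁻ x in cell n k m, (tb p.toReal T j x * G x) ^ p.toReal
    have he : ((2:ℝ≥0∞) ^ (α₁ * ((k:ℝ) - j))) ^ p.toReal = tw (-(α₁ * p.toReal * ((j:ℝ) - k))) := by
      change tw _ ^ _ = _
      rw [tw_rpow]; congr 1; ring
    rw [he] at hh2
    calc _ ≤ T k m ^ p.toReal * ((tw ((k * n : ℕ)) * I) * A ^ p.toReal) := by gcongr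
      _ = (tw ((k * n : ℕ)) * T k m ^ p.toReal * A ^ p.toReal) * I := by ring
      _ ≤ (C₁ ^ p.toReal * tw (-(α₁ * p.toReal * ((j:ℝ) - k)))) * I := by gcongr
      _ = _ := by ring
  · intro k j hkj m
    have hh := h2 k j hkj m
    have hh2 := ENNReal.rpow_le_rpow hh hP.le
    rw [ENNReal.mul_rpow_of_nonneg _ _ hP.le, ENNReal.inv_rpow, avg_tb hp0 hp.ne,
      ENNReal.mul_rpow_of_nonneg _ _ hP.le, avg_eq hp.ne, ← ENNReal.rpow_mul,
      one_div_mul_cancel hP.ne', ENNReal.rpow_one] at hh2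
    simp only [tbarOf_eq] at hh2
    have he : ((2:ℝ≥0∞) ^ (α₂ * ((j:ℝ) - k))) ^ p.toReal = tw (α₂ * p.toReal * ((j:ℝ) - k)) := by
      change tw _ ^ _ = _
      rw [tw_rpow]; congr 1; ring
    rw [he] at hh2
    set I := ∫⁻ x in cell n k m, tb p.toReal T j x ^ p.toReal
    have hT0 : T k m ^ p.toReal ≠ 0 := (ENNReal.rpow_pos (hpos k m) (hfin k m).ne).ne'
    have hT1 : T k m ^ p.toReal ≠ ∞ := ENNReal.rpow_ne_top_of_nonneg hP.le (hfin k m).ne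
    have hX0 : tw ((k * n : ℕ)) * T k m ^ p.toReal ≠ 0 := mul_ne_zero (tw_ne_zero _) hT0
    have hX1 : tw ((k * n : ℕ)) * T k m ^ p.toReal ≠ ∞ := ENNReal.mul_ne_top (tw_ne_top _) hT1
    have h5 : (tw ((k * n : ℕ)) * T k m ^ p.toReal)⁻¹ * (tw ((k * n : ℕ)) * I) =
        (T k m ^ p.toReal)⁻¹ * I := by
      rw [ENNReal.mul_inv (Or.inl (tw_ne_zero _)) (Or.inl (tw_ne_top _)), mul_mul_mul_comm,
        ENNReal.inv_mul_cancel (tw_ne_zero _) (tw_ne_top _), one_mul]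
    rw [h5] at hh2
    calc I = T k m ^ p.toReal * ((T k m ^ p.toReal)⁻¹ * I) := by
          rw [← mul_assoc, ENNReal.mul_inv_cancel hT0 hT1, one_mul]
      _ ≤ T k m ^ p.toReal * (C₂ ^ p.toReal * tw (α₂ * p.toReal * ((j:ℝ) - k))) := by gcongr
      _ = _ := by ring

lemma tkm_eq {n : ℕ} {p : ℝ≥0∞} (hp0 : 0 < p) (hp : p < ∞) (t : ℕ → Rn n → ℝ) (k : ℕ) (m : Fin n → ℤ)
    (hpos : ∀ x, 0 < t k x) :
    tkm n p t k m ^ p.toReal = ∫⁻ x in cell n k m, ENNReal.ofReal (t k x) ^ p.toReal := by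
  have hP : 0 < p.toReal := ENNReal.toReal_pos hp0.ne' hp.ne
  unfold tkm
  rw [cube_restrict, eLpNorm_eq_lintegral_rpow_enorm_toReal hp0.ne' hp.ne, ← ENNReal.rpow_mul,
    one_div_mul_cancel hP.ne', ENNReal.rpow_one]
  refine lintegral_congr fun x => ?_
  rw [← ofReal_norm, Real.norm_of_nonneg (hpos x).le]

lemma tkm_fin {n : ℕ} {p : ℝ≥0∞} (t : ℕ → Rn n → ℝ) (ht : pAdmissible n p t) (k : ℕ) (m : Fin n → ℤ) :
    tkm n p t k m < ∞ := by
  refine lt_of_le_of_lt ?_ ((ht k).2.2 (Set.Icc (fun i => (m i : ℝ) / 2 ^ k) (fun i => ((m i : ℝ) + 1) / 2 ^ k))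
    isCompact_Icc)
  refine eLpNorm_mono_measure _ (Measure.restrict_mono ?_ le_rfl)
  intro x hx
  exact ⟨fun i => (hx i).1.le, fun i => (hx i).2.le⟩

lemma WW_t {n : ℕ} {p : ℝ≥0∞} (hp0 : 0 < p) (hp : p < ∞) (t : ℕ → Rn n → ℝ) (ht : pAdmissible n p t) :
    WW n p.toReal (tkm n p t) (fun k x => ENNReal.ofReal (t k x)) where
  meas k := (ht k).1.1.ennreal_ofReal
  pos k x := by simpa using (ht k).1.2 x
  int k m := (tkm_eq hp0 hp t k m (ht k).1.2).symm

lemma WW_tb {n : ℕ} {p : ℝ≥0∞} (hp0 : 0 < p) (hp : p < ∞) (T : ℕ → (Fin n → ℤ) → ℝ≥0∞)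
    (hT : ∀ k m, 0 < T k m) : WW n p.toReal T (tbarOf n p T) := by
  have : tbarOf n p T = tb p.toReal T := by funext k x; exact tbarOf_eq p T k x
  rw [this]
  exact ⟨tb_meas _ _, fun k x => tb_pos hT k x,
    tb_lint (ENNReal.toReal_pos hp0.ne' hp.ne) T⟩


abbrev MS (n : ℕ) := ℕ → (Fin n → ℤ) → ℝ≥0∞

def bS {n : ℕ} (P : ℝ) (T g : MS n) (k : ℕ) : ℝ≥0∞ := ∑' m, (T k m * g k m) ^ P
def ES {n : ℕ} (P Q : ℝ) (T g : MS n) : ℝ≥0∞ := ∑' k, bS P T g k ^ (Q / P)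

/-- the step function -/
def sf {n : ℕ} (g : MS n) (k : ℕ) (x : Rn n) : ℝ≥0∞ := g k (idx k x)

lemma sf_meas {n : ℕ} (g : MS n) (k : ℕ) : Measurable (sf g k) :=
  (measurable_of_countable (g k)).comp (idx_measurable k)

/-- neighbour sums -/
def nbS {n : ℕ} (R : ℕ) (g : MS n) : MS n := fun k m =>
  ∑ e ∈ Finset.Icc (fun _ => -(R : ℤ)) (fun _ => (R : ℤ)), g k (m + e)

lemma le_nbS {n : ℕ} {R : ℕ} (g : MS n) {k : ℕ} {m m' : Fin n → ℤ} (h : ∀ i, |m' i - m i| ≤ (R : ℤ)) :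
    g k m' ≤ nbS R g k m := by
  unfold nbS
  have : m' = m + (m' - m) := by abel
  conv_lhs => rw [this]
  refine Finset.single_le_sum (f := fun e => g k (m + e)) (fun _ _ => zero_le) ?_
  rw [Finset.mem_Icc]
  constructor
  · intro i; exact (abs_le.1 (h i)).1
  · intro i; exact (abs_le.1 (h i)).2

lemma bS_int {n : ℕ} {P : ℝ} (hP : 0 < P) (T g : MS n) (k : ℕ) :
    ∫⁻ x, (tb P T k x * sf g k x) ^ P = bS P T g k := by
  rw [lint_cells k]
  unfold bS
  refine tsum_congr fun m => ?_
  rw [lint_cell_congr (g := fun x => tb P T k x ^ P * (g k m) ^ P),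
    lintegral_mul_const _ ((tb_meas P T k).pow_const _), tb_lint hP,
    ENNReal.mul_rpow_of_nonneg _ _ hP.le]
  intro x hx
  rw [sf, hx, ENNReal.mul_rpow_of_nonneg _ _ hP.le]

lemma bS_mono {n : ℕ} {P : ℝ} (hP : 0 < P) {T g g' : MS n} {k : ℕ} (h : ∀ m, g k m ≤ g' k m) :
    bS P T g k ≤ bS P T g' k := by
  unfold bS
  gcongr with m
  exact h m

lemma bS_const_mul {n : ℕ} {P : ℝ} (hP : 0 < P) (T g : MS n) (k : ℕ) (c : ℝ≥0∞) :
    bS P T (fun k m => c * g k m) k = c ^ P * bS P T g k := by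
  unfold bS
  rw [← ENNReal.tsum_mul_left]
  refine tsum_congr fun m => ?_
  rw [← ENNReal.mul_rpow_of_nonneg _ _ hP.le]
  congr 1; ring

lemma bS_add {n : ℕ} {P : ℝ} (hP : 0 < P) (T g g' : MS n) (k : ℕ) :
    bS P T (fun k m => g k m + g' k m) k ≤ (2 : ℝ≥0∞) ^ P * (bS P T g k + bS P T g' k) := by
  unfold bS
  rw [← ENNReal.tsum_add, ← ENNReal.tsum_mul_left]
  gcongr with m
  rw [mul_add]
  exact add_rpow_le _ _ hP

lemma bS_nb {n : ℕ} {P θ α₁ α₂ : ℝ} (hP : 0 < P) {T : MS n} (wd : WD n P θ α₁ α₂ T) (R : ℕ) :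
    ∃ C : ℝ≥0∞, C < ∞ ∧ ∀ (g : MS n) (k : ℕ), bS P T (nbS R g) k ≤ C * bS P T g k := by
  obtain ⟨C, hC, h1⟩ := wd.t1 R
  set B : Finset (Fin n → ℤ) := Finset.Icc (fun _ => -(R : ℤ)) (fun _ => (R : ℤ)) with hB
  refine ⟨(B.card : ℝ≥0∞) ^ P * (B.card * C ^ P), ?_, fun g k => ?_⟩
  · refine ENNReal.mul_lt_top (ENNReal.rpow_lt_top_of_nonneg hP.le (natCast_ne_top _)) ?_
    exact ENNReal.mul_lt_top (natCast_lt_top _) (ENNReal.rpow_lt_top_of_nonneg hP.le hC.ne)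
  have hT : ∀ m, ∀ e ∈ B, T k m ≤ C * T k (m + e) := by
    intro m e he
    rw [hB, Finset.mem_Icc] at he
    refine h1 k m (m + e) fun i => ?_
    have a := he.1 i
    have b := he.2 i
    simp only [Pi.add_apply] at *
    rw [abs_le]; constructor <;> omega
  calc bS P T (nbS R g) k ≤ ∑' m, (B.card : ℝ≥0∞) ^ P * ∑ e ∈ B, C ^ P * (T k (m + e) * g k (m + e)) ^ P := by
        unfold bS
        gcongr with m
        unfold nbS
        rw [Finset.mul_sum]
        refine (sum_rpow_le B _ hP).trans ?_
        gcongr with e he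
        rw [← ENNReal.mul_rpow_of_nonneg _ _ hP.le, ← mul_assoc]
        gcongr
        exact hT m e he
    _ = (B.card : ℝ≥0∞) ^ P * ∑ e ∈ B, C ^ P * ∑' m, (T k (m + e) * g k (m + e)) ^ P := by
        rw [ENNReal.tsum_mul_left, Summable.tsum_finsetSum (fun _ _ => ENNReal.summable)]
        simp only [ENNReal.tsum_mul_left]
    _ = _ := by
        have : ∀ e : Fin n → ℤ, ∑' m, (T k (m + e) * g k (m + e)) ^ P = bS P T g k := fun e =>
          (Equiv.addRight e).tsum_eq (fun m => (T k m * g k m) ^ P)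
        simp only [this, Finset.sum_const, nsmul_eq_mul]
        ring

lemma conv_w (ε : ℝ) (h : 0 < ε) : ∃ A : ℝ≥0∞, A < ∞ ∧
    ∀ k : ℕ, ∑' j : ℕ, tw (-(ε * |(k:ℝ) - j|)) ≤ A := by
  refine ⟨_, ENNReal.add_lt_top.2 ⟨tw_sum ε h, tw_sum ε h⟩, fun k => ?_⟩
  rw [← ENNReal.summable.sum_add_tsum_nat_add' (k := k)]
  refine add_le_add ?_ ?_
  · rw [← Finset.sum_range_reflect]
    refine le_trans (Finset.sum_le_sum fun j hj => ?_) (ENNReal.sum_le_tsum (Finset.range k))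
    refine tw_mono ?_
    rw [Finset.mem_range] at hj
    have : ((k - 1 - j : ℕ) : ℝ) = (k:ℝ) - 1 - j := by
      rw [Nat.cast_sub (by omega), Nat.cast_sub (by omega)]; simp
    rw [this]
    have h2 : |(k:ℝ) - ((k:ℝ) - 1 - j)| = 1 + j := by
      rw [abs_of_nonneg] <;> ring_nf
      positivity
    rw [h2]
    nlinarith
  · refine le_of_eq (tsum_congr fun j => ?_)
    congr 3
    push_cast
    rw [← sub_sub, sub_right_comm, sub_self, zero_sub, abs_neg, Nat.abs_cast]

/-- discrete convolution bound -/
lemma conv_sum (ε s : ℝ) (h : 0 < ε) (hs : 0 < s) : ∃ A : ℝ≥0∞, A < ∞ ∧ ∀ b : ℕ → ℝ≥0∞,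
    ∑' k : ℕ, (∑' j : ℕ, tw (-(ε * |(k:ℝ) - j|)) * b j) ^ s ≤ A * ∑' j, b j ^ s := by
  obtain ⟨A, hA, hA1⟩ := conv_w (ε / 2) (by positivity)
  obtain ⟨A', hA', hA2⟩ := conv_w (ε / 2 * s) (by positivity)
  refine ⟨A ^ s * A', ENNReal.mul_lt_top (ENNReal.rpow_lt_top_of_nonneg hs.le hA.ne) hA', fun b => ?_⟩
  calc ∑' k : ℕ, (∑' j : ℕ, tw (-(ε * |(k:ℝ) - j|)) * b j) ^ s
      ≤ ∑' k : ℕ, A ^ s * ∑' j : ℕ, tw (-(ε / 2 * s * |(j:ℝ) - k|)) * b j ^ s := by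
        gcongr with k
        have h1 : ∀ j : ℕ, tw (-(ε * |(k:ℝ) - j|)) * b j =
            tw (-(ε / 2 * |(k:ℝ) - j|)) * (tw (-(ε / 2 * |(k:ℝ) - j|)) * b j) := by
          intro j
          rw [← mul_assoc, ← tw_add]; congr 2; ring
        simp only [h1]
        refine (geoG _ _ hs).trans ?_
        gcongr with j
        · exact hA1 k
        · rw [ENNReal.mul_rpow_of_nonneg _ _ hs.le, tw_rpow, abs_sub_comm]
          refine le_of_eq ?_
          congr 2; ring
    _ = A ^ s * ∑' j : ℕ, ∑' k : ℕ, tw (-(ε / 2 * s * |(j:ℝ) - k|)) * b j ^ s := by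
        rw [ENNReal.tsum_mul_left, ENNReal.tsum_comm]
    _ ≤ A ^ s * ∑' j : ℕ, A' * b j ^ s := by
        gcongr with j
        rw [ENNReal.tsum_mul_right]
        gcongr
        exact hA2 j
    _ = _ := by rw [ENNReal.tsum_mul_left, mul_assoc]

lemma lrS {ι : Type} [Countable ι] (w : ι → ℝ≥0∞) (r : ℝ≥0∞) (hr : r ≠ 0) (hw : ∀ i, w i ≤ 1)
    (h1 : ∑' i, w i < ∞) (h2 : ∑' i, w i ^ r.toReal < ∞ ∨ r = ∞) :
    ∃ K : ℝ≥0∞, K < ∞ ∧ ∀ {X : Type} [MeasurableSpace X] (μ : Measure X) (G : ι → X → ℝ≥0∞) (_ : ∀ i, Measurable (G i))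
      (S : ℝ≥0∞), (∀ i, eLpNorm (G i) r μ ≤ S) →
      eLpNorm (fun x => ∑' i, w i * (w i * G i x)) r μ ≤ K * S := by
  by_cases hrt : r = ∞
  · subst hrt
    refine ⟨_, h1, fun {X} _ μ G hG S hS => ?_⟩
    rw [eLpNorm_exponent_top]
    refine eLpNormEssSup_le_of_ae_enorm_bound ?_
    have : ∀ᵐ x ∂μ, ∀ i, G i x ≤ S := by
      rw [ae_all_iff]
      intro i
      have h3 := enorm_ae_le_eLpNormEssSup (G i) μ
      filter_upwards [h3] with x hx
      have h4 := hS i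
      rw [eLpNorm_exponent_top] at h4
      exact hx.trans h4
    filter_upwards [this] with x hx
    rw [← ENNReal.tsum_mul_right]
    simp only [enorm_eq_self]
    gcongr with i
    calc w i * G i x ≤ 1 * S := mul_le_mul' (hw i) (hx i)
      _ = S := one_mul S
  · have h2' := h2.resolve_right hrt
    have hR : 0 < r.toReal := ENNReal.toReal_pos hr hrt
    refine ⟨(∑' i, w i) * (∑' i, w i ^ r.toReal) ^ (1 / r.toReal),
      ENNReal.mul_lt_top h1 (ENNReal.rpow_lt_top_of_nonneg (by positivity) h2'.ne),
      fun {X} _ μ G hG S hS => ?_⟩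
    rw [eLpNorm_eq_lintegral_rpow_enorm_toReal hr hrt]
    have hS' : ∀ i, ∫⁻ x, G i x ^ r.toReal ∂μ ≤ S ^ r.toReal := by
      intro i
      have := hS i
      rw [eLpNorm_eq_lintegral_rpow_enorm_toReal hr hrt, one_div, ENNReal.rpow_inv_le_iff hR] at this
      simpa using this
    rw [one_div, ENNReal.rpow_inv_le_iff hR]
    simp only [enorm_eq_self]
    calc ∫⁻ x, (∑' i, w i * (w i * G i x)) ^ r.toReal ∂μ
        ≤ ∫⁻ x, (∑' i, w i) ^ r.toReal * ∑' i, w i ^ r.toReal * G i x ^ r.toReal ∂μ := by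
          refine lintegral_mono fun x => (geoG _ _ hR).trans_eq ?_
          simp only [ENNReal.mul_rpow_of_nonneg _ _ hR.le]
      _ = (∑' i, w i) ^ r.toReal * ∑' i, w i ^ r.toReal * ∫⁻ x, G i x ^ r.toReal ∂μ := by
          rw [lintegral_const_mul, lintegral_tsum]
          · congr 1
            refine tsum_congr fun i => ?_
            rw [lintegral_const_mul _ ((hG i).pow_const _)]
          · exact fun i => (((hG i).pow_const _).const_mul _).aemeasurable
          · exact Measurable.tsum fun i => ((hG i).pow_const _).const_mul _
      _ ≤ (∑' i, w i) ^ r.toReal * ∑' i, w i ^ r.toReal * S ^ r.toReal := by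
          gcongr with i; exact hS' i
      _ = _ := by
          rw [ENNReal.tsum_mul_right, ENNReal.mul_rpow_of_nonneg _ _ hR.le,
            ENNReal.mul_rpow_of_nonneg _ _ hR.le, ← ENNReal.rpow_mul, inv_mul_cancel₀ hR.ne',
            ENNReal.rpow_one]
          ring

/-- Nikolskii inequality for step functions -/
lemma nik {n : ℕ} {k j : ℕ} (hkj : k ≤ j) (m : Fin n → ℤ) (g : MS n) {r : ℝ≥0∞} (hr : r ≠ 0)
    {θ : ℝ} (hθ : 0 < θ) (hθr : r ≠ ∞ → θ ≤ r.toReal) :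
    eLpNorm (sf g j) r (volume.restrict (cell n k m)) ≤
      tw (-((j * n : ℕ) : ℝ) / r.toReal) *
        (tw ((j * n : ℕ)) * ∫⁻ x in cell n k m, sf g j x ^ θ) ^ (1 / θ) := by
  set I := ∫⁻ x in cell n k m, sf g j x ^ θ with hI
  set S := (tw ((j * n : ℕ)) * I) ^ (1 / θ) with hS
  have hSθ : S ^ θ = tw ((j * n : ℕ)) * I := by
    rw [hS, ← ENNReal.rpow_mul, one_div_mul_cancel hθ.ne', ENNReal.rpow_one]
  have hsup : ∀ x ∈ cell n k m, sf g j x ≤ S := by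
    intro x hx
    rw [hS, one_div, ENNReal.le_rpow_inv_iff hθ]
    have : ∫⁻ y in cell n j (idx j x), sf g j y ^ θ ≤ I := by
      refine lintegral_mono_set ?_
      have := cell_sub hkj x
      rwa [mem_cell.1 hx] at this
    rw [lint_cell_congr (g := fun _ => sf g j x ^ θ) (fun y hy => by rw [sf, hy]; rfl), lint_cell_const] at this
    calc sf g j x ^ θ = tw ((j * n : ℕ)) * (sf g j x ^ θ * tw (-((j * n : ℕ) : ℝ))) := by
          rw [mul_comm, mul_assoc, tw_neg_mul, mul_one]
      _ ≤ _ := by gcongr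
  by_cases hrt : r = ∞
  · subst hrt
    rw [eLpNorm_exponent_top]
    rw [ENNReal.toReal_top, _root_.div_zero, tw_zero, one_mul]
    refine eLpNormEssSup_le_of_ae_enorm_bound ?_
    rw [ae_restrict_iff' (cell_meas n k m)]
    exact Eventually.of_forall fun x hx => hsup x hx
  · have hR : 0 < r.toReal := ENNReal.toReal_pos hr hrt
    rw [eLpNorm_eq_lintegral_rpow_enorm_toReal hr hrt, one_div, ENNReal.rpow_inv_le_iff hR,
      ENNReal.mul_rpow_of_nonneg _ _ hR.le, tw_rpow]
    simp only [enorm_eq_self]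
    have h1 := hθr hrt
    have hsplit : ∀ y : ℝ≥0∞, y ^ r.toReal = y ^ (r.toReal - θ) * y ^ θ := by
      intro y
      rw [← ENNReal.rpow_add_of_nonneg _ _ (by linarith) hθ.le]; congr 1; ring
    calc ∫⁻ x in cell n k m, sf g j x ^ r.toReal ≤ ∫⁻ x in cell n k m, S ^ (r.toReal - θ) * sf g j x ^ θ := by
          refine lint_cell_mono fun x hx => ?_
          rw [hsplit]
          exact mul_le_mul' (ENNReal.rpow_le_rpow (hsup x hx) (by linarith)) le_rfl
      _ = S ^ (r.toReal - θ) * I := lintegral_const_mul _ ((sf_meas g j).pow_const _)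
      _ = tw (-((j * n : ℕ) : ℝ)) * S ^ r.toReal := by
          rw [hsplit S, hSθ]
          calc S ^ (r.toReal - θ) * I = (tw (-((j * n : ℕ) : ℝ)) * tw ((j * n : ℕ))) * (S ^ (r.toReal - θ) * I) := by
                rw [tw_neg_mul, one_mul]
            _ = _ := by ring
      _ = _ := by
          congr 2
          field_simp


/-- tails of the step functions -/
def HH {n : ℕ} (g : MS n) (k : ℕ) (x : Rn n) : ℝ≥0∞ := ∑' i, sf g (k + i) x

lemma HH_meas {n : ℕ} (g : MS n) (k : ℕ) : Measurable (HH g k) :=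
  Measurable.tsum fun i => sf_meas g (k + i)

def Lam {n : ℕ} (r : ℝ≥0∞) (g : MS n) : MS n := fun k m =>
  tw (((k * n : ℕ) : ℝ) / r.toReal) * eLpNorm (HH g k) r (volume.restrict (cell n k m))

lemma high {n : ℕ} {P θ α₁ α₂ : ℝ} (hP : 0 < P) (hθ : 0 < θ) {T : MS n} (wd : WD n P θ α₁ α₂ T)
    {r : ℝ≥0∞} (hr : r ≠ 0) (hθr : r ≠ ∞ → θ ≤ r.toReal)
    (hα : (n : ℝ) * (1 / θ - 1 / r.toReal) < α₁) :
    ∃ C : ℝ≥0∞, C < ∞ ∧ ∃ ε : ℝ, 0 < ε ∧ ∀ (g : MS n) (k : ℕ),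
      bS P T (Lam r g) k ≤ C * ∑' j : ℕ, tw (-(ε * |(k:ℝ) - j|)) * bS P T g j := by
  set γ := α₁ - (n : ℝ) * (1 / θ - 1 / r.toReal) with hγ
  have hγ0 : 0 < γ := by linarith
  obtain ⟨C, hC, h2⟩ := wd.t2
  obtain ⟨K, hK, hlr⟩ := lrS (fun i : ℕ => tw (-(γ / 4 * i))) r hr
    (fun i => by rw [← tw_zero]; exact tw_mono (by have : 0 ≤ γ / 4 * i := by positivity
                                                   linarith))
    (tw_sum _ (by positivity))
    (by
      by_cases hrt : r = ∞
      · exact Or.inr hrt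
      · left
        have hR : 0 < r.toReal := ENNReal.toReal_pos hr hrt
        have := tw_sum (γ / 4 * r.toReal) (by positivity)
        refine lt_of_eq_of_lt (tsum_congr fun i => ?_) this
        rw [tw_rpow]; congr 1; ring)
  refine ⟨K ^ P * C, ENNReal.mul_lt_top (ENNReal.rpow_lt_top_of_nonneg hP.le hK.ne) hC, γ * P / 2,
    by positivity, fun g k => ?_⟩
  set g' : MS n := fun j m => tw (γ / 2 * ((j:ℝ) - k)) * g j m with hg'
  have hHH : HH g k = fun x => ∑' i : ℕ, tw (-(γ / 4 * i)) * (tw (-(γ / 4 * i)) * sf g' (k + i) x) := by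
    funext x
    unfold HH
    refine tsum_congr fun i => ?_
    rw [sf, sf, hg']
    simp only []
    rw [← mul_assoc, ← mul_assoc, ← tw_add, ← tw_add]
    have : -(γ / 4 * (i:ℝ)) + -(γ / 4 * i) + γ / 2 * (((k + i : ℕ) : ℝ) - k) = 0 := by
      push_cast; ring
    rw [this, tw_zero, one_mul]
  have hm : ∀ m, (T k m * Lam r g k m) ^ P ≤ K ^ P * ∑' i : ℕ, C * (tw (-(γ * P * i)) *
      ∫⁻ x in cell n k m, (tb P T (k + i) x * sf g' (k + i) x) ^ P) := by
    intro m
    set N : ℕ → ℝ≥0∞ := fun i => eLpNorm (sf g' (k + i)) r (volume.restrict (cell n k m)) with hN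
    set S := (∑' i, N i ^ P) ^ (1 / P) with hS
    have hSP : S ^ P = ∑' i, N i ^ P := by
      rw [hS, ← ENNReal.rpow_mul, one_div_mul_cancel hP.ne', ENNReal.rpow_one]
    have h1 : eLpNorm (HH g k) r (volume.restrict (cell n k m)) ≤ K * S := by
      rw [hHH]
      refine hlr _ _ (fun i => sf_meas g' (k + i)) S fun i => ?_
      rw [hS, one_div, ENNReal.le_rpow_inv_iff hP]
      exact ENNReal.le_tsum (f := fun i => N i ^ P) i
    calc (T k m * Lam r g k m) ^ P
        ≤ (T k m * (tw (((k * n : ℕ) : ℝ) / r.toReal) * (K * S))) ^ P := by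
          unfold Lam; gcongr
      _ = K ^ P * ∑' i, T k m ^ P * (tw (((k * n : ℕ) : ℝ) / r.toReal * P) * N i ^ P) := by
          rw [ENNReal.mul_rpow_of_nonneg _ _ hP.le, ENNReal.mul_rpow_of_nonneg _ _ hP.le,
            ENNReal.mul_rpow_of_nonneg _ _ hP.le, hSP, tw_rpow, ENNReal.tsum_mul_left,
            ENNReal.tsum_mul_left]
          ring
      _ ≤ _ := by
          refine mul_le_mul' le_rfl (ENNReal.tsum_le_tsum fun i => ?_)
          have hn := nik (Nat.le_add_right k i) m g' hr hθ hθr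
          have hB := h2 k (k + i) (Nat.le_add_right k i) m (sf g' (k + i)) (sf_meas _ _)
          set I := ∫⁻ x in cell n k m, sf g' (k + i) x ^ θ with hI
          set J := ∫⁻ x in cell n k m, (tb P T (k + i) x * sf g' (k + i) x) ^ P with hJ
          have e1 : (tw (((k + i) * n : ℕ)) * I) ^ (1 / θ) =
              tw ((i:ℝ) * n / θ) * (tw ((k * n : ℕ)) * I) ^ (1 / θ) := by
            have : tw (((k + i) * n : ℕ)) = tw ((i:ℝ) * n) * tw ((k * n : ℕ)) := by
              rw [← tw_add]; congr 1; push_cast; ring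
            rw [this, mul_assoc, ENNReal.mul_rpow_of_nonneg _ _ (by positivity : 0 ≤ 1 / θ), tw_rpow]
            congr 2; ring
          rw [e1, ← mul_assoc, ← tw_add] at hn
          calc T k m ^ P * (tw (((k * n : ℕ) : ℝ) / r.toReal * P) * N i ^ P)
              ≤ T k m ^ P * (tw (((k * n : ℕ) : ℝ) / r.toReal * P) *
                 (tw (-(((k + i) * n : ℕ) : ℝ) / r.toReal + (i:ℝ) * n / θ) *
                  (tw ((k * n : ℕ)) * I) ^ (1 / θ)) ^ P) := by gcongr
            _ = tw (((k * n : ℕ) : ℝ) / r.toReal * P + (-(((k + i) * n : ℕ) : ℝ) / r.toReal + (i:ℝ) * n / θ) * P) *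
                 (T k m ^ P * (tw ((k * n : ℕ)) * I) ^ (P / θ)) := by
                rw [ENNReal.mul_rpow_of_nonneg _ _ hP.le, tw_rpow, ← ENNReal.rpow_mul, tw_add,
                  show 1 / θ * P = P / θ by ring]
                ring
            _ ≤ tw (((k * n : ℕ) : ℝ) / r.toReal * P + (-(((k + i) * n : ℕ) : ℝ) / r.toReal + (i:ℝ) * n / θ) * P) *
                 (C * (tw (-(α₁ * P * (((k + i : ℕ) : ℝ) - k))) * J)) := by gcongr
            _ = _ := by
                rw [← mul_assoc, mul_comm _ C, mul_assoc, ← mul_assoc (tw _) (tw _), ← tw_add]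
                congr 3
                rw [hγ]; push_cast; ring
  calc bS P T (Lam r g) k ≤ ∑' m, K ^ P * ∑' i : ℕ, C * (tw (-(γ * P * i)) *
      ∫⁻ x in cell n k m, (tb P T (k + i) x * sf g' (k + i) x) ^ P) := by
        unfold bS; gcongr with m; exact hm m
    _ = K ^ P * (C * ∑' i : ℕ, tw (-(γ * P * i)) * bS P T g' (k + i)) := by
        rw [ENNReal.tsum_mul_left, ENNReal.tsum_comm, ← ENNReal.tsum_mul_left (a := C)]
        congr 1
        refine tsum_congr fun i => ?_
        rw [← bS_int hP, lint_cells k, ENNReal.tsum_mul_left, ENNReal.tsum_mul_left]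
    _ = K ^ P * (C * ∑' i : ℕ, tw (-(γ * P / 2 * |(k:ℝ) - ((k + i : ℕ) : ℝ)|)) * bS P T g (k + i)) := by
        congr 3
        funext i
        have : bS P T g' (k + i) = tw (γ / 2 * i) ^ P * bS P T g (k + i) := by
          rw [← bS_const_mul hP]
          unfold bS
          refine tsum_congr fun m => ?_
          rw [hg']; simp only []
          congr 4
          push_cast; ring
        rw [this, tw_rpow, ← mul_assoc, ← tw_add]
        congr 2
        have : |(k:ℝ) - ((k + i : ℕ) : ℝ)| = i := by
          push_cast
          rw [← sub_sub, sub_self, zero_sub, abs_neg, Nat.abs_cast]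
        rw [this]; ring
    _ ≤ _ := by
        rw [mul_assoc]
        refine mul_le_mul' le_rfl (mul_le_mul' le_rfl ?_)
        exact ENNReal.tsum_comp_le_tsum_of_injective (add_right_injective k)
          (fun j : ℕ => tw (-(γ * P / 2 * |(k:ℝ) - j|)) * bS P T g j)

def rep {n : ℕ} (k : ℕ) (m : Fin n → ℤ) : Rn n := fun i => (m i : ℝ) / 2 ^ k

lemma idx_rep {n : ℕ} (k : ℕ) (m : Fin n → ℤ) : idx k (rep k m) = m := by
  funext i
  unfold idx rep
  rw [mul_div_cancel₀ _ (by positivity)]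
  exact Int.floor_intCast _

def Lo {n : ℕ} (D : ℕ) (g : MS n) : MS n := fun k m =>
  ∑ j ∈ Finset.range k, tw (-((D:ℝ) * ((k:ℝ) - j))) * sf g j (rep k m)

lemma sf_Lo {n : ℕ} (D : ℕ) (g : MS n) (k : ℕ) (x : Rn n) :
    sf (Lo D g) k x = ∑ j ∈ Finset.range k, tw (-((D:ℝ) * ((k:ℝ) - j))) * sf g j x := by
  rw [sf]
  unfold Lo
  refine Finset.sum_congr rfl fun j hj => ?_
  rw [Finset.mem_range] at hj
  rw [sf, sf, idx_coarse hj.le (idx_rep k (idx k x))]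

lemma t3_int {n : ℕ} {P θ α₁ α₂ : ℝ} (hP : 0 < P) {T : MS n} (wd : WD n P θ α₁ α₂ T) :
    ∃ C : ℝ≥0∞, C < ∞ ∧ ∀ (g : MS n) (j k : ℕ), j ≤ k →
      ∫⁻ x, (tb P T k x * sf g j x) ^ P ≤ C * (tw (α₂ * P * ((k:ℝ) - j)) * bS P T g j) := by
  obtain ⟨C, hC, h3⟩ := wd.t3
  refine ⟨C, hC, fun g j k hjk => ?_⟩
  rw [lint_cells j]
  unfold bS
  rw [← ENNReal.tsum_mul_left, ← ENNReal.tsum_mul_left]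
  gcongr with m
  rw [lint_cell_congr (g := fun x => tb P T k x ^ P * (g j m) ^ P),
    lintegral_mul_const _ ((tb_meas P T k).pow_const _), ENNReal.mul_rpow_of_nonneg _ _ hP.le]
  · calc (∫⁻ x in cell n j m, tb P T k x ^ P) * g j m ^ P
        ≤ (C * (tw (α₂ * P * ((k : ℝ) - j)) * T j m ^ P)) * g j m ^ P := by gcongr; exact h3 j k hjk m
      _ = _ := by ring
  · intro x hx
    rw [sf, hx, ENNReal.mul_rpow_of_nonneg _ _ hP.le]

lemma low {n : ℕ} {P θ α₁ α₂ : ℝ} (hP : 0 < P) {T : MS n} (wd : WD n P θ α₁ α₂ T) {D : ℕ} (hD : α₂ < D) :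
    ∃ C : ℝ≥0∞, C < ∞ ∧ ∃ ε : ℝ, 0 < ε ∧ ∀ (g : MS n) (k : ℕ),
      bS P T (Lo D g) k ≤ C * ∑' j : ℕ, tw (-(ε * |(k:ℝ) - j|)) * bS P T g j := by
  obtain ⟨C, hC, h3⟩ := t3_int hP wd
  set γ := ((D:ℝ) - α₂) / 2 with hγ
  have hγ0 : 0 < γ := by rw [hγ]; linarith
  obtain ⟨A, hA, hA1⟩ := conv_w γ hγ0
  refine ⟨A ^ P * C, ENNReal.mul_lt_top (ENNReal.rpow_lt_top_of_nonneg hP.le hA.ne) hC, γ * P, by positivity,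
    fun g k => ?_⟩
  rw [← bS_int hP]
  set b : ℕ → ℝ → ℝ≥0∞ := fun j c => if j < k then tw c else 0 with hb
  calc ∫⁻ x, (tb P T k x * sf (Lo D g) k x) ^ P
      ≤ ∫⁻ x, A ^ P * ∑ j ∈ Finset.range k, tw (-(((D:ℝ) - γ) * P * ((k:ℝ) - j))) * (tb P T k x * sf g j x) ^ P := by
        refine lintegral_mono fun x => ?_
        dsimp only
        rw [sf_Lo]
        have e : tb P T k x * ∑ j ∈ Finset.range k, tw (-((D:ℝ) * ((k:ℝ) - j))) * sf g j x =
            ∑' j : Finset.range k, tw (-(γ * ((k:ℝ) - j))) * (tw (-(γ * ((k:ℝ) - j))) *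
              (tw (-(((D:ℝ) - 2 * γ) * ((k:ℝ) - j))) * (tb P T k x * sf g j x))) := by
          rw [Finset.tsum_subtype (Finset.range k) (fun j : ℕ => tw (-(γ * ((k:ℝ) - j))) * (tw (-(γ * ((k:ℝ) - j))) *
              (tw (-(((D:ℝ) - 2 * γ) * ((k:ℝ) - j))) * (tb P T k x * sf g j x)))), Finset.mul_sum]
          refine Finset.sum_congr rfl fun j _ => ?_
          rw [← mul_assoc, ← mul_assoc, ← mul_assoc, ← mul_assoc, ← tw_add, ← tw_add,
            mul_comm (tb P T k x)]
          congr 3; ring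
        rw [e]
        refine (geoG _ _ hP).trans ?_
        rw [Finset.tsum_subtype (Finset.range k) (fun j : ℕ => (tw (-(γ * ((k:ℝ) - j))) *
              (tw (-(((D:ℝ) - 2 * γ) * ((k:ℝ) - j))) * (tb P T k x * sf g j x))) ^ P)]
        gcongr with j hj
        · refine le_trans ?_ (hA1 k)
          rw [Finset.tsum_subtype (Finset.range k) (fun j : ℕ => tw (-(γ * ((k:ℝ) - j))))]
          refine le_trans (Finset.sum_le_sum fun j hj => ?_) (ENNReal.sum_le_tsum (Finset.range k))
          rw [Finset.mem_range] at hj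
          have : (j:ℝ) < k := by exact_mod_cast hj
          rw [abs_of_pos (by linarith)]
        · rw [← mul_assoc, ← tw_add, ENNReal.mul_rpow_of_nonneg _ _ hP.le, tw_rpow]
          refine le_of_eq ?_
          congr 2; ring
    _ = A ^ P * ∑ j ∈ Finset.range k, tw (-(((D:ℝ) - γ) * P * ((k:ℝ) - j))) * ∫⁻ x, (tb P T k x * sf g j x) ^ P := by
        have hmm : ∀ j, Measurable fun x => (tb P T k x * sf g j x) ^ P := fun j =>
          ((tb_meas P T k).mul (sf_meas g j)).pow_const _
        rw [lintegral_const_mul, lintegral_finsetSum]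
        · congr 1
          refine Finset.sum_congr rfl fun j _ => ?_
          rw [lintegral_const_mul _ (hmm j)]
        · exact fun j _ => (hmm j).const_mul _
        · exact Finset.measurable_sum _ fun j _ => (hmm j).const_mul _
    _ ≤ A ^ P * ∑ j ∈ Finset.range k, C * (tw (-(γ * P * |(k:ℝ) - j|)) * bS P T g j) := by
        refine mul_le_mul' le_rfl (Finset.sum_le_sum fun j hj => ?_)
        rw [Finset.mem_range] at hj
        have hj' : (j:ℝ) < k := by exact_mod_cast hj
        calc _ ≤ tw (-(((D:ℝ) - γ) * P * ((k:ℝ) - j))) * (C * (tw (α₂ * P * ((k:ℝ) - j)) * bS P T g j)) := by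
              gcongr; exact h3 g j k hj.le
          _ = _ := by
              rw [← mul_assoc, mul_comm _ C, mul_assoc, ← mul_assoc (tw _) (tw _), ← tw_add,
                abs_of_pos (by linarith)]
              congr 3
              rw [hγ]; ring
    _ ≤ _ := by
        rw [← Finset.mul_sum, mul_assoc]
        gcongr
        exact ENNReal.sum_le_tsum (Finset.range k)


def gE {n : ℕ} (g : ℕ → (Fin n → ℤ) → ℝ≥0) : MS n := fun k m => (g k m : ℝ≥0∞)

/-- multiscale pieces with controlled differences -/
def Dec {n : ℕ} (s : ℕ) (v : ℕ → Rn n → ℝ) (g : ℕ → (Fin n → ℤ) → ℝ≥0) : Prop :=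
  ∀ (k : ℕ) (y h : Rn n), 2 ^ k * ‖h‖ ≤ 2 →
    SB s (2 ^ k * ‖h‖) (g k (idx k y) : ℝ) (fun b : ℕ => v k (y + (b : ℝ) • h))

lemma Dec.le {n s : ℕ} {v : ℕ → Rn n → ℝ} {g : ℕ → (Fin n → ℤ) → ℝ≥0} (h : Dec s v g) (k : ℕ) (x : Rn n) :
    ‖v k x‖ₑ ≤ sf (gE g) k x := by
  have := h k x 0 (by simp) 0 0 (by simp)
  simp at this
  rw [sf, gE, ← ofReal_norm, Real.norm_eq_abs]
  rw [← ENNReal.ofReal_coe_nnreal]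
  exact ENNReal.ofReal_le_ofReal this

lemma openCube_eq {n : ℕ} (x : Rn n) (s : ℝ) :
    openCube x s = Set.pi Set.univ (fun i => Set.Ioo (x i - s) (x i + s)) := by
  ext y
  simp only [openCube, Set.mem_ofPred_eq, Set.mem_pi, Set.mem_univ, true_imp_iff, Set.mem_Ioo, abs_lt]
  refine forall_congr' fun i => ?_
  constructor <;> rintro ⟨a, b⟩ <;> constructor <;> linarith

lemma openCube_meas {n : ℕ} (x : Rn n) (s : ℝ) : MeasurableSet (openCube x s) := by
  rw [openCube_eq]
  exact MeasurableSet.univ_pi fun i => measurableSet_Ioo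

lemma openCube_vol {n : ℕ} (x : Rn n) (s : ℝ) : volume (openCube x s) = ENNReal.ofReal (2 * s) ^ n := by
  rw [openCube_eq, Real.volume_pi_Ioo]
  have : ∀ i, x i + s - (x i - s) = 2 * s := fun i => by ring
  simp [this]

lemma map_le {n : ℕ} {A B B' : Set (Rn n)} (hA : MeasurableSet A) (c : ℝ) (h : ∀ a ∈ A, ∀ y ∈ B, y + c • a ∈ B') :
    Measure.map (fun z : Rn n × Rn n => z.2 + c • z.1)
      ((volume.restrict A).prod (volume.restrict B)) ≤ volume A • volume.restrict B' := by
  have hmeas : Measurable (fun z : Rn n × Rn n => z.2 + c • z.1) := by fun_prop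
  rw [Measure.le_iff]
  intro s hs
  rw [Measure.map_apply hmeas hs, Measure.prod_apply (hmeas hs)]
  simp only [Measure.smul_apply, smul_eq_mul]
  rw [Measure.restrict_apply hs, mul_comm, ← setLIntegral_const]
  refine setLIntegral_mono' hA fun a ha => ?_
  rw [Measure.restrict_apply ((hmeas hs).preimage (by fun_prop))]
  rw [← measure_preimage_add_right volume (c • a) (s ∩ B')]
  refine measure_mono ?_
  rintro y ⟨hy1, hy2⟩
  exact ⟨hy1, h a ha y hy2⟩

lemma lint_fin_union_le {X ι : Type} [MeasurableSpace X] (μ : Measure X) (S : Finset ι) (A : ι → Set X)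
    (F : X → ℝ≥0∞) : ∫⁻ x in ⋃ e ∈ S, A e, F x ∂μ ≤ ∑ e ∈ S, ∫⁻ x in A e, F x ∂μ := by
  induction S using Finset.induction_on with
  | empty => simp
  | insert a S ha ih =>
    rw [Finset.set_biUnion_insert, Finset.sum_insert ha]
    exact (lintegral_union_le _ _ _).trans (by gcongr)

lemma eLp_union {X ι : Type} [MeasurableSpace X] (μ : Measure X) (S : Finset ι) (A : ι → Set X) {r : ℝ≥0∞}
    (hr : r ≠ 0) (F : X → ℝ≥0∞) :
    eLpNorm F r (μ.restrict (⋃ e ∈ S, A e)) ≤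
      (S.card : ℝ≥0∞) ^ (1 / r.toReal) * ∑ e ∈ S, eLpNorm F r (μ.restrict (A e)) := by
  by_cases hrt : r = ∞
  · subst hrt
    rw [ENNReal.toReal_top, _root_.div_zero, ENNReal.rpow_zero, one_mul]
    simp only [eLpNorm_exponent_top]
    refine eLpNormEssSup_le_of_ae_enorm_bound ?_
    rw [ae_restrict_biUnion_finset_iff]
    intro i hi
    filter_upwards [enorm_ae_le_eLpNormEssSup F (μ.restrict (A i))] with x hx
    exact hx.trans (Finset.single_le_sum (f := fun e => eLpNormEssSup F (μ.restrict (A e))) (fun _ _ => zero_le) hi)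
  · have hR : 0 < r.toReal := ENNReal.toReal_pos hr hrt
    rw [eLpNorm_eq_lintegral_rpow_enorm_toReal hr hrt, one_div, ENNReal.rpow_inv_le_iff hR,
      ENNReal.mul_rpow_of_nonneg _ _ hR.le, ← ENNReal.rpow_mul, inv_mul_cancel₀ hR.ne', ENNReal.rpow_one]
    calc ∫⁻ x in ⋃ e ∈ S, A e, ‖F x‖ₑ ^ r.toReal ∂μ ≤ ∑ e ∈ S, ∫⁻ x in A e, ‖F x‖ₑ ^ r.toReal ∂μ :=
          lint_fin_union_le μ S A _
      _ ≤ ∑ e ∈ S, (∑ e ∈ S, eLpNorm F r (μ.restrict (A e))) ^ r.toReal := by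
          refine Finset.sum_le_sum fun e he => ?_
          have : ∫⁻ x in A e, ‖F x‖ₑ ^ r.toReal ∂μ = (eLpNorm F r (μ.restrict (A e))) ^ r.toReal := by
            rw [eLpNorm_eq_lintegral_rpow_enorm_toReal hr hrt, ← ENNReal.rpow_mul, one_div, inv_mul_cancel₀ hR.ne',
              ENNReal.rpow_one]
          rw [this]
          gcongr
          exact Finset.single_le_sum (f := fun e => eLpNorm F r (μ.restrict (A e))) (fun _ _ => zero_le) he
      _ = _ := by rw [Finset.sum_const, nsmul_eq_mul]

/-- quasi-triangle inequality for finitely many functions -/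
lemma eLp_sum (N : ℕ) {r : ℝ≥0∞} (hr : r ≠ 0) : ∃ K : ℝ≥0∞, K < ∞ ∧
    ∀ {X : Type} [MeasurableSpace X] (μ : Measure X) (G : ℕ → X → ℝ≥0∞), (∀ i, Measurable (G i)) →
      eLpNorm (fun x => ∑ i ∈ Finset.range N, G i x) r μ ≤ K * ∑ i ∈ Finset.range N, eLpNorm (G i) r μ := by
  obtain ⟨K, hK, h⟩ := lrS (fun _ : Fin N => (1 : ℝ≥0∞)) r hr (fun _ => le_rfl) (by simp) (by left; simp)
  refine ⟨K, hK, fun {X} _ μ G hG => ?_⟩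
  have := h μ (fun i => G i) (fun i => hG i) (∑ i ∈ Finset.range N, eLpNorm (G i) r μ) (fun i =>
    Finset.single_le_sum (f := fun i => eLpNorm (G i) r μ) (fun _ _ => zero_le) (Finset.mem_range.2 i.2))
  simp only [one_mul, tsum_fintype] at this
  have e : ∀ x, ∑ i : Fin N, G i x = ∑ i ∈ Finset.range N, G i x := fun x =>
    Fin.sum_univ_eq_sum_range (fun i => G i x) N
  simpa only [e] using this

lemma cube_cover {n k R : ℕ} (x : Rn n) : openCube x ((R:ℝ) * (2 ^ k)⁻¹) ⊆
    ⋃ e ∈ (Finset.Icc (fun _ => -(R : ℤ)) (fun _ => (R : ℤ)) : Finset (Fin n → ℤ)), cell n k (idx k x + e) := by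
  intro y hy
  have h1 := idx_near_lt (k := k) (x := y) (y := x) (R := R) (fun i => by
    have := hy i
    calc 2 ^ k * |y i - x i| < 2 ^ k * ((R:ℝ) * (2 ^ k)⁻¹) := by gcongr
      _ = R := by field_simp)
  simp only [Set.mem_iUnion]
  refine ⟨idx k y - idx k x, ?_, ?_⟩
  · rw [Finset.mem_Icc]
    exact ⟨fun i => (abs_le.1 (h1 i)).1, fun i => (abs_le.1 (h1 i)).2⟩
  · rw [mem_cell]; abel

lemma HH_cube {n : ℕ} (R : ℕ) {r : ℝ≥0∞} (hr : r ≠ 0) : ∃ K : ℝ≥0∞, K < ∞ ∧ ∀ (g : MS n) (k : ℕ) (x : Rn n),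
    tw (((k * n : ℕ) : ℝ) / r.toReal) * eLpNorm (HH g k) r (volume.restrict (openCube x ((R:ℝ) * (2 ^ k)⁻¹))) ≤
      K * nbS R (Lam r g) k (idx k x) := by
  refine ⟨_, ENNReal.rpow_lt_top_of_nonneg (y := 1 / r.toReal) (by positivity)
    (natCast_ne_top (Finset.Icc (fun _ => -(R : ℤ)) (fun _ => (R : ℤ)) : Finset (Fin n → ℤ)).card), fun g k x => ?_⟩
  calc _ ≤ tw (((k * n : ℕ) : ℝ) / r.toReal) * _ :=
        mul_le_mul' le_rfl ((eLpNorm_mono_measure _ (Measure.restrict_mono_set _ (cube_cover x))).trans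
          (eLp_union _ _ _ hr _))
    _ = _ := by
        unfold nbS Lam
        rw [Finset.mul_sum, Finset.mul_sum, Finset.mul_sum]
        refine Finset.sum_congr rfl fun e _ => ?_
        ring

lemma diffl_enorm {n : ℕ} (D : ℕ) (h : Rn n) (u : Rn n → ℝ) (y : Rn n) :
    ‖diffl D h u y‖ₑ ≤ ∑ i ∈ Finset.range (D + 1), (2 : ℝ≥0∞) ^ D * ‖u (y + (i : ℝ) • h)‖ₑ := by
  unfold diffl
  refine (enorm_sum_le _ _).trans (Finset.sum_le_sum fun i hi => ?_)
  rw [enorm_mul]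
  gcongr
  have : (2 : ℝ≥0∞) ^ D = ENNReal.ofReal (2 ^ D) := by
    rw [ENNReal.ofReal_pow (by norm_num)]; norm_num
  rw [this, ← ofReal_norm]
  refine ENNReal.ofReal_le_ofReal ?_
  rw [norm_mul, norm_pow, norm_neg, norm_one, one_pow, mul_one, Real.norm_natCast]
  exact_mod_cast Nat.choose_le_two_pow D i

lemma diffl_sum_fn {n : ℕ} (D : ℕ) (h : Rn n) {ι : Type} (S : Finset ι) (u : ι → Rn n → ℝ) (y : Rn n) :
    diffl D h (fun z => ∑ j ∈ S, u j z) y = ∑ j ∈ S, diffl D h (u j) y := by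
  unfold diffl
  rw [Finset.sum_comm]
  simp only [Finset.mul_sum]

lemma diffl_add_fn {n : ℕ} (D : ℕ) (h : Rn n) (u w : Rn n → ℝ) (y : Rn n) :
    diffl D h (fun z => u z + w z) y = diffl D h u y + diffl D h w y := by
  unfold diffl
  rw [← Finset.sum_add_distrib]
  simp only [mul_add]

lemma Dec_low {n D : ℕ} {v : ℕ → Rn n → ℝ} {g : ℕ → (Fin n → ℤ) → ℝ≥0} (hd : Dec D v g) (k : ℕ) (x y h : Rn n)
    (hh : h ∈ openCube (0 : Rn n) (2 * (2 ^ k)⁻¹)) (hy : y ∈ openCube x ((2 ^ k)⁻¹)) :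
    ‖diffl D h (fun z => ∑ j ∈ Finset.range k, v j z) y‖ₑ ≤
      (2 : ℝ≥0∞) ^ D * Lo D (nbS 1 (gE g)) k (idx k x) := by
  have hn : ‖h‖ ≤ 2 * (2 ^ k)⁻¹ := by
    rw [pi_norm_le_iff_of_nonneg (by positivity)]
    intro i
    have := hh i
    simp only [Pi.zero_apply, sub_zero] at this
    exact this.le
  rw [diffl_sum_fn]
  have : Lo D (nbS 1 (gE g)) k (idx k x) = sf (Lo D (nbS 1 (gE g))) k x := rfl
  rw [this, sf_Lo, Finset.mul_sum]
  refine (enorm_sum_le _ _).trans (Finset.sum_le_sum fun j hj => ?_)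
  rw [Finset.mem_range] at hj
  have hjk : (2:ℝ) ^ j * ‖h‖ ≤ 2 ^ (j + 1) * (2 ^ k)⁻¹ := by
    calc (2:ℝ) ^ j * ‖h‖ ≤ 2 ^ j * (2 * (2 ^ k)⁻¹) := by gcongr
      _ = _ := by ring
  have hj1 : (2:ℝ) ^ (j + 1) * (2 ^ k)⁻¹ ≤ 1 := by
    rw [mul_inv_le_iff₀ (by positivity), one_mul]
    exact pow_le_pow_right₀ (by norm_num) (by omega)
  have h1 := hd j y h (by linarith) D 0 (by simp)
  rw [← diffl_eq_fwd] at h1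
  have h2 : |diffl D h (v j) y| ≤ (g j (idx j y) : ℝ) * (2 ^ (j + 1) * (2 ^ k)⁻¹) ^ D := by
    refine h1.trans ?_
    gcongr
  have h3 : gE g j (idx j y) ≤ sf (nbS 1 (gE g)) j x := by
    refine le_nbS _ ?_
    have := idx_near_lt (k := j) (x := y) (y := x) (R := 1) (fun i => by
      have := hy i
      calc (2:ℝ) ^ j * |y i - x i| < 2 ^ j * (2 ^ k)⁻¹ := by gcongr
        _ ≤ 2 ^ (j + 1) * (2 ^ k)⁻¹ := by gcongr <;> simp
        _ ≤ 1 := hj1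
        _ = ((1:ℕ) : ℝ) := by simp)
    exact this
  have h4 : ENNReal.ofReal ((2 ^ (j + 1) * (2 ^ k)⁻¹) ^ D) = (2 : ℝ≥0∞) ^ D * tw (-((D:ℝ) * ((k:ℝ) - j))) := by
    rw [tw_nat, ← tw_add, ENNReal.ofReal_pow (by positivity), ENNReal.ofReal_mul (by positivity),
      ENNReal.ofReal_inv_of_pos (by positivity), ENNReal.ofReal_pow (by norm_num), ENNReal.ofReal_pow (by norm_num)]
    have : ENNReal.ofReal 2 = 2 := by norm_num
    rw [this, tw_nat, tw_nat, tw_inv, ← tw_add, ← ENNReal.rpow_natCast, tw_rpow]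
    congr 1; push_cast; ring
  rw [← ofReal_norm, Real.norm_eq_abs]
  calc ENNReal.ofReal |diffl D h (v j) y| ≤ ENNReal.ofReal ((g j (idx j y) : ℝ) * (2 ^ (j + 1) * (2 ^ k)⁻¹) ^ D) :=
        ENNReal.ofReal_le_ofReal h2
    _ = gE g j (idx j y) * ((2 : ℝ≥0∞) ^ D * tw (-((D:ℝ) * ((k:ℝ) - j)))) := by
        rw [ENNReal.ofReal_mul (by positivity), h4, gE, ENNReal.ofReal_coe_nnreal]
    _ ≤ sf (nbS 1 (gE g)) j x * ((2 : ℝ≥0∞) ^ D * tw (-((D:ℝ) * ((k:ℝ) - j)))) := by gcongr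
    _ = _ := by ring

lemma tail_le {n s : ℕ} {v : ℕ → Rn n → ℝ} {g : ℕ → (Fin n → ℤ) → ℝ≥0} (hd : Dec s v g) {f : Rn n → ℝ} {z : Rn n}
    (hz : HasSum (fun k => v k z) (f z)) (k : ℕ) :
    ‖f z - ∑ j ∈ Finset.range k, v j z‖ₑ ≤ HH (gE g) k z := by
  have h1 := (hasSum_nat_add_iff' k).2 hz
  rw [← h1.tsum_eq]
  refine (enorm_tsum_le_tsum_enorm).trans ?_
  unfold HH
  refine ENNReal.tsum_le_tsum fun i => ?_
  rw [add_comm k i]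
  exact hd.le _ _


lemma ofReal_tw (a k : ℕ) : ENNReal.ofReal (2 ^ a * (2 ^ k)⁻¹) = tw ((a:ℝ) - k) := by
  rw [ENNReal.ofReal_mul (by positivity),
      ENNReal.ofReal_inv_of_pos (by positivity), ENNReal.ofReal_pow (by norm_num), ENNReal.ofReal_pow (by norm_num)]
  have : ENNReal.ofReal 2 = 2 := by norm_num
  rw [this, tw_nat, tw_nat, tw_inv, ← tw_add, sub_eq_add_neg]

lemma delta_bound (n D : ℕ) {r : ℝ≥0∞} (hr : r ≠ 0) : ∃ C : ℝ≥0∞, C < ∞ ∧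
    ∀ (f : Rn n → ℝ) (v : ℕ → Rn n → ℝ) (g : ℕ → (Fin n → ℤ) → ℝ≥0), Dec D v g →
      (∀ᵐ x, HasSum (fun k => v k x) (f x)) → ∀ (k : ℕ) (x : Rn n),
      deltaE n D r (2 * (2 ^ k)⁻¹) (openCube x ((2 ^ k)⁻¹)) f ≤
        C * (Lo D (nbS 1 (gE g)) k (idx k x) + nbS (2 * D + 1) (Lam r (gE g)) k (idx k x)) := by
  obtain ⟨K, hK, hsum⟩ := eLp_sum (D + 2) hr
  obtain ⟨K', hK', hHH⟩ := HH_cube (n := n) (2 * D + 1) hr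
  set a : ℝ := (n : ℝ) / r.toReal with ha
  refine ⟨(2:ℝ≥0∞) ^ D * K * (tw a + (D + 1 : ℕ) * K'), ?_, fun f v g hd hf k x => ?_⟩
  · refine ENNReal.mul_lt_top (ENNReal.mul_lt_top (by simp) hK) (ENNReal.add_lt_top.2 ⟨tw_lt_top _, ?_⟩)
    exact ENNReal.mul_lt_top (natCast_lt_top _) hK'
  set A := openCube (0 : Rn n) (2 * (2 ^ k)⁻¹) with hA
  set B := openCube x ((2 ^ k)⁻¹) with hB
  set B' := openCube x (((2 * D + 1 : ℕ):ℝ) * (2 ^ k)⁻¹) with hB'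
  set μ := (volume.restrict A).prod (volume.restrict B) with hμ
  set c₀ := Lo D (nbS 1 (gE g)) k (idx k x) with hc₀
  have vA : volume A = tw ((2 - (k:ℝ)) * n) := by
    rw [hA, openCube_vol, show (2:ℝ) * (2 * (2 ^ k)⁻¹) = 2 ^ 2 * (2 ^ k)⁻¹ by ring, ofReal_tw,
      ← ENNReal.rpow_natCast, tw_rpow]
    norm_num
  have vB : volume B = tw ((1 - (k:ℝ)) * n) := by
    rw [hB, openCube_vol, show (2:ℝ) * ((2 ^ k)⁻¹) = 2 ^ 1 * (2 ^ k)⁻¹ by ring, ofReal_tw,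
      ← ENNReal.rpow_natCast, tw_rpow]
    norm_num
  have hmap : ∀ i : ℕ, i < D + 1 → Measure.map (fun z : Rn n × Rn n => z.2 + (i:ℝ) • z.1) μ ≤
      volume A • volume.restrict B' := by
    intro i hi
    refine map_le (openCube_meas _ _) _ fun h hh y hy j => ?_
    have h1 := hh j
    have h2 := hy j
    simp only [Pi.zero_apply, sub_zero] at h1
    have hi' : (i:ℝ) ≤ D := by exact_mod_cast Nat.lt_succ_iff.1 hi
    calc |(y + (i:ℝ) • h) j - x j| = |(y j - x j) + i * h j| := by
          simp only [Pi.add_apply, Pi.smul_apply, smul_eq_mul]; ring_nf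
      _ ≤ |y j - x j| + i * |h j| := by
          refine (abs_add_le _ _).trans ?_
          rw [abs_mul, Nat.abs_cast]
      _ ≤ |y j - x j| + D * (2 * (2 ^ k)⁻¹) := by gcongr
      _ < (2 ^ k)⁻¹ + D * (2 * (2 ^ k)⁻¹) := by gcongr
      _ = _ := by push_cast; ring
  have hmeasΦ : ∀ i : ℕ, Measurable (fun z : Rn n × Rn n => z.2 + (i:ℝ) • z.1) := fun i => by fun_prop
  have hae : ∀ᵐ z ∂μ, ∀ i : ℕ, i < D + 1 → HasSum (fun k => v k (z.2 + (i:ℝ) • z.1)) (f (z.2 + (i:ℝ) • z.1)) := by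
    rw [ae_all_iff]
    intro i
    by_cases hi : i < D + 1
    · have h1 : ∀ᵐ x ∂(Measure.map (fun z : Rn n × Rn n => z.2 + (i:ℝ) • z.1) μ),
          HasSum (fun k => v k x) (f x) := by
        have hac : Measure.map (fun z : Rn n × Rn n => z.2 + (i:ℝ) • z.1) μ ≪ volume :=
          (Measure.absolutelyContinuous_of_le (hmap i hi)).trans
            ((Measure.smul_absolutelyContinuous).trans Measure.restrict_le_self.absolutelyContinuous)
        exact hac hf
      filter_upwards [ae_of_ae_map (hmeasΦ i).aemeasurable h1] with z hz _
      exact hz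
    · exact Eventually.of_forall fun z h => absurd h hi
  have hAB : ∀ᵐ z ∂μ, z.1 ∈ A ∧ z.2 ∈ B := by
    have : μ = (volume.prod volume).restrict (A ×ˢ B) := by rw [hμ, Measure.prod_restrict]
    rw [this]
    exact (ae_restrict_iff' ((openCube_meas _ _).prod (openCube_meas _ _))).2
      (Eventually.of_forall fun z hz => hz)
  set G : ℕ → Rn n × Rn n → ℝ≥0∞ := fun i z =>
    if i = D + 1 then c₀ else HH (gE g) k (z.2 + (i:ℝ) • z.1) with hG
  have hGm : ∀ i, Measurable (G i) := by
    intro i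
    simp only [hG]
    split_ifs
    · exact measurable_const
    · exact (HH_meas _ k).comp (hmeasΦ i)
  have hpt : ∀ᵐ z ∂μ, ‖diffl D z.1 f z.2‖ₑ ≤ ((2:ℝ≥0) ^ D : ℝ≥0) * ‖∑ i ∈ Finset.range (D + 2), G i z‖ₑ := by
    filter_upwards [hae, hAB] with z hz hz2
    have e1 : f = fun x => (∑ j ∈ Finset.range k, v j x) + (f x - ∑ j ∈ Finset.range k, v j x) := by
      funext x; ring
    rw [e1, diffl_add_fn, enorm_eq_self]
    refine (enorm_add_le _ _).trans ?_
    rw [Finset.sum_range_succ, mul_add, add_comm]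
    refine add_le_add ?_ ?_
    · refine (diffl_enorm _ _ _ _).trans ?_
      rw [Finset.mul_sum]
      refine Finset.sum_le_sum fun i hi => ?_
      rw [Finset.mem_range] at hi
      simp only [hG, if_neg hi.ne]
      push_cast
      gcongr
      exact tail_le hd (hz i hi) k
    · simp only [hG, if_true]
      push_cast
      exact Dec_low hd k x z.2 z.1 hz2.1 hz2.2
  have hHi : ∀ i, i < D + 1 → eLpNorm (G i) r μ ≤
      tw ((2 - (k:ℝ)) * a) * eLpNorm (HH (gE g) k) r (volume.restrict B') := by
    intro i hi
    have e : G i = (HH (gE g) k) ∘ (fun z : Rn n × Rn n => z.2 + (i:ℝ) • z.1) := by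
      funext z
      simp only [hG, if_neg hi.ne, Function.comp]
    rw [e, ← eLpNorm_map_measure (HH_meas _ k).aestronglyMeasurable (hmeasΦ i).aemeasurable]
    refine (eLpNorm_mono_measure _ (hmap i hi)).trans ?_
    rw [eLpNorm_smul_measure_of_ne_zero (by rw [vA]; exact tw_ne_zero _), vA, tw_rpow, smul_eq_mul]
    refine le_of_eq ?_
    congr 2
    rw [ha, one_div, ENNReal.toReal_inv]; ring
  have hH0 : eLpNorm (G (D + 1)) r μ ≤ c₀ * tw ((3 - 2 * (k:ℝ)) * a) := by
    have e : G (D + 1) = fun _ => c₀ := by funext z; simp [hG]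
    rw [e]
    refine (eLpNorm_le_of_ae_enorm_bound (C := c₀) (Eventually.of_forall fun z => le_rfl)).trans ?_
    rw [smul_eq_mul]
    refine le_of_eq ?_
    congr 1
    have : μ Set.univ = volume A * volume B := by
      rw [hμ, ← Set.univ_prod_univ, Measure.prod_prod, Measure.restrict_apply_univ, Measure.restrict_apply_univ]
    rw [this, vA, vB, ← tw_add, tw_rpow, ha]
    congr 1
    ring
  have hpre : ENNReal.ofReal (2 * (2 ^ k)⁻¹) ^ (-(2 * (n : ℝ)) / r.toReal) = tw ((2 * (k:ℝ) - 2) * a) := by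
    rw [show (2:ℝ) * (2 ^ k)⁻¹ = 2 ^ 1 * (2 ^ k)⁻¹ by ring, ofReal_tw, tw_rpow, ha]
    congr 1
    push_cast; ring
  have hX := hHH (gE g) k x
  rw [← hB'] at hX
  set N := nbS (2 * D + 1) (Lam r (gE g)) k (idx k x) with hN
  set E := eLpNorm (HH (gE g) k) r (volume.restrict B') with hE
  have hkn : ((k * n : ℕ) : ℝ) / r.toReal = k * a := by rw [ha]; push_cast; ring
  rw [hkn] at hX
  unfold deltaE
  rw [hpre]
  calc tw ((2 * (k:ℝ) - 2) * a) * eLpNorm (fun hx : Rn n × Rn n => diffl D hx.1 f hx.2) r μ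
      ≤ tw ((2 * (k:ℝ) - 2) * a) * (((2:ℝ≥0) ^ D : ℝ≥0) * (K * ∑ i ∈ Finset.range (D + 2), eLpNorm (G i) r μ)) := by
        gcongr
        refine (eLpNorm_le_nnreal_smul_eLpNorm_of_ae_le_mul' hpt r).trans ?_
        rw [ENNReal.smul_def, smul_eq_mul]
        gcongr
        exact hsum μ G hGm
    _ ≤ tw ((2 * (k:ℝ) - 2) * a) * (((2:ℝ≥0) ^ D : ℝ≥0) * (K *
          (((D + 1 : ℕ) : ℝ≥0∞) * (tw ((2 - (k:ℝ)) * a) * E) + c₀ * tw ((3 - 2 * (k:ℝ)) * a)))) := by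
        rw [Finset.sum_range_succ]
        gcongr
        refine (Finset.sum_le_sum fun i hi => hHi i (Finset.mem_range.1 hi)).trans ?_
        rw [Finset.sum_const, Finset.card_range, nsmul_eq_mul]
    _ = (2:ℝ≥0∞) ^ D * K * (((D + 1 : ℕ) : ℝ≥0∞) * ((tw ((2 * (k:ℝ) - 2) * a) * tw ((2 - (k:ℝ)) * a)) * E) +
          c₀ * (tw ((2 * (k:ℝ) - 2) * a) * tw ((3 - 2 * (k:ℝ)) * a))) := by
        push_cast; ring
    _ = (2:ℝ≥0∞) ^ D * K * (((D + 1 : ℕ) : ℝ≥0∞) * (tw (k * a) * E) + c₀ * tw a) := by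
        rw [← tw_add, ← tw_add]
        congr 3
        · congr 3; ring
        · congr 2; ring
    _ ≤ (2:ℝ≥0∞) ^ D * K * (((D + 1 : ℕ) : ℝ≥0∞) * (K' * N) + c₀ * tw a) := by gcongr
    _ ≤ _ := by
        rw [mul_assoc ((2:ℝ≥0∞) ^ D * K)]
        refine mul_le_mul' le_rfl ?_
        rw [add_mul, mul_add, add_comm, mul_comm c₀, ← mul_assoc]
        refine add_le_add le_self_add ?_
        rw [mul_add]
        exact le_add_self

lemma bS_intW {n : ℕ} {P : ℝ} (hP : 0 < P) {T : MS n} {W : ℕ → Rn n → ℝ≥0∞} (ww : WW n P T W) (g : MS n) (k : ℕ) :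
    ∫⁻ x, (W k x * sf g k x) ^ P = bS P T g k := by
  rw [lint_cells k]
  unfold bS
  refine tsum_congr fun m => ?_
  rw [lint_cell_congr (g := fun x => W k x ^ P * (g k m) ^ P),
    lintegral_mul_const _ ((ww.meas k).pow_const _), ww.int,
    ENNReal.mul_rpow_of_nonneg _ _ hP.le]
  intro x hx
  rw [sf, hx, ENNReal.mul_rpow_of_nonneg _ _ hP.le]

lemma zero_bound (n : ℕ) {r : ℝ≥0∞} (hr : r ≠ 0) : ∃ C : ℝ≥0∞, C < ∞ ∧
    ∀ (f : Rn n → ℝ) (s : ℕ) (v : ℕ → Rn n → ℝ) (g : ℕ → (Fin n → ℤ) → ℝ≥0), Dec s v g →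
      (∀ᵐ x, HasSum (fun k => v k x) (f x)) → ∀ (x : Rn n),
      eLpNorm f r (volume.restrict (openCube x 1)) ≤ C * nbS 1 (Lam r (gE g)) 0 (idx 0 x) := by
  obtain ⟨K', hK', hHH⟩ := HH_cube (n := n) 1 hr
  refine ⟨K', hK', fun f s v g hd hf x => ?_⟩
  have hX := hHH (gE g) 0 x
  simp only [Nat.cast_one, pow_zero, inv_one, mul_one, zero_mul, Nat.cast_zero, _root_.zero_div, tw_zero, one_mul] at hX
  refine le_trans ?_ hX
  refine eLpNorm_mono_enorm_ae (ae_restrict_of_ae ?_)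
  filter_upwards [hf] with z hz
  have := tail_le hd hz 0
  simpa using this


/-- All hypotheses about exponents and weights. -/
structure GH (n : ℕ) (P θ α₁ α₂ : ℝ) (T : MS n) (r : ℝ≥0∞) (D : ℕ) : Prop where
  hP : 0 < P
  hθ : 0 < θ
  wd : WD n P θ α₁ α₂ T
  hr : r ≠ 0
  hθr : r ≠ ∞ → θ ≤ r.toReal
  hα : (n : ℝ) * (1 / θ - 1 / r.toReal) < α₁
  hD : α₂ < D

lemma cv_mono {ε ε' : ℝ} (h : ε' ≤ ε) (b : ℕ → ℝ≥0∞) (k : ℕ) :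
    ∑' j : ℕ, tw (-(ε * |(k:ℝ) - j|)) * b j ≤ ∑' j : ℕ, tw (-(ε' * |(k:ℝ) - j|)) * b j := by
  refine ENNReal.tsum_le_tsum fun j => mul_le_mul' (tw_mono ?_) le_rfl
  have := mul_le_mul_of_nonneg_right h (abs_nonneg ((k:ℝ) - j))
  linarith

lemma ZZ_bound {n : ℕ} {P θ α₁ α₂ : ℝ} {T : MS n} {r : ℝ≥0∞} {D : ℕ} (G : GH n P θ α₁ α₂ T r D) (R : ℕ) (c : ℝ≥0∞)
    (hc : c < ∞) :
    ∃ C : ℝ≥0∞, C < ∞ ∧ ∃ ε : ℝ, 0 < ε ∧ ∀ (g : MS n) (k : ℕ),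
      bS P T (fun k m => c * (Lo D (nbS 1 g) k m + nbS R (Lam r g) k m)) k
        ≤ C * ∑' j : ℕ, tw (-(ε * |(k:ℝ) - j|)) * bS P T g j := by
  have hP := G.hP
  obtain ⟨C1, hC1, ε1, hε1, H1⟩ := high G.hP G.hθ G.wd G.hr G.hθr G.hα
  obtain ⟨C2, hC2, ε2, hε2, H2⟩ := low G.hP G.wd G.hD
  obtain ⟨C3, hC3, H3⟩ := bS_nb G.hP G.wd 1
  obtain ⟨C4, hC4, H4⟩ := bS_nb G.hP G.wd R
  have hlt : ∀ {a b : ℝ≥0∞}, a < ∞ → b < ∞ → a * b < ∞ := ENNReal.mul_lt_top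
  have h2P : (2:ℝ≥0∞) ^ P < ∞ := ENNReal.rpow_lt_top_of_nonneg hP.le (by simp)
  have hcP : c ^ P < ∞ := ENNReal.rpow_lt_top_of_nonneg hP.le hc.ne
  refine ⟨c ^ P * (2 ^ P * (C2 * C3 + C4 * C1)), hlt hcP (hlt h2P (ENNReal.add_lt_top.2 ⟨hlt hC2 hC3, hlt hC4 hC1⟩)),
    min ε1 ε2, lt_min hε1 hε2, fun g k => ?_⟩
  rw [bS_const_mul hP T (fun k m => Lo D (nbS 1 g) k m + nbS R (Lam r g) k m), mul_assoc]
  refine mul_le_mul' le_rfl ((bS_add hP _ _ _ _).trans ?_)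
  rw [mul_assoc]
  refine mul_le_mul' le_rfl ?_
  set X := ∑' j : ℕ, tw (-(min ε1 ε2 * |(k:ℝ) - j|)) * bS P T g j with hX
  rw [add_mul]
  refine add_le_add ?_ ?_
  · refine (H2 _ k).trans ?_
    rw [mul_assoc]
    refine mul_le_mul' le_rfl ?_
    calc _ ≤ ∑' j : ℕ, tw (-(ε2 * |(k:ℝ) - j|)) * (C3 * bS P T g j) :=
          ENNReal.tsum_le_tsum fun j => mul_le_mul' le_rfl (H3 g j)
      _ = C3 * ∑' j : ℕ, tw (-(ε2 * |(k:ℝ) - j|)) * bS P T g j := by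
          rw [← ENNReal.tsum_mul_left]; refine tsum_congr fun j => by ring
      _ ≤ _ := mul_le_mul' le_rfl (cv_mono (min_le_right _ _) _ _)
  · refine (H4 _ k).trans ?_
    rw [mul_assoc]
    exact mul_le_mul' le_rfl ((H1 g k).trans (mul_le_mul' le_rfl (cv_mono (min_le_left _ _) _ _)))

lemma lpNormE_rpow {X : Type*} [MeasurableSpace X] {p : ℝ≥0∞} (hp0 : 0 < p) (hp : p < ∞) (μ : Measure X) (f : X → ℝ≥0∞) (Q : ℝ) :
    lpNormE p μ f ^ Q = (∫⁻ x, f x ^ p.toReal ∂μ) ^ (Q / p.toReal) := by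
  rw [lpNormE, if_neg hp.ne, ← ENNReal.rpow_mul]
  congr 1; ring

lemma lqNorm_rpow {ι : Type*} {q : ℝ≥0∞} (hq0 : 0 < q) (hq : q < ∞) (c : ι → ℝ≥0∞) :
    lqNorm q c ^ q.toReal = ∑' i, c i ^ q.toReal := by
  rw [lqNorm, if_neg hq.ne, ← ENNReal.rpow_mul, one_div_mul_cancel (ENNReal.toReal_pos hq0.ne' hq.ne).ne', ENNReal.rpow_one]

/-- the pieces of the norm -/
def DL {n : ℕ} (D : ℕ) (r : ℝ≥0∞) (f : Rn n → ℝ) (k : ℕ) (x : Rn n) : ℝ≥0∞ :=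
  if k = 0 then eLpNorm f r (volume.restrict (openCube x 1))
  else deltaE n D r (2 * (2 ^ k)⁻¹) (openCube x ((2 ^ k)⁻¹)) f

lemma zpow_a (k : ℕ) : (2:ℝ) ^ (1 - ((k : ℤ) + 1)) = 2 * (2 ^ (k+1))⁻¹ := by
  rw [zpow_sub₀ (by norm_num), zpow_one, div_eq_mul_inv]; norm_cast
lemma zpow_b (k : ℕ) : (2:ℝ) ^ (-((k : ℤ) + 1)) = (2 ^ (k+1))⁻¹ := by
  rw [zpow_neg]; norm_cast

lemma tilde_eq {n D : ℕ} {p q : ℝ≥0∞} (r : ℝ≥0∞) (W : ℕ → Rn n → ℝ≥0∞) (f : Rn n → ℝ) :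
    tildeBnormE n D p q r W f = lqNorm q (fun k => lpNormE p volume (fun x => W (k+1) x * DL D r f (k+1) x))
      + lpNormE p volume (fun x => W 0 x * DL D r f 0 x) := by
  simp only [tildeBnormE, DL, zpow_a, zpow_b, if_neg (Nat.succ_ne_zero _), if_true]

lemma tsum_zero_add (f : ℕ → ℝ≥0∞) : ∑' k, f k = f 0 + ∑' k, f (k+1) :=
  tsum_eq_zero_add' ENNReal.summable

lemma tilde_le {n D : ℕ} {p q : ℝ≥0∞} (hp0 : 0 < p) (hp : p < ∞) (hq0 : 0 < q) (hq : q < ∞) (r : ℝ≥0∞) (W : ℕ → Rn n → ℝ≥0∞) (f : Rn n → ℝ) :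
    tildeBnormE n D p q r W f ^ q.toReal ≤ (2:ℝ≥0∞) ^ q.toReal *
      ∑' k, (∫⁻ x, (W k x * DL D r f k x) ^ p.toReal) ^ (q.toReal / p.toReal) := by
  rw [tilde_eq]
  refine (add_rpow_le _ _ (ENNReal.toReal_pos hq0.ne' hq.ne)).trans (mul_le_mul' le_rfl ?_)
  rw [lqNorm_rpow hq0 hq, add_comm]
  simp only [lpNormE_rpow hp0 hp]
  rw [← tsum_zero_add (fun k => (∫⁻ x, (W k x * DL D r f k x) ^ p.toReal) ^ (q.toReal / p.toReal))]

lemma le_tilde {n D : ℕ} {p q : ℝ≥0∞} (hp0 : 0 < p) (hp : p < ∞) (hq0 : 0 < q) (hq : q < ∞) (r : ℝ≥0∞) (W : ℕ → Rn n → ℝ≥0∞) (f : Rn n → ℝ) :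
    ∑' k, (∫⁻ x, (W k x * DL D r f k x) ^ p.toReal) ^ (q.toReal / p.toReal) ≤
      2 * tildeBnormE n D p q r W f ^ q.toReal := by
  rw [tilde_eq, two_mul]
  have hQ := ENNReal.toReal_pos hq0.ne' hq.ne
  rw [tsum_zero_add, add_comm]
  refine add_le_add ?_ ?_
  · refine le_trans (le_of_eq ?_) (ENNReal.rpow_le_rpow le_self_add hQ.le)
    rw [lqNorm_rpow hq0 hq]
    simp only [lpNormE_rpow hp0 hp]
  · refine le_trans (le_of_eq ?_) (ENNReal.rpow_le_rpow le_add_self hQ.le)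
    simp only [lpNormE_rpow hp0 hp]

lemma DL_bound (n D : ℕ) {r : ℝ≥0∞} (hr : r ≠ 0) : ∃ C : ℝ≥0∞, C < ∞ ∧
    ∀ (f : Rn n → ℝ) (v : ℕ → Rn n → ℝ) (g : ℕ → (Fin n → ℤ) → ℝ≥0), Dec D v g →
      (∀ᵐ x, HasSum (fun k => v k x) (f x)) → ∀ (k : ℕ) (x : Rn n),
      DL D r f k x ≤ sf (fun k m => C * (Lo D (nbS 1 (gE g)) k m + nbS (2 * D + 1) (Lam r (gE g)) k m)) k x := by
  obtain ⟨C1, hC1, H1⟩ := delta_bound n D hr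
  obtain ⟨C2, hC2, H2⟩ := zero_bound n hr
  refine ⟨C1 + C2, ENNReal.add_lt_top.2 ⟨hC1, hC2⟩, fun f v g hd hf k x => ?_⟩
  unfold DL sf
  split_ifs with hk
  · subst hk
    refine (H2 f D v g hd hf x).trans (mul_le_mul' le_add_self ?_)
    refine le_trans ?_ le_add_self
    unfold nbS
    refine Finset.sum_le_sum_of_subset (Finset.Icc_subset_Icc ?_ ?_)
    · intro i; simp
    · intro i; simp
  · exact (H1 f v g hd hf k x).trans (mul_le_mul' le_self_add le_rfl)

/-- Proposition B (synthesis) -/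
lemma propB {n : ℕ} {θ α₁ α₂ : ℝ} {T : MS n} {p q r : ℝ≥0∞} {D : ℕ} (hp0 : 0 < p) (hp : p < ∞) (hq0 : 0 < q) (hq : q < ∞)
    (G : GH n p.toReal θ α₁ α₂ T r D) :
    ∃ C : ℝ≥0∞, C < ∞ ∧ ∀ (W : ℕ → Rn n → ℝ≥0∞), WW n p.toReal T W →
     ∀ (f : Rn n → ℝ) (v : ℕ → Rn n → ℝ) (g : ℕ → (Fin n → ℤ) → ℝ≥0), Dec D v g →
      (∀ᵐ x, HasSum (fun k => v k x) (f x)) →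
      tildeBnormE n D p q r W f ^ q.toReal ≤ C * ES p.toReal q.toReal T (gE g) := by
  have hQ := ENNReal.toReal_pos hq0.ne' hq.ne
  have hP := G.hP
  obtain ⟨C1, hC1, H1⟩ := DL_bound n D G.hr
  obtain ⟨C2, hC2, ε, hε, H2⟩ := ZZ_bound G (2 * D + 1) C1 hC1
  obtain ⟨A, hA, HA⟩ := conv_sum ε (q.toReal / p.toReal) hε (by positivity)
  have h2 : C2 ^ (q.toReal / p.toReal) < ∞ := ENNReal.rpow_lt_top_of_nonneg (by positivity) hC2.ne
  refine ⟨2 ^ q.toReal * (C2 ^ (q.toReal / p.toReal) * A), ENNReal.mul_lt_top (ENNReal.rpow_lt_top_of_nonneg hQ.le (by simp))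
    (ENNReal.mul_lt_top h2 hA), fun W ww f v g hd hf => ?_⟩
  refine (tilde_le hp0 hp hq0 hq r W f).trans ?_
  rw [mul_assoc]
  refine mul_le_mul' le_rfl ?_
  rw [mul_assoc]
  unfold ES
  refine le_trans ?_ (mul_le_mul' le_rfl (HA _))
  rw [← ENNReal.tsum_mul_left]
  refine ENNReal.tsum_le_tsum fun k => ?_
  rw [← ENNReal.mul_rpow_of_nonneg _ _ (by positivity)]
  refine ENNReal.rpow_le_rpow ?_ (by positivity)
  refine le_trans ?_ (H2 (gE g) k)
  rw [← bS_intW hP ww]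
  refine lintegral_mono fun x => ENNReal.rpow_le_rpow (mul_le_mul' le_rfl ?_) hP.le
  exact H1 f v g hd hf k x

lemma ae_fin {n : ℕ} {P θ α₁ α₂ : ℝ} {T : MS n} {r : ℝ≥0∞} {D : ℕ} (G : GH n P θ α₁ α₂ T r D) {Q : ℝ} (hQ : 0 < Q)
    (g : MS n) (hg : ES P Q T g < ∞) : ∀ᵐ x, ∑' k, sf g k x < ∞ := by
  obtain ⟨C1, hC1, ε1, hε1, H1⟩ := high G.hP G.hθ G.wd G.hr G.hθr G.hα
  have hP := G.hP
  have hb : ∀ j, bS P T g j ≤ ES P Q T g ^ (1 / (Q / P)) := by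
    intro j
    rw [one_div, ENNReal.le_rpow_inv_iff (by positivity)]
    exact ENNReal.le_tsum (f := fun k => bS P T g k ^ (Q / P)) j
  have h0 : bS P T (Lam r g) 0 < ∞ := by
    refine (H1 g 0).trans_lt (ENNReal.mul_lt_top hC1 ?_)
    calc _ ≤ ∑' j : ℕ, tw (-(ε1 * j)) * ES P Q T g ^ (1 / (Q / P)) := by
          refine ENNReal.tsum_le_tsum fun j => mul_le_mul' (le_of_eq ?_) (hb j)
          simp
      _ = (∑' j : ℕ, tw (-(ε1 * j))) * ES P Q T g ^ (1 / (Q / P)) := ENNReal.tsum_mul_right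
      _ < ∞ := ENNReal.mul_lt_top (tw_sum _ hε1) (ENNReal.rpow_lt_top_of_nonneg (by positivity) hg.ne)
  have h1 : ∀ m, eLpNorm (HH g 0) r (volume.restrict (cell n 0 m)) < ∞ := by
    intro m
    have h2 : (T 0 m * Lam r g 0 m) ^ P < ∞ := lt_of_le_of_lt (ENNReal.le_tsum (f := fun m => (T 0 m * Lam r g 0 m) ^ P) m) h0
    rw [ENNReal.rpow_lt_top_iff_of_pos hP] at h2
    have h3 : Lam r g 0 m < ∞ := by
      by_contra hh
      rw [not_lt, top_le_iff] at hh
      rw [hh, ENNReal.mul_top (G.wd.pos 0 m).ne'] at h2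
      exact lt_irrefl _ h2
    simpa [Lam, tw_zero] using h3
  have h2 : ∀ m, ∀ᵐ x ∂(volume.restrict (cell n 0 m)), HH g 0 x < ∞ := by
    intro m
    have hm := h1 m
    by_cases hr : r = ∞
    · rw [hr, eLpNorm_exponent_top] at hm
      filter_upwards [enorm_ae_le_eLpNormEssSup (HH g 0) (volume.restrict (cell n 0 m))] with x hx
      exact lt_of_le_of_lt hx hm
    · rw [eLpNorm_lt_top_iff_lintegral_rpow_enorm_lt_top G.hr hr] at hm
      have := ae_lt_top (by simpa using (HH_meas g 0).pow_const _) hm.ne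
      filter_upwards [this] with x hx
      rwa [ENNReal.rpow_lt_top_iff_of_pos (ENNReal.toReal_pos G.hr hr)] at hx
  have h3 : ∀ᵐ x ∂(volume.restrict (⋃ m, cell n 0 m)), HH g 0 x < ∞ := by
    rw [ae_restrict_iUnion_iff]; exact h2
  rw [cells_union, Measure.restrict_univ] at h3
  filter_upwards [h3] with x hx
  simpa [HH] using hx


lemma Dec.summable {n s : ℕ} {v : ℕ → Rn n → ℝ} {g : ℕ → (Fin n → ℤ) → ℝ≥0} (h : Dec s v g) {x : Rn n}
    (hx : ∑' k, sf (gE g) k x < ∞) : Summable (fun k => v k x) := by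
  refine Summable.of_enorm ((ENNReal.tsum_le_tsum fun k => h.le k x).trans_lt hx).ne

lemma exists_sum {n s : ℕ} {v : ℕ → Rn n → ℝ} {g : ℕ → (Fin n → ℤ) → ℝ≥0} (h : Dec s v g)
    (hv : ∀ k, Measurable (v k)) (hx : ∀ᵐ x, ∑' k, sf (gE g) k x < ∞) :
    ∃ f : Rn n → ℝ, Measurable f ∧ ∀ᵐ x, HasSum (fun k => v k x) (f x) := by
  obtain ⟨f, hf, hf2⟩ := measurable_limit_of_tendsto_metrizable_ae (μ := (volume : Measure (Rn n)))
    (f := fun N x => ∑ k ∈ Finset.range N, v k x) (L := atTop)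
    (fun N => (Finset.measurable_fun_sum _ fun k _ => hv k).aemeasurable)
    (by filter_upwards [hx] with x hx; exact ⟨_, (h.summable hx).hasSum.tendsto_sum_nat⟩)
  refine ⟨f, hf, ?_⟩
  filter_upwards [hx, hf2] with x hx hx2
  have h1 := (h.summable hx).hasSum
  rwa [← tendsto_nhds_unique h1.tendsto_sum_nat hx2]

lemma Dec.add {n s : ℕ} {v w : ℕ → Rn n → ℝ} {g g' : ℕ → (Fin n → ℤ) → ℝ≥0} (h : Dec s v g) (h' : Dec s w g') :
    Dec s (fun k x => v k x + w k x) (fun k m => g k m + g' k m) := by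
  intro k y z hz
  have := (h k y z hz).add (h' k y z hz)
  simpa using this

lemma Dec.neg {n s : ℕ} {v : ℕ → Rn n → ℝ} {g : ℕ → (Fin n → ℤ) → ℝ≥0} (h : Dec s v g) :
    Dec s (fun k x => - v k x) g := by
  intro k y z hz
  have := (h k y z hz).const_mul (-1)
  simpa using this

lemma Dec.tail {n s : ℕ} {v : ℕ → Rn n → ℝ} {g : ℕ → (Fin n → ℤ) → ℝ≥0} (h : Dec s v g) (K : ℕ) :
    Dec s (fun k x => if K ≤ k then v k x else 0) (fun k m => if K ≤ k then g k m else 0) := by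
  intro k y z hz
  by_cases hk : K ≤ k
  · simpa [hk] using h k y z hz
  · simpa [hk] using SB.zero

lemma Dec.mono_s {n s s' : ℕ} {v : ℕ → Rn n → ℝ} {g : ℕ → (Fin n → ℤ) → ℝ≥0} (h : Dec s v g) (hs : s' ≤ s) :
    Dec s' v g := fun k y z hz => (h k y z hz).mono_s hs

lemma hasSum_tail {a : ℕ → ℝ} {c : ℝ} (h : HasSum a c) (K : ℕ) :
    HasSum (fun k => if K ≤ k then a k else 0) (c - ∑ k ∈ Finset.range K, a k) := by
  have h1 := hasSum_sum_of_ne_finset_zero (L := SummationFilter.unconditional ℕ) (f := fun k => if k < K then a k else 0) (s := Finset.range K) (by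
    intro b hb; simp at hb; simp; omega)
  have h2 := h.sub h1
  have e : ∑ k ∈ Finset.range K, (if k < K then a k else 0) = ∑ k ∈ Finset.range K, a k :=
    Finset.sum_congr rfl fun k hk => by simp [Finset.mem_range.1 hk]
  rw [e] at h2
  convert! h2 using 2 with k
  by_cases hk : K ≤ k
  · simp [hk, not_lt.2 hk]
  · simp [hk, not_le.1 hk]

lemma ES_add {n : ℕ} {P Q : ℝ} (hP : 0 < P) (hQ : 0 < Q) (T : MS n) : ∃ C : ℝ≥0∞, C < ∞ ∧ ∀ (g g' : MS n),
    ES P Q T (fun k m => g k m + g' k m) ≤ C * (ES P Q T g + ES P Q T g') := by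
  have hs : 0 < Q / P := by positivity
  refine ⟨((2:ℝ≥0∞) ^ P) ^ (Q / P) * 2 ^ (Q / P), ENNReal.mul_lt_top (ENNReal.rpow_lt_top_of_nonneg hs.le
    (ENNReal.rpow_lt_top_of_nonneg hP.le (by simp)).ne) (ENNReal.rpow_lt_top_of_nonneg hs.le (by simp)), fun g g' => ?_⟩
  unfold ES
  rw [← ENNReal.tsum_add, ← ENNReal.tsum_mul_left]
  refine ENNReal.tsum_le_tsum fun k => ?_
  refine (ENNReal.rpow_le_rpow (bS_add hP T g g' k) hs.le).trans ?_
  rw [ENNReal.mul_rpow_of_nonneg _ _ hs.le, mul_assoc]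
  exact mul_le_mul' le_rfl (add_rpow_le _ _ hs)

lemma ES_mono {n : ℕ} {P Q : ℝ} (hP : 0 < P) (hQ : 0 < Q) {T g g' : MS n} (h : ∀ k m, g k m ≤ g' k m) :
    ES P Q T g ≤ ES P Q T g' := by
  unfold ES
  exact ENNReal.tsum_le_tsum fun k => ENNReal.rpow_le_rpow (bS_mono hP (h k)) (by positivity)

lemma bS_zero {n : ℕ} {P : ℝ} (hP : 0 < P) (T g : MS n) (k : ℕ) (h : ∀ m, g k m = 0) : bS P T g k = 0 := by
  unfold bS
  simp [h, hP]

lemma ES_tail {n : ℕ} {P Q : ℝ} (hP : 0 < P) (hQ : 0 < Q) (T : MS n) (g : ℕ → (Fin n → ℤ) → ℝ≥0)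
    (h : ES P Q T (gE g) < ∞) :
    Tendsto (fun K : ℕ => ES P Q T (gE (fun k m => if K ≤ k then g k m else 0))) atTop (nhds 0) := by
  have h1 := ENNReal.tendsto_sum_nat_add (fun k => bS P T (gE g) k ^ (Q / P)) h.ne
  refine h1.congr fun K => ?_
  unfold ES
  have hs : 0 < Q / P := by positivity
  rw [← (ENNReal.summable).sum_add_tsum_nat_add' (f := fun k => bS P T (gE fun k m => if K ≤ k then g k m else 0) k ^ (Q / P)) (k := K)]
  rw [Finset.sum_eq_zero, zero_add]
  · refine tsum_congr fun k => ?_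
    unfold bS gE
    simp
  · intro k hk
    rw [bS_zero hP, ENNReal.zero_rpow_of_pos hs]
    intro m
    simp [gE, Finset.mem_range.1 hk]

lemma memLr_of {n D : ℕ} {T : MS n} {p q r : ℝ≥0∞} (hp0 : 0 < p) (hp : p < ∞) (hq0 : 0 < q) (hq : q < ∞) (hr : r ≠ 0)
    {W : ℕ → Rn n → ℝ≥0∞} (ww : WW n p.toReal T W) {f : Rn n → ℝ} (hf : Measurable f)
    (hN : tildeBnormE n D p q r W f < ∞) : MemLrLoc n r f := by
  have hP := ENNReal.toReal_pos hp0.ne' hp.ne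
  have hQ := ENNReal.toReal_pos hq0.ne' hq.ne
  have h0 : ∫⁻ x, (W 0 x * DL D r f 0 x) ^ p.toReal < ∞ := by
    have h1 := le_tilde (D := D) hp0 hp hq0 hq r W f
    have h2 : (∫⁻ x, (W 0 x * DL D r f 0 x) ^ p.toReal) ^ (q.toReal / p.toReal) < ∞ :=
      lt_of_le_of_lt ((ENNReal.le_tsum (f := fun k => (∫⁻ x, (W k x * DL D r f k x) ^ p.toReal) ^ (q.toReal / p.toReal)) 0).trans h1)
        (ENNReal.mul_lt_top (by simp) (ENNReal.rpow_lt_top_of_nonneg hQ.le hN.ne))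
    rwa [ENNReal.rpow_lt_top_iff_of_pos (by positivity)] at h2
  have key : ∀ z : Rn n, eLpNorm f r (volume.restrict (openCube z (1/2))) < ∞ := by
    intro z
    by_contra hh
    rw [not_lt, top_le_iff] at hh
    refine h0.not_ge ?_
    calc (∞ : ℝ≥0∞) = ∫⁻ x in openCube z (1/2), ∞ := by
          rw [lintegral_const, Measure.restrict_apply_univ, openCube_vol, ENNReal.top_mul]
          simp
      _ ≤ ∫⁻ x in openCube z (1/2), (W 0 x * DL D r f 0 x) ^ p.toReal := by
          refine setLIntegral_mono' (openCube_meas _ _) fun x hx => ?_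
          have : DL D r f 0 x = ∞ := by
            rw [DL, if_pos rfl, eq_top_iff, ← hh]
            refine eLpNorm_mono_measure f (Measure.restrict_mono (fun y hy i => ?_) le_rfl)
            have h1 := hx i
            have h2 := hy i
            rw [abs_lt] at *
            constructor <;> linarith
          rw [this, ENNReal.mul_top (ww.pos 0 x).ne', ENNReal.top_rpow_of_pos hP]
      _ ≤ _ := setLIntegral_le_lintegral _ _
  refine ⟨hf, fun K hK => ?_⟩
  refine hK.induction_on (p := fun K => eLpNorm f r (volume.restrict K) < ∞) ?_ ?_ ?_ ?_
  · simp
  · intro A B h1 h2; exact lt_of_le_of_lt (eLpNorm_mono_measure f (Measure.restrict_mono h1 le_rfl)) h2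
  · intro A B h1 h2
    have h3 := eLp_union volume (Finset.univ : Finset Bool) (fun b => if b then A else B) hr (fun x => ‖f x‖ₑ)
    simp only [eLpNorm_enorm] at h3
    have e : (⋃ e ∈ (Finset.univ : Finset Bool), if e then A else B) = A ∪ B := by
      ext x; simp [or_comm]
    simp only [e] at h3
    refine h3.trans_lt (ENNReal.mul_lt_top (ENNReal.rpow_lt_top_of_nonneg (by positivity) (by simp)) ?_)
    simp [h1, h2]
  · intro x _
    refine ⟨openCube x (1/2), mem_nhdsWithin_of_mem_nhds (IsOpen.mem_nhds ?_ ?_), key x⟩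
    · rw [openCube_eq]
      exact isOpen_set_pi Set.finite_univ fun i _ => isOpen_Ioo
    · intro i; simp

lemma GH.alpha {n : ℕ} {P θ α₁ α₂ : ℝ} {T : MS n} {r : ℝ≥0∞} {D : ℕ} (G : GH n P θ α₁ α₂ T r D) : 0 < D := by
  have hP := G.hP
  have h1 : 0 < α₁ := by
    refine lt_of_le_of_lt ?_ G.hα
    have hθ := G.hθ
    refine mul_nonneg (by positivity) (sub_nonneg.2 ?_)
    by_cases hr : r = ∞
    · simp [hr]; positivity
    · exact one_div_le_one_div_of_le hθ (G.hθr hr)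
  have h2 : α₁ ≤ α₂ := by
    by_contra hlt
    push Not at hlt
    obtain ⟨C, hC, H2⟩ := G.wd.t2
    obtain ⟨C', hC', H3⟩ := G.wd.t3
    have hε : 0 < (α₁ - α₂) * P := mul_pos (by linarith) hP
    have hT0 : T 0 0 ^ P ≠ 0 := (ENNReal.rpow_pos (G.wd.pos 0 0) (G.wd.fin 0 0).ne).ne'
    have hT1 : T 0 0 ^ P ≠ ∞ := (ENNReal.rpow_lt_top_of_nonneg hP.le (G.wd.fin 0 0).ne).ne
    have key : ∀ j : ℕ, 1 ≤ C * C' * tw (-((α₁ - α₂) * P * j)) := by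
      intro j
      have a := H2 0 j (Nat.zero_le _) 0 (fun _ => 1) measurable_const
      have b := H3 0 j (Nat.zero_le _) 0
      simp only [ENNReal.one_rpow, lintegral_const, Measure.restrict_apply_univ, cell_vol, mul_one, one_mul, zero_mul,
        Nat.cast_zero, neg_zero, tw_zero, sub_zero] at a b
      have c : T 0 0 ^ P * 1 ≤ T 0 0 ^ P * (C * C' * tw (-((α₁ - α₂) * P * j))) := by
        calc T 0 0 ^ P * 1 ≤ C * (tw (-(α₁ * P * j)) * (C' * (tw (α₂ * P * j) * T 0 0 ^ P))) := by
              rw [mul_one]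
              exact a.trans (mul_le_mul' le_rfl (mul_le_mul' le_rfl b))
          _ = T 0 0 ^ P * (C * C' * (tw (-(α₁ * P * j)) * tw (α₂ * P * j))) := by ring
          _ = _ := by rw [← tw_add]; congr 3; ring
      exact (ENNReal.mul_le_mul_iff_right hT0 hT1).1 c
    have h4 : ∑' j : ℕ, (1:ℝ≥0∞) ≤ C * C' * ∑' j : ℕ, tw (-((α₁ - α₂) * P * j)) := by
      rw [← ENNReal.tsum_mul_left]
      exact ENNReal.tsum_le_tsum key
    rw [ENNReal.tsum_const_eq_top_of_ne_zero one_ne_zero, top_le_iff] at h4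
    exact (ENNReal.mul_lt_top (ENNReal.mul_lt_top hC hC') (tw_sum _ hε)).ne h4
  have h3 := G.hD
  have : (0:ℝ) < D := by linarith
  exact_mod_cast this


lemma cheb {r : ℝ≥0∞} (hr : r ≠ 0) {η : ℝ≥0∞} (hη : 0 < η) : ∃ K : ℝ≥0, 0 < K ∧
    ∀ {X : Type} [MeasurableSpace X] (μ : Measure X) (f : X → ℝ), AEStronglyMeasurable f μ →
      μ {x | K * eLpNorm f r μ < ‖f x‖ₑ} ≤ η := by
  by_cases hrt : r = ∞
  · refine ⟨1, one_pos, fun μ f hf => ?_⟩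
    subst hrt
    have : μ {x | ((1:ℝ≥0):ℝ≥0∞) * eLpNorm f ∞ μ < ‖f x‖ₑ} = 0 := by
      have h := enorm_ae_le_eLpNormEssSup f μ
      rw [ae_iff] at h
      rw [eLpNorm_exponent_top]
      simpa using h
    rw [this]; exact zero_le
  have hr0 : 0 < r.toReal := ENNReal.toReal_pos hr hrt
  obtain ⟨K, hK0, hK⟩ : ∃ K : ℝ≥0, 0 < K ∧ ((K:ℝ≥0∞)⁻¹) ^ r.toReal ≤ η := by
    have ht : Tendsto (fun K : ℕ => (((K:ℕ):ℝ≥0∞)⁻¹) ^ r.toReal) atTop (nhds (0 ^ r.toReal)) :=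
      (ENNReal.continuous_rpow_const.tendsto 0).comp ENNReal.tendsto_inv_nat_nhds_zero
    rw [ENNReal.zero_rpow_of_pos hr0] at ht
    obtain ⟨K, h1, h2⟩ := ((ht.eventually_le_const hη).and (eventually_gt_atTop 0)).exists
    exact ⟨K, by exact_mod_cast h2, by simpa using h1⟩
  refine ⟨K, hK0, fun μ f hf => ?_⟩
  by_cases hE : eLpNorm f r μ = ∞
  · have : {x | (K:ℝ≥0∞) * eLpNorm f r μ < ‖f x‖ₑ} = ∅ := by
      ext x; simp [hE, ENNReal.mul_top, hK0.ne']
    rw [this]; simp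
  by_cases hE0 : eLpNorm f r μ = 0
  · have h0 : f =ᵐ[μ] 0 := (eLpNorm_eq_zero_iff hf hr).1 hE0
    have : μ {x | (K:ℝ≥0∞) * eLpNorm f r μ < ‖f x‖ₑ} = 0 := by
      rw [hE0]
      have := ae_iff.1 h0
      simpa using this
    rw [this]; exact zero_le
  · have hK' : (K:ℝ≥0∞) ≠ 0 := by simpa using hK0.ne'
    have h := meas_ge_le_mul_pow_eLpNorm_enorm μ hr hrt hf (ε := K * eLpNorm f r μ) (mul_ne_zero hK' hE0)
      (fun h => absurd h (ENNReal.mul_ne_top coe_ne_top hE))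
    refine (measure_mono (fun x hx => ?_)).trans (h.trans ?_)
    · rw [Set.mem_ofPred_eq] at hx ⊢; exact hx.le
    · rw [← ENNReal.mul_rpow_of_nonneg _ _ hr0.le]
      have : (K * eLpNorm f r μ)⁻¹ * eLpNorm f r μ = (K:ℝ≥0∞)⁻¹ := by
        rw [ENNReal.mul_inv (Or.inl hK') (Or.inl coe_ne_top), mul_assoc, ENNReal.inv_mul_cancel hE0 hE, mul_one]
      rw [this]; exact hK

/-- The scaled measure used for the differences. -/
def muD (n k : ℕ) (m : Fin n → ℤ) : Measure (Rn n × Rn n) :=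
  tw (2 * (k * n : ℕ)) • ((volume.restrict (openCube (0 : Rn n) (2 * (2 ^ k)⁻¹))).prod (volume.restrict (cell n k m)))

/-- Local differences on cells. -/
def dE {n : ℕ} (L : ℕ) (r : ℝ≥0∞) (φ : Rn n → ℝ) : MS n := fun k m =>
  if k = 0 then eLpNorm φ r (volume.restrict (cell n 0 m))
  else eLpNorm (fun hx : Rn n × Rn n => diffl L hx.1 φ hx.2) r (muD n k m)

lemma cell_sub_cube {n k : ℕ} (x : Rn n) : cell n k (idx k x) ⊆ openCube x ((2 ^ k)⁻¹) := by
  intro y hy i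
  rw [mem_cell] at hy
  have h1 := idx_le (k := k) x i
  have h2 := idx_lt (k := k) x i
  have h3 := idx_le (k := k) y i
  have h4 := idx_lt (k := k) y i
  rw [hy] at h3 h4
  have hk : (0:ℝ) < 2 ^ k := by positivity
  have : 2 ^ k * |y i - x i| < 1 := by
    have he : 2 ^ k * |y i - x i| = |2 ^ k * (y i - x i)| := by rw [abs_mul, abs_of_pos hk]
    rw [he, abs_lt]; constructor <;> nlinarith
  rw [← one_div, lt_div_iff₀ hk]; linarith

lemma dE_le {n : ℕ} (L : ℕ) {r : ℝ≥0∞} (_hr : r ≠ 0) (φ : Rn n → ℝ) (k : ℕ) (x : Rn n) :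
    sf (dE L r φ) k x ≤ tw (2 * n / r.toReal) * DL L r φ k x := by
  have h1 : (1:ℝ≥0∞) ≤ tw (2 * n / r.toReal) := by
    rw [← tw_zero]; exact tw_mono (by positivity)
  unfold sf dE DL
  by_cases hk : k = 0
  · subst hk
    simp only [if_true]
    refine le_trans ?_ (le_mul_of_one_le_left zero_le h1)
    refine eLpNorm_mono_measure _ (Measure.restrict_mono ?_ le_rfl)
    simpa using cell_sub_cube (k := 0) x
  · simp only [if_neg hk]
    unfold muD deltaE
    rw [eLpNorm_smul_measure_of_ne_zero (tw_ne_zero _), smul_eq_mul, tw_rpow, ← mul_assoc]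
    refine mul_le_mul' ?_ ?_
    · have : ENNReal.ofReal (2 * (2 ^ k)⁻¹) = tw (1 - k) := by
        have := ofReal_tw 1 k
        simpa using this
      rw [this, tw_rpow, ← tw_add]
      apply tw_mono
      rw [ENNReal.toReal_div]
      push_cast
      simp only [ENNReal.toReal_one]
      apply le_of_eq
      ring
    · exact eLpNorm_mono_measure _ (Measure.prod_mono le_rfl (Measure.restrict_mono (cell_sub_cube x) le_rfl))

lemma E_le {n : ℕ} {p q : ℝ≥0∞} (hp0 : 0 < p) (hp : p < ∞) (hq0 : 0 < q) (hq : q < ∞) (L : ℕ) {r : ℝ≥0∞} (hr : r ≠ 0) :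
    ∃ C : ℝ≥0∞, C < ∞ ∧ ∀ (T : MS n) (W : ℕ → Rn n → ℝ≥0∞), WW n p.toReal T W → ∀ φ : Rn n → ℝ,
      ES p.toReal q.toReal T (dE L r φ) ≤ C * tildeBnormE n L p q r W φ ^ q.toReal := by
  have hP : 0 < p.toReal := ENNReal.toReal_pos hp0.ne' hp.ne
  have hQ : 0 < q.toReal := ENNReal.toReal_pos hq0.ne' hq.ne
  refine ⟨tw (2 * n / r.toReal) ^ q.toReal * 2, ENNReal.mul_lt_top
    (ENNReal.rpow_lt_top_of_nonneg hQ.le (tw_ne_top _)) (by simp), fun T W ww φ => ?_⟩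
  set c := tw (2 * n / r.toReal)
  rw [mul_assoc]
  refine le_trans ?_ (mul_le_mul' le_rfl (le_tilde hp0 hp hq0 hq r W φ))
  rw [ES, ← ENNReal.tsum_mul_left]
  refine ENNReal.tsum_le_tsum fun k => ?_
  rw [← bS_intW hP ww]
  have : (∫⁻ x, (W k x * sf (dE L r φ) k x) ^ p.toReal) ≤ c ^ p.toReal * ∫⁻ x, (W k x * DL L r φ k x) ^ p.toReal := by
    rw [← lintegral_const_mul' _ _ (ENNReal.rpow_ne_top_of_nonneg hP.le (tw_ne_top _))]
    refine lintegral_mono fun x => ?_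
    rw [← ENNReal.mul_rpow_of_nonneg _ _ hP.le]
    refine ENNReal.rpow_le_rpow ?_ hP.le
    calc _ ≤ W k x * (c * DL L r φ k x) := mul_le_mul' le_rfl (dE_le L hr φ k x)
      _ = _ := by ring
  refine (ENNReal.rpow_le_rpow this (by positivity)).trans ?_
  rw [ENNReal.mul_rpow_of_nonneg _ _ (by positivity), ← ENNReal.rpow_mul]
  apply le_of_eq
  congr 2
  field_simp

lemma map_aff {n : ℕ} (c : Rn n) {b : ℝ} (hb : 0 < b) :
    Measure.map (fun u : Rn n => c + b • u) volume = ENNReal.ofReal ((b ^ n)⁻¹) • (volume : Measure (Rn n)) := by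
  have h : (fun u : Rn n => c + b • u) = (fun x => c + x) ∘ (fun u => b • u) := rfl
  rw [h, ← Measure.map_map (measurable_const_add c) (measurable_const_smul b), Measure.map_addHaar_smul volume hb.ne', Measure.map_smul, map_add_left_eq_self]
  simp [abs_of_pos hb]

lemma vol_aff {n : ℕ} (c : Rn n) {b : ℝ} (hb : 0 < b) {A : Set (Rn n)} (hA : MeasurableSet A) :
    volume {u : Rn n | c + b • u ∈ A} = ENNReal.ofReal ((b ^ n)⁻¹) * volume A := by
  have hm : Measurable (fun u : Rn n => c + b • u) := by fun_prop
  have := congrArg (fun μ => μ A) (map_aff c hb)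
  simp only [Measure.map_apply hm hA, Measure.smul_apply, smul_eq_mul] at this
  exact this

lemma vol_Psi {n : ℕ} (c : Rn n) {a b : ℝ} (ha : 0 < a) (hb : 0 < b) {A : Set (Rn n × Rn n)} (hA : MeasurableSet A) :
    (volume.prod volume) {p : Rn n × Rn n | (a • (p.2 - p.1), c + b • p.1) ∈ A} =
      ENNReal.ofReal ((a ^ n)⁻¹) * ENNReal.ofReal ((b ^ n)⁻¹) * (volume.prod volume) A := by
  have hm : Measurable (fun p : Rn n × Rn n => (a • (p.2 - p.1), c + b • p.1)) := by fun_prop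
  have hm2 : Measurable (fun u : Rn n => c + b • u) := by fun_prop
  rw [Measure.prod_apply_symm hA]
  refine (Measure.prod_apply (hm hA)).trans ?_
  have h1 : ∀ u : Rn n, volume (Prod.mk u ⁻¹' ((fun p : Rn n × Rn n => (a • (p.2 - p.1), c + b • p.1)) ⁻¹' A)) =
      ENNReal.ofReal ((a ^ n)⁻¹) * volume ((fun x => (x, c + b • u)) ⁻¹' A) := by
    intro u
    rw [← vol_aff (-(a • u)) ha (measurable_prodMk_right hA)]
    congr 1
    ext v
    simp only [Set.mem_preimage, Set.mem_ofPred_eq]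
    rw [show a • (v - u) = -(a • u) + a • v by rw [smul_sub]; abel]
  have h2 : ∫⁻ u : Rn n, volume (Prod.mk u ⁻¹' ((fun p : Rn n × Rn n => (a • (p.2 - p.1), c + b • p.1)) ⁻¹' A)) =
      ENNReal.ofReal ((a ^ n)⁻¹) * ∫⁻ u : Rn n, volume ((fun x => (x, c + b • u)) ⁻¹' A) := by
    rw [← lintegral_const_mul' _ _ ofReal_ne_top]
    exact lintegral_congr h1
  refine h2.trans ?_
  rw [mul_assoc]
  congr 1
  have hg : Measurable (fun y : Rn n => volume ((fun x : Rn n => (x, y)) ⁻¹' A)) := measurable_measure_prodMk_right hA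
  rw [← lintegral_map (μ := volume) hg hm2, map_aff c hb, lintegral_smul_measure, smul_eq_mul]


/-- integer point as a real point -/
def rI {n : ℕ} (m : Fin n → ℤ) : Rn n := fun i => (m i : ℝ)

lemma diffl_meas {n : ℕ} (L : ℕ) {φ : Rn n → ℝ} (hφ : Measurable φ) :
    Measurable (fun hx : Rn n × Rn n => diffl L hx.1 φ hx.2) := by
  unfold diffl
  refine Finset.measurable_fun_sum _ fun j _ => Measurable.const_mul (hφ.comp ?_) _
  fun_prop

/-- the index box -/
def bx (n R : ℕ) : Finset (Fin n → ℤ) := Finset.Icc (fun _ => -(R : ℤ)) (fun _ => (R : ℤ))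

lemma mem_bx {n R : ℕ} {e : Fin n → ℤ} : e ∈ bx n R ↔ ∀ i, |e i| ≤ (R:ℤ) := by
  unfold bx
  rw [Finset.mem_Icc, Pi.le_def, Pi.le_def]
  simp only [abs_le]
  exact ⟨fun h i => ⟨h.1 i, h.2 i⟩, fun h => ⟨fun i => (h i).1, fun i => (h i).2⟩⟩

lemma bx_pos (n R : ℕ) : 0 < (bx n R).card := Finset.card_pos.2 ⟨0, mem_bx.2 fun i => by simp⟩

lemma LA0 {n : ℕ} (L : ℕ) {r : ℝ≥0∞} (hr : r ≠ 0) {η : ℝ≥0∞} (hη : 0 < η) :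
    ∃ C : ℝ≥0, ∀ φ : Rn n → ℝ, Measurable φ → ∀ m : Fin n → ℤ, nbS 2 (dE L r φ) 0 m < ∞ → ∀ C' ≥ C,
      volume {w : Rn n | w ∈ Set.Icc (rI m) (rI m + 2) ∧ (C' * nbS 2 (dE L r φ) 0 m).toReal < |φ w|} ≤ η := by
  set N := (bx n 2).card with hN
  have hN0 : (N:ℝ≥0∞) ≠ 0 := Nat.cast_ne_zero.2 (bx_pos n 2).ne'
  obtain ⟨K, hK0, hK⟩ := cheb hr (η := η / N) (ENNReal.div_pos hη.ne' (by simp))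
  refine ⟨K, fun φ hφ m hfin C' hC' => ?_⟩
  have hsub : {w : Rn n | w ∈ Set.Icc (rI m) (rI m + 2) ∧ (C' * nbS 2 (dE L r φ) 0 m).toReal < |φ w|} ⊆
      ⋃ e ∈ bx n 2, ({w | K * eLpNorm φ r (volume.restrict (cell n 0 (m + e))) < ‖φ w‖ₑ} ∩ cell n 0 (m + e)) := by
    rintro w ⟨hw, hlt⟩
    have hidx : ∀ i, |(idx 0 w - m) i| ≤ ((2:ℕ):ℤ) := by
      intro i
      have h1 := hw.1 i
      have h2 := hw.2 i
      simp only [Pi.add_apply, Pi.ofNat_apply, rI] at h1 h2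
      have h3 : m i ≤ idx 0 w i := by
        unfold idx; rw [Int.le_floor]; simpa using h1
      have h4 : idx 0 w i ≤ m i + 2 := by
        have := idx_le (k := 0) w i
        have : ((idx 0 w i : ℤ):ℝ) ≤ ((m i + 2 : ℤ) : ℝ) := by push_cast; simp only [pow_zero, one_mul] at this; linarith
        exact_mod_cast this
      rw [Pi.sub_apply, abs_le]; constructor <;> push_cast <;> linarith
    refine Set.mem_biUnion (mem_bx.2 hidx) ⟨?_, ?_⟩
    · rw [Set.mem_ofPred_eq]
      have h1 : K * eLpNorm φ r (volume.restrict (cell n 0 (m + (idx 0 w - m)))) ≤ C' * nbS 2 (dE L r φ) 0 m := by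
        refine mul_le_mul' (by exact_mod_cast hC') ?_
        have := le_nbS (R := 2) (dE L r φ) (k := 0) (m := m) (m' := idx 0 w) hidx
        rw [show m + (idx 0 w - m) = idx 0 w by abel]
        simpa [dE] using this
      refine h1.trans_lt ?_
      rw [← ENNReal.ofReal_toReal (ENNReal.mul_lt_top coe_lt_top hfin).ne, Real.enorm_eq_ofReal_abs]
      exact (ENNReal.ofReal_lt_ofReal_iff_of_nonneg toReal_nonneg).2 hlt
    · rw [mem_cell]; abel
  refine (measure_mono hsub).trans ((measure_biUnion_finset_le _ _).trans ?_)
  refine (Finset.sum_le_card_nsmul _ _ (η / N) fun e _ => ?_).trans ?_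
  · have := hK (volume.restrict (cell n 0 (m + e))) φ hφ.aestronglyMeasurable
    rwa [Measure.restrict_apply (measurableSet_lt measurable_const hφ.enorm)] at this
  · rw [nsmul_eq_mul, ENNReal.mul_div_cancel hN0 (by simp)]

lemma nuU_Ioo (n : ℕ) : nuU n = (volume.prod volume).restrict
    ((Set.univ.pi fun _ : Fin n => Set.Ioo (0:ℝ) 1) ×ˢ (Set.univ.pi fun _ : Fin n => Set.Ioo (0:ℝ) 1)) := by
  have h : muU n = volume.restrict (Set.univ.pi fun _ : Fin n => Set.Ioo (0:ℝ) 1) := by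
    unfold muU
    exact (Measure.restrict_congr_set (Measure.univ_pi_Ioo_ae_eq_Icc (f := (0 : Rn n)) (g := (1 : Rn n)))).symm
  unfold nuU
  rw [h, Measure.prod_restrict]

lemma LA1 {n : ℕ} (L : ℕ) (hL : 0 < L) {r : ℝ≥0∞} (hr : r ≠ 0) {η : ℝ} (hη : 0 < η) :
    ∃ C : ℝ≥0, ∀ φ : Rn n → ℝ, Measurable φ → ∀ (k : ℕ) (m : Fin n → ℤ), k ≠ 0 → nbS 2 (dE L r φ) k m < ∞ → ∀ C' ≥ C,
      ∃ P ∈ VL n L, muU n {u : Rn n | (C' * nbS 2 (dE L r φ) k m).toReal <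
        |φ (((2 ^ k)⁻¹ : ℝ) • rI m + (2 * (2 ^ k)⁻¹ : ℝ) • u) - P u|} ≤ ENNReal.ofReal η := by
  obtain ⟨ε, hε, hw⟩ := whitney n L hL η hη
  set N := (bx n 2).card with hN
  have hN0 : (N:ℝ≥0∞) ≠ 0 := Nat.cast_ne_zero.2 (bx_pos n 2).ne'
  have hLr : (0:ℝ) < L := by exact_mod_cast hL
  set B : ℝ≥0∞ := ENNReal.ofReal ((L:ℝ) ^ n) * N with hB
  have hB0 : B ≠ 0 := mul_ne_zero (ENNReal.ofReal_pos.2 (by positivity)).ne' hN0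
  have hBt : B ≠ ∞ := ENNReal.mul_ne_top ofReal_ne_top (by simp)
  obtain ⟨K, hK0, hK⟩ := cheb hr (η := ENNReal.ofReal ε / B) (ENNReal.div_pos (by simpa using hε) hBt)
  set εn : ℝ≥0 := ε.toNNReal with hεn
  have hεn0 : εn ≠ 0 := (Real.toNNReal_pos.2 hε).ne'
  refine ⟨K / εn, fun φ hφ k m hk hfin C' hC' => ?_⟩
  set D := dE L r φ
  set M := (C' * nbS 2 D k m).toReal with hM
  have hcn : (C' * nbS 2 D k m) ≠ ∞ := (ENNReal.mul_lt_top coe_lt_top hfin).ne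
  have hk2 : (0:ℝ) < (2 ^ k)⁻¹ := by positivity
  set b : ℝ := 2 * (2 ^ k)⁻¹ with hb
  have hb0 : 0 < b := by positivity
  set a : ℝ := b * (1 / L) with ha
  have ha0 : 0 < a := by positivity
  set c : Rn n := ((2 ^ k)⁻¹ : ℝ) • rI m with hc
  set ψ : Rn n → ℝ := fun u => φ (c + b • u) with hψ
  have hψm : Measurable ψ := hφ.comp (by fun_prop)
  refine hw ψ hψm M toReal_nonneg ?_
  set A : (Fin n → ℤ) → Set (Rn n × Rn n) := fun e => {hx | K * D k (m + e) < ‖diffl L hx.1 φ hx.2‖ₑ} ∩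
    (openCube (0 : Rn n) b ×ˢ cell n k (m + e)) with hA
  have hAs : ∀ e, MeasurableSet {hx : Rn n × Rn n | K * D k (m + e) < ‖diffl L hx.1 φ hx.2‖ₑ} := fun e =>
    measurableSet_lt measurable_const (diffl_meas L hφ).enorm
  have hAm : ∀ e, MeasurableSet (A e) := fun e => (hAs e).inter ((openCube_meas _ _).prod (cell_meas _ _ _))
  have hAv : ∀ e, (volume.prod volume) (A e) ≤ tw (-(2 * (k * n : ℕ))) * (ENNReal.ofReal ε / B) := by
    intro e
    have h1 := hK (muD n k (m + e)) (fun hx => diffl L hx.1 φ hx.2) (diffl_meas L hφ).aestronglyMeasurable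
    have h2 : eLpNorm (fun hx : Rn n × Rn n => diffl L hx.1 φ hx.2) r (muD n k (m + e)) = D k (m + e) := by
      simp only [D, dE, if_neg hk]
    rw [h2] at h1
    unfold muD at h1
    rw [Measure.prod_restrict, Measure.smul_apply, Measure.restrict_apply (hAs e), smul_eq_mul] at h1
    calc (volume.prod volume) (A e) = tw (-(2 * (k * n : ℕ))) * (tw (2 * (k * n : ℕ)) * (volume.prod volume) (A e)) := by
          rw [← mul_assoc, tw_neg_mul, one_mul]
      _ ≤ _ := mul_le_mul' le_rfl h1
  have hUm : MeasurableSet (⋃ e ∈ bx n 2, A e) := Finset.measurableSet_biUnion _ fun e _ => hAm e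
  have hUv : (volume.prod volume) (⋃ e ∈ bx n 2, A e) ≤ N * (tw (-(2 * (k * n : ℕ))) * (ENNReal.ofReal ε / B)) := by
    refine (measure_biUnion_finset_le _ _).trans ?_
    refine (Finset.sum_le_card_nsmul _ _ _ fun e _ => hAv e).trans ?_
    rw [nsmul_eq_mul]
  have hsub : {p : Rn n × Rn n | ε * M < |DD L ψ p.1 p.2|} ∩ ((Set.univ.pi fun _ : Fin n => Set.Ioo (0:ℝ) 1) ×ˢ (Set.univ.pi fun _ : Fin n => Set.Ioo (0:ℝ) 1)) ⊆
      {p : Rn n × Rn n | (a • (p.2 - p.1), c + b • p.1) ∈ ⋃ e ∈ bx n 2, A e} := by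
    rintro ⟨u, v⟩ ⟨h1, hu, hv⟩
    simp only [Set.mem_ofPred_eq] at h1 ⊢
    simp only [Set.mem_pi, Set.mem_univ, true_implies, Set.mem_Ioo] at hu hv
    have hDD : DD L ψ u v = diffl L (a • (v - u)) φ (c + b • u) := by
      unfold DD diffl
      refine Finset.sum_congr rfl fun j _ => ?_
      simp only [hψ]
      congr 2
      rw [ha]
      ext i; simp; ring
    set x := c + b • u with hx
    have h2k : ∀ i, 2 ^ k * x i = m i + 2 * u i := by
      intro i
      simp only [hx, hc, hb, rI, Pi.add_apply, Pi.smul_apply, smul_eq_mul]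
      field_simp
    have hidx : ∀ i, |(idx k x - m) i| ≤ ((2:ℕ):ℤ) := by
      intro i
      have h3 : m i ≤ idx k x i := by
        unfold idx; rw [Int.le_floor, h2k]; linarith [(hu i).1]
      have h4 : idx k x i ≤ m i + 2 := by
        have := idx_le (k := k) x i
        rw [h2k] at this
        have : ((idx k x i : ℤ):ℝ) ≤ ((m i + 2 : ℤ) : ℝ) := by push_cast; linarith [(hu i).2]
        exact_mod_cast this
      rw [Pi.sub_apply, abs_le]; constructor <;> push_cast <;> linarith
    refine Set.mem_biUnion (mem_bx.2 hidx) ⟨?_, ?_, ?_⟩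
    · rw [Set.mem_ofPred_eq]
      rw [show m + (idx k x - m) = idx k x by abel]
      have h5 : K * D k (idx k x) ≤ ENNReal.ofReal ε * (C' * nbS 2 D k m) := by
        rw [← mul_assoc]
        refine mul_le_mul' ?_ (le_nbS (R := 2) D hidx)
        have : K ≤ εn * C' := by
          calc K = εn * (K / εn) := by field_simp
            _ ≤ _ := mul_le_mul' le_rfl hC'
        rw [ENNReal.ofReal]; exact_mod_cast this
      refine h5.trans_lt ?_
      rw [← ENNReal.ofReal_toReal hcn, ← ENNReal.ofReal_mul hε.le, Real.enorm_eq_ofReal_abs]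
      rw [hDD] at h1
      exact (ENNReal.ofReal_lt_ofReal_iff_of_nonneg (mul_nonneg hε.le toReal_nonneg)).2 h1
    · intro i
      simp only [Pi.smul_apply, Pi.sub_apply, smul_eq_mul, Pi.zero_apply, sub_zero]
      rw [abs_mul, abs_of_pos ha0, ha]
      have h7 : |v i - u i| < 1 := by
        rw [abs_lt]; constructor <;> linarith [(hu i).1, (hu i).2, (hv i).1, (hv i).2]
      have h8 : (1:ℝ) / L ≤ 1 := by
        rw [div_le_one hLr]; exact_mod_cast hL
      calc b * (1 / L) * |v i - u i| ≤ b * 1 * |v i - u i| := by gcongr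
        _ < b * 1 * 1 := by gcongr
        _ = b := by ring
    · simp only [mem_cell]; abel
  rw [nuU_Ioo, Measure.restrict_apply (measurableSet_lt measurable_const (DD_measurable L hψm).abs)]
  refine (measure_mono hsub).trans ?_
  rw [vol_Psi c ha0 hb0 hUm]
  refine (mul_le_mul' le_rfl hUv).trans ?_
  have hab : ENNReal.ofReal (a ^ n)⁻¹ * ENNReal.ofReal (b ^ n)⁻¹ ≤ ENNReal.ofReal ((L:ℝ) ^ n) * tw (2 * (k * n : ℕ)) := by
    have h9 : tw (2 * (k * n : ℕ)) = ENNReal.ofReal (2 ^ (2 * (k * n))) := by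
      have := (tw_nat (2 * (k * n))).symm
      push_cast at this ⊢
      rw [this, ENNReal.ofReal_pow (by norm_num)]; simp
    rw [h9, ← ENNReal.ofReal_mul (by positivity), ← ENNReal.ofReal_mul (by positivity)]
    refine ENNReal.ofReal_le_ofReal ?_
    have e1 : (a ^ n)⁻¹ * (b ^ n)⁻¹ = (L:ℝ) ^ n * 2 ^ (2 * (k * n)) * ((1/4) ^ n) := by
      have e2 : (2:ℝ) ^ (2 * (k * n)) = (2 ^ k * 2 ^ k) ^ n := by
        rw [← pow_add, ← pow_mul]; congr 1; ring
      rw [e2, ← mul_pow, ← mul_pow, ← inv_pow, ← inv_pow, ← mul_pow]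
      congr 1
      rw [ha, hb]; field_simp; norm_num
    rw [e1]
    exact mul_le_of_le_one_right (by positivity) (pow_le_one₀ (by norm_num) (by norm_num))
  refine (mul_le_mul' hab le_rfl).trans (le_of_eq ?_)
  calc _ = (tw (-(2 * (k * n : ℕ))) * tw (2 * (k * n : ℕ))) * (B * (ENNReal.ofReal ε / B)) := by rw [hB]; ring
    _ = _ := by rw [tw_neg_mul, one_mul, ENNReal.mul_div_cancel hB0 hBt]


lemma LA {n : ℕ} (L : ℕ) (hL : 0 < L) {r : ℝ≥0∞} (hr : r ≠ 0) {η : ℝ≥0∞} (hη : 0 < η) :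
    ∃ C : ℝ≥0, ∀ φ : Rn n → ℝ, Measurable φ → ∀ (k : ℕ) (m : Fin n → ℤ), nbS 2 (dE L r φ) k m < ∞ →
      ∃ P ∈ VL n L, (k = 0 → P = 0) ∧ volume {w : Rn n | w ∈ Set.Icc (rI m) (rI m + 2) ∧
        (C * nbS 2 (dE L r φ) k m).toReal < |φ (((2 ^ k)⁻¹ : ℝ) • w) - P w|} ≤ η := by
  obtain ⟨ηw, hηw, hηw'⟩ : ∃ e : ℝ, 0 < e ∧ 2 ^ n * ENNReal.ofReal e ≤ η := by
    have h1 : (min η 1) ≠ ∞ := ((min_le_right _ _).trans_lt one_lt_top).ne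
    refine ⟨(min η 1 / 2 ^ n).toReal, ENNReal.toReal_pos ?_ ?_, ?_⟩
    · exact (ENNReal.div_pos (lt_min hη one_pos).ne' (by simp)).ne'
    · exact (ENNReal.div_lt_top h1 (by simp)).ne
    · rw [ENNReal.ofReal_toReal (ENNReal.div_lt_top h1 (by simp)).ne, ENNReal.mul_div_cancel (by simp) (by simp)]
      exact min_le_left _ _
  obtain ⟨C0, h0⟩ := LA0 (n := n) L hr hη
  obtain ⟨C1, h1⟩ := LA1 (n := n) L hL hr hηw
  refine ⟨max C0 C1, fun φ hφ k m hfin => ?_⟩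
  by_cases hk : k = 0
  · subst hk
    refine ⟨0, zero_mem _, fun _ => rfl, ?_⟩
    simpa using h0 φ hφ m hfin _ (le_max_left _ _)
  · obtain ⟨P, hP, hv⟩ := h1 φ hφ k m hk hfin _ (le_max_right C0 C1)
    set M := (((max C0 C1 : ℝ≥0) : ℝ≥0∞) * nbS 2 (dE L r φ) k m).toReal
    have hP' := VL_affine hP (1 / 2) (fun i => -(m i : ℝ) / 2)
    refine ⟨_, hP', fun h => absurd h hk, ?_⟩
    set P' : Rn n → ℝ := fun x => P (fun i => 1 / 2 * x i + -(m i : ℝ) / 2) with hP'd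
    set S := {w : Rn n | w ∈ Set.Icc (rI m) (rI m + 2) ∧ M < |φ (((2 ^ k)⁻¹ : ℝ) • w) - P' w|} with hS
    have hSm : MeasurableSet S := by
      have hS' : S = Set.Icc (rI m) (rI m + 2) ∩ {w | M < |φ (((2 ^ k)⁻¹ : ℝ) • w) - P' w|} := rfl
      rw [hS']
      refine measurableSet_Icc.inter (measurableSet_lt measurable_const (Measurable.abs ?_))
      exact (hφ.comp (measurable_const_smul _)).sub (VL_continuous hP').measurable
    have e1 := vol_aff (rI m) (b := 2) two_pos hSm
    have e2 : volume S = 2 ^ n * volume {u : Rn n | rI m + (2:ℝ) • u ∈ S} := by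
      rw [e1, ← mul_assoc, ENNReal.ofReal_inv_of_pos (by positivity), ENNReal.ofReal_pow (by norm_num)]
      rw [show ENNReal.ofReal 2 = 2 by simp, ENNReal.mul_inv_cancel (by simp) (by simp), one_mul]
    rw [e2]
    refine (mul_le_mul' le_rfl ?_).trans hηw'
    refine le_trans ?_ hv
    unfold muU
    rw [Measure.restrict_apply' measurableSet_Icc]
    refine measure_mono ?_
    rintro u ⟨hu1, hu2⟩
    refine ⟨?_, ?_, ?_⟩
    · rw [Set.mem_ofPred_eq]
      have a1 : P' (rI m + (2:ℝ) • u) = P u := by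
        simp only [hP'd]; congr 1; ext i; simp [rI]; ring
      rw [a1] at hu2
      have a2 : ((2 ^ k)⁻¹ : ℝ) • (rI m + (2:ℝ) • u) = ((2 ^ k)⁻¹ : ℝ) • rI m + (2 * (2 ^ k)⁻¹ : ℝ) • u := by
        rw [smul_add, smul_smul, mul_comm (2:ℝ)]
      rwa [a2] at hu2
    · intro i
      have := hu1.1 i
      simp [rI] at this ⊢; linarith
    · intro i
      have := hu1.2 i
      simp [rI] at this ⊢; linarith


/-- Local polynomial data. -/
structure LAD (n L : ℕ) (η : ℝ≥0∞) (φ : Rn n → ℝ) (Pk : ℕ → (Fin n → ℤ) → Rn n → ℝ)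
    (lam : ℕ → (Fin n → ℤ) → ℝ≥0) : Prop where
  meas : Measurable φ
  mem : ∀ k m, Pk k m ∈ VL n L
  zero : ∀ m, Pk 0 m = 0
  bad : ∀ k m, volume {w : Rn n | w ∈ Set.Icc (rI m) (rI m + 2) ∧
        (lam k m : ℝ) < |φ (((2 ^ k)⁻¹ : ℝ) • w) - Pk k m w|} ≤ η

/-- The Remez property with threshold. -/
def RZ (n L : ℕ) (η : ℝ≥0∞) : Prop := ∀ (s : ℕ) (R : ℝ), 0 ≤ R →
    ∃ K : ℝ, 0 ≤ K ∧ ∀ P ∈ VL n L, ∀ (c : Rn n) (lam : ℝ), 0 ≤ lam →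
    volume {u | u ∈ Set.Icc c (c + 1) ∧ lam < |P u|} ≤ η →
    ∀ (w h : Rn n) (t : ℝ), (∀ i, |w i - c i| ≤ R) → (∀ i, |h i| ≤ t) → 0 ≤ t → t ≤ 2 →
    SB s t (K * lam) (fun b => P (w + (b : ℝ) • h))

lemma SB.congr {s : ℕ} {t A : ℝ} {F G : ℕ → ℝ} (h : SB s t A F) (hFG : ∀ b ≤ s, F b = G b) : SB s t A G := by
  intro i b hib
  have : (fwdDiff 1)^[i] G b = (fwdDiff 1)^[i] F b := by
    rw [fwdDiff_iter_eq_sum_shift, fwdDiff_iter_eq_sum_shift]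
    refine Finset.sum_congr rfl fun j hj => ?_
    have := Finset.mem_range.1 hj
    rw [hFG _ (by simp; omega)]
  rw [this]; exact h i b hib

lemma bad_union {n : ℕ} {φ P Q : Rn n → ℝ} {A : Set (Rn n)} {a b : ℝ} :
    volume {u | u ∈ A ∧ a + b < |P u - Q u|} ≤
      volume {u | u ∈ A ∧ a < |φ u - P u|} + volume {u | u ∈ A ∧ b < |φ u - Q u|} := by
  refine (measure_mono ?_).trans (measure_union_le _ _)
  rintro u ⟨hu, h⟩
  by_contra hc
  simp only [Set.mem_union, Set.mem_ofPred_eq, hu, true_and, not_or, not_lt] at hc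
  have : |P u - Q u| ≤ |φ u - P u| + |φ u - Q u| := by
    rw [abs_sub_comm (φ u) (P u)]; exact abs_sub_le _ _ _
  linarith [hc.1, hc.2]

lemma cmp1 {n L : ℕ} {ηr η : ℝ≥0∞} (hη : η + η ≤ ηr) (hrz : RZ n L ηr) (s : ℕ) (ρ : ℝ) (hρ : 0 ≤ ρ) :
    ∃ K : ℝ, 0 ≤ K ∧ ∀ φ Pk lam, LAD n L η φ Pk lam → ∀ (k : ℕ) (m m' : Fin n → ℤ), (∀ i, |m' i - m i| ≤ 1) →
      ∀ (w h : Rn n) (t : ℝ), (∀ i, |w i - m i| ≤ ρ) → (∀ i, |h i| ≤ t) → 0 ≤ t → t ≤ 2 →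
      SB s t (K * (lam k m' + lam k m)) (fun b => Pk k m' (w + (b : ℝ) • h) - Pk k m (w + (b : ℝ) • h)) := by
  obtain ⟨K, hK, H⟩ := hrz s (ρ + 1) (by linarith)
  refine ⟨K, hK, fun φ Pk lam D k m m' hm w h t hw hh ht ht2 => ?_⟩
  have hm' : ∀ i, |(m' i : ℝ) - m i| ≤ 1 := fun i => by
    have := hm i
    have h2 : ((|m' i - m i| : ℤ) : ℝ) ≤ 1 := by exact_mod_cast this
    simpa using h2
  refine H (fun x => Pk k m' x - Pk k m x) ((VL n L).sub_mem (D.mem k m') (D.mem k m)) (rI m' ⊔ rI m) _ (by positivity) ?_ w h t ?_ hh ht ht2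
  · refine (bad_union (φ := fun w => φ (((2 ^ k)⁻¹ : ℝ) • w))).trans (le_trans (add_le_add ?_ ?_) hη)
    · refine (measure_mono ?_).trans (D.bad k m')
      rintro u ⟨hu, h⟩
      refine ⟨⟨le_sup_left.trans hu.1, hu.2.trans fun i => ?_⟩, h⟩
      have := abs_le.1 (hm' i)
      simp only [Pi.add_apply, Pi.sup_apply, rI, Pi.one_apply, Pi.ofNat_apply]
      have : max (m' i : ℝ) (m i) ≤ m' i + 1 := max_le (by linarith) (by linarith)
      linarith
    · refine (measure_mono ?_).trans (D.bad k m)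
      rintro u ⟨hu, h⟩
      refine ⟨⟨le_sup_right.trans hu.1, hu.2.trans fun i => ?_⟩, h⟩
      have := abs_le.1 (hm' i)
      simp only [Pi.add_apply, Pi.sup_apply, rI, Pi.one_apply, Pi.ofNat_apply]
      have : max (m' i : ℝ) (m i) ≤ m i + 1 := max_le (by linarith) (by linarith)
      linarith
  · intro i
    have h1 := abs_le.1 (hm' i)
    have h2 := abs_le.1 (hw i)
    simp only [Pi.sup_apply, rI]
    have h3 : (m i : ℝ) ≤ max (m' i : ℝ) (m i) := le_max_right _ _
    have h4 : max (m' i : ℝ) (m i) ≤ m i + 1 := max_le (by linarith) (by linarith)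
    rw [abs_le]; constructor <;> linarith

lemma cmpR {n L : ℕ} {ηr η : ℝ≥0∞} (hη : η + η ≤ ηr) (hrz : RZ n L ηr) (s R : ℕ) (ρ : ℝ) (hρ : 0 ≤ ρ) :
    ∃ K : ℝ, 0 ≤ K ∧ ∀ φ Pk lam, LAD n L η φ Pk lam → ∀ (k : ℕ) (m m' : Fin n → ℤ) (Λ : ℝ), (∀ i, |m' i - m i| ≤ (R:ℤ)) →
      (∀ m'', (∀ i, |m'' i - m i| ≤ (R:ℤ)) → lam k m'' ≤ Λ) →
      ∀ (w h : Rn n) (t : ℝ), (∀ i, |w i - m i| ≤ ρ) → (∀ i, |h i| ≤ t) → 0 ≤ t → t ≤ 2 →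
      SB s t (K * Λ) (fun b => Pk k m' (w + (b : ℝ) • h) - Pk k m (w + (b : ℝ) • h)) := by
  induction R with
  | zero =>
    refine ⟨0, le_rfl, fun φ Pk lam D k m m' Λ hm hΛ w h t hw hh ht ht2 => ?_⟩
    have : m' = m := by
      ext i; have := hm i; simp only [Nat.cast_zero, abs_nonpos_iff] at this; omega
    subst this
    simpa using SB.zero
  | succ R ih =>
    obtain ⟨K1, hK1, H1⟩ := ih
    obtain ⟨K2, hK2, H2⟩ := cmp1 hη hrz s (ρ + R) (by positivity)
    refine ⟨K1 + K2 * 2, by positivity, fun φ Pk lam D k m m' Λ hm hΛ w h t hw hh ht ht2 => ?_⟩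
    set m'' : Fin n → ℤ := fun i => max (min (m' i) (m i + R)) (m i - R) with hm''
    have a1 : ∀ i, |m'' i - m i| ≤ (R:ℤ) := fun i => by
      rw [abs_le]
      simp only [hm'']
      omega
    have a2 : ∀ i, |m' i - m'' i| ≤ 1 := fun i => by
      have := abs_le.1 (hm i)
      push_cast at this
      rw [abs_le]
      simp only [hm'']
      omega
    have e1 := H1 φ Pk lam D k m m'' Λ a1 (fun q hq => hΛ q fun i => (hq i).trans (by push_cast; omega)) w h t hw hh ht ht2
    have e2 := H2 φ Pk lam D k m'' m' a2 w h t (fun i => ?_) hh ht ht2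
    · have e3 := (e2.add e1).mono (B := (K1 + K2 * 2) * Λ) ht ?_
      · refine e3.congr fun b _ => by ring
      · have b1 := hΛ m' hm
        have b2 := hΛ m'' fun i => (a1 i).trans (by push_cast; omega)
        have : K2 * (lam k m' + lam k m'') ≤ K2 * (2 * Λ) := by gcongr; linarith
        linarith
    · have : |(m'' i : ℝ) - m i| ≤ R := by
        have := a1 i
        have h2 : ((|m'' i - m i| : ℤ) : ℝ) ≤ ((R:ℤ):ℝ) := by exact_mod_cast this
        simpa using h2
      have h3 := abs_le.1 this
      have h4 := abs_le.1 (hw i)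
      rw [abs_le]; constructor <;> linarith

lemma cmpP {n L : ℕ} {ηr η : ℝ≥0∞} (hη : η + 2 ^ n * η ≤ ηr) (hrz : RZ n L ηr) (s : ℕ) :
    ∃ K : ℝ, 0 ≤ K ∧ ∀ φ Pk lam, LAD n L η φ Pk lam → ∀ (k : ℕ) (y h : Rn n) (t : ℝ),
       (∀ i, |2 ^ (k+1) * h i| ≤ t) → 0 ≤ t → t ≤ 2 →
      SB s t (K * (lam (k+1) (idx (k+1) y) + lam k (idx k y))) (fun b => Pk (k+1) (idx (k+1) y) ((2 ^ (k+1) : ℝ) • (y + (b : ℝ) • h))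
        - Pk k (idx k y) ((2 ^ k : ℝ) • (y + (b : ℝ) • h))) := by
  obtain ⟨K, hK, H⟩ := hrz s 1 (by linarith)
  refine ⟨K, hK, fun φ Pk lam D k y h t hh ht ht2 => ?_⟩
  set m := idx (k+1) y with hm
  set m' := idx k y with hm'
  have hQ := VL_affine (D.mem k m') (1/2) 0
  set Q : Rn n → ℝ := fun x => Pk k m' (fun i => 1 / 2 * x i + (0 : Rn n) i) with hQd
  have hidx : ∀ i, 2 * (m' i : ℝ) ≤ m i ∧ (m i : ℝ) ≤ 2 * m' i + 1 := by
    intro i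
    have h1 := idx_le (k := k+1) y i
    have h2 := idx_lt (k := k+1) y i
    have h3 := idx_le (k := k) y i
    have h4 := idx_lt (k := k) y i
    rw [← hm] at h1 h2
    rw [← hm'] at h3 h4
    rw [pow_succ] at h1 h2
    have a : (2 * m' i : ℤ) < m i + 1 := by
      have : ((2 * m' i : ℤ) : ℝ) < ((m i + 1 : ℤ) : ℝ) := by push_cast; linarith
      exact_mod_cast this
    have b : m i < 2 * m' i + 2 := by
      have : ((m i : ℤ) : ℝ) < ((2 * m' i + 2 : ℤ) : ℝ) := by push_cast; linarith
      exact_mod_cast this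
    have a' : 2 * m' i ≤ m i := by omega
    have b' : m i ≤ 2 * m' i + 1 := by omega
    exact ⟨by exact_mod_cast a', by exact_mod_cast b'⟩
  have hS := H (fun x => Pk (k+1) m x - Q x) ((VL n L).sub_mem (D.mem _ m) hQ) (rI m) (lam (k+1) m + lam k m') (by positivity) ?_
    ((2 ^ (k+1) : ℝ) • y) ((2 ^ (k+1) : ℝ) • h) t ?_ ?_ ht ht2
  · refine hS.congr fun b _ => ?_
    have e1 : (2 ^ (k+1) : ℝ) • y + (b:ℝ) • (2 ^ (k+1) : ℝ) • h = (2 ^ (k+1) : ℝ) • (y + (b : ℝ) • h) := by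
      rw [smul_add, smul_comm]
    rw [e1]
    congr 1
    simp only [hQd]
    congr 1
    ext i
    simp [pow_succ]; ring
  · refine (bad_union (φ := fun w => φ (((2 ^ (k+1))⁻¹ : ℝ) • w))).trans (le_trans (add_le_add ?_ ?_) hη)
    · refine (measure_mono ?_).trans (D.bad (k+1) m)
      rintro u ⟨hu, h⟩
      refine ⟨⟨hu.1, hu.2.trans fun i => ?_⟩, h⟩
      simp only [Pi.add_apply, Pi.one_apply, Pi.ofNat_apply]; linarith
    · set B := {w : Rn n | w ∈ Set.Icc (rI m') (rI m' + 2) ∧ (lam k m' : ℝ) < |φ (((2 ^ k)⁻¹ : ℝ) • w) - Pk k m' w|} with hB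
      have hBm : MeasurableSet B := by
        have hS' : B = Set.Icc (rI m') (rI m' + 2) ∩ {w | (lam k m' : ℝ) < |φ (((2 ^ k)⁻¹ : ℝ) • w) - Pk k m' w|} := rfl
        rw [hS']
        refine measurableSet_Icc.inter (measurableSet_lt measurable_const (Measurable.abs ?_))
        exact (D.meas.comp (measurable_const_smul _)).sub (VL_continuous (D.mem k m')).measurable
      have e2 := vol_aff (0 : Rn n) (b := 1/2) (by norm_num) hBm
      have e3 : ENNReal.ofReal (((1/2 : ℝ) ^ n)⁻¹) = 2 ^ n := by
        rw [← inv_pow, one_div, inv_inv, ENNReal.ofReal_pow (by norm_num)]; simp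
      rw [e3] at e2
      refine le_trans ?_ (mul_le_mul' le_rfl (D.bad k m'))
      rw [← hB, ← e2]
      refine measure_mono ?_
      rintro u ⟨hu, h⟩
      refine ⟨⟨fun i => ?_, fun i => ?_⟩, ?_⟩
      · have := hu.1 i
        simp [rI] at this ⊢; linarith [(hidx i).1]
      · have := hu.2 i
        simp [rI] at this ⊢; linarith [(hidx i).2]
      · have e4 : ((2 ^ k)⁻¹ : ℝ) • (0 + (1/2 : ℝ) • u) = ((2 ^ (k+1))⁻¹ : ℝ) • u := by
          rw [zero_add, smul_smul, pow_succ, mul_inv]; norm_num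
        have e5 : Q u = Pk k m' (0 + (1/2:ℝ) • u) := by
          simp only [hQd]; congr 1; ext i; simp
        rw [e4, ← e5]; exact h
  · intro i
    have h1 := idx_le (k := k+1) y i
    have h2 := idx_lt (k := k+1) y i
    rw [← hm] at h1 h2
    simp only [Pi.smul_apply, smul_eq_mul, rI]
    rw [abs_le]; constructor <;> linarith
  · intro i; exact hh i


/-- partition of unity weights -/
def wt {n : ℕ} (k : ℕ) (m : Fin n → ℤ) (x : Rn n) : ℝ := ∏ i, chi (2 ^ k * x i - m i - 1)

/-- quasi-interpolant -/
def Sk {n : ℕ} (Pk : ℕ → (Fin n → ℤ) → Rn n → ℝ) (k : ℕ) (x : Rn n) : ℝ :=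
  ∑' m, Pk k m ((2 ^ k : ℝ) • x) * wt k m x

/-- index neighbourhood -/
def nb {n : ℕ} (R : ℕ) (m : Fin n → ℤ) : Finset (Fin n → ℤ) := (bx n R).image (fun e => m + e)

lemma mem_nb {n R : ℕ} {m m' : Fin n → ℤ} : m' ∈ nb R m ↔ ∀ i, |m' i - m i| ≤ (R:ℤ) := by
  unfold nb
  rw [Finset.mem_image]
  constructor
  · rintro ⟨e, he, rfl⟩ i
    simpa using mem_bx.1 he i
  · intro h
    exact ⟨m' - m, mem_bx.2 h, by abel⟩

lemma wt_supp {n k : ℕ} {m : Fin n → ℤ} {x : Rn n} (h : wt k m x ≠ 0) (i : Fin n) :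
    |m i - idx k x i| ≤ 1 := by
  have h1 : chi (2 ^ k * x i - m i - 1) ≠ 0 := fun h0 => h (Finset.prod_eq_zero (Finset.mem_univ i) h0)
  have h2 : |2 ^ k * x i - m i - 1| < 1 := by
    by_contra hc
    exact h1 (chi_eq_zero (not_lt.1 hc))
  have h3 := abs_lt.1 h2
  have h4 := idx_le (k := k) x i
  have h5 := idx_lt (k := k) x i
  have a : (m i : ℝ) < ((idx k x i + 1 : ℤ):ℝ) := by push_cast; linarith
  have b : ((idx k x i : ℤ) : ℝ) < ((m i + 2 : ℤ):ℝ) := by push_cast; linarith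
  have a' : m i < idx k x i + 1 := by exact_mod_cast a
  have b' : idx k x i < m i + 2 := by exact_mod_cast b
  rw [abs_le]; omega

lemma wt_supp_near {n k R : ℕ} {m m0 : Fin n → ℤ} {x : Rn n} (h0 : ∀ i, |idx k x i - m0 i| ≤ (R:ℤ)) (h : wt k m x ≠ 0) :
    m ∈ nb (R + 1) m0 := by
  rw [mem_nb]; intro i
  have h1 := abs_le.1 (wt_supp h i)
  have h2 := abs_le.1 (h0 i)
  rw [abs_le]; push_cast; omega

lemma Sk_eq {n k R : ℕ} (Pk : ℕ → (Fin n → ℤ) → Rn n → ℝ) {m0 : Fin n → ℤ} {x : Rn n} (h0 : ∀ i, |idx k x i - m0 i| ≤ (R:ℤ)) :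
    Sk Pk k x = ∑ m ∈ nb (R + 1) m0, Pk k m ((2 ^ k : ℝ) • x) * wt k m x := by
  refine tsum_eq_sum fun m hm => ?_
  by_cases h : wt k m x = 0
  · rw [h, mul_zero]
  · exact absurd (wt_supp_near h0 h) hm

lemma wt_sum {n k R : ℕ} {m0 : Fin n → ℤ} {x : Rn n} (h0 : ∀ i, |idx k x i - m0 i| ≤ (R:ℤ)) :
    ∑ m ∈ nb (R + 1) m0, wt k m x = 1 := by
  have h1 : ∑' m, wt k m x = ∑ m ∈ nb (R + 1) m0, wt k m x := by
    refine tsum_eq_sum fun m hm => ?_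
    by_contra h
    exact hm (wt_supp_near h0 h)
  rw [← h1]
  have h2 : ∑' m, wt k m x = ∑ m ∈ Fintype.piFinset (fun i => Finset.Icc (idx k x i - 1) (idx k x i + 1)), wt k m x := by
    refine tsum_eq_sum fun m hm => ?_
    by_contra h
    refine hm (Fintype.mem_piFinset.2 fun i => Finset.mem_Icc.2 ?_)
    have := abs_le.1 (wt_supp h i)
    omega
  rw [h2]
  unfold wt
  rw [← Finset.prod_univ_sum (fun i => Finset.Icc (idx k x i - 1) (idx k x i + 1)) (fun i (j : ℤ) => chi (2 ^ k * x i - j - 1))]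
  refine Finset.prod_eq_one fun i _ => ?_
  have := chi_sum_block (2 ^ k * x i - 1) (Finset.Icc (idx k x i - 1) (idx k x i + 1)) ?_
  · refine Eq.trans ?_ this
    refine Finset.sum_congr rfl fun j _ => by congr 1; ring
  · intro j hj
    have h3 := abs_lt.1 hj
    have h4 := idx_le (k := k) x i
    have h5 := idx_lt (k := k) x i
    have a : (j : ℝ) < ((idx k x i + 1 : ℤ):ℝ) := by push_cast; linarith
    have b : ((idx k x i : ℤ) : ℝ) < ((j + 2 : ℤ):ℝ) := by push_cast; linarith
    have a' : j < idx k x i + 1 := by exact_mod_cast a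
    have b' : idx k x i < j + 2 := by exact_mod_cast b
    rw [Finset.mem_Icc]; omega

lemma wt_cont {n : ℕ} (k : ℕ) (m : Fin n → ℤ) : Continuous (wt k m) := by
  unfold wt
  refine continuous_finsetProd _ fun i _ => chi_continuous.comp ?_
  fun_prop

lemma Sk_cont {n L : ℕ} {Pk : ℕ → (Fin n → ℤ) → Rn n → ℝ} (h : ∀ k m, Pk k m ∈ VL n L) (k : ℕ) : Continuous (Sk Pk k) := by
  rw [continuous_iff_continuousAt]
  intro x0
  have h1 : ContinuousAt (fun x => ∑ m ∈ nb (1 + 1) (idx k x0), Pk k m ((2 ^ k : ℝ) • x) * wt k m x) x0 := by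
    refine Continuous.continuousAt ?_
    refine continuous_finsetSum _ fun m _ => ((VL_continuous (h k m)).comp (continuous_const_smul _)).mul (wt_cont k m)
  refine h1.congr ?_
  have : Metric.ball x0 ((2 ^ k)⁻¹) ∈ nhds x0 := Metric.ball_mem_nhds _ (by positivity)
  filter_upwards [this] with x hx
  refine (Sk_eq Pk ?_).symm
  refine idx_near_lt fun i => ?_
  have h2 : |x i - x0 i| < (2 ^ k)⁻¹ := (norm_le_pi_norm (x - x0) i).trans_lt (by simpa [dist_eq_norm] using hx)
  calc 2 ^ k * |x i - x0 i| < 2 ^ k * (2 ^ k)⁻¹ := by gcongr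
    _ = ((1:ℕ):ℝ) := by rw [mul_inv_cancel₀ (by positivity)]; simp

lemma S_SB {n L : ℕ} {ηr η : ℝ≥0∞} (hη : η + η ≤ ηr) (hrz : RZ n L ηr) (s : ℕ) :
    ∃ K : ℝ, 0 ≤ K ∧ ∃ R : ℕ, ∀ φ Pk lam, LAD n L η φ Pk lam → ∀ (k : ℕ) (y h : Rn n) (t Λ : ℝ),
      (∀ i, |2 ^ k * h i| ≤ t) → 0 ≤ t → t ≤ 2 → (∀ m'', (∀ i, |m'' i - idx k y i| ≤ (R:ℤ)) → lam k m'' ≤ Λ) →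
      SB s t (K * Λ) (fun b => Sk Pk k (y + (b:ℝ) • h) - Pk k (idx k y) ((2 ^ k : ℝ) • (y + (b : ℝ) • h))) := by
  obtain ⟨K1, hK1, H1⟩ := cmpR hη hrz s (2 * s + 1 + 1) 1 zero_le_one
  obtain ⟨K2, hK2, H2⟩ := bump_SB s chi chi_contDiff chi_compact
  set N := (bx n (2 * s + 1 + 1)).card
  refine ⟨N * (2 ^ s * (K1 * (2 ^ s * K2) ^ n)), by positivity, 2 * s + 1 + 1, fun φ Pk lam D k y h t Λ hh ht ht2 hΛ => ?_⟩
  have hΛ0 : 0 ≤ Λ := (NNReal.coe_nonneg _).trans (hΛ (idx k y) (fun i => by simp; omega))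
  have hSB : SB s t (∑ m ∈ nb (2 * s + 1 + 1) (idx k y), 2 ^ s * (K1 * Λ * (2 ^ s * K2) ^ n))
      (fun b => ∑ m ∈ nb (2 * s + 1 + 1) (idx k y), (Pk k m ((2 ^ k : ℝ) • y + (b:ℝ) • ((2 ^ k : ℝ) • h)) - Pk k (idx k y) ((2 ^ k : ℝ) • y + (b:ℝ) • ((2 ^ k : ℝ) • h))) * wt k m (y + (b:ℝ) • h)) := by
    refine SB.sum _ fun m hm => ?_
    refine SB.mul ht ?_ ?_
    · refine H1 φ Pk lam D k (idx k y) m Λ (mem_nb.1 hm) hΛ _ _ t (fun i => ?_) (fun i => hh i) ht ht2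
      have h1 := idx_le (k := k) y i
      have h2 := idx_lt (k := k) y i
      simp only [Pi.smul_apply, smul_eq_mul]
      rw [abs_le]; constructor <;> linarith
    · have := SB.prod (Finset.univ : Finset (Fin n)) ht (F := fun i (b:ℕ) => chi ((2 ^ k * y i - m i - 1) + b * (2 ^ k * h i)))
        (K := K2) (s := s) (fun i _ => H2 _ _ _ (hh i))
      rw [Finset.card_univ, Fintype.card_fin] at this
      refine this.congr fun b _ => ?_
      unfold wt
      refine Finset.prod_congr rfl fun i _ => ?_
      congr 1
      simp only [Pi.add_apply, Pi.smul_apply, smul_eq_mul]; ring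
  refine (hSB.mono (B := N * (2 ^ s * (K1 * (2 ^ s * K2) ^ n)) * Λ) ht ?_).congr fun b hb => ?_
  · rw [Finset.sum_const, nsmul_eq_mul]
    have : ((nb (2 * s + 1 + 1) (idx k y)).card : ℝ) ≤ N := by
      exact_mod_cast Finset.card_image_le
    calc _ ≤ N * (2 ^ s * (K1 * Λ * (2 ^ s * K2) ^ n)) := by gcongr
      _ = _ := by ring
  · have h0 : ∀ i, |idx k (y + (b:ℝ) • h) i - idx k y i| ≤ ((2 * s + 1 : ℕ) : ℤ) := by
      refine fun i => idx_near (R := 2 * s) (fun i => ?_) i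
      simp only [Pi.add_apply, Pi.smul_apply, smul_eq_mul, add_sub_cancel_left]
      have h1 : 2 ^ k * |(b:ℝ) * h i| = b * |2 ^ k * h i| := by
        rw [abs_mul, abs_mul, abs_of_nonneg (by positivity : (0:ℝ) ≤ b), abs_of_pos (by positivity : (0:ℝ) < 2 ^ k)]; ring
      rw [h1]
      have h2 : (b:ℝ) ≤ s := by exact_mod_cast hb
      calc (b:ℝ) * |2 ^ k * h i| ≤ s * 2 := by gcongr; exact (hh i).trans ht2
        _ = _ := by push_cast; ring
    rw [Sk_eq Pk h0]
    have e1 : (2 ^ k : ℝ) • y + (b:ℝ) • (2 ^ k : ℝ) • h = (2 ^ k : ℝ) • (y + (b : ℝ) • h) := by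
      rw [smul_add, smul_comm]
    simp only [e1, sub_mul, Finset.sum_sub_distrib]
    rw [← Finset.mul_sum, wt_sum h0, mul_one]


def nbN {n : ℕ} (R : ℕ) (lam : ℕ → (Fin n → ℤ) → ℝ≥0) (k : ℕ) (m : Fin n → ℤ) : ℝ≥0 :=
  ∑ e ∈ bx n R, lam k (m + e)

lemma nbN_coe {n : ℕ} (R : ℕ) (lam : ℕ → (Fin n → ℤ) → ℝ≥0) : gE (nbN R lam) = nbS R (gE lam) := by
  funext k m
  unfold gE nbN nbS bx
  push_cast
  rfl

lemma le_nbN {n R : ℕ} (lam : ℕ → (Fin n → ℤ) → ℝ≥0) {k : ℕ} {m m' : Fin n → ℤ}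
    (h : ∀ i, |m' i - m i| ≤ (R : ℤ)) : lam k m' ≤ nbN R lam k m := by
  have := le_nbS (gE lam) (k := k) h
  rw [← nbN_coe] at this
  unfold gE at this
  exact_mod_cast this

/-- value at the parent cube -/
def par {α : Type*} {n : ℕ} (g : ℕ → (Fin n → ℤ) → α) (k : ℕ) (m : Fin n → ℤ) : α :=
  g (k - 1) (idx (k - 1) (rep k m))

lemma par_idx {α : Type*} {n : ℕ} (g : ℕ → (Fin n → ℤ) → α) (k : ℕ) (x : Rn n) :
    par g k (idx k x) = g (k - 1) (idx (k - 1) x) := by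
  unfold par
  rw [idx_coarse (Nat.sub_le k 1) (idx_rep k (idx k x))]

lemma ES_const_mul {n : ℕ} {P Q : ℝ} (hP : 0 < P) (hQ : 0 < Q) (T g : MS n) (c : ℝ≥0∞) :
    ES P Q T (fun k m => c * g k m) = c ^ Q * ES P Q T g := by
  unfold ES
  rw [← ENNReal.tsum_mul_left]
  refine tsum_congr fun k => ?_
  rw [bS_const_mul hP, ENNReal.mul_rpow_of_nonneg _ _ (by positivity), ← ENNReal.rpow_mul]
  congr 2
  field_simp

lemma ES_of_bS {n : ℕ} {P Q : ℝ} (hP : 0 < P) (hQ : 0 < Q) {T g g' : MS n} {C : ℝ≥0∞}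
    (h : ∀ k, bS P T g k ≤ C * bS P T g' k) : ES P Q T g ≤ C ^ (Q / P) * ES P Q T g' := by
  unfold ES
  rw [← ENNReal.tsum_mul_left]
  refine ENNReal.tsum_le_tsum fun k => ?_
  rw [← ENNReal.mul_rpow_of_nonneg _ _ (by positivity)]
  exact ENNReal.rpow_le_rpow (h k) (by positivity)

lemma ES_par {n : ℕ} {P θ α₁ α₂ Q : ℝ} (hP : 0 < P) (hQ : 0 < Q) {T : MS n} (wd : WD n P θ α₁ α₂ T) :
    ∃ C : ℝ≥0∞, C < ∞ ∧ ∀ g : MS n, ES P Q T (par g) ≤ C * ES P Q T g := by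
  obtain ⟨C, hC, H⟩ := t3_int hP wd
  have hs : 0 < Q / P := by positivity
  set C' := C * tw |α₂ * P|
  have hC' : C' < ∞ := ENNReal.mul_lt_top hC (tw_lt_top _)
  have hb : ∀ (g : MS n) (k : ℕ), bS P T (par g) k ≤ C' * bS P T g (k - 1) := by
    intro g k
    rw [← bS_int hP]
    have : ∀ x, sf (par g) k x = sf g (k - 1) x := fun x => par_idx g k x
    simp only [this]
    refine (H g (k - 1) k (Nat.sub_le _ _)).trans ?_
    rw [← mul_assoc]
    refine mul_le_mul' (mul_le_mul' le_rfl (tw_mono ?_)) le_rfl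
    rcases Nat.eq_zero_or_pos k with h | h
    · subst h; simp; positivity
    · rw [Nat.cast_sub h]; simp; rw [← abs_mul]; exact le_abs_self _
  refine ⟨C' ^ (Q / P) * 2, ENNReal.mul_lt_top (ENNReal.rpow_lt_top_of_nonneg hs.le hC'.ne) (by simp), fun g => ?_⟩
  unfold ES
  calc ∑' k, bS P T (par g) k ^ (Q / P) ≤ ∑' k, C' ^ (Q / P) * bS P T g (k - 1) ^ (Q / P) := by
        refine ENNReal.tsum_le_tsum fun k => ?_
        rw [← ENNReal.mul_rpow_of_nonneg _ _ hs.le]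
        exact ENNReal.rpow_le_rpow (hb g k) hs.le
    _ = C' ^ (Q / P) * (bS P T g 0 ^ (Q / P) + ∑' k, bS P T g k ^ (Q / P)) := by
        rw [ENNReal.tsum_mul_left, tsum_eq_zero_add' ENNReal.summable]
        simp
    _ ≤ C' ^ (Q / P) * (∑' k, bS P T g k ^ (Q / P) + ∑' k, bS P T g k ^ (Q / P)) := by
        refine mul_le_mul' le_rfl (add_le_add ?_ le_rfl)
        exact ENNReal.le_tsum (f := fun k => bS P T g k ^ (Q / P)) 0
    _ = _ := by rw [← two_mul, mul_assoc]

/-- the pieces of the decomposition -/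
def vP {n : ℕ} (Pk : ℕ → (Fin n → ℤ) → Rn n → ℝ) (k : ℕ) (x : Rn n) : ℝ := Sk Pk k x - Sk Pk (k - 1) x

def gP {n : ℕ} (C : ℝ≥0) (R : ℕ) (lam : ℕ → (Fin n → ℤ) → ℝ≥0) (k : ℕ) (m : Fin n → ℤ) : ℝ≥0 :=
  C * (nbN R lam k m + par (nbN R lam) k m)

lemma coord_le {n k : ℕ} (h : Rn n) (i : Fin n) : |2 ^ k * h i| ≤ 2 ^ k * ‖h‖ := by
  rw [abs_mul, abs_of_pos (by positivity : (0:ℝ) < 2 ^ k)]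
  exact mul_le_mul_of_nonneg_left (norm_le_pi_norm h i) (by positivity)

lemma dec_P {n L : ℕ} {ηr η : ℝ≥0∞} (hη : η + η ≤ ηr) (hη2 : η + 2 ^ n * η ≤ ηr) (hrz : RZ n L ηr) (s : ℕ) :
    ∃ C : ℝ≥0, 1 ≤ C ∧ ∃ R : ℕ, ∀ φ Pk lam, LAD n L η φ Pk lam → Dec s (vP Pk) (gP C R lam) ∧
      ∀ k x, |Sk Pk k x - Pk k (idx k x) ((2 ^ k : ℝ) • x)| ≤ C * nbN R lam k (idx k x) := by
  obtain ⟨K1, hK1, R, H1⟩ := S_SB hη hrz s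
  obtain ⟨K2, hK2, H2⟩ := cmpP hη2 hrz s
  set C : ℝ≥0 := ⟨1 + K1 + K2, by positivity⟩ with hCd
  have hC : (C:ℝ) = 1 + K1 + K2 := rfl
  refine ⟨C, ?_, R, fun φ Pk lam D => ⟨fun k y h hh => ?_, fun k x => ?_⟩⟩
  · rw [← NNReal.coe_le_coe, hC]; push_cast; linarith
  · have hn : 0 ≤ 2 ^ k * ‖h‖ := by positivity
    rcases k with _ | k
    · have : (fun b : ℕ => vP Pk 0 (y + (b:ℝ) • h)) = fun _ => 0 := by
        funext b; simp [vP]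
      rw [this]
      exact (SB.zero (s := s) (t := 2 ^ 0 * ‖h‖)).mono hn (NNReal.coe_nonneg _)
    · have a1 := H1 φ Pk lam D (k+1) y h (2 ^ (k+1) * ‖h‖) (nbN R lam (k+1) (idx (k+1) y)) (fun i => coord_le h i) hn hh
        (fun m'' hm => by exact_mod_cast le_nbN lam hm)
      have hle : (2:ℝ) ^ k * ‖h‖ ≤ 2 ^ (k+1) * ‖h‖ :=
        mul_le_mul_of_nonneg_right (pow_le_pow_right₀ (by norm_num) (by omega)) (norm_nonneg _)
      have a2 := H1 φ Pk lam D k y h (2 ^ (k+1) * ‖h‖) (nbN R lam k (idx k y)) (fun i => (coord_le h i).trans hle) hn hh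
        (fun m'' hm => by exact_mod_cast le_nbN lam hm)
      have a3 := H2 φ Pk lam D k y h (2 ^ (k+1) * ‖h‖) (fun i => coord_le h i) hn hh
      have a4 := (a1.add a3).sub a2
      have a5 : SB s (2 ^ (k+1) * ‖h‖) _ (fun b : ℕ => vP Pk (k+1) (y + (b:ℝ) • h)) := a4.congr fun b _ => by
        simp only [vP, Nat.add_sub_cancel]
        ring
      refine a5.mono hn ?_
      have e1 : (gP C R lam (k+1) (idx (k+1) y) : ℝ) = (1 + K1 + K2) * (nbN R lam (k+1) (idx (k+1) y) + nbN R lam k (idx k y)) := by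
        unfold gP
        rw [par_idx]
        push_cast
        rw [hC]
      rw [e1]
      have b1 : (lam (k+1) (idx (k+1) y) : ℝ) ≤ nbN R lam (k+1) (idx (k+1) y) := by
        exact_mod_cast le_nbN lam (fun i => by simp)
      have b2 : (lam k (idx k y) : ℝ) ≤ nbN R lam k (idx k y) := by
        exact_mod_cast le_nbN lam (fun i => by simp)
      have c1 : (0:ℝ) ≤ nbN R lam (k+1) (idx (k+1) y) := NNReal.coe_nonneg _
      have c2 : (0:ℝ) ≤ nbN R lam k (idx k y) := NNReal.coe_nonneg _
      have b3 := mul_le_mul_of_nonneg_left (add_le_add b1 b2) hK2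
      linarith
  · have a1 := H1 φ Pk lam D k x 0 0 (nbN R lam k (idx k x)) (fun i => by simp) le_rfl (by norm_num)
        (fun m'' hm => by exact_mod_cast le_nbN lam hm)
    have := a1 0 0 (by omega)
    simp only [Function.iterate_zero, id, pow_zero, mul_one, smul_zero, add_zero] at this
    refine this.trans ?_
    rw [hC]
    have c2 : (0:ℝ) ≤ nbN R lam k (idx k x) := NNReal.coe_nonneg _
    nlinarith

lemma ES_gP {n : ℕ} {P θ α₁ α₂ Q : ℝ} (hP : 0 < P) (hQ : 0 < Q) {T : MS n} (wd : WD n P θ α₁ α₂ T) (C : ℝ≥0) (R : ℕ) :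
    ∃ C' : ℝ≥0∞, C' < ∞ ∧ ∀ lam, ES P Q T (gE (gP C R lam)) ≤ C' * ES P Q T (gE lam) := by
  obtain ⟨C1, hC1, H1⟩ := ES_par (Q := Q) hP hQ wd
  obtain ⟨C2, hC2, H2⟩ := ES_add (Q := Q) hP hQ T
  obtain ⟨C3, hC3, H3⟩ := bS_nb hP wd R
  refine ⟨(C:ℝ≥0∞) ^ Q * (C2 * ((1 + C1) * C3 ^ (Q / P))), ?_, fun lam => ?_⟩
  · refine ENNReal.mul_lt_top (ENNReal.rpow_lt_top_of_nonneg hQ.le (by simp)) (ENNReal.mul_lt_top hC2 (ENNReal.mul_lt_top ?_ ?_))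
    · exact ENNReal.add_lt_top.2 ⟨by simp, hC1⟩
    · exact ENNReal.rpow_lt_top_of_nonneg (by positivity) hC3.ne
  have e : gE (gP C R lam) = fun k m => (C:ℝ≥0∞) * (nbS R (gE lam) k m + par (nbS R (gE lam)) k m) := by
    rw [← nbN_coe]
    funext k m
    unfold gE gP par
    push_cast
    rfl
  rw [e, ES_const_mul hP hQ T (fun k m => nbS R (gE lam) k m + par (nbS R (gE lam)) k m), mul_assoc, mul_assoc, mul_assoc]
  refine mul_le_mul' le_rfl ((H2 _ _).trans (mul_le_mul' le_rfl ?_))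
  have h3 := ES_of_bS (Q := Q) hP hQ (fun k => H3 (gE lam) k)
  calc _ ≤ ES P Q T (nbS R (gE lam)) + C1 * ES P Q T (nbS R (gE lam)) := add_le_add le_rfl (H1 _)
    _ = (1 + C1) * ES P Q T (nbS R (gE lam)) := by ring
    _ ≤ _ := mul_le_mul' le_rfl h3

lemma dE_fin {n : ℕ} {P Q : ℝ} (hP : 0 < P) (hQ : 0 < Q) {T d : MS n} (hT : ∀ k m, 0 < T k m) (h : ES P Q T d < ∞)
    (k : ℕ) (m : Fin n → ℤ) : d k m < ∞ := by
  have h1 : bS P T d k ^ (Q / P) < ∞ := (ENNReal.le_tsum (f := fun k => bS P T d k ^ (Q / P)) k).trans_lt h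
  have h2 : bS P T d k < ∞ := by
    by_contra h0
    rw [not_lt, top_le_iff] at h0
    rw [h0, ENNReal.top_rpow_of_pos (by positivity)] at h1
    exact lt_irrefl _ h1
  have h3 : (T k m * d k m) ^ P < ∞ := (ENNReal.le_tsum (f := fun m => (T k m * d k m) ^ P) m).trans_lt h2
  by_contra h0
  rw [not_lt, top_le_iff] at h0
  rw [h0, ENNReal.mul_top (hT k m).ne', ENNReal.top_rpow_of_pos hP] at h3
  exact lt_irrefl _ h3

/-- approximate continuity -/
def AC {n : ℕ} (φ : Rn n → ℝ) (x : Rn n) : Prop := ∀ ε > 0, ∀ δ : ℝ≥0∞, 0 < δ → ∀ᶠ k : ℕ in atTop,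
  volume {u : Rn n | u ∈ Set.Icc (rI (idx k x)) (rI (idx k x) + 1) ∧ ε < |φ (((2 ^ k)⁻¹ : ℝ) • u) - φ x|} ≤ δ

lemma conv_P {n L : ℕ} (hL : 0 < L) {ηr η : ℝ≥0∞} (hη0 : 0 < η) (hη : η + η ≤ ηr) (hrz : RZ n L ηr)
    {φ Pk lam} (D : LAD n L η φ Pk lam) {x : Rn n} (hx : AC φ x) (hl : Tendsto (fun k => (lam k (idx k x) : ℝ)) atTop (nhds 0)) :
    Tendsto (fun k => Pk k (idx k x) ((2 ^ k : ℝ) • x)) atTop (nhds (φ x)) := by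
  obtain ⟨K, hK, H⟩ := hrz 0 1 zero_le_one
  rw [Metric.tendsto_nhds]
  intro ε hε
  set e := ε / (2 * (K + 1)) with he
  have he0 : 0 < e := by positivity
  filter_upwards [hx e he0 η hη0, hl.eventually_lt_const he0] with k h1 h2
  set m := idx k x with hm
  have hmem : (fun u => Pk k m u - φ x) ∈ VL n L := Submodule.sub_mem _ (D.mem k m) (VL_const hL (φ x))
  have hv : volume {u | u ∈ Set.Icc (rI m) (rI m + 1) ∧ e + e < |Pk k m u - φ x|} ≤ ηr := by
    refine le_trans ?_ hη
    refine le_trans (measure_mono (t := {w : Rn n | w ∈ Set.Icc (rI m) (rI m + 2) ∧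
        (lam k m : ℝ) < |φ (((2 ^ k)⁻¹ : ℝ) • w) - Pk k m w|} ∪ {u : Rn n | u ∈ Set.Icc (rI m) (rI m + 1) ∧ e < |φ (((2 ^ k)⁻¹ : ℝ) • u) - φ x|}) ?_)
      ((measure_union_le _ _).trans (add_le_add (D.bad k m) h1))
    rintro u ⟨hu, hu2⟩
    by_cases hc : e < |φ (((2 ^ k)⁻¹ : ℝ) • u) - φ x|
    · exact Or.inr ⟨hu, hc⟩
    · refine Or.inl ⟨⟨hu.1, hu.2.trans ?_⟩, ?_⟩
      · intro i; simp
      · push Not at hc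
        by_contra h3
        push Not at h3
        have := abs_sub_le (Pk k m u) (φ (((2 ^ k)⁻¹ : ℝ) • u)) (φ x)
        rw [abs_sub_comm (Pk k m u) (φ (((2 ^ k)⁻¹ : ℝ) • u))] at this
        linarith
  have := H _ hmem (rI m) (e + e) (by positivity) hv ((2 ^ k : ℝ) • x) 0 0 (fun i => by
      have h1 := idx_le (k := k) x i
      have h2 := idx_lt (k := k) x i
      simp only [Pi.smul_apply, smul_eq_mul, rI]
      rw [abs_le]; constructor <;> linarith) (fun i => by simp) le_rfl (by norm_num) 0 0 (by omega)
  simp only [Function.iterate_zero, id, pow_zero, mul_one, smul_zero, add_zero] at this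
  rw [Real.dist_eq]
  refine this.trans_lt ?_
  have : (K + 1) * (e + e) = ε := by rw [he]; field_simp; norm_num
  nlinarith

lemma sc_ball {n k : ℕ} {x u : Rn n} (hu : u ∈ Set.Icc (rI (idx k x)) (rI (idx k x) + 1)) :
    ((2 ^ k)⁻¹ : ℝ) • u ∈ Metric.closedBall x ((2 ^ k)⁻¹ : ℝ) := by
  rw [Metric.mem_closedBall, dist_pi_le_iff (by positivity)]
  intro i
  have h1 := idx_le (k := k) x i
  have h2 := idx_lt (k := k) x i
  have h3 : (idx k x i : ℝ) ≤ u i := hu.1 i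
  have h4 : u i ≤ idx k x i + 1 := hu.2 i
  rw [Real.dist_eq]
  simp only [Pi.smul_apply, smul_eq_mul]
  have e : (2 ^ k)⁻¹ * u i - x i = (2 ^ k)⁻¹ * (u i - 2 ^ k * x i) := by field_simp
  rw [e, abs_mul, abs_of_pos (by positivity : (0:ℝ) < (2 ^ k)⁻¹)]
  refine mul_le_of_le_one_right (by positivity) ?_
  rw [abs_le]; constructor <;> linarith

lemma half_tendsto : Tendsto (fun k : ℕ => ((2 ^ k)⁻¹ : ℝ)) atTop (nhdsWithin 0 (Set.Ioi 0)) := by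
  refine tendsto_nhdsWithin_iff.2 ⟨?_, Eventually.of_forall fun k => Set.mem_Ioi.2 (by positivity)⟩
  have := tendsto_pow_atTop_nhds_zero_of_lt_one (r := (1/2 : ℝ)) (by norm_num) (by norm_num)
  refine this.congr fun k => ?_
  rw [one_div, inv_pow]

lemma AC_cont {n : ℕ} {φ : Rn n → ℝ} (h : Continuous φ) (x : Rn n) : AC φ x := by
  intro ε hε δ hδ
  obtain ⟨d, hd, hd2⟩ := Metric.continuous_iff.1 h x ε hε
  have := (tendsto_nhdsWithin_iff.1 half_tendsto).1.eventually_lt_const hd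
  filter_upwards [this] with k hk
  have : {u : Rn n | u ∈ Set.Icc (rI (idx k x)) (rI (idx k x) + 1) ∧ ε < |φ (((2 ^ k)⁻¹ : ℝ) • u) - φ x|} = ∅ := by
    refine Set.eq_empty_iff_forall_notMem.2 fun u hu => ?_
    have h1 := hd2 _ ((Metric.mem_closedBall.1 (sc_ball hu.1)).trans_lt hk)
    rw [Real.dist_eq] at h1
    exact absurd hu.2 (by linarith)
  rw [this]; simp

lemma arctan_gap (a ε : ℝ) (hε : 0 < ε) : ∃ c > 0, ∀ b, ε < |b - a| → c ≤ |Real.arctan b - Real.arctan a| := by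
  have h1 : Real.arctan a < Real.arctan (a + ε) := Real.arctan_strictMono (by linarith)
  have h2 : Real.arctan (a - ε) < Real.arctan a := Real.arctan_strictMono (by linarith)
  refine ⟨min (Real.arctan (a + ε) - Real.arctan a) (Real.arctan a - Real.arctan (a - ε)), lt_min (by linarith) (by linarith), fun b hb => ?_⟩
  rcases lt_abs.1 hb with h | h
  · have := Real.arctan_strictMono.monotone (show a + ε ≤ b by linarith)
    exact (min_le_left _ _).trans (le_trans (by linarith) (le_abs_self _))
  · have := Real.arctan_strictMono.monotone (show b ≤ a - ε by linarith)
    exact (min_le_right _ _).trans (le_trans (by linarith) (neg_le_abs (Real.arctan b - Real.arctan a)))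

lemma AC_meas {n : ℕ} {φ : Rn n → ℝ} (h : Measurable φ) : ∀ᵐ x, AC φ x := by
  have hloc : LocallyIntegrable (fun x => Real.arctan (φ x)) (volume : Measure (Rn n)) := by
    have hm : Measurable (fun x => Real.arctan (φ x)) := Real.measurable_arctan.comp h
    have hc : LocallyIntegrable (fun _ : Rn n => (2 : ℝ)) (volume : Measure (Rn n)) := locallyIntegrable_const 2
    refine hc.mono hm.aestronglyMeasurable (Eventually.of_forall fun x => ?_)
    rw [Real.norm_eq_abs, Real.norm_eq_abs, abs_of_pos (by norm_num : (0:ℝ) < 2), abs_le]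
    have := Real.neg_pi_div_two_lt_arctan (φ x)
    have := Real.arctan_lt_pi_div_two (φ x)
    have := Real.pi_lt_four
    constructor <;> linarith
  filter_upwards [(IsUnifLocDoublingMeasure.vitaliFamily (volume : Measure (Rn n)) 1).ae_tendsto_lintegral_enorm_sub_div hloc] with x hx
  have hx2 := hx.comp (IsUnifLocDoublingMeasure.tendsto_closedBall_filterAt volume (fun _ : ℕ => x) (fun k : ℕ => ((2 ^ k)⁻¹ : ℝ)) half_tendsto
    (Eventually.of_forall fun k => Metric.mem_closedBall_self (by positivity)))
  intro ε hε δ hδ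
  obtain ⟨c, hc, hgap⟩ := arctan_gap (φ x) ε hε
  have hx3 : Tendsto (fun k : ℕ => 2 ^ n * (ENNReal.ofReal c)⁻¹ * ((∫⁻ y in Metric.closedBall x ((2 ^ k)⁻¹ : ℝ), ‖Real.arctan (φ y) - Real.arctan (φ x)‖ₑ) /
      volume (Metric.closedBall x ((2 ^ k)⁻¹ : ℝ)))) atTop (nhds 0) := by
    have := ENNReal.Tendsto.const_mul (a := 2 ^ n * (ENNReal.ofReal c)⁻¹) hx2 (Or.inr (ENNReal.mul_ne_top (by simp) (by simp [hc])))
    simpa using this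
  filter_upwards [hx3.eventually_le_const hδ] with k hk
  refine le_trans ?_ hk
  set B := Metric.closedBall x ((2 ^ k)⁻¹ : ℝ)
  set A := {y | y ∈ B ∧ ENNReal.ofReal c ≤ ‖Real.arctan (φ y) - Real.arctan (φ x)‖ₑ} with hA
  have hm : Measurable (fun y => ‖Real.arctan (φ y) - Real.arctan (φ x)‖ₑ) :=
    ((Real.measurable_arctan.comp h).sub_const _).enorm
  have hAm : MeasurableSet A := Metric.isClosed_closedBall.measurableSet.inter (measurableSet_le measurable_const hm)
  have h1 : volume {u : Rn n | u ∈ Set.Icc (rI (idx k x)) (rI (idx k x) + 1) ∧ ε < |φ (((2 ^ k)⁻¹ : ℝ) • u) - φ x|} ≤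
      ENNReal.ofReal ((((2 ^ k)⁻¹ : ℝ) ^ n)⁻¹) * volume A := by
    rw [← vol_aff 0 (by positivity) hAm]
    refine measure_mono fun u hu => ?_
    rw [Set.mem_ofPred_eq, zero_add]
    refine ⟨sc_ball hu.1, ?_⟩
    rw [Real.enorm_eq_ofReal_abs]
    exact ENNReal.ofReal_le_ofReal (hgap _ hu.2)
  have h2 : ENNReal.ofReal c * volume A ≤ ∫⁻ y in B, ‖Real.arctan (φ y) - Real.arctan (φ x)‖ₑ := by
    have := mul_meas_ge_le_lintegral (μ := volume.restrict B) hm (ENNReal.ofReal c)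
    rw [Measure.restrict_apply (measurableSet_le measurable_const hm)] at this
    refine le_trans (mul_le_mul' le_rfl (measure_mono ?_)) this
    rintro y ⟨hy1, hy2⟩; exact ⟨hy2, hy1⟩
  have hB : volume B = 2 ^ n * ENNReal.ofReal (((2 ^ k)⁻¹ : ℝ) ^ n) := by
    rw [Real.volume_pi_closedBall _ (by positivity), mul_pow, ENNReal.ofReal_mul (by positivity), Fintype.card_fin,
      ENNReal.ofReal_pow (by norm_num)]
    simp
  refine h1.trans ?_
  have hc0 : ENNReal.ofReal c ≠ 0 := by simp [hc]
  have h3 : volume A ≤ (ENNReal.ofReal c)⁻¹ * ∫⁻ y in B, ‖Real.arctan (φ y) - Real.arctan (φ x)‖ₑ := by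
    rw [← ENNReal.div_eq_inv_mul, ENNReal.le_div_iff_mul_le (Or.inl hc0) (Or.inl ofReal_ne_top), mul_comm]
    exact h2
  refine (mul_le_mul' le_rfl h3).trans (le_of_eq ?_)
  rw [hB, div_eq_mul_inv, ENNReal.mul_inv (Or.inl (by simp)) (Or.inl (by simp)), ENNReal.ofReal_inv_of_pos (by positivity)]
  have : (2:ℝ≥0∞) ^ n * ((2:ℝ≥0∞) ^ n)⁻¹ = 1 := ENNReal.mul_inv_cancel (by simp) (by simp)
  set I := ∫⁻ y in B, ‖Real.arctan (φ y) - Real.arctan (φ x)‖ₑ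
  set b := (ENNReal.ofReal (((2 ^ k)⁻¹ : ℝ) ^ n))⁻¹
  set ci := (ENNReal.ofReal c)⁻¹
  calc b * (ci * I) = ((2:ℝ≥0∞) ^ n * ((2:ℝ≥0∞) ^ n)⁻¹) * (b * (ci * I)) := by rw [this, one_mul]
    _ = _ := by ring

/-- Proposition A: the multiscale decomposition. -/
lemma propA {n : ℕ} {P θ α₁ α₂ Q : ℝ} (hP : 0 < P) (hQ : 0 < Q) {T : MS n} (wd : WD n P θ α₁ α₂ T) (L : ℕ) (hL : 0 < L)
    {r : ℝ≥0∞} (hr : r ≠ 0) (s : ℕ) :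
    ∃ C : ℝ≥0∞, C < ∞ ∧ ∀ φ : Rn n → ℝ, Measurable φ → ES P Q T (dE L r φ) < ∞ →
      ∃ (v : ℕ → Rn n → ℝ) (g : ℕ → (Fin n → ℤ) → ℝ≥0), (∀ k, Continuous (v k)) ∧ Dec s v g ∧
        ES P Q T (gE g) ≤ C * ES P Q T (dE L r φ) ∧
        ∀ x, AC φ x → ∑' k, sf (gE g) k x < ∞ → HasSum (fun k => v k x) (φ x) := by
  obtain ⟨ηr, hηr, hrz⟩ := remez n L hL
  have hrz : RZ n L ηr := hrz
  obtain ⟨η, hη0, hη1, hη2⟩ : ∃ η : ℝ≥0∞, 0 < η ∧ η + η ≤ ηr ∧ η + 2 ^ n * η ≤ ηr := by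
    refine ⟨ηr / (1 + 2 ^ n), ENNReal.div_pos hηr.ne' (by simp), ?_, ?_⟩
    · rw [← two_mul]
      refine le_trans (mul_le_mul' (show (2:ℝ≥0∞) ≤ 1 + 2 ^ n from ?_) le_rfl) ENNReal.mul_div_le
      rw [← one_add_one_eq_two]
      exact add_le_add le_rfl (one_le_pow₀ (by simp))
    · have : ηr / (1 + 2 ^ n) + 2 ^ n * (ηr / (1 + 2 ^ n)) = (1 + 2 ^ n) * (ηr / (1 + 2 ^ n)) := by ring
      rw [this]
      exact ENNReal.mul_div_le
  obtain ⟨C0, h0⟩ := LA (n := n) L hL hr hη0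
  obtain ⟨C1, hC1, R, h1⟩ := dec_P hη1 hη2 hrz s
  obtain ⟨C2, hC2, h2⟩ := ES_gP (Q := Q) hP hQ wd C1 R
  obtain ⟨C3, hC3, h3⟩ := bS_nb hP wd 2
  refine ⟨C2 * ((C0:ℝ≥0∞) ^ Q * C3 ^ (Q / P)), ENNReal.mul_lt_top hC2 (ENNReal.mul_lt_top
    (ENNReal.rpow_lt_top_of_nonneg hQ.le (by simp)) (ENNReal.rpow_lt_top_of_nonneg (by positivity) hC3.ne)), fun φ hφ hE => ?_⟩
  have hfin : ∀ k m, nbS 2 (dE L r φ) k m < ∞ := fun k m => by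
    unfold nbS
    exact ENNReal.sum_lt_top.2 fun e _ => dE_fin hP hQ wd.pos hE k _
  set lam : ℕ → (Fin n → ℤ) → ℝ≥0 := fun k m => ((C0:ℝ≥0∞) * nbS 2 (dE L r φ) k m).toNNReal with hlam
  choose Pk hPk1 hPk2 hPk3 using fun k m => h0 φ hφ k m (hfin k m)
  have D : LAD n L η φ Pk lam := ⟨hφ, hPk1, fun m => hPk2 0 m rfl, hPk3⟩
  obtain ⟨hdec, hnear⟩ := h1 φ Pk lam D
  have hS0 : ∀ x, Sk Pk 0 x = 0 := fun x => by
    unfold Sk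
    simp [hPk2 0 _ rfl]
  refine ⟨vP Pk, gP C1 R lam, fun k => (Sk_cont hPk1 k).sub (Sk_cont hPk1 (k-1)), hdec, ?_, fun x hx hs => ?_⟩
  · refine (h2 lam).trans ?_
    rw [mul_assoc, mul_assoc]
    refine mul_le_mul' le_rfl ?_
    have : gE lam = fun k m => (C0:ℝ≥0∞) * nbS 2 (dE L r φ) k m := by
      funext k m
      simp only [gE, hlam]
      exact ENNReal.coe_toNNReal (ENNReal.mul_lt_top (by simp) (hfin k m)).ne
    rw [this, ES_const_mul hP hQ]
    exact mul_le_mul' le_rfl (ES_of_bS hP hQ (h3 _))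
  · have hsum := hdec.summable hs
    have hg0 : Tendsto (fun k => (gP C1 R lam k (idx k x) : ℝ)) atTop (nhds 0) := by
      have := ENNReal.tendsto_atTop_zero_of_tsum_ne_top hs.ne
      have h4 := (ENNReal.tendsto_toReal (by simp)).comp this
      simpa [Function.comp_def, sf, gE] using h4
    have hle : ∀ k, (C1:ℝ) * nbN R lam k (idx k x) ≤ gP C1 R lam k (idx k x) := fun k => by
      unfold gP
      push_cast
      exact mul_le_mul_of_nonneg_left (le_add_of_nonneg_right (NNReal.coe_nonneg _)) (NNReal.coe_nonneg _)
    have hC1' : (1:ℝ) ≤ C1 := by exact_mod_cast hC1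
    have hl : Tendsto (fun k => (lam k (idx k x) : ℝ)) atTop (nhds 0) := by
      refine squeeze_zero (fun k => NNReal.coe_nonneg _) (fun k => ?_) hg0
      have : (lam k (idx k x) : ℝ) ≤ nbN R lam k (idx k x) := by
        exact_mod_cast le_nbN lam (fun i => by simp)
      refine (this.trans ?_).trans (hle k)
      exact le_mul_of_one_le_left (NNReal.coe_nonneg _) hC1'
    have hc := conv_P hL hη0 hη1 hrz D hx hl
    have hd : Tendsto (fun k => Sk Pk k x - Pk k (idx k x) ((2 ^ k : ℝ) • x)) atTop (nhds 0) :=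
      squeeze_zero_norm (fun k => (hnear k x).trans (hle k)) hg0
    have hS : Tendsto (fun k => Sk Pk k x) atTop (nhds (φ x)) := by
      have := hd.add hc
      simpa using this
    have hpart : ∀ k, ∑ i ∈ Finset.range (k+1), vP Pk i x = Sk Pk k x := by
      intro k
      rw [Finset.sum_range_succ']
      simp only [vP, Nat.add_sub_cancel, Nat.zero_sub, sub_self, add_zero]
      rw [Finset.sum_range_sub (fun i => Sk Pk i x), hS0, sub_zero]
    have ht := (hsum.hasSum.tendsto_sum_nat).comp (tendsto_add_atTop_nat 1)
    have : Tendsto (fun k => Sk Pk k x) atTop (nhds (∑' k, vP Pk k x)) := ht.congr hpart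
    rw [tendsto_nhds_unique hS this]
    exact hsum.hasSum

def emb {n' : ℕ} (n'' : ℕ) (x : Rn n') : Rn (n' + n'') := Fin.append x (0 : Fin n'' → ℝ)

/-- restriction of a multiple sequence to the plane -/
def rs {α : Type*} {n' n'' : ℕ} (g : ℕ → (Fin (n' + n'') → ℤ) → α) (k : ℕ) (m : Fin n' → ℤ) : α :=
  g k (Fin.append m (0 : Fin n'' → ℤ))

lemma idx_emb {n' n'' : ℕ} (k : ℕ) (x : Rn n') : idx k (emb n'' x) = Fin.append (idx k x) (0 : Fin n'' → ℤ) := by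
  funext i
  refine Fin.addCases (fun i => ?_) (fun i => ?_) i
  · simp [idx, emb]
  · simp [idx, emb]

lemma emb_norm {n' n'' : ℕ} (x : Rn n') : ‖emb n'' x‖ = ‖x‖ := by
  refine le_antisymm ?_ ?_
  · rw [pi_norm_le_iff_of_nonneg (norm_nonneg _)]
    intro i
    refine Fin.addCases (fun i => ?_) (fun i => ?_) i
    · simpa [emb] using norm_le_pi_norm x i
    · simp [emb]
  · rw [pi_norm_le_iff_of_nonneg (norm_nonneg _)]
    intro i
    simpa [emb] using norm_le_pi_norm (emb n'' x) (Fin.castAdd n'' i)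

lemma emb_add_smul {n' n'' : ℕ} (x h : Rn n') (b : ℝ) : emb n'' (x + b • h) = emb n'' x + b • emb n'' h := by
  funext i
  refine Fin.addCases (fun i => ?_) (fun i => ?_) i <;> simp [emb]

lemma emb_cont {n' n'' : ℕ} : Continuous (emb (n' := n') n'') := by
  refine continuous_pi fun i => ?_
  refine Fin.addCases (fun i => ?_) (fun i => ?_) i
  · simpa [emb] using continuous_apply i
  · simpa [emb] using continuous_const

lemma Dec.restrict {n' n'' s : ℕ} {v : ℕ → Rn (n' + n'') → ℝ} {g : ℕ → (Fin (n' + n'') → ℤ) → ℝ≥0} (h : Dec s v g) :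
    Dec s (fun k x => v k (emb n'' x)) (rs g) := by
  intro k y z hz
  have := h k (emb n'' y) (emb n'' z) (by rwa [emb_norm])
  rw [emb_norm, idx_emb] at this
  simp only [emb_add_smul]
  exact this

lemma ES_rs {n' n'' : ℕ} {P Q : ℝ} (hP : 0 < P) (hQ : 0 < Q) (T g : MS (n' + n'')) :
    ES P Q (rs T : MS n') (rs g) ≤ ES P Q T g := by
  unfold ES
  refine ENNReal.tsum_le_tsum fun k => ENNReal.rpow_le_rpow ?_ (by positivity)
  unfold bS
  refine ENNReal.tsum_comp_le_tsum_of_injective (f := fun m' : Fin n' → ℤ => Fin.append m' (0 : Fin n'' → ℤ)) ?_ (fun m => (T k m * g k m) ^ P)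
  intro a b hab
  funext i
  simpa using congrFun hab (Fin.castAdd n'' i)

lemma gE_add {n : ℕ} (g g' : ℕ → (Fin n → ℤ) → ℝ≥0) : gE (fun k m => g k m + g' k m) = fun k m => gE g k m + gE g' k m := by
  funext k m; simp [gE]

lemma propR {n' n'' : ℕ} {P θ α₁ α₂ θ' α'₁ α'₂ Q : ℝ} (hQ : 0 < Q) {T : MS (n' + n'')} {r r' : ℝ≥0∞} {l l' : ℕ}
    (G : GH (n' + n'') P θ α₁ α₂ T r l) (G' : GH n' P θ' α'₁ α'₂ (rs T) r' l') :
    ∃ C : ℝ≥0∞, C < ∞ ∧ ∀ F : Rn (n' + n'') → ℝ, Continuous F → ES P Q T (dE l r F) < ∞ →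
      ∃ w g, Dec l' w g ∧ ES P Q (rs T : MS n') (gE g) ≤ C * ES P Q T (dE l r F) ∧
        ∀ᵐ x, HasSum (fun k => w k x) (F (emb n'' x)) := by
  obtain ⟨C, hC, H⟩ := propA (Q := Q) G.hP hQ G.wd l G.alpha G.hr l'
  refine ⟨C, hC, fun F hF hE => ?_⟩
  obtain ⟨v, g, hv, hd, hg, hs⟩ := H F hF.measurable hE
  have hg' : ES P Q (rs T : MS n') (gE (rs g)) ≤ C * ES P Q T (dE l r F) :=
    (ES_rs (n' := n') G.hP hQ T (gE g)).trans hg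
  refine ⟨_, _, hd.restrict, hg', ?_⟩
  filter_upwards [ae_fin G' hQ _ (hg'.trans_lt (ENNReal.mul_lt_top hC hE))] with x hx
  refine hs _ (AC_cont hF _) ?_
  have : ∀ k, sf (gE g) k (emb n'' x) = sf (gE (rs g)) k x := fun k => by
    unfold sf
    rw [idx_emb]
    rfl
  simpa only [this] using hx

lemma ibt {n' n'' : ℕ} {p q : ℝ≥0∞} (hp0 : 0 < p) (hp : p < ∞) (hq0 : 0 < q) (hq : q < ∞) {θ α₁ α₂ θ' α'₁ α'₂ : ℝ}
    {T : MS (n' + n'')} {r r' : ℝ≥0∞} {l l' : ℕ}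
    (G : GH (n' + n'') p.toReal θ α₁ α₂ T r l) (G' : GH n' p.toReal θ' α'₁ α'₂ (rs T) r' l')
    {W : ℕ → Rn (n' + n'') → ℝ≥0∞} (ww : WW (n' + n'') p.toReal T W) {W' : ℕ → Rn n' → ℝ≥0∞} (ww' : WW n' p.toReal (rs T) W') :
    ∃ C : ℝ≥0∞, C < ∞ ∧ ∀ (V : ℕ → Rn (n' + n'') → ℝ) (g : ℕ → (Fin (n' + n'') → ℤ) → ℝ≥0) (g' : ℕ → (Fin n' → ℤ) → ℝ≥0)
      (φ : Rn (n' + n'') → ℝ) (φ' : Rn n' → ℝ), (∀ k, Continuous (V k)) → Dec l V g → ES p.toReal q.toReal T (gE g) < ∞ →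
      Dec l' (fun k x => V k (emb n'' x)) g' → ES p.toReal q.toReal (rs T : MS n') (gE g') < ∞ →
      Measurable φ → (∀ᵐ x, HasSum (fun k => V k x) (φ x)) → (∀ᵐ x, HasSum (fun k => V k (emb n'' x)) (φ' x)) →
      ∀ S : Rn (n' + n'') → ℝ, Continuous S → tildeBnormE (n' + n'') l p q r W (fun x => φ x - S x) < ∞ →
        tildeBnormE n' l' p q r' W' (fun x => φ' x - S (emb n'' x)) ^ q.toReal ≤
          C * tildeBnormE (n' + n'') l p q r W (fun x => φ x - S x) ^ q.toReal := by
  have hP := ENNReal.toReal_pos hp0.ne' hp.ne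
  have hQ := ENNReal.toReal_pos hq0.ne' hq.ne
  obtain ⟨C1, hC1, H1⟩ := E_le (n := n' + n'') hp0 hp hq0 hq l G.hr
  obtain ⟨C2, hC2, H2⟩ := propA hP hQ G.wd l G.alpha G.hr l
  obtain ⟨C3, hC3, H3⟩ := propB hp0 hp hq0 hq G
  obtain ⟨C4, hC4, H4⟩ := ES_add hP hQ T
  obtain ⟨C5, hC5, H5⟩ := propR hQ G G'
  obtain ⟨C6, hC6, H6⟩ := propB hp0 hp hq0 hq G'
  obtain ⟨C7, hC7, H7⟩ := ES_add hP hQ (rs T : MS n')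
  refine ⟨C6 * (C7 * (C5 * (C1 * (C3 * (C4 * (C2 * C1)))))), ?_, ?_⟩
  · repeat' refine ENNReal.mul_lt_top ?_ ?_
    all_goals assumption
  intro V g g' φ φ' hVc hV hg hV' hg' hφ hs hs' S hS hN
  set N := tildeBnormE (n' + n'') l p q r W (fun x => φ x - S x)
  have hNq : N ^ q.toReal < ∞ := ENNReal.rpow_lt_top_of_nonneg hQ.le hN.ne
  have hE := H1 T W ww (fun x => φ x - S x)
  have hE' := hE.trans_lt (ENNReal.mul_lt_top hC1 hNq)
  obtain ⟨u, gu, -, hu, hgu, hus⟩ := H2 _ (hφ.sub hS.measurable) hE'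
  have hgu2 : ES p.toReal q.toReal T (gE gu) ≤ C2 * (C1 * N ^ q.toReal) := hgu.trans (mul_le_mul' le_rfl hE)
  have hgu3 := hgu2.trans_lt (ENNReal.mul_lt_top hC2 (ENNReal.mul_lt_top hC1 hNq))
  have hus2 : ∀ᵐ x, HasSum (fun k => u k x) (φ x - S x) := by
    filter_upwards [AC_meas (hφ.sub hS.measurable), ae_fin G hQ _ hgu3] with x h1 h2
    exact hus x h1 h2
  set a : ℕ → ℝ≥0∞ := fun K => ES p.toReal q.toReal T (gE (fun k m => if K ≤ k then g k m else 0))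
  set a' : ℕ → ℝ≥0∞ := fun K => ES p.toReal q.toReal (rs T : MS n') (gE (fun k m => if K ≤ k then g' k m else 0))
  have ha : Tendsto a atTop (nhds 0) := ES_tail hP hQ T g hg
  have ha' : Tendsto a' atTop (nhds 0) := ES_tail hP hQ _ g' hg'
  have hafin : ∀ K, a K < ∞ := fun K => (ES_mono hP hQ (fun k m => by
    show ((if K ≤ k then g k m else 0 : ℝ≥0) : ℝ≥0∞) ≤ (g k m : ℝ≥0∞)
    split_ifs <;> simp)).trans_lt hg
  have main : ∀ K, tildeBnormE n' l' p q r' W' (fun x => φ' x - S (emb n'' x)) ^ q.toReal ≤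
      C6 * (C7 * (C5 * (C1 * (C3 * (C4 * (C2 * (C1 * N ^ q.toReal) + a K)))) + a' K)) := by
    intro K
    set A : Rn (n' + n'') → ℝ := fun x => ∑ k ∈ Finset.range K, V k x
    have hA : Continuous A := continuous_finsetSum _ fun k _ => hVc k
    have d1 := hu.add (hV.tail K).neg
    have s1 : ∀ᵐ x, HasSum (fun k => u k x + - (if K ≤ k then V k x else 0)) (A x - S x) := by
      filter_upwards [hus2, hs] with x h1 h2
      have := h1.add (hasSum_tail h2 K).neg
      convert! this using 1
      simp only [A]; ring
    have b1 := H3 W ww _ _ _ d1 s1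
    rw [gE_add] at b1
    have b2 : ES p.toReal q.toReal T (dE l r (fun x => A x - S x)) ≤ C1 * (C3 * (C4 * (C2 * (C1 * N ^ q.toReal) + a K))) := by
      refine (H1 T W ww _).trans (mul_le_mul' le_rfl (b1.trans (mul_le_mul' le_rfl ((H4 _ _).trans (mul_le_mul' le_rfl ?_)))))
      exact add_le_add hgu2 le_rfl
    have b3 : ES p.toReal q.toReal T (dE l r (fun x => A x - S x)) < ∞ := by
      refine b2.trans_lt (ENNReal.mul_lt_top hC1 (ENNReal.mul_lt_top hC3 (ENNReal.mul_lt_top hC4 (ENNReal.add_lt_top.2 ⟨?_, hafin K⟩))))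
      exact ENNReal.mul_lt_top hC2 (ENNReal.mul_lt_top hC1 hNq)
    obtain ⟨w, gw, dw, hgw, hws⟩ := H5 _ (hA.sub hS) b3
    have d2 := dw.add (hV'.tail K)
    have s2 : ∀ᵐ x, HasSum (fun k => w k x + (if K ≤ k then V k (emb n'' x) else 0)) (φ' x - S (emb n'' x)) := by
      filter_upwards [hws, hs'] with x h1 h2
      have := h1.add (hasSum_tail h2 K)
      convert! this using 1
      simp only [A, Pi.sub_apply]; ring
    have b4 := H6 W' ww' _ _ _ d2 s2
    rw [gE_add] at b4
    refine b4.trans (mul_le_mul' le_rfl ((H7 _ _).trans (mul_le_mul' le_rfl (add_le_add ?_ le_rfl))))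
    exact hgw.trans (mul_le_mul' le_rfl b2)
  have c1 : ∀ {c : ℝ≥0∞} {f : ℕ → ℝ≥0∞} {b : ℝ≥0∞}, c < ∞ → Tendsto f atTop (nhds b) → Tendsto (fun K => c * f K) atTop (nhds (c * b)) :=
    fun hc hf => ENNReal.Tendsto.const_mul hf (Or.inr hc.ne)
  have lim : Tendsto (fun K => C6 * (C7 * (C5 * (C1 * (C3 * (C4 * (C2 * (C1 * N ^ q.toReal) + a K)))) + a' K))) atTop
      (nhds (C6 * (C7 * (C5 * (C1 * (C3 * (C4 * (C2 * (C1 * N ^ q.toReal) + 0)))) + 0)))) :=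
    c1 hC6 (c1 hC7 ((c1 hC5 (c1 hC1 (c1 hC3 (c1 hC4 (tendsto_const_nhds.add ha))))).add ha'))
  refine (ge_of_tendsto' lim main).trans (le_of_eq ?_)
  ring

/-- the extended pieces -/
def Vx {n' : ℕ} (n'' : ℕ) (v : ℕ → Rn n' → ℝ) (k : ℕ) (x : Rn (n' + n'')) : ℝ :=
  v k (fun i => x (Fin.castAdd n'' i)) * ∏ i : Fin n'', chi (2 ^ k * x (Fin.natAdd n' i))

def gx {n' : ℕ} (n'' : ℕ) (C : ℝ≥0) (R : ℕ) (g : ℕ → (Fin n' → ℤ) → ℝ≥0) (k : ℕ) (m : Fin (n' + n'') → ℤ) : ℝ≥0 :=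
  if (fun i => m (Fin.natAdd n' i)) ∈ bx n'' R then C * g k (fun i => m (Fin.castAdd n'' i)) else 0

lemma Vx_emb {n' n'' : ℕ} (v : ℕ → Rn n' → ℝ) (k : ℕ) (x : Rn n') : Vx n'' v k (emb n'' x) = v k x := by
  simp [Vx, emb, chi_zero]

lemma Vx_cont {n' n'' : ℕ} {v : ℕ → Rn n' → ℝ} (hv : ∀ k, Continuous (v k)) (k : ℕ) : Continuous (Vx n'' v k) := by
  unfold Vx
  refine ((hv k).comp (continuous_pi fun i => continuous_apply _)).mul (continuous_finsetProd _ fun i _ => chi_continuous.comp ?_)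
  exact continuous_const.mul (continuous_apply _)

lemma Dec_ext (n' n'' s : ℕ) : ∃ (C : ℝ≥0) (R : ℕ), ∀ (v : ℕ → Rn n' → ℝ) g, Dec s v g → Dec s (Vx n'' v) (gx n'' C R g) := by
  obtain ⟨K, hK, H⟩ := bump_SB s chi chi_contDiff chi_compact
  obtain ⟨C, hC⟩ : ∃ C : ℝ≥0, (C : ℝ) = 2 ^ s * (2 ^ s * K) ^ n'' := ⟨⟨_, by positivity⟩, rfl⟩
  refine ⟨C, 2 * s + 2, fun v g hd k y h hh => ?_⟩
  have ht : 0 ≤ 2 ^ k * ‖h‖ := by positivity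
  by_cases hb : (fun i => idx k y (Fin.natAdd n' i)) ∈ bx n'' (2 * s + 2)
  · set y' : Rn n' := fun i => y (Fin.castAdd n'' i)
    set h' : Rn n' := fun i => h (Fin.castAdd n'' i)
    have hn : ‖h'‖ ≤ ‖h‖ := by
      rw [pi_norm_le_iff_of_nonneg (norm_nonneg _)]
      exact fun i => norm_le_pi_norm h _
    have hle : (2:ℝ) ^ k * ‖h'‖ ≤ 2 ^ k * ‖h‖ := mul_le_mul_of_nonneg_left hn (by positivity)
    have d1 := (hd k y' h' (hle.trans hh)).mono_t (by positivity) hle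
    have d2 : SB s (2 ^ k * ‖h‖) ((2 ^ s * K) ^ (Finset.univ : Finset (Fin n'')).card)
        (fun b : ℕ => ∏ i : Fin n'', chi (2 ^ k * y (Fin.natAdd n' i) + b * (2 ^ k * h (Fin.natAdd n' i)))) :=
      SB.prod _ ht fun i _ => H _ _ _ (coord_le h _)
    have d3 := d1.mul ht d2
    have e : (gx n'' C (2 * s + 2) g k (idx k y) : ℝ) = 2 ^ s * ((g k (idx k y')) * (2 ^ s * K) ^ (Finset.univ : Finset (Fin n'')).card) := by
      unfold gx
      rw [if_pos hb, Finset.card_fin]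
      push_cast
      have : (fun i => idx k y (Fin.castAdd n'' i)) = idx k y' := rfl
      rw [this]
      rw [hC]
      ring
    rw [e]
    refine d3.congr fun b _ => ?_
    unfold Vx
    congr 1
    refine Finset.prod_congr rfl fun i _ => ?_
    congr 1
    simp only [Pi.add_apply, Pi.smul_apply, smul_eq_mul]
    ring
  · have e : (gx n'' C (2 * s + 2) g k (idx k y) : ℝ) = 0 := by
      unfold gx
      rw [if_neg hb]; rfl
    rw [e]
    refine SB.zero.congr fun b hbs => ?_
    rw [mem_bx] at hb
    push Not at hb
    obtain ⟨i, hi⟩ := hb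
    symm
    unfold Vx
    refine mul_eq_zero_of_right _ (Finset.prod_eq_zero (Finset.mem_univ i) (chi_eq_zero ?_))
    set j := Fin.natAdd n' i
    have h1 := idx_le (k := k) y j
    have h2 := idx_lt (k := k) y j
    have h3 : ((b:ℝ)) * (2 ^ k * |h j|) ≤ s * 2 := by
      have := coord_le (k := k) h j
      rw [abs_mul, abs_of_pos (by positivity : (0:ℝ) < 2 ^ k)] at this
      exact mul_le_mul (by exact_mod_cast hbs) (this.trans hh) (by positivity) (by positivity)
    have h4 : 2 ^ k * (y + (b:ℝ) • h) j = 2 ^ k * y j + b * (2 ^ k * h j) := by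
      simp only [Pi.add_apply, Pi.smul_apply, smul_eq_mul]; ring
    rw [h4]
    have h5 : |(b:ℝ) * (2 ^ k * h j)| ≤ s * 2 := by
      rw [abs_mul, abs_mul, abs_of_pos (by positivity : (0:ℝ) < 2 ^ k), abs_of_nonneg (by positivity : (0:ℝ) ≤ b)]
      exact h3
    rw [abs_le] at h5
    rcases lt_abs.1 hi with h6 | h6
    · have h7 : ((2 * s + 2 + 1 : ℤ):ℝ) ≤ (idx k y j : ℝ) := by
        have : (2 * s + 2 + 1 : ℤ) ≤ idx k y j := by push_cast at h6; omega
        exact_mod_cast this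
      push_cast at h7
      exact le_trans (by linarith) (le_abs_self _)
    · have h7 : (idx k y j : ℝ) ≤ ((-(2 * s + 2 + 1) : ℤ):ℝ) := by
        have : idx k y j ≤ (-(2 * s + 2 + 1) : ℤ) := by push_cast at h6; omega
        exact_mod_cast this
      push_cast at h7
      exact le_trans (by linarith) (neg_le_abs _)

lemma ES_ext {n' n'' : ℕ} {P θ α₁ α₂ Q : ℝ} (hP : 0 < P) (hQ : 0 < Q) {T : MS (n' + n'')} (wd : WD (n' + n'') P θ α₁ α₂ T) (C : ℝ≥0) (R : ℕ) :
    ∃ C' : ℝ≥0∞, C' < ∞ ∧ ∀ g, ES P Q T (gE (gx n'' C R g)) ≤ C' * ES P Q (rs T : MS n') (gE g) := by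
  obtain ⟨C1, hC1, H1⟩ := wd.t1 R
  refine ⟨((bx n'' R).card * (C1 * C) ^ P) ^ (Q / P), ENNReal.rpow_lt_top_of_nonneg (by positivity)
    (ENNReal.mul_lt_top (by simp) (ENNReal.rpow_lt_top_of_nonneg hP.le (ENNReal.mul_lt_top hC1 (by simp)).ne)).ne, fun g => ?_⟩
  unfold ES
  rw [← ENNReal.tsum_mul_left]
  refine ENNReal.tsum_le_tsum fun k => ?_
  rw [← ENNReal.mul_rpow_of_nonneg _ _ (by positivity)]
  refine ENNReal.rpow_le_rpow ?_ (by positivity)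
  unfold bS
  rw [← (Fin.appendEquiv n' n'').tsum_eq, ENNReal.tsum_prod', ← ENNReal.tsum_mul_left]
  refine ENNReal.tsum_le_tsum fun m' => ?_
  have hz : ∀ m'' ∉ bx n'' R, (T k (Fin.append m' m'') * gE (gx n'' C R g) k (Fin.append m' m'')) ^ P = 0 := by
    intro m'' hm
    simp [gE, gx, hm, hP]
  calc ∑' m'', (T k (Fin.append m' m'') * gE (gx n'' C R g) k (Fin.append m' m'')) ^ P
      = ∑ m'' ∈ bx n'' R, (T k (Fin.append m' m'') * gE (gx n'' C R g) k (Fin.append m' m'')) ^ P := tsum_eq_sum hz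
    _ ≤ ∑ m'' ∈ bx n'' R, (C1 * C) ^ P * (rs T k m' * gE g k m') ^ P := by
        refine Finset.sum_le_sum fun m'' hm => ?_
        rw [← ENNReal.mul_rpow_of_nonneg _ _ hP.le]
        refine ENNReal.rpow_le_rpow ?_ hP.le
        have h1 : gE (gx n'' C R g) k (Fin.append m' m'') = C * gE g k m' := by
          simp [gE, gx, hm]
        have h2 : T k (Fin.append m' m'') ≤ C1 * rs T k m' := by
          refine H1 k _ _ fun i => ?_
          refine Fin.addCases (fun i => ?_) (fun i => ?_) i
          · simp
          · simpa using mem_bx.1 hm i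
        rw [h1]
        calc _ ≤ C1 * rs T k m' * (C * gE g k m') := mul_le_mul' h2 le_rfl
          _ = _ := by ring
    _ = _ := by rw [Finset.sum_const, nsmul_eq_mul, mul_assoc]

lemma root_le {a b C : ℝ≥0∞} {Q : ℝ} (hQ : 0 < Q) (h : a ^ Q ≤ C * b ^ Q) : a ≤ C ^ (1 / Q) * b := by
  have h1 := ENNReal.rpow_le_rpow h (by positivity : 0 ≤ 1 / Q)
  rw [ENNReal.mul_rpow_of_nonneg _ _ (by positivity), ← ENNReal.rpow_mul, ← ENNReal.rpow_mul, mul_one_div_cancel hQ.ne',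
    ENNReal.rpow_one, ENNReal.rpow_one] at h1
  exact h1

lemma isBTrace_of {n' n'' l l' : ℕ} {p q r r' : ℝ≥0∞} (hq0 : 0 < q) (hq : q < ∞) (hl : 0 < l) {t : ℕ → Rn (n' + n'') → ℝ}
    {φ : Rn (n' + n'') → ℝ} {φ' : Rn n' → ℝ} {C : ℝ≥0∞} (hC : C < ∞)
    (H : ∀ S : Rn (n' + n'') → ℝ, Continuous S → tildeBnormE (n' + n'') l p q r (fun k x => ENNReal.ofReal (t k x)) (fun x => φ x - S x) < ∞ →
        tildeBnormE n' l' p q r' (traceSeq n' n'' p t) (fun x => φ' x - S (emb n'' x)) ^ q.toReal ≤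
          C * tildeBnormE (n' + n'') l p q r (fun k x => ENNReal.ofReal (t k x)) (fun x => φ x - S x) ^ q.toReal) :
    IsBTrace n' n'' l l' p q r r' t φ φ' := by
  have hQ := ENNReal.toReal_pos hq0.ne' hq.ne
  intro S hS hlim
  obtain ⟨d, rfl⟩ : ∃ d, l = d + 1 := ⟨l - 1, by omega⟩
  have hfin : ∀ᶠ j in atTop, tildeBnorm (n' + n'') (d + 1) p q r t (fun x => φ x - S j x) < ∞ :=
    hlim.eventually (gt_mem_nhds (by simp))
  have hC' : C ^ (1 / q.toReal) < ∞ := ENNReal.rpow_lt_top_of_nonneg (by positivity) hC.ne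
  have h0 : Tendsto (fun j => C ^ (1 / q.toReal) * tildeBnorm (n' + n'') (d + 1) p q r t (fun x => φ x - S j x)) atTop (nhds 0) := by
    have := ENNReal.Tendsto.const_mul hlim (Or.inr hC'.ne)
    rwa [mul_zero] at this
  refine tendsto_of_tendsto_of_tendsto_of_le_of_le' tendsto_const_nhds h0 (Eventually.of_forall fun _ => zero_le) ?_
  filter_upwards [hfin] with j hj
  exact root_le hQ (H (S j) (splineFn_continuous _ d _ (hS j)) hj)

lemma trace_core {n' n'' l l' : ℕ} {p q r r' : ℝ≥0∞} (hp0 : 0 < p) (hp : p < ∞) (hq0 : 0 < q) (hq : q < ∞)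
    {θ α₁ α₂ θ' α'₁ α'₂ : ℝ} (hll' : l ≤ l') {t : ℕ → Rn (n' + n'') → ℝ}
    (ww : WW (n' + n'') p.toReal (tkm (n' + n'') p t) (fun k x => ENNReal.ofReal (t k x)))
    (ww' : WW n' p.toReal (rs (tkm (n' + n'') p t)) (traceSeq n' n'' p t))
    (G : GH (n' + n'') p.toReal θ α₁ α₂ (tkm (n' + n'') p t) r l)
    (G' : GH n' p.toReal θ' α'₁ α'₂ (rs (tkm (n' + n'') p t)) r' l') :
    ∃ C : ℝ≥0∞, C < ∞ ∧ ∀ φ : Rn (n' + n'') → ℝ, MemTildeB (n' + n'') l p q r t φ →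
        ∃ φ' : Rn n' → ℝ, MemLrLoc n' r' φ' ∧
          tildeBnormE n' l' p q r' (traceSeq n' n'' p t) φ' < ∞ ∧
          IsBTrace n' n'' l l' p q r r' t φ φ' ∧
          tildeBnormE n' l' p q r' (traceSeq n' n'' p t) φ' ≤
            C * tildeBnorm (n' + n'') l p q r t φ := by
  have hP := ENNReal.toReal_pos hp0.ne' hp.ne
  have hQ := ENNReal.toReal_pos hq0.ne' hq.ne
  obtain ⟨C1, hC1, H1⟩ := E_le (n := n' + n'') hp0 hp hq0 hq l G.hr
  obtain ⟨C2, hC2, H2⟩ := propA hP hQ G.wd l G.alpha G.hr l'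
  obtain ⟨C3, hC3, H3⟩ := propB hp0 hp hq0 hq G'
  obtain ⟨C4, hC4, H4⟩ := ibt hp0 hp hq0 hq G G' ww ww'
  have hC : C3 * (C2 * C1) < ∞ := ENNReal.mul_lt_top hC3 (ENNReal.mul_lt_top hC2 hC1)
  have hC' : (C3 * (C2 * C1)) ^ (1 / q.toReal) < ∞ := ENNReal.rpow_lt_top_of_nonneg (by positivity) hC.ne
  refine ⟨_, hC', fun φ hφ => ?_⟩
  have hN : tildeBnormE (n' + n'') l p q r (fun k x => ENNReal.ofReal (t k x)) φ < ∞ := hφ.2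
  have hNq := ENNReal.rpow_lt_top_of_nonneg hQ.le hN.ne
  have hE := H1 _ _ ww φ
  have hE' := hE.trans_lt (ENNReal.mul_lt_top hC1 hNq)
  obtain ⟨v, g, hv, hd, hg, hs⟩ := H2 φ hφ.1.1 hE'
  have hg1 := hg.trans_lt (ENNReal.mul_lt_top hC2 hE')
  have hsum : ∀ᵐ x, HasSum (fun k => v k x) (φ x) := by
    filter_upwards [AC_meas hφ.1.1, ae_fin G hQ _ hg1] with x h1 h2
    exact hs x h1 h2
  have hg2 : ES p.toReal q.toReal (rs (tkm (n' + n'') p t) : MS n') (gE (rs g)) ≤ ES p.toReal q.toReal (tkm (n' + n'') p t) (gE g) :=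
    ES_rs (n' := n') hP hQ _ (gE g)
  have hg3 := hg2.trans_lt hg1
  obtain ⟨φ', hφ', hsum'⟩ := exists_sum hd.restrict (fun k => ((hv k).comp emb_cont).measurable) (ae_fin G' hQ _ hg3)
  have hb := H3 _ ww' _ _ _ hd.restrict hsum'
  have hb2 : tildeBnormE n' l' p q r' (traceSeq n' n'' p t) φ' ^ q.toReal ≤
      C3 * (C2 * C1) * tildeBnormE (n' + n'') l p q r (fun k x => ENNReal.ofReal (t k x)) φ ^ q.toReal := by
    refine (hb.trans (mul_le_mul' le_rfl (hg2.trans (hg.trans (mul_le_mul' le_rfl hE))))).trans (le_of_eq ?_)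
    ring
  have hb3 := root_le hQ hb2
  have hb4 := hb3.trans_lt (ENNReal.mul_lt_top hC' hN)
  refine ⟨φ', memLr_of (D := l') hp0 hp hq0 hq G'.hr ww' hφ' hb4, hb4, isBTrace_of hq0 hq G.alpha hC4 ?_, hb3⟩
  exact H4 v g (rs g) φ φ' hv (hd.mono_s hll') hg1 hd.restrict hg3 hφ.1.1 hsum hsum'

lemma ext_core {n' n'' l l' : ℕ} {p q r r' : ℝ≥0∞} (hp0 : 0 < p) (hp : p < ∞) (hq0 : 0 < q) (hq : q < ∞)
    {θ α₁ α₂ θ' α'₁ α'₂ : ℝ} (hll' : l ≤ l') {t : ℕ → Rn (n' + n'') → ℝ}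
    (ww : WW (n' + n'') p.toReal (tkm (n' + n'') p t) (fun k x => ENNReal.ofReal (t k x)))
    (ww' : WW n' p.toReal (rs (tkm (n' + n'') p t)) (traceSeq n' n'' p t))
    (G : GH (n' + n'') p.toReal θ α₁ α₂ (tkm (n' + n'') p t) r l)
    (G' : GH n' p.toReal θ' α'₁ α'₂ (rs (tkm (n' + n'') p t)) r' l') :
    ∃ C : ℝ≥0∞, C < ∞ ∧ ∀ φ' : Rn n' → ℝ, MemLrLoc n' r' φ' →
        tildeBnormE n' l' p q r' (traceSeq n' n'' p t) φ' < ∞ →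
        ∃ φ : Rn (n' + n'') → ℝ, MemTildeB (n' + n'') l p q r t φ ∧
          IsBTrace n' n'' l l' p q r r' t φ φ' ∧
          tildeBnorm (n' + n'') l p q r t φ ≤
            C * tildeBnormE n' l' p q r' (traceSeq n' n'' p t) φ' := by
  have hP := ENNReal.toReal_pos hp0.ne' hp.ne
  have hQ := ENNReal.toReal_pos hq0.ne' hq.ne
  obtain ⟨C1, hC1, H1⟩ := E_le (n := n') hp0 hp hq0 hq l' G'.hr
  obtain ⟨C2, hC2, H2⟩ := propA hP hQ G'.wd l' G'.alpha G'.hr l'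
  obtain ⟨C3, hC3, H3⟩ := propB hp0 hp hq0 hq G
  obtain ⟨C4, hC4, H4⟩ := ibt hp0 hp hq0 hq G G' ww ww'
  obtain ⟨C0, R, H0⟩ := Dec_ext n' n'' l'
  obtain ⟨C5, hC5, H5⟩ := ES_ext hP hQ G.wd C0 R
  have hC : C3 * (C5 * (C2 * C1)) < ∞ := ENNReal.mul_lt_top hC3 (ENNReal.mul_lt_top hC5 (ENNReal.mul_lt_top hC2 hC1))
  have hC' : (C3 * (C5 * (C2 * C1))) ^ (1 / q.toReal) < ∞ := ENNReal.rpow_lt_top_of_nonneg (by positivity) hC.ne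
  refine ⟨_, hC', fun φ' hφ' hN => ?_⟩
  have hNq := ENNReal.rpow_lt_top_of_nonneg hQ.le hN.ne
  have hE := H1 _ _ ww' φ'
  have hE' := hE.trans_lt (ENNReal.mul_lt_top hC1 hNq)
  obtain ⟨v, g, hv, hd, hg, hs⟩ := H2 φ' hφ'.1 hE'
  have hg1 := hg.trans_lt (ENNReal.mul_lt_top hC2 hE')
  have hsum' : ∀ᵐ x, HasSum (fun k => v k x) (φ' x) := by
    filter_upwards [AC_meas hφ'.1, ae_fin G' hQ _ hg1] with x h1 h2
    exact hs x h1 h2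
  have hdx := (H0 v g hd).mono_s hll'
  have hg2 := H5 g
  have hg3 := hg2.trans_lt (ENNReal.mul_lt_top hC5 hg1)
  obtain ⟨φ, hφ, hsum⟩ := exists_sum hdx (fun k => (Vx_cont hv k).measurable) (ae_fin G hQ _ hg3)
  have hb := H3 _ ww _ _ _ hdx hsum
  have hb2 : tildeBnormE (n' + n'') l p q r (fun k x => ENNReal.ofReal (t k x)) φ ^ q.toReal ≤
      C3 * (C5 * (C2 * C1)) * tildeBnormE n' l' p q r' (traceSeq n' n'' p t) φ' ^ q.toReal := by
    refine (hb.trans (mul_le_mul' le_rfl (hg2.trans (mul_le_mul' le_rfl (hg.trans (mul_le_mul' le_rfl hE)))))).trans (le_of_eq ?_)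
    ring
  have hb3 := root_le hQ hb2
  have hb4 := hb3.trans_lt (ENNReal.mul_lt_top hC' hN)
  refine ⟨φ, ⟨memLr_of (D := l) hp0 hp hq0 hq G.hr ww hφ hb4, hb4⟩, isBTrace_of hq0 hq G.alpha hC4 ?_, hb3⟩
  refine H4 (Vx n'' v) _ g φ φ' (Vx_cont hv) hdx hg3 ?_ hg1 hφ hsum ?_
  · simpa only [Vx_emb] using hd
  · simpa only [Vx_emb] using hsum'


end

/-- **Theorem 6.1: the trace of `B̃^l_{p,q,r}(ℝⁿ,{t_k})` on the coordinate subspace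
`x'' = 0` is `B̃^{l'}_{p,q,r'}(ℝ^{n'},{t'_k})`: the trace operator is bounded and has a
bounded right inverse (an extension operator).** -/
theorem trace_theorem (n' n'' : ℕ) (hn' : 0 < n') (hn'' : 0 < n'')
    (p q : ℝ≥0∞) (hp0 : 0 < p) (hp : p < ∞) (hq0 : 0 < q) (hq : q < ∞)
    (r θ : ℝ≥0∞) (hr : 0 < r) (hθ0 : 0 < θ) (hθp : θ ≤ p) (hθr : θ ≤ r)
    (α₁ α₂ α₃ : ℝ) (hα₃ : 0 ≤ α₃)
    (hα₁ : ((n' + n'' : ℕ) : ℝ) * (1 / θ.toReal - 1 / r.toReal) < α₁)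
    (l : ℕ) (hl : α₂ < l)
    (t : ℕ → Rn (n' + n'') → ℝ)
    (ht : MemX (n' + n'') α₁ α₂ α₃ (θ * conjE (pTheta p θ)) p p t)
    (l' : ℕ) (hll' : l ≤ l') (r' θ' : ℝ≥0∞) (hr' : 0 < r')
    (hθ'0 : 0 < θ') (hθ'p : θ' ≤ p) (hθ'r' : θ' ≤ r')
    (α'₁ α'₂ α'₃ : ℝ) (hα'₃ : 0 ≤ α'₃)
    (hα'₁ : (n' : ℝ) * (1 / θ'.toReal - 1 / r'.toReal) < α'₁) (hl' : α'₂ < l')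
    (ht' : MemXseq n' α'₁ α'₂ α'₃ (θ' * conjE (pTheta p θ')) p p (traceSeqM n' n'' p t)) :
    ∃ C : ℝ≥0∞, 0 < C ∧ C < ∞ ∧
      (∀ φ : Rn (n' + n'') → ℝ, MemTildeB (n' + n'') l p q r t φ →
        ∃ φ' : Rn n' → ℝ, MemLrLoc n' r' φ' ∧
          tildeBnormE n' l' p q r' (traceSeq n' n'' p t) φ' < ∞ ∧
          IsBTrace n' n'' l l' p q r r' t φ φ' ∧
          tildeBnormE n' l' p q r' (traceSeq n' n'' p t) φ' ≤
            C * tildeBnorm (n' + n'') l p q r t φ) ∧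
      (∀ φ' : Rn n' → ℝ, MemLrLoc n' r' φ' →
        tildeBnormE n' l' p q r' (traceSeq n' n'' p t) φ' < ∞ →
        ∃ φ : Rn (n' + n'') → ℝ, MemTildeB (n' + n'') l p q r t φ ∧
          IsBTrace n' n'' l l' p q r r' t φ φ' ∧
          tildeBnorm (n' + n'') l p q r t φ ≤
            C * tildeBnormE n' l' p q r' (traceSeq n' n'' p t) φ') := by
  have hfin := tkm_fin t ht.1
  have hpos' : ∀ k m, 0 < traceSeqM n' n'' p t k m := fun k m => (ht'.2.2 k m m (by simp)).1
  have hP := ENNReal.toReal_pos hp0.ne' hp.ne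
  have ww := WW_t hp0 hp t ht.1
  have ww' : WW n' p.toReal (rs (tkm (n' + n'') p t)) (traceSeq n' n'' p t) :=
    WW_tb hp0 hp (traceSeqM n' n'' p t) hpos'
  have G : GH (n' + n'') p.toReal θ.toReal α₁ α₂ (tkm (n' + n'') p t) r l :=
    ⟨hP, ENNReal.toReal_pos hθ0.ne' (hθp.trans_lt hp).ne, WD_of hp hθ0 hθp hfin ht.2, hr.ne',
      fun h => ENNReal.toReal_mono h hθr, hα₁, hl⟩
  have G' : GH n' p.toReal θ'.toReal α'₁ α'₂ (rs (tkm (n' + n'') p t)) r' l' :=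
    ⟨hP, ENNReal.toReal_pos hθ'0.ne' (hθ'p.trans_lt hp).ne, WD_of hp hθ'0 hθ'p (fun k m => hfin k _) ht', hr'.ne',
      fun h => ENNReal.toReal_mono h hθ'r', hα'₁, hl'⟩
  obtain ⟨C1, hC1, H1⟩ := trace_core (q := q) hp0 hp hq0 hq hll' ww ww' G G'
  obtain ⟨C2, hC2, H2⟩ := ext_core (q := q) hp0 hp hq0 hq hll' ww ww' G G'
  refine ⟨C1 + C2 + 1, by positivity, by simp [hC1, hC2], fun φ hφ => ?_, fun φ' hφ' hN => ?_⟩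
  · obtain ⟨φ', h1, h2, h3, h4⟩ := H1 φ hφ
    exact ⟨φ', h1, h2, h3, h4.trans (mul_le_mul' (by rw [add_assoc]; exact le_self_add) le_rfl)⟩
  · obtain ⟨φ, h1, h2, h3⟩ := H2 φ' hφ' hN
    refine ⟨φ, h1, h2, h3.trans (mul_le_mul' ?_ le_rfl)⟩
    exact le_add_self.trans le_self_add

end
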